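/- Let p be an even positive integer and q a positive integer, and set n = p+q. Let Q(x) = x_1^2 + ... + x_p^2 - x_{p+1}^2 - ... - x_{n+1}^2 on ℝ^{n+1}, let X = {x ∈ ℝ^{n+1} : Q(x) = -1} with the subspace topology and the action of O(p,q+1) = {A ∈ GL(n+1,ℝ) : Q(Ax) = Q(x) for all x}, and let μ be the cone measure on X defined by μ(A) = λ({t • x : x ∈ A, t ∈ (0,1]}) for Borel sets A ⊆ X, where λ is Lebesgue measure on ℝ^{n+1}. Let Γ be a discrete subgroup of O(p,q+1) acting properly discontinuously and cocompactly on X, and let D ⊆ X be a fundamental domain for the action of Γ on (X, μ). Then there exists a rational number r such that μ(D) = r · λ(B^{n+1}), where λ(B^{n+1}) is the Lebesgue measure of the closed unit Euclidean ball in ℝ^{n+1}. Equivalently, the volume of any compact Clifford–Klein form of H^{p,q} with p even is a rational multiple of the volume of the round sphere S^{p+q}. -/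

import Mathlib

/-!
The volume of any compact Clifford–Klein form of `H^{p,q}` with `p` even is a rational
multiple of the volume of the round sphere `S^{p+q}` (equivalently: the cone measure of a
fundamental domain is a rational multiple of the Lebesgue measure of the unit ball).
-/

open Matrix MeasureTheory

set_option maxHeartbeats 1000000
set_option synthInstance.maxHeartbeats 1000000

noncomputable section

/-- The quadratic form `Q(x) = x_1² + ⋯ + x_p² − x_{p+1}² − ⋯ − x_N²` on `ℝ^N`. -/
def Qpq (p N : ℕ) (x : Fin N → ℝ) : ℝ :=
  ∑ i : Fin N, if (i : ℕ) < p then (x i) ^ 2 else -((x i) ^ 2)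

/-- The indefinite orthogonal group `O(p, N-p)`: the subgroup of `GL(N, ℝ)` of matrices
preserving the quadratic form `Q`. -/
def Opq (p N : ℕ) : Subgroup (GL (Fin N) ℝ) where
  carrier := {A | ∀ x, Qpq p N (A.val *ᵥ x) = Qpq p N x}
  one_mem' := by
    intro x
    rw [Units.val_one, Matrix.one_mulVec]
  mul_mem' := by
    intro A B hA hB x
    rw [Units.val_mul, ← Matrix.mulVec_mulVec, hA, hB]
  inv_mem' := by
    intro A hA x
    have h := hA ((A⁻¹).val *ᵥ x)
    rw [Matrix.mulVec_mulVec, Units.mul_inv, Matrix.one_mulVec] at h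
    exact h.symm

/-- The pseudo-Riemannian hyperbolic space `H^{p,q}` of signature `(p,q)`, realized as the
quadric `{x ∈ ℝ^{p+q+1} : Q(x) = -1}` (with the subspace topology). -/
def Hpq (p N : ℕ) : Type := {x : Fin N → ℝ // Qpq p N x = -1}

instance (p N : ℕ) : TopologicalSpace (Hpq p N) :=
  inferInstanceAs (TopologicalSpace {x : Fin N → ℝ // Qpq p N x = -1})

instance (p N : ℕ) : MeasurableSpace (Hpq p N) :=
  inferInstanceAs (MeasurableSpace {x : Fin N → ℝ // Qpq p N x = -1})

/-- `O(p, N-p)` acts on the quadric `H^{p,q}` by matrix multiplication. -/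
instance (p N : ℕ) : SMul ↥(Opq p N) (Hpq p N) :=
  ⟨fun A x => ⟨A.val.val *ᵥ x.val, by rw [A.prop x.val]; exact x.prop⟩⟩

instance (p N : ℕ) : MulAction ↥(Opq p N) (Hpq p N) where
  one_smul x := by
    apply Subtype.ext
    show (1 : Matrix (Fin N) (Fin N) ℝ) *ᵥ x.val = x.val
    rw [Matrix.one_mulVec]
  mul_smul A B x := by
    apply Subtype.ext
    show ((A * B).val.val) *ᵥ x.val = A.val.val *ᵥ (B.val.val *ᵥ x.val)
    rw [Matrix.mulVec_mulVec]
    rfl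

/-- The cone over a subset `s` of the quadric `H^{p,q}`: the set of points `t • x` with
`x ∈ s` and `t ∈ (0, 1]`. -/
def coneOver (p N : ℕ) (s : Set (Hpq p N)) : Set (Fin N → ℝ) :=
  {y | ∃ x ∈ s, ∃ t : ℝ, t ∈ Set.Ioc (0 : ℝ) 1 ∧ y = t • x.val}

namespace PolyChain

/-- Lexicographic positivity of a real tuple. -/
def LexPos {r : ℕ} (c : Fin r → ℝ) : Prop := ∃ i, 0 < c i ∧ ∀ j < i, c j = 0

theorem LexPos.add {r : ℕ} {a b : Fin r → ℝ} (ha : LexPos a) (hb : LexPos b) :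
    LexPos (a + b) := by
  obtain ⟨i, hi, hi'⟩ := ha
  obtain ⟨j, hj, hj'⟩ := hb
  rcases lt_trichotomy i j with h | h | h
  · exact ⟨i, by simp [hj' i h, hi], fun k hk => by simp [hi' k hk, hj' k (hk.trans h)]⟩
  · subst h
    exact ⟨i, by simp only [Pi.add_apply]; linarith, fun k hk => by simp [hi' k hk, hj' k hk]⟩
  · exact ⟨j, by simp [hi' j h, hj], fun k hk => by simp [hj' k hk, hi' k (hk.trans h)]⟩

theorem LexPos.smul {r : ℕ} {a : Fin r → ℝ} (ha : LexPos a) {t : ℝ} (ht : 0 < t) :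
    LexPos (t • a) := by
  obtain ⟨i, hi, hi'⟩ := ha
  exact ⟨i, mul_pos ht hi, fun k hk => by simp [hi' k hk]⟩

theorem lexPos_smul_iff {r : ℕ} {a : Fin r → ℝ} {t : ℝ} (ht : 0 < t) :
    LexPos (t • a) ↔ LexPos a := by
  refine ⟨fun h => ?_, fun h => h.smul ht⟩
  have := h.smul (inv_pos.2 ht)
  rwa [smul_smul, inv_mul_cancel₀ ht.ne', one_smul] at this

theorem not_lexPos_zero {r : ℕ} : ¬ LexPos (0 : Fin r → ℝ) := by
  rintro ⟨i, hi, -⟩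
  simp at hi

theorem LexPos.not_neg {r : ℕ} {a : Fin r → ℝ} (ha : LexPos a) : ¬ LexPos (-a) := fun h =>
  not_lexPos_zero (by simpa using ha.add h)

theorem lexPos_or_neg {r : ℕ} {a : Fin r → ℝ} (ha : a ≠ 0) : LexPos a ∨ LexPos (-a) := by
  classical
  have hne : (Finset.univ.filter fun i => a i ≠ 0).Nonempty := by
    by_contra h
    apply ha
    funext i
    by_contra h2
    exact h ⟨i, by simpa using h2⟩
  set i := (Finset.univ.filter fun i => a i ≠ 0).min' hne
  have hi : a i ≠ 0 := by
    have := Finset.min'_mem _ hne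
    simpa using this
  have hlt : ∀ j < i, a j = 0 := by
    intro j hj
    by_contra h
    exact absurd (Finset.min'_le _ j (by simpa using h)) (not_le.2 hj)
  rcases lt_or_gt_of_ne hi with h | h
  · exact Or.inr ⟨i, by simpa using h, fun j hj => by simp [hlt j hj]⟩
  · exact Or.inl ⟨i, h, hlt⟩

theorem LexPos.nonneg_zero {r : ℕ} {a : Fin (r + 1) → ℝ} (ha : LexPos a) : 0 ≤ a 0 := by
  obtain ⟨i, hi, hi'⟩ := ha
  rcases eq_or_ne i 0 with h | h
  · subst h; exact hi.le
  · exact (hi' 0 (Fin.pos_of_ne_zero h)).ge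

theorem lexPos_of_pos_zero {r : ℕ} {a : Fin (r + 1) → ℝ} (ha : 0 < a 0) : LexPos a :=
  ⟨0, ha, fun j hj => absurd hj (Fin.not_lt_zero j)⟩

theorem lexPos_snoc {r : ℕ} {a : Fin r → ℝ} (ha : a ≠ 0) (u : ℝ) :
    LexPos (Fin.snoc a u : Fin (r + 1) → ℝ) ↔ LexPos a := by
  have key : ∀ (a : Fin r → ℝ) (u : ℝ), LexPos a → LexPos (Fin.snoc a u : Fin (r + 1) → ℝ) := by
    rintro a u ⟨i, hi, hi'⟩
    refine ⟨i.castSucc, by simpa using hi, fun j hj => ?_⟩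
    induction j using Fin.lastCases with
    | last => exact absurd hj (not_lt.2 (Fin.le_last _))
    | cast j => simpa using hi' j (by simpa using hj)
  refine ⟨fun h => ?_, key a u⟩
  rcases lexPos_or_neg ha with h2 | h2
  · exact h2
  · have := key _ (-u) h2
    refine absurd this ?_
    have e : (Fin.snoc (-a) (-u) : Fin (r + 1) → ℝ) = -(Fin.snoc a u : Fin (r + 1) → ℝ) := by
      funext j
      induction j using Fin.lastCases <;> simp
    rw [e]
    exact h.not_neg

theorem lexPos_snoc_zero {r : ℕ} (u : ℝ) :
    LexPos (Fin.snoc (0 : Fin r → ℝ) u : Fin (r + 1) → ℝ) ↔ 0 < u := by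
  constructor
  · rintro ⟨i, hi, -⟩
    induction i using Fin.lastCases with
    | last => simpa using hi
    | cast j => simp at hi
  · intro h
    refine ⟨Fin.last r, by simpa using h, fun j hj => ?_⟩
    induction j using Fin.lastCases with
    | last => exact absurd hj (lt_irrefl _)
    | cast j => simp

theorem lexPos_sum {r : ℕ} {ι : Type*} {s : Finset ι} {f : ι → Fin r → ℝ}
    (hs : s.Nonempty) (h : ∀ i ∈ s, LexPos (f i)) : LexPos (∑ i ∈ s, f i) := by
  classical
  induction hs using Finset.Nonempty.cons_induction with
  | singleton a => simpa using h a
  | cons a s ha hs ih =>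
    rw [Finset.sum_cons]
    exact (h a (by simp)).add (ih fun i hi => h i (by simp [hi]))

theorem lexPos_sum_smul {r m : ℕ} {A : Fin m → Fin r → ℝ} (hA : ∀ i, LexPos (A i))
    {t : Fin m → ℝ} (ht : ∀ i, 0 ≤ t i) (ht0 : t ≠ 0) :
    LexPos (fun j => ∑ i, A i j * t i) := by
  classical
  have e : (fun j => ∑ i, A i j * t i) = ∑ i ∈ Finset.univ.filter (fun i => 0 < t i), t i • A i := by
    rw [Finset.sum_filter]
    funext j
    rw [Finset.sum_apply]
    refine Finset.sum_congr rfl fun i _ => ?_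
    by_cases h : 0 < t i
    · simp [h, mul_comm]
    · have : t i = 0 := le_antisymm (not_lt.1 h) (ht i)
      simp [this]
  rw [e]
  refine lexPos_sum ?_ fun i hi => (hA i).smul (by simpa using hi)
  obtain ⟨i, hi⟩ := Function.ne_iff.1 ht0
  exact ⟨i, by simpa using lt_of_le_of_ne (ht i) (Ne.symm hi)⟩

section Basic

variable {E : Type*} [AddCommGroup E] [Module ℝ E]

/-- The space of functions on `r`-frames of `E`. -/
abbrev PF (E : Type*) (r : ℕ) := (Fin r → E) → ℚ

open Classical in
/-- The oriented indicator of the simplicial cone spanned by `σ`, evaluated at the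
infinitesimally perturbed point given by the frame `w`. -/
def ev {r : ℕ} (σ : Fin r → E) : PF E r := fun w =>
  if h : ∃ A : Matrix (Fin r) (Fin r) ℝ, (∀ j, w j = ∑ i, A i j • σ i) ∧ ∀ i, LexPos (A i)
  then (SignType.sign h.choose.det : ℚ) else 0

theorem matrix_unique {r m : ℕ} {σ : Fin r → E} (hσ : LinearIndependent ℝ σ)
    {A B : Matrix (Fin r) (Fin m) ℝ} {w : Fin m → E}
    (hA : ∀ j, w j = ∑ i, A i j • σ i) (hB : ∀ j, w j = ∑ i, B i j • σ i) : A = B := by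
  ext i j
  have h : ∑ i, (A i j - B i j) • σ i = 0 := by
    simp only [sub_smul, Finset.sum_sub_distrib]
    rw [← hA, ← hB, sub_self]
  have := Fintype.linearIndependent_iff.1 hσ _ h i
  linarith

open Classical in
theorem ev_of {r : ℕ} {σ : Fin r → E} (hσ : LinearIndependent ℝ σ) {w : Fin r → E}
    {A : Matrix (Fin r) (Fin r) ℝ} (hA : ∀ j, w j = ∑ i, A i j • σ i) :
    ev σ w = if ∀ i, LexPos (A i) then (SignType.sign A.det : ℚ) else 0 := by
  unfold ev
  by_cases h : ∀ i, LexPos (A i)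
  · have hex : ∃ A : Matrix (Fin r) (Fin r) ℝ,
      (∀ j, w j = ∑ i, A i j • σ i) ∧ ∀ i, LexPos (A i) := ⟨A, hA, h⟩
    rw [dif_pos hex, if_pos h, matrix_unique hσ hex.choose_spec.1 hA]
  · rw [if_neg h, dif_neg]
    rintro ⟨B, hB, hB'⟩
    rw [matrix_unique hσ hB hA] at hB'
    exact h hB'

theorem exists_matrix {r m : ℕ} {σ : Fin r → E} {w : Fin m → E}
    (h : ∀ j, w j ∈ Submodule.span ℝ (Set.range σ)) :
    ∃ A : Matrix (Fin r) (Fin m) ℝ, ∀ j, w j = ∑ i, A i j • σ i := by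
  have := fun j => (Submodule.mem_span_range_iff_exists_fun ℝ).1 (h j)
  choose c hc using this
  exact ⟨fun i j => c j i, fun j => (hc j).symm⟩

theorem det_ne_zero_of_indep {r : ℕ} {σ w : Fin r → E} (hw : LinearIndependent ℝ w)
    {A : Matrix (Fin r) (Fin r) ℝ} (hA : ∀ j, w j = ∑ i, A i j • σ i) : A.det ≠ 0 := by
  intro h
  obtain ⟨v, hv, hv'⟩ := Matrix.exists_mulVec_eq_zero_iff.2 h
  apply hv
  have : ∑ j, v j • w j = 0 := by
    simp only [hA, Finset.smul_sum, smul_smul]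
    rw [Finset.sum_comm]
    refine Finset.sum_eq_zero fun i _ => ?_
    rw [← Finset.sum_smul]
    have := congrFun hv' i
    simp only [Matrix.mulVec, dotProduct, Pi.zero_apply] at this
    simp only [mul_comm (v _), this, zero_smul]
  funext j
  exact Fintype.linearIndependent_iff.1 hw _ this j

theorem indep_of_det_ne_zero {r : ℕ} {σ w : Fin r → E} (hσ : LinearIndependent ℝ σ)
    {A : Matrix (Fin r) (Fin r) ℝ} (hA : ∀ j, w j = ∑ i, A i j • σ i) (h : A.det ≠ 0) :
    LinearIndependent ℝ w := by
  rw [Fintype.linearIndependent_iff]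
  intro v hv
  have h0 : A *ᵥ v = 0 := by
    funext i
    have : ∑ i, (A *ᵥ v) i • σ i = 0 := by
      rw [← hv]
      simp only [hA, Finset.smul_sum, smul_smul, Matrix.mulVec, dotProduct, Finset.sum_smul]
      rw [Finset.sum_comm]
      simp only [mul_comm]
    exact Fintype.linearIndependent_iff.1 hσ _ this i
  by_contra hne
  push Not at hne
  obtain ⟨i, hi⟩ := hne
  exact h (Matrix.exists_mulVec_eq_zero_iff.1 ⟨v, fun e => hi (by rw [e]; rfl), h0⟩)

theorem exists_of_ev_ne_zero {r : ℕ} {σ w : Fin r → E} (hσ : LinearIndependent ℝ σ)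
    (h : ev σ w ≠ 0) : ∃ A : Matrix (Fin r) (Fin r) ℝ, (∀ j, w j = ∑ i, A i j • σ i) ∧
      (∀ i, LexPos (A i)) ∧ A.det ≠ 0 ∧ ev σ w = (SignType.sign A.det : ℚ) := by
  classical
  by_cases hex : ∃ A : Matrix (Fin r) (Fin r) ℝ, (∀ j, w j = ∑ i, A i j • σ i) ∧ ∀ i, LexPos (A i)
  · obtain ⟨A, hA, hA'⟩ := hex
    have e := ev_of hσ hA
    rw [if_pos hA'] at e
    refine ⟨A, hA, hA', ?_, e⟩
    intro h0
    rw [e, h0] at h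
    simp at h
  · exact absurd (by unfold ev; rw [dif_neg hex]) h

theorem indep_of_ev_ne_zero {r : ℕ} {σ w : Fin r → E} (hσ : LinearIndependent ℝ σ)
    (h : ev σ w ≠ 0) : LinearIndependent ℝ w := by
  obtain ⟨A, hA, -, hd, -⟩ := exists_of_ev_ne_zero hσ h
  exact indep_of_det_ne_zero hσ hA hd

theorem mem_span_of_ev_ne_zero {r : ℕ} {σ w : Fin r → E} (hσ : LinearIndependent ℝ σ)
    (h : ev σ w ≠ 0) (j : Fin r) : w j ∈ Submodule.span ℝ (Set.range σ) := by
  obtain ⟨A, hA, -⟩ := exists_of_ev_ne_zero hσ h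
  rw [hA]
  exact Submodule.sum_mem _ fun i _ => Submodule.smul_mem _ _ (Submodule.subset_span ⟨i, rfl⟩)

theorem span_eq_of_indep {r : ℕ} {σ w : Fin r → E} (hw : LinearIndependent ℝ w)
    (h : ∀ j, w j ∈ Submodule.span ℝ (Set.range σ)) :
    Submodule.span ℝ (Set.range w) = Submodule.span ℝ (Set.range σ) := by
  have : FiniteDimensional ℝ (Submodule.span ℝ (Set.range σ)) :=
    FiniteDimensional.span_of_finite ℝ (Set.finite_range σ)
  apply Submodule.eq_of_le_of_finrank_le
  · rw [Submodule.span_le]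
    rintro _ ⟨j, rfl⟩
    exact h j
  · rw [finrank_span_eq_card hw]
    exact finrank_range_le_card σ

theorem span_eq_of_ev_ne_zero {r : ℕ} {σ w : Fin r → E} (hσ : LinearIndependent ℝ σ)
    (h : ev σ w ≠ 0) : Submodule.span ℝ (Set.range w) = Submodule.span ℝ (Set.range σ) :=
  span_eq_of_indep (indep_of_ev_ne_zero hσ h) (mem_span_of_ev_ne_zero hσ h)

/-- Translating a cone by an injective linear map. -/
theorem ev_map {F : Type*} [AddCommGroup F] [Module ℝ F] {r : ℕ} (f : E →ₗ[ℝ] F)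
    (hf : Function.Injective f) (σ w : Fin r → E) :
    ev (fun i => f (σ i)) (fun i => f (w i)) = ev σ w := by
  classical
  have key : ∀ P Q : Matrix (Fin r) (Fin r) ℝ → Prop, P = Q →
      (if h : ∃ A, P A then (SignType.sign h.choose.det : ℚ) else 0) =
        if h : ∃ A, Q A then (SignType.sign h.choose.det : ℚ) else 0 := by
    rintro P Q rfl
    rfl
  unfold ev
  refine key _ _ (funext fun A => ?_)
  congr 1
  refine propext (forall_congr' fun j => ?_)
  rw [← hf.eq_iff, map_sum]
  simp only [map_smul]

/-- Fibrewise vanishing of a relation between cones, grouped by linear span. -/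
theorem sum_fiber {r : ℕ} {ι : Type*} {s : Finset ι} {σ : ι → Fin r → E} {b : ι → ℚ}
    (hσ : ∀ a ∈ s, LinearIndependent ℝ (σ a)) (h : ∑ a ∈ s, b a • ev (σ a) = 0)
    (g : Submodule ℝ E → ℚ) (w : Submodule ℝ E → Fin r → E) :
    ∑ a ∈ s, b a * (g (Submodule.span ℝ (Set.range (σ a))) *
      ev (σ a) (w (Submodule.span ℝ (Set.range (σ a))))) = 0 := by
  classical
  rw [← Finset.sum_fiberwise_of_maps_to (t := s.image fun a => Submodule.span ℝ (Set.range (σ a)))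
    (g := fun a => Submodule.span ℝ (Set.range (σ a)))
    (fun a ha => Finset.mem_image_of_mem _ ha)]
  refine Finset.sum_eq_zero fun W _ => ?_
  have h1 : ∑ a ∈ s with Submodule.span ℝ (Set.range (σ a)) = W, b a * ev (σ a) (w W) = 0 := by
    by_cases hW : Submodule.span ℝ (Set.range (w W)) = W
    · have := congrFun h (w W)
      simp only [Finset.sum_apply, Pi.smul_apply, smul_eq_mul, Pi.zero_apply] at this
      rw [← this, Finset.sum_filter]
      refine Finset.sum_congr rfl fun a ha => ?_
      split_ifs with h2
      · rfl
      · symm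
        rw [mul_eq_zero]
        right
        by_contra h3
        exact h2 ((span_eq_of_ev_ne_zero (hσ a ha) h3).symm.trans hW)
    · refine Finset.sum_eq_zero fun a ha => ?_
      rw [Finset.mem_filter] at ha
      rw [mul_eq_zero]
      right
      by_contra h3
      exact hW ((span_eq_of_ev_ne_zero (hσ a ha.1) h3).trans ha.2)
  calc _ = ∑ a ∈ s with Submodule.span ℝ (Set.range (σ a)) = W, g W * (b a * ev (σ a) (w W)) := by
        refine Finset.sum_congr rfl fun a ha => ?_
        rw [(Finset.mem_filter.1 ha).2]
        ring
    _ = 0 := by rw [← Finset.mul_sum, h1, mul_zero]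

end Basic

end PolyChain

namespace PolyChain

section Boundary

variable {E : Type*} [AddCommGroup E] [Module ℝ E]

/-- The facet of a simplicial cone opposite to its `i`-th vertex. -/
def facet {r : ℕ} (σ : Fin (r + 1) → E) (i : Fin (r + 1)) : Fin r → E :=
  fun j => σ (i.succAbove j)

/-- The alternating sum of the facets of a simplicial cone. -/
def bdSum {r : ℕ} (σ : Fin (r + 1) → E) : PF E r :=
  ∑ i : Fin (r + 1), ((-1 : ℚ) ^ (i : ℕ)) • ev (facet σ i)

theorem facet_indep {r : ℕ} {σ : Fin (r + 1) → E} (hσ : LinearIndependent ℝ σ) (i) :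
    LinearIndependent ℝ (facet σ i) :=
  hσ.comp _ Fin.succAbove_right_injective

theorem sign_neg_rat (x : ℝ) : (SignType.sign (-x) : ℚ) = -(SignType.sign x : ℚ) := by
  rcases lt_trichotomy x 0 with h | h | h
  · simp [sign_neg h, sign_pos (neg_pos.2 h)]
  · simp [h]
  · simp [sign_pos h, sign_neg (neg_lt_zero.2 h)]

theorem sign_mul_rat (x y : ℝ) :
    (SignType.sign (x * y) : ℚ) = (SignType.sign x : ℚ) * (SignType.sign y : ℚ) := by
  rw [sign_mul]
  cases SignType.sign x <;> cases SignType.sign y <;> simp [SignType.coe_mul]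

theorem sign_neg_one_pow (k : ℕ) : (SignType.sign ((-1 : ℝ) ^ k) : ℚ) = (-1) ^ k := by
  rcases Nat.even_or_odd k with h | h <;> simp [h.neg_one_pow]

theorem bdSum_apply_eq {r : ℕ} {σ : Fin (r + 1) → E} (hσ : LinearIndependent ℝ σ)
    {w : Fin r → E} {u : E} (hw : ∀ j, w j ∈ Submodule.span ℝ (Set.range σ))
    (hu : u ∈ Submodule.span ℝ (Set.range σ))
    (hwu : LinearIndependent ℝ (Fin.snoc w u : Fin (r + 1) → E)) :
    bdSum σ w = (-1 : ℚ) ^ r * (ev σ (Fin.snoc w u) + ev σ (Fin.snoc w (-u))) := by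
  classical
  obtain ⟨A, hA⟩ := exists_matrix hw
  obtain ⟨c, hc⟩ := (Submodule.mem_span_range_iff_exists_fun ℝ).1 hu
  let Ap : ℝ → Matrix (Fin (r + 1)) (Fin (r + 1)) ℝ := fun t =>
    Matrix.of fun i => Fin.snoc (A i) (t * c i)
  have hAp : ∀ t, ∀ j, (Fin.snoc w (t • u) : Fin (r + 1) → E) j = ∑ i, Ap t i j • σ i := by
    intro t j
    induction j using Fin.lastCases with
    | last => simp [Ap, ← hc, Finset.smul_sum, smul_smul]
    | cast j => simp [Ap, hA]
  have hwu' : (Fin.snoc w u : Fin (r + 1) → E) = Fin.snoc w ((1 : ℝ) • u) := by simp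
  have hwu'' : (Fin.snoc w (-u) : Fin (r + 1) → E) = Fin.snoc w ((-1 : ℝ) • u) := by simp
  have hd : (Ap 1).det ≠ 0 := det_ne_zero_of_indep hwu (by rw [hwu']; exact hAp 1)
  have hdneg : (Ap (-1)).det = -(Ap 1).det := by
    have : Ap (-1) = (Ap 1).updateCol (Fin.last r) ((-1 : ℝ) • fun i => Ap 1 i (Fin.last r)) := by
      ext i j
      induction j using Fin.lastCases with
      | last => simp [Ap]
      | cast j => simp [Ap, Matrix.updateCol_apply]
    rw [this, Matrix.det_updateCol_smul, Matrix.updateCol_eq_self]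
    simp
  rw [hwu', hwu'', ev_of hσ (hAp 1), ev_of hσ (hAp (-1)), hdneg, sign_neg_rat]
  -- a nonzero facet determines a zero row
  have hfac : ∀ i, ev (facet σ i) w ≠ 0 → A i = 0 ∧ ∀ k, LexPos (A (i.succAbove k)) := by
    intro i h
    obtain ⟨B, hB, hB', -⟩ := exists_of_ev_ne_zero (facet_indep hσ i) h
    have : A = Matrix.of fun l j =>
        (Fin.insertNth i (0 : ℝ) (fun k => B k j) : Fin (r + 1) → ℝ) l := by
      refine matrix_unique hσ hA fun j => ?_
      rw [Fin.sum_univ_succAbove _ i]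
      simp [hB, facet]
    constructor
    · rw [this]; funext j; simp
    · intro k
      have e : A (i.succAbove k) = B k := by rw [this]; funext j; simp
      rw [e]
      exact hB' k
  simp only [bdSum, Finset.sum_apply, Pi.smul_apply, smul_eq_mul]
  by_cases hz : ∃ i, A i = 0
  · obtain ⟨i, hi⟩ := hz
    rw [Finset.sum_eq_single i]
    rotate_left
    · intro j _ hj
      rw [mul_eq_zero]
      right
      by_contra h
      obtain ⟨k, hk⟩ := Fin.exists_succAbove_eq hj.symm
      have := (hfac j h).2 k
      rw [hk, hi] at this
      exact not_lexPos_zero this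
    · simp
    have hfe : ∀ j, w j = ∑ k, A (i.succAbove k) j • facet σ i k := by
      intro j
      rw [hA, Fin.sum_univ_succAbove _ i]
      simp [hi, facet]
    obtain ⟨M, hM⟩ : ∃ M : Matrix (Fin r) (Fin r) ℝ, ∀ k, M k = A (i.succAbove k) :=
      ⟨Matrix.of fun k => A (i.succAbove k), fun k => rfl⟩
    rw [ev_of (A := M) (facet_indep hσ i) (by simpa only [hM] using hfe)]
    have hdet : (Ap 1).det = (-1) ^ ((i : ℕ) + r) * c i * M.det := by
      rw [Matrix.det_succ_row _ i, Fin.sum_univ_castSucc]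
      have : ∀ j : Fin r, Ap 1 i j.castSucc = 0 := by
        intro j; simp [Ap, hi]
      simp only [this, mul_zero, zero_mul, Finset.sum_const_zero, zero_add]
      have e1 : Ap 1 i (Fin.last r) = c i := by simp [Ap]
      have e2 : (Ap 1).submatrix i.succAbove (Fin.last r).succAbove = M := by
        ext a b; simp [Ap, hM]
      rw [e1, e2]
      simp
    rw [hdet] at hd
    have hci : c i ≠ 0 := fun h => hd (by simp [h])
    have hMd : M.det ≠ 0 := fun h => hd (by simp [h])
    have hrow : ∀ k, A (i.succAbove k) ≠ 0 := fun k h =>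
      hMd (Matrix.det_eq_zero_of_row_eq_zero k fun j => by simp [hM, h])
    have hpos : ∀ t : ℝ, t ≠ 0 → ((∀ l, LexPos (Ap t l)) ↔ 0 < t * c i ∧ ∀ k, LexPos (M k)) := by
      intro t ht
      rw [Fin.forall_iff_succAbove i]
      apply and_congr
      · show LexPos (Fin.snoc (A i) (t * c i) : Fin (r + 1) → ℝ) ↔ _
        rw [hi]
        exact lexPos_snoc_zero _
      · exact forall_congr' fun k => by
          rw [hM]; exact lexPos_snoc (hrow k) (t * c (i.succAbove k))
    simp only [hpos 1 one_ne_zero, hpos (-1) (by norm_num), hdet]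
    by_cases hMp : ∀ k, LexPos (M k)
    · simp only [hMp, implies_true, and_true, if_true, sign_mul_rat, sign_neg_one_pow, one_mul,
        neg_mul, Left.neg_pos_iff]
      have hs : ((-1 : ℚ) ^ r) * (-1) ^ ((i : ℕ) + r) = (-1) ^ (i : ℕ) := by
        rw [pow_add]
        have : ((-1 : ℚ) ^ r) * (-1) ^ r = 1 := by rw [← mul_pow]; simp
        linear_combination (-1 : ℚ) ^ (i : ℕ) * this
      rcases lt_or_gt_of_ne hci with h | h
      · rw [if_neg (not_lt.2 h.le), if_pos h, sign_neg h]
        simp only [SignType.coe_neg, SignType.coe_one]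
        linear_combination -(SignType.sign M.det : ℚ) * hs
      · rw [if_pos h, if_neg (not_lt.2 h.le), sign_pos h]
        simp only [SignType.coe_one]
        linear_combination -(SignType.sign M.det : ℚ) * hs
    · have : ¬ ∀ k, LexPos (M k) := hMp
      simp [this]
  · push Not at hz
    have : ∀ t : ℝ, (∀ l, LexPos (Ap t l)) ↔ ∀ l, LexPos (A l) := fun t =>
      forall_congr' fun l => lexPos_snoc (hz l) _
    rw [Finset.sum_eq_zero]
    · simp only [this]
      split_ifs <;> simp
    · intro i _
      rw [mul_eq_zero]
      right
      by_contra h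
      exact hz i (hfac i h).1

theorem bdSum_apply_of_not_mem {r : ℕ} {σ : Fin (r + 1) → E} (hσ : LinearIndependent ℝ σ)
    {w : Fin r → E} (hw : ¬ (LinearIndependent ℝ w ∧
      ∀ j, w j ∈ Submodule.span ℝ (Set.range σ))) : bdSum σ w = 0 := by
  simp only [bdSum, Finset.sum_apply, Pi.smul_apply, smul_eq_mul]
  refine Finset.sum_eq_zero fun i _ => ?_
  rw [mul_eq_zero]
  right
  by_contra h
  refine hw ⟨indep_of_ev_ne_zero (facet_indep hσ i) h, fun j => ?_⟩
  refine Submodule.span_mono ?_ (mem_span_of_ev_ne_zero (facet_indep hσ i) h j)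
  rintro _ ⟨k, rfl⟩
  exact ⟨_, rfl⟩

theorem exists_complement_vector {r : ℕ} {w : Fin r → E} (hw : LinearIndependent ℝ w)
    {σ : Fin (r + 1) → E} (hσ : LinearIndependent ℝ σ) :
    ∃ u ∈ Submodule.span ℝ (Set.range σ), LinearIndependent ℝ (Fin.snoc w u : Fin (r + 1) → E) := by
  have hfin : FiniteDimensional ℝ (Submodule.span ℝ (Set.range w)) :=
    FiniteDimensional.span_of_finite ℝ (Set.finite_range w)
  have : ¬ Submodule.span ℝ (Set.range σ) ≤ Submodule.span ℝ (Set.range w) := by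
    intro h
    have := Submodule.finrank_mono h
    rw [finrank_span_eq_card hσ, finrank_span_eq_card hw] at this
    simp at this
  obtain ⟨u, hu, hu'⟩ := SetLike.not_le_iff_exists.1 this
  refine ⟨u, hu, ?_⟩
  rw [linearIndependent_finSnoc]
  exact ⟨hw, hu'⟩

theorem bdSum_rel {r : ℕ} {ι : Type*} {s : Finset ι} {σ : ι → Fin (r + 1) → E} {b : ι → ℚ}
    (hσ : ∀ a ∈ s, LinearIndependent ℝ (σ a)) (h : ∑ a ∈ s, b a • ev (σ a) = 0) :
    ∑ a ∈ s, b a • bdSum (σ a) = 0 := by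
  classical
  funext w
  simp only [Finset.sum_apply, Pi.smul_apply, smul_eq_mul, Pi.zero_apply]
  by_cases hw : LinearIndependent ℝ w
  · let good : Submodule ℝ E → Prop := fun W =>
      (∀ j, w j ∈ W) ∧ ∃ u ∈ W, LinearIndependent ℝ (Fin.snoc w u : Fin (r + 1) → E)
    let u : Submodule ℝ E → E := fun W => if h : good W then h.2.choose else 0
    let g : Submodule ℝ E → ℚ := fun W => if good W then (-1) ^ r else 0
    have h1 := sum_fiber hσ h g (fun W => Fin.snoc w (u W))
    have h2 := sum_fiber hσ h g (fun W => Fin.snoc w (-u W))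
    have h3 := congrArg₂ (· + ·) h1 h2
    simp only [← Finset.sum_add_distrib, add_zero] at h3
    rw [← h3]
    refine Finset.sum_congr rfl fun a ha => ?_
    rw [← mul_add, ← mul_add]
    congr 1
    by_cases hg : good (Submodule.span ℝ (Set.range (σ a)))
    · simp only [g, u, dif_pos hg, if_pos hg]
      exact bdSum_apply_eq (hσ a ha) hg.1 hg.2.choose_spec.1 hg.2.choose_spec.2
    · simp only [g, if_neg hg, zero_mul, add_zero]
      refine bdSum_apply_of_not_mem (hσ a ha) fun hh => hg ⟨hh.2, ?_⟩
      exact exists_complement_vector hw (hσ a ha)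
  · refine Finset.sum_eq_zero fun a ha => ?_
    rw [bdSum_apply_of_not_mem (hσ a ha) (fun hh => hw hh.1), mul_zero]

/-- The span of all simplicial cones. -/
def PCall (E : Type*) [AddCommGroup E] [Module ℝ E] (r : ℕ) : Submodule ℚ (PF E r) :=
  Submodule.span ℚ (ev '' {σ | LinearIndependent ℝ σ})

theorem exists_bd (E : Type*) [AddCommGroup E] [Module ℝ E] (r : ℕ) :
    ∃ f : PF E (r + 1) →ₗ[ℚ] PF E r,
      ∀ σ : Fin (r + 1) → E, LinearIndependent ℝ σ → f (ev σ) = bdSum σ := by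
  classical
  let I := {σ : Fin (r + 1) → E // LinearIndependent ℝ σ}
  let f₁ : (I →₀ ℚ) →ₗ[ℚ] PF E (r + 1) := Finsupp.linearCombination ℚ fun σ => ev σ.1
  let f₂ : (I →₀ ℚ) →ₗ[ℚ] PF E r := Finsupp.linearCombination ℚ fun σ => bdSum σ.1
  have hker : LinearMap.ker f₁ ≤ LinearMap.ker f₂ := by
    intro b hb
    rw [LinearMap.mem_ker] at hb ⊢
    simp only [f₁, f₂, Finsupp.linearCombination_apply, Finsupp.sum] at hb ⊢
    exact bdSum_rel (fun a _ => a.2) hb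
  let g : LinearMap.range f₁ →ₗ[ℚ] PF E r :=
    (Submodule.liftQ _ f₂ hker).comp f₁.quotKerEquivRange.symm.toLinearMap
  obtain ⟨f, hf⟩ := LinearMap.exists_extend g
  refine ⟨f, fun σ hσ => ?_⟩
  have h1 : f₁ (Finsupp.single ⟨σ, hσ⟩ 1) = ev σ := by simp [f₁]
  have h2 : f₂ (Finsupp.single ⟨σ, hσ⟩ 1) = bdSum σ := by simp [f₂]
  have h3 := LinearMap.congr_fun hf ⟨f₁ (Finsupp.single ⟨σ, hσ⟩ 1), LinearMap.mem_range_self _ _⟩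
  simp only [LinearMap.comp_apply, Submodule.subtype_apply] at h3
  rw [← h1, h3, ← h2]
  simp only [g, LinearMap.comp_apply, LinearEquiv.coe_coe]
  have : f₁.quotKerEquivRange.symm ⟨f₁ (Finsupp.single ⟨σ, hσ⟩ 1), LinearMap.mem_range_self _ _⟩ =
      Submodule.Quotient.mk (Finsupp.single ⟨σ, hσ⟩ 1) := by
    rw [LinearEquiv.symm_apply_eq]
    rfl
  rw [this]
  exact Submodule.liftQ_apply _ _ _

/-- The boundary operator on polyhedral conic chains. -/
def bd {E : Type*} [AddCommGroup E] [Module ℝ E] (r : ℕ) : PF E (r + 1) →ₗ[ℚ] PF E r :=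
  (exists_bd E r).choose

theorem bd_ev {r : ℕ} {σ : Fin (r + 1) → E} (hσ : LinearIndependent ℝ σ) :
    bd r (ev σ) = bdSum σ :=
  (exists_bd E r).choose_spec σ hσ

theorem bd_apply_top {r : ℕ} (hr : Module.finrank ℝ E = r + 1) {T : PF E (r + 1)}
    (hT : T ∈ PCall E (r + 1)) {w : Fin r → E} {u : E}
    (hwu : LinearIndependent ℝ (Fin.snoc w u : Fin (r + 1) → E)) :
    bd r T w = (-1 : ℚ) ^ r * (T (Fin.snoc w u) + T (Fin.snoc w (-u))) := by
  induction hT using Submodule.span_induction with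
  | mem x hx =>
    obtain ⟨σ, hσ, rfl⟩ := hx
    have : Submodule.span ℝ (Set.range σ) = ⊤ := by
      have : FiniteDimensional ℝ E := FiniteDimensional.of_finrank_pos (by omega)
      apply LinearIndependent.span_eq_top_of_card_eq_finrank' hσ
      simp [hr]
    rw [bd_ev hσ]
    exact bdSum_apply_eq hσ (by simp [this]) (by simp [this]) hwu
  | zero => simp
  | add x y _ _ hx hy => rw [map_add]; simp only [Pi.add_apply, hx, hy]; ring
  | smul a x _ hx => rw [map_smul]; simp only [Pi.smul_apply, hx, smul_eq_mul]; ring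

theorem bd_apply_of_dep {r : ℕ} {T : PF E (r + 1)}
    (hT : T ∈ PCall E (r + 1)) {w : Fin r → E} (hw : ¬ LinearIndependent ℝ w) :
    bd r T w = 0 := by
  induction hT using Submodule.span_induction with
  | mem x hx =>
    obtain ⟨σ, hσ, rfl⟩ := hx
    rw [bd_ev hσ]
    exact bdSum_apply_of_not_mem hσ fun h => hw h.1
  | zero => simp
  | add x y _ _ hx hy => rw [map_add]; simp only [Pi.add_apply, hx, hy]; ring
  | smul a x _ hx => rw [map_smul]; simp only [Pi.smul_apply, hx, smul_eq_mul]; ring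

end Boundary

theorem facet_facet {E : Type*} {r : ℕ} (σ : Fin (r + 2) → E) (i : Fin (r + 2)) (j : Fin (r + 1)) :
    facet (facet σ i) j = facet (facet σ (i.succAbove j)) (j.predAbove i) := by
  funext k
  simp only [facet]
  congr 1
  exact (Fin.succAbove_succAbove_succAbove_predAbove i j k).symm


end PolyChain

namespace PolyChain

section Coning

variable {E : Type*} [AddCommGroup E] [Module ℝ E]

theorem lexPos_comp_succAbove {r : ℕ} {a c : Fin (r + 1) → ℝ} {j₀ : Fin (r + 1)}
    (hc : ∑ j, c j * a j = 0) (h1 : c j₀ = 1) (h2 : ∀ j, j₀ < j → c j = 0) :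
    LexPos a ↔ LexPos (fun k => a (j₀.succAbove k)) := by
  have key : (∀ j < j₀, a j = 0) → a j₀ = 0 := by
    intro h
    rw [Finset.sum_eq_single j₀] at hc
    · simpa [h1] using hc
    · intro j _ hj
      rcases lt_or_gt_of_ne hj with h3 | h3
      · rw [h j h3, mul_zero]
      · rw [h2 j h3, zero_mul]
    · simp
  constructor
  · rintro ⟨i, hi, hi'⟩
    have hne : i ≠ j₀ := by
      rintro rfl
      exact hi.ne' (key hi')
    obtain ⟨k, rfl⟩ := Fin.exists_succAbove_eq hne
    exact ⟨k, hi, fun j hj => hi' _ (Fin.strictMono_succAbove j₀ hj)⟩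
  · rintro ⟨k, hk, hk'⟩
    refine ⟨_, hk, fun j hj => ?_⟩
    have aux : ∀ j, j ≠ j₀ → j < j₀.succAbove k → a j = 0 := by
      intro j hj hlt
      obtain ⟨l, rfl⟩ := Fin.exists_succAbove_eq hj
      exact hk' l ((Fin.strictMono_succAbove j₀).lt_iff_lt.1 hlt)
    by_cases hjj : j = j₀
    · subst hjj
      exact key fun l hl => aux l hl.ne (hl.trans hj)
    · exact aux j hjj hj

theorem exists_last_relation {r : ℕ} {H : Type*} [AddCommGroup H] [Module ℝ H]
    {h : Fin (r + 1) → H} (hdep : ¬ LinearIndependent ℝ h) :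
    ∃ (c : Fin (r + 1) → ℝ) (j₀ : Fin (r + 1)), ∑ j, c j • h j = 0 ∧ c j₀ = 1 ∧
      ∀ j, j₀ < j → c j = 0 := by
  classical
  rw [Fintype.linearIndependent_iff] at hdep
  push Not at hdep
  obtain ⟨g, hg, i, hi⟩ := hdep
  have hne : (Finset.univ.filter fun i => g i ≠ 0).Nonempty := ⟨i, by simpa using hi⟩
  set j₀ := (Finset.univ.filter fun i => g i ≠ 0).max' hne with hj₀
  have h0 : g j₀ ≠ 0 := by
    have := Finset.max'_mem _ hne
    simpa using this
  refine ⟨fun j => (g j₀)⁻¹ * g j, j₀, ?_, inv_mul_cancel₀ h0, fun j hj => ?_⟩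
  · simp only [mul_smul, ← Finset.smul_sum, hg, smul_zero]
  · have : g j = 0 := by
      by_contra h
      exact absurd (Finset.le_max' _ j (by simpa using h)) (not_le.2 hj)
    simp [this]

theorem ev_cons_factor {r : ℕ} (H : Submodule ℝ E) {v : E} (hv : v ∉ H) (w : Fin (r + 1) → E) :
    ∃ (g : ℚ) (w' : Fin r → E), ∀ τ : Fin r → E, LinearIndependent ℝ τ →
      Submodule.span ℝ (Set.range τ) = H →
      ev (Fin.cons v τ : Fin (r + 1) → E) w = g * ev τ w' := by
  classical
  by_cases hτ₀ : ∃ τ : Fin r → E, LinearIndependent ℝ τ ∧ Submodule.span ℝ (Set.range τ) = H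
  swap
  · exact ⟨0, fun _ => 0, fun τ h1 h2 => absurd ⟨τ, h1, h2⟩ hτ₀⟩
  obtain ⟨τ₀, hτ₀, hH⟩ := hτ₀
  have hcons : ∀ τ : Fin r → E, LinearIndependent ℝ τ → Submodule.span ℝ (Set.range τ) = H →
      LinearIndependent ℝ (Fin.cons v τ : Fin (r + 1) → E) := by
    intro τ h1 h2
    rw [linearIndependent_finCons, h2]
    exact ⟨h1, hv⟩
  by_cases hw : ∀ j, ∃ (t : ℝ) (h : H), w j = t • v + (h : E)
  swap
  · refine ⟨0, fun _ => 0, fun τ h1 h2 => ?_⟩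
    rw [zero_mul]
    by_contra hne
    refine hw fun j => ?_
    have := mem_span_of_ev_ne_zero (hcons τ h1 h2) hne j
    rw [Fin.range_cons, Submodule.mem_span_insert] at this
    obtain ⟨t, z, hz, e⟩ := this
    exact ⟨t, ⟨z, h2 ▸ hz⟩, e⟩
  choose α h hαh using hw
  have hfin : FiniteDimensional ℝ H := hH ▸ FiniteDimensional.span_of_finite ℝ (Set.finite_range τ₀)
  have hrank : Module.finrank ℝ H = r := by
    rw [← hH, finrank_span_eq_card hτ₀, Fintype.card_fin]
  have hdep : ¬ LinearIndependent ℝ h := by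
    intro hi
    have := hi.fintype_card_le_finrank
    simp [hrank] at this
  obtain ⟨c, j₀, hc0, hc1, hc2⟩ := exists_last_relation hdep
  refine ⟨(if LexPos α then 1 else 0) * ((-1) ^ (j₀ : ℕ) * (SignType.sign (∑ j, c j * α j) : ℚ)),
    fun k => (h (j₀.succAbove k) : E), fun τ h1 h2 => ?_⟩
  have hmem : ∀ j, (h j : E) ∈ Submodule.span ℝ (Set.range τ) := fun j => h2 ▸ (h j).2
  obtain ⟨a, ha⟩ := exists_matrix hmem
  obtain ⟨A, hA0, hAs⟩ : ∃ A : Matrix (Fin (r + 1)) (Fin (r + 1)) ℝ,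
      A 0 = α ∧ ∀ i, A (Fin.succ i) = a i :=
    ⟨Matrix.of (Fin.cons α a), rfl, fun i => rfl⟩
  obtain ⟨a', ha'⟩ : ∃ a' : Matrix (Fin r) (Fin r) ℝ, ∀ i j, a' i j = a i (j₀.succAbove j) :=
    ⟨Matrix.of fun i j => a i (j₀.succAbove j), fun i j => rfl⟩
  have hAw : ∀ j, w j = ∑ i, A i j • (Fin.cons v τ : Fin (r + 1) → E) i := by
    intro j
    rw [Fin.sum_univ_succ]
    simp [hA0, hAs, hαh, ha]
  have haw : ∀ k, (h (j₀.succAbove k) : E) = ∑ i, a' i k • τ i := by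
    intro k
    simp only [ha, ha']
  have hrel : ∀ i, ∑ j, c j * a i j = 0 := by
    intro i
    have : ∑ i, (∑ j, c j * a i j) • τ i = 0 := by
      have e : ((∑ j, c j • h j : H) : E) = 0 := by rw [hc0]; rfl
      rw [← e]
      simp only [AddSubmonoidClass.coe_finsetSum, Submodule.coe_smul, ha, Finset.smul_sum,
        smul_smul, Finset.sum_smul]
      rw [Finset.sum_comm]
    exact Fintype.linearIndependent_iff.1 h1 _ this i
  have hdet : A.det = (-1) ^ (j₀ : ℕ) * (∑ j, c j * α j) * a'.det := by
    have e := Matrix.det_updateCol_sum A j₀ c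
    rw [hc1, one_smul] at e
    rw [← e, Matrix.det_succ_column _ j₀, Fin.sum_univ_succ]
    have z : ∀ i : Fin r, (A.updateCol j₀ fun k => ∑ i, c i • A k i) i.succ j₀ = 0 := by
      intro i
      rw [Matrix.updateCol_self]
      simpa [hAs] using hrel i
    simp only [z, mul_zero, zero_mul, Finset.sum_const_zero, add_zero]
    have e3 : ((A.updateCol j₀ fun k => ∑ i, c i • A k i).submatrix
        (Fin.succAbove 0) j₀.succAbove) = a' := by
      ext i j
      rw [Matrix.submatrix_apply, Matrix.updateCol_ne (Fin.succAbove_ne j₀ j)]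
      simp [hAs, ha']
    rw [e3, Matrix.updateCol_self]
    simp [hA0]
  have hlp : ∀ i, LexPos (a i) ↔ LexPos (a' i) := by
    intro i
    rw [lexPos_comp_succAbove (hrel i) hc1 hc2]
    have : a' i = fun k => a i (j₀.succAbove k) := by funext k; exact ha' i k
    rw [this]
  have hall : (∀ i, LexPos (A i)) ↔ LexPos α ∧ ∀ i, LexPos (a' i) := by
    constructor
    · intro h
      exact ⟨hA0 ▸ h 0, fun i => (hlp i).1 (hAs i ▸ h i.succ)⟩
    · rintro ⟨h, h'⟩ i
      induction i using Fin.cases with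
      | zero => exact hA0.symm ▸ h
      | succ i => exact (hAs i).symm ▸ (hlp i).2 (h' i)
  rw [ev_of (hcons τ h1 h2) hAw, ev_of h1 haw, hdet]
  simp only [hall, sign_mul_rat, sign_neg_one_pow]
  by_cases c1 : LexPos α <;> by_cases c2 : ∀ i, LexPos (a' i) <;> simp [c1, c2]

theorem cone_rel {r : ℕ} {ι : Type*} {s : Finset ι} {τ : ι → Fin r → E} {b : ι → ℚ}
    (hτ : ∀ a ∈ s, LinearIndependent ℝ (τ a)) (h : ∑ a ∈ s, b a • ev (τ a) = 0) {v : E}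
    (hv : ∀ a ∈ s, v ∉ Submodule.span ℝ (Set.range (τ a))) :
    ∑ a ∈ s, b a • ev (Fin.cons v (τ a) : Fin (r + 1) → E) = 0 := by
  classical
  funext w
  have := fun (H : Submodule ℝ E) (hv : v ∉ H) => ev_cons_factor (r := r) H hv w
  choose g w' hg using this
  have h1 := sum_fiber hτ h (fun H => if hH : v ∉ H then g H hH else 0)
    (fun H => if hH : v ∉ H then w' H hH else 0)
  simp only [Finset.sum_apply, Pi.smul_apply, smul_eq_mul, Pi.zero_apply]
  rw [← h1]
  refine Finset.sum_congr rfl fun a ha => ?_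
  rw [dif_pos (hv a ha), dif_pos (hv a ha), hg _ (hv a ha) _ (hτ a ha) rfl]

theorem facet_cons_succ {E : Type*} {r : ℕ} (v : E) (τ : Fin (r + 1) → E) (i : Fin (r + 1)) :
    facet (Fin.cons v τ : Fin (r + 2) → E) i.succ = Fin.cons v (facet τ i) := by
  funext j
  induction j using Fin.cases <;> simp [facet]

theorem facet_cons_zero {E : Type*} {r : ℕ} (v : E) (τ : Fin r → E) :
    facet (Fin.cons v τ : Fin (r + 1) → E) 0 = τ := by
  funext j
  simp [facet]

theorem bdSum_cons {r : ℕ} (v : E) (τ : Fin (r + 1) → E) :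
    bdSum (Fin.cons v τ : Fin (r + 2) → E) =
      ev τ - ∑ i : Fin (r + 1), ((-1 : ℚ) ^ (i : ℕ)) • ev (Fin.cons v (facet τ i) :
        Fin (r + 1) → E) := by
  rw [bdSum, Fin.sum_univ_succ, facet_cons_zero, sub_eq_add_neg, ← Finset.sum_neg_distrib]
  congr 1
  · simp
  · refine Finset.sum_congr rfl fun i _ => ?_
    rw [facet_cons_succ, Fin.val_succ, pow_succ, ← neg_smul]
    congr 1
    ring

theorem bdSum_cons_nil (v : E) (τ : Fin 0 → E) :
    bdSum (Fin.cons v τ : Fin 1 → E) = ev τ := by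
  rw [bdSum, Fin.sum_univ_succ, facet_cons_zero]
  simp

end Coning

/-- A class of linearly independent tuples, closed under facets. -/
structure ConeClass (E : Type*) [AddCommGroup E] [Module ℝ E] where
  carrier : ∀ r, Set (Fin r → E)
  indep : ∀ {r} {σ : Fin r → E}, σ ∈ carrier r → LinearIndependent ℝ σ
  facet_mem : ∀ {r} {σ : Fin (r + 1) → E}, σ ∈ carrier (r + 1) → ∀ i, facet σ i ∈ carrier r
  nil_mem : ∀ σ : Fin 0 → E, σ ∈ carrier 0

section Complex

variable {E : Type*} [AddCommGroup E] [Module ℝ E]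

/-- The chains generated by a class of simplicial cones. -/
def ConeClass.PC (S : ConeClass E) (r : ℕ) : Submodule ℚ (PF E r) :=
  Submodule.span ℚ (ev '' S.carrier r)

theorem ConeClass.ev_mem (S : ConeClass E) {r : ℕ} {σ : Fin r → E} (h : σ ∈ S.carrier r) :
    ev σ ∈ S.PC r := Submodule.subset_span ⟨σ, h, rfl⟩

theorem ConeClass.le_all (S : ConeClass E) (r : ℕ) : S.PC r ≤ PCall E r :=
  Submodule.span_mono (Set.image_mono fun _ h => S.indep h)

theorem ConeClass.exists_rep (S : ConeClass E) {r : ℕ} {T : PF E r} (hT : T ∈ S.PC r) :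
    ∃ (s : Finset (Fin r → E)) (b : (Fin r → E) → ℚ), (∀ σ ∈ s, σ ∈ S.carrier r) ∧
      T = ∑ σ ∈ s, b σ • ev σ := by
  obtain ⟨l, hl, rfl⟩ := (Finsupp.mem_span_image_iff_linearCombination ℚ).1 hT
  exact ⟨l.support, l, fun σ hσ => (Finsupp.mem_supported ℚ l).1 hl hσ, rfl⟩

theorem ConeClass.bdSum_mem (S : ConeClass E) {r : ℕ} {σ : Fin (r + 1) → E}
    (h : σ ∈ S.carrier (r + 1)) : bdSum σ ∈ S.PC r :=
  Submodule.sum_mem _ fun i _ => Submodule.smul_mem _ _ (S.ev_mem (S.facet_mem h i))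

theorem ConeClass.bd_mem (S : ConeClass E) {r : ℕ} {T : PF E (r + 1)} (hT : T ∈ S.PC (r + 1)) :
    bd r T ∈ S.PC r := by
  have : S.PC (r + 1) ≤ (S.PC r).comap (bd r) := by
    rw [ConeClass.PC, Submodule.span_le]
    rintro _ ⟨σ, hσ, rfl⟩
    rw [SetLike.mem_coe, Submodule.mem_comap, bd_ev (S.indep hσ)]
    exact S.bdSum_mem hσ
  exact this hT

theorem bd_bdSum {r : ℕ} {σ : Fin (r + 2) → E} (hσ : LinearIndependent ℝ σ) :
    bd r (bdSum σ) = 0 := by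
  have h1 : bd r (bdSum σ) = ∑ i : Fin (r + 2), ∑ j : Fin (r + 1),
      ((-1 : ℚ) ^ ((i : ℕ) + j)) • ev (facet (facet σ i) j) := by
    simp only [bdSum, map_sum, map_smul]
    refine Finset.sum_congr rfl fun i _ => ?_
    rw [bd_ev (facet_indep hσ i), bdSum, Finset.smul_sum]
    simp only [smul_smul, pow_add]
  rw [h1, ← Finset.sum_product']
  refine Finset.sum_involution (fun x _ => (x.1.succAbove x.2, x.2.predAbove x.1)) ?_ ?_ ?_ ?_
  · rintro ⟨i, j⟩ -
    simp only
    rw [← facet_facet σ i j, ← add_smul]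
    have : ((-1 : ℚ) ^ ((i : ℕ) + j)) + (-1) ^ ((i.succAbove j : ℕ) + (j.predAbove i : ℕ)) = 0 := by
      have key := Fin.neg_one_pow_succAbove_add_predAbove (R := ℚ) i j
      rw [key]
      ring
    rw [this, zero_smul]
  · rintro ⟨i, j⟩ - - h
    exact Fin.succAbove_ne i j (Prod.ext_iff.1 h).1
  · simp
  · rintro ⟨i, j⟩ -
    simp [Fin.succAbove_succAbove_predAbove, Fin.predAbove_predAbove_succAbove]

theorem ConeClass.bd_bd (S : ConeClass E) {r : ℕ} {T : PF E (r + 2)} (hT : T ∈ S.PC (r + 2)) :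
    bd r (bd (r + 1) T) = 0 := by
  have : S.PC (r + 2) ≤ LinearMap.ker ((bd r).comp (bd (E := E) (r + 1))) := by
    rw [ConeClass.PC, Submodule.span_le]
    rintro _ ⟨σ, hσ, rfl⟩
    rw [SetLike.mem_coe, LinearMap.mem_ker, LinearMap.comp_apply, bd_ev (S.indep hσ),
      bd_bdSum (S.indep hσ)]
  exact this hT

/-- Cycles, with the convention that every `0`-chain is a cycle. -/
def IsCyc : ∀ {r : ℕ}, PF E r → Prop
  | 0, _ => True
  | r + 1, T => bd r T = 0

theorem ConeClass.exists_bd_of_coning (S : ConeClass E) {r : ℕ}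
    (hcone : ∀ F : Finset (Fin r → E), (∀ σ ∈ F, σ ∈ S.carrier r) →
      ∃ v, ∀ σ ∈ F, v ∉ Submodule.span ℝ (Set.range σ) ∧
        (Fin.cons v σ : Fin (r + 1) → E) ∈ S.carrier (r + 1))
    {T : PF E r} (hT : T ∈ S.PC r) (hc : IsCyc T) :
    ∃ R ∈ S.PC (r + 1), bd r R = T := by
  classical
  obtain ⟨s, b, hs, rfl⟩ := S.exists_rep hT
  obtain ⟨v, hv⟩ := hcone s hs
  refine ⟨∑ σ ∈ s, b σ • ev (Fin.cons v σ : Fin (r + 1) → E),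
    Submodule.sum_mem _ fun σ hσ => Submodule.smul_mem _ _ (S.ev_mem (hv σ hσ).2), ?_⟩
  rw [map_sum]
  have e : ∀ σ ∈ s, bd r (b σ • ev (Fin.cons v σ : Fin (r + 1) → E)) =
      b σ • bdSum (Fin.cons v σ : Fin (r + 1) → E) := fun σ hσ => by
    rw [map_smul, bd_ev (S.indep (hv σ hσ).2)]
  rw [Finset.sum_congr rfl e]
  cases r with
  | zero => simp only [bdSum_cons_nil]
  | succ r =>
    simp only [bdSum_cons, smul_sub, Finset.sum_sub_distrib]
    rw [sub_eq_self]
    have h0 : ∑ x ∈ s ×ˢ (Finset.univ : Finset (Fin (r + 1))),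
        (b x.1 * (-1) ^ (x.2 : ℕ)) • ev (facet x.1 x.2) = 0 := by
      have hc' : bd r (∑ σ ∈ s, b σ • ev σ) = 0 := hc
      rw [Finset.sum_product, ← hc', map_sum]
      refine Finset.sum_congr rfl fun σ hσ => ?_
      rw [map_smul, bd_ev (S.indep (hs σ hσ)), bdSum, Finset.smul_sum]
      simp only [smul_smul]
    have h1 := cone_rel (v := v) (fun a ha => facet_indep
      (S.indep (hs _ (Finset.mem_product.1 ha).1)) _) h0 (fun a ha hm =>
        (hv _ (Finset.mem_product.1 ha).1).1 (Submodule.span_mono (by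
          rintro _ ⟨k, rfl⟩
          exact ⟨_, rfl⟩) hm))
    rw [Finset.sum_product] at h1
    rw [← h1]
    refine Finset.sum_congr rfl fun σ hσ => ?_
    rw [Finset.smul_sum]
    simp only [smul_smul]

end Complex

end PolyChain

namespace PolyChain

section Top

open Classical in
theorem sum_upper_telescope {ι α : Type*} [Fintype ι] [LinearOrder α] {s : ι → α}
    (hs : Function.Injective s) (P S : Finset ι) (hS : ∀ a ∈ S, ∀ b, s a ≤ s b → b ∈ S) :
    ∑ a ∈ S, ((if P = Finset.univ.filter (fun b => s a ≤ s b) then (1 : ℚ) else 0) -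
      if P = Finset.univ.filter (fun b => s a < s b) then 1 else 0) =
      (if P = S then 1 else 0) - if P = ∅ then 1 else 0 := by
  induction S using Finset.induction_on_min_value s with
  | empty => simp
  | insert a S haS hle ih =>
    rw [Finset.sum_insert haS, ih ?_]
    · have e1 : Finset.univ.filter (fun b => s a ≤ s b) = insert a S := by
        ext b
        simp only [Finset.mem_filter, Finset.mem_univ, true_and]
        constructor
        · exact hS a (Finset.mem_insert_self _ _) b
        · intro h
          rcases Finset.mem_insert.1 h with rfl | h
          · exact le_rfl
          · exact hle b h
      have e2 : Finset.univ.filter (fun b => s a < s b) = S := by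
        ext b
        simp only [Finset.mem_filter, Finset.mem_univ, true_and]
        constructor
        · intro h
          rcases Finset.mem_insert.1 (hS a (Finset.mem_insert_self _ _) b h.le) with rfl | h'
          · exact absurd h (lt_irrefl _)
          · exact h'
        · intro h
          refine lt_of_le_of_ne (hle b h) fun e => haS ?_
          rw [hs e]
          exact h
      rw [e1, e2]
      ring
    · intro b hb c hbc
      rcases Finset.mem_insert.1 (hS b (Finset.mem_insert_of_mem hb) c hbc) with rfl | h
      · have := hs (le_antisymm (hle b hb) hbc)
        subst this
        exact hb
      · exact h

open Classical in
theorem sum_upper_identity {ι α : Type*} [Fintype ι] [LinearOrder α] {s : ι → α}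
    (hs : Function.Injective s) (z : α) (P : ι → Prop) :
    (if ∀ i, (P i ↔ z < s i) then (1 : ℚ) else 0) -
      ∑ i, (if z < s i ∧ ∀ k, k ≠ i → (P k ↔ s i < s k) then (if P i then (1 : ℚ) else -1) else 0) =
      if ∀ i, ¬ P i then 1 else 0 := by
  have h := sum_upper_telescope hs (Finset.univ.filter P) (Finset.univ.filter fun i => z < s i)
    (fun a ha b hb => by
      simp only [Finset.mem_filter, Finset.mem_univ, true_and] at ha ⊢
      exact ha.trans_le hb)
  rw [Finset.sum_filter] at h
  have e1 : (Finset.univ.filter P = Finset.univ.filter fun i => z < s i) ↔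
      ∀ i, (P i ↔ z < s i) := by
    simp [Finset.ext_iff]
  have e2 : (Finset.univ.filter P = ∅) ↔ ∀ i, ¬ P i := by
    simp [Finset.ext_iff]
  have e3 : ∀ i, (if z < s i ∧ ∀ k, k ≠ i → (P k ↔ s i < s k) then
      (if P i then (1 : ℚ) else -1) else 0) = if z < s i then
        ((if Finset.univ.filter P = Finset.univ.filter (fun b => s i ≤ s b) then (1 : ℚ) else 0) -
        if Finset.univ.filter P = Finset.univ.filter (fun b => s i < s b) then 1 else 0) else 0 := by
    intro i
    by_cases hz : z < s i
    swap
    · simp [hz]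
    have f1 : (Finset.univ.filter P = Finset.univ.filter fun b => s i ≤ s b) ↔
        P i ∧ ∀ k, k ≠ i → (P k ↔ s i < s k) := by
      simp only [Finset.ext_iff, Finset.mem_filter, Finset.mem_univ, true_and]
      constructor
      · intro h
        refine ⟨(h i).2 le_rfl, fun k hk => (h k).trans ?_⟩
        rw [le_iff_lt_or_eq, or_iff_left]
        exact fun e => hk (hs e).symm
      · rintro ⟨h1, h2⟩ k
        by_cases hk : k = i
        · subst hk
          simp [h1]
        · rw [h2 k hk, le_iff_lt_or_eq, or_iff_left]
          exact fun e => hk (hs e).symm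
    have f2 : (Finset.univ.filter P = Finset.univ.filter fun b => s i < s b) ↔
        ¬ P i ∧ ∀ k, k ≠ i → (P k ↔ s i < s k) := by
      simp only [Finset.ext_iff, Finset.mem_filter, Finset.mem_univ, true_and]
      constructor
      · intro h
        exact ⟨fun h' => lt_irrefl _ ((h i).1 h'), fun k _ => h k⟩
      · rintro ⟨h1, h2⟩ k
        by_cases hk : k = i
        · subst hk
          simp [h1]
        · exact h2 k hk
    simp only [hz, true_and, if_true, f1, f2]
    by_cases h1 : P i <;> by_cases h2 : ∀ k, k ≠ i → (P k ↔ s i < s k) <;>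
      simp [h1, h2] <;> split_ifs <;> norm_num
  rw [Finset.sum_congr rfl fun i _ => e3 i, h]
  simp only [e1, e2]
  ring

open Classical in
theorem sum_upper_identity' {ι α : Type*} [Fintype ι] [LinearOrder α] {s : ι → α}
    (hs : Function.Injective s) (z : α) (P : ι → Prop) {R : ι → Prop} {R' : ι → ι → Prop}
    (hR : ∀ i, R i ↔ z < s i) (hR' : ∀ i k, R' i k ↔ s i < s k) :
    (if ∀ i, (P i ↔ R i) then (1 : ℚ) else 0) -
      ∑ i, (if R i ∧ ∀ k, k ≠ i → (P k ↔ R' i k) then (if P i then (1 : ℚ) else -1) else 0) =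
      if ∀ i, ¬ P i then 1 else 0 := by
  simp only [hR, hR']
  exact sum_upper_identity hs z P

variable {E : Type*} [AddCommGroup E] [Module ℝ E]

theorem lexPos_sub_iff {r : ℕ} (a b : Fin r → ℝ) : LexPos (a - b) ↔ toLex b < toLex a := by
  constructor
  · rintro ⟨i, hi, h⟩
    exact ⟨i, fun j hj => (sub_eq_zero.1 (h j hj)).symm, sub_pos.1 hi⟩
  · rintro ⟨i, h, hi⟩
    exact ⟨i, sub_pos.2 hi, fun j hj => sub_eq_zero.2 (h j hj).symm⟩

theorem lexPos_smul_sub_iff {r : ℕ} {a : Fin r → ℝ} (ha : a ≠ 0) {t : ℝ} (ht : t ≠ 0) :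
    LexPos (t • a) ↔ (0 < t ↔ LexPos a) := by
  rcases lt_or_gt_of_ne ht with h | h
  · have : t • a = (-t) • (-a) := by simp
    rw [this, lexPos_smul_iff (by linarith)]
    simp only [h.not_gt, false_iff]
    constructor
    · exact fun h1 h2 => h2.not_neg h1
    · exact fun h1 => (lexPos_or_neg ha).resolve_left h1
  · rw [lexPos_smul_iff h]
    simp [h]

open Classical in
theorem ev_of' {r : ℕ} {σ : Fin r → E} (hσ : LinearIndependent ℝ σ) {w : Fin r → E}
    {a : Fin r → Fin r → ℝ} (ha : ∀ j, w j = ∑ i, a i j • σ i) :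
    ev σ w = if ∀ i, LexPos (a i) then (SignType.sign (Matrix.of a).det : ℚ) else 0 :=
  ev_of hσ (A := Matrix.of a) ha

theorem ev_cons_facet {r : ℕ} {σ w : Fin (r + 1) → E} (hσ : LinearIndependent ℝ σ)
    {c : Fin (r + 1) → ℝ} (hc : ∀ i, c i ≠ 0)
    {A : Fin (r + 1) → Fin (r + 1) → ℝ} (hA : ∀ j, w j = ∑ i, A i j • σ i)
    (i : Fin (r + 1)) :
    (-1 : ℚ) ^ (i : ℕ) * ev (Fin.cons (∑ i, c i • σ i) (facet σ i) : Fin (r + 1) → E) w =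
      (open Classical in if LexPos ((c i)⁻¹ • A i) ∧ ∀ k, k ≠ i →
        LexPos (c k • ((c k)⁻¹ • A k - (c i)⁻¹ • A i))
        then (SignType.sign (c i) : ℚ) * SignType.sign (Matrix.of A).det else 0) := by
  classical
  obtain ⟨B, hB0, hBs⟩ : ∃ B : Fin (r + 1) → Fin (r + 1) → ℝ, B 0 = (c i)⁻¹ • A i ∧
      ∀ k, B (Fin.succ k) =
        c (i.succAbove k) • ((c (i.succAbove k))⁻¹ • A (i.succAbove k) - (c i)⁻¹ • A i) :=
    ⟨Fin.cons ((c i)⁻¹ • A i) fun k =>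
      c (i.succAbove k) • ((c (i.succAbove k))⁻¹ • A (i.succAbove k) - (c i)⁻¹ • A i),
      rfl, fun k => rfl⟩
  obtain ⟨M, hM⟩ : ∃ M : Fin (r + 1) → Fin (r + 1) → ℝ, ∀ l, M l =
      Fin.cons (c l) (fun k => if l = i.succAbove k then 1 else 0) :=
    ⟨fun l => Fin.cons (c l) (fun k => if l = i.succAbove k then 1 else 0),
      fun l => rfl⟩
  have hMσ : ∀ j, (Fin.cons (∑ i, c i • σ i) (facet σ i) : Fin (r + 1) → E) j =
      ∑ l, M l j • σ l := by
    intro j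
    induction j using Fin.cases with
    | zero => simp [hM]
    | succ k => simp [hM, facet]
  have hMdet : (Matrix.of M).det = (-1) ^ (i : ℕ) * c i := by
    rw [Matrix.det_succ_row (Matrix.of M) i, Fin.sum_univ_succ]
    have z : ∀ k : Fin r, M i k.succ = 0 := by
      intro k
      simp [hM, (Fin.succAbove_ne i k).symm]
    have e : (Matrix.of M).submatrix i.succAbove (Fin.succAbove 0) = 1 := by
      ext a b
      simp [hM, Matrix.one_apply]
    simp only [Matrix.of_apply, z, mul_zero, zero_mul, Finset.sum_const_zero, add_zero, e, Matrix.det_one, mul_one]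
    simp [hM]
  have hτ : LinearIndependent ℝ (Fin.cons (∑ i, c i • σ i) (facet σ i) : Fin (r + 1) → E) := by
    refine indep_of_det_ne_zero hσ (A := Matrix.of M) hMσ ?_
    rw [hMdet]
    exact mul_ne_zero (pow_ne_zero _ (by norm_num)) (hc i)
  have hMB : Matrix.of A = Matrix.of M * Matrix.of B := by
    ext l j
    rw [Matrix.of_apply, Matrix.mul_apply, Fin.sum_univ_succ]
    rcases eq_or_ne l i with rfl | hl
    · have z : ∀ k : Fin r, M l k.succ = 0 := by
        intro k
        simp [hM, (Fin.succAbove_ne l k).symm]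
      simp [z, hB0, hM, hc]
    · obtain ⟨k, rfl⟩ := Fin.exists_succAbove_eq hl
      rw [Finset.sum_eq_single k]
      · have := hc (i.succAbove k)
        have := hc i
        simp only [Matrix.of_apply, hM, hB0, hBs, Fin.cons_zero, Fin.cons_succ, if_true, Pi.smul_apply,
          smul_eq_mul, Pi.sub_apply]
        field_simp
        ring
      · intro b _ hb
        simp [hM, Fin.succAbove_right_inj, hb.symm]
      · simp
  have hBw : ∀ j, w j = ∑ l, B l j •
      (Fin.cons (∑ i, c i • σ i) (facet σ i) : Fin (r + 1) → E) l := by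
    intro j
    have hMB' : ∀ l j, A l j = (Matrix.of M * Matrix.of B) l j := fun l j => by rw [← hMB]; rfl
    simp only [hA, hMB', Matrix.mul_apply, Matrix.of_apply]
    simp only [hMσ, Finset.smul_sum, smul_smul, Finset.sum_smul]
    rw [Finset.sum_comm]
    simp only [mul_comm]
  have hall : (∀ l, LexPos (B l)) ↔ LexPos ((c i)⁻¹ • A i) ∧ ∀ k, k ≠ i →
        LexPos (c k • ((c k)⁻¹ • A k - (c i)⁻¹ • A i)) := by
    constructor
    · intro h
      refine ⟨hB0 ▸ h 0, fun k hk => ?_⟩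
      obtain ⟨k, rfl⟩ := Fin.exists_succAbove_eq hk
      exact hBs k ▸ h k.succ
    · rintro ⟨h, h'⟩ l
      induction l using Fin.cases with
      | zero => exact hB0.symm ▸ h
      | succ k => exact (hBs k).symm ▸ h' _ (Fin.succAbove_ne i k)
  rw [ev_of' hτ hBw, hMB, Matrix.det_mul, hMdet]
  simp only [hall]
  split_ifs
  · rw [sign_mul_rat, sign_mul_rat, sign_neg_one_pow]
    have : (SignType.sign (c i) : ℚ) * SignType.sign (c i) = 1 := by
      rcases lt_or_gt_of_ne (hc i) with h | h <;> simp [h]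
    linear_combination (-(-1 : ℚ) ^ (i : ℕ) * SignType.sign (Matrix.of B).det) * this
  · simp

theorem ev_sub_cone {r : ℕ} {σ w : Fin (r + 1) → E} (hσ : LinearIndependent ℝ σ)
    {c : Fin (r + 1) → ℝ} (hc : ∀ i, c i ≠ 0)
    {A : Fin (r + 1) → Fin (r + 1) → ℝ} (hA : ∀ j, w j = ∑ i, A i j • σ i) :
    ev σ w - ∑ i : Fin (r + 1), (-1 : ℚ) ^ (i : ℕ) *
      ev (Fin.cons (∑ i, c i • σ i) (facet σ i) : Fin (r + 1) → E) w =
      (open Classical in if ∀ i, c i < 0 then (SignType.sign (Matrix.of A).det : ℚ) else 0) := by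
  classical
  rw [ev_of' hσ hA, Finset.sum_congr rfl fun i _ => ev_cons_facet hσ hc hA i]
  by_cases hd : (Matrix.of A).det = 0
  · simp [hd]
  have hrow : ∀ i, A i ≠ 0 := by
    intro i h
    exact hd (Matrix.det_eq_zero_of_row_eq_zero i fun j => congrFun h j)
  have hs : ∀ i k, i ≠ k → (c i)⁻¹ • A i ≠ (c k)⁻¹ • A k := by
    intro i k hik h
    have h2 : A i = (c i * (c k)⁻¹) • A k := by
      rw [mul_smul, ← h, smul_smul, mul_inv_cancel₀ (hc i), one_smul]
    apply hd
    have h3 : Matrix.of A = (Matrix.of A).updateRow i ((c i * (c k)⁻¹) • Matrix.of A k) := by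
      conv_lhs => rw [← Matrix.updateRow_eq_self (Matrix.of A) i]
      congr 1
    rw [h3, Matrix.det_updateRow_smul, Matrix.det_updateRow_eq_zero hik.symm, mul_zero]
  have key := sum_upper_identity' (s := fun i => toLex ((c i)⁻¹ • A i))
    (fun i k h => by_contra fun hne => hs i k hne (toLex_inj.1 h)) (toLex 0) (fun i => 0 < c i)
    (R := fun i => LexPos ((c i)⁻¹ • A i)) (R' := fun i k => LexPos ((c k)⁻¹ • A k - (c i)⁻¹ • A i))
    (fun i => by
      have := lexPos_sub_iff ((c i)⁻¹ • A i) 0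
      rw [sub_zero] at this
      exact this)
    (fun i k => lexPos_sub_iff _ _)
  have f1 : (∀ i, LexPos (A i)) ↔ ∀ i, (0 < c i ↔ LexPos ((c i)⁻¹ • A i)) := by
    refine forall_congr' fun i => ?_
    rw [← lexPos_smul_sub_iff (smul_ne_zero (inv_ne_zero (hc i)) (hrow i)) (hc i), smul_smul,
      mul_inv_cancel₀ (hc i), one_smul]
  have f2 : ∀ i, (∀ k, k ≠ i → LexPos (c k • ((c k)⁻¹ • A k - (c i)⁻¹ • A i))) ↔
      ∀ k, k ≠ i → (0 < c k ↔ LexPos ((c k)⁻¹ • A k - (c i)⁻¹ • A i)) := by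
    refine fun i => forall_congr' fun k => forall_congr' fun hk => ?_
    rw [lexPos_smul_sub_iff (sub_ne_zero.2 (hs k i hk)) (hc k)]
  have f3 : ∀ i, (SignType.sign (c i) : ℚ) = if 0 < c i then 1 else -1 := by
    intro i
    rcases lt_or_gt_of_ne (hc i) with h | h
    · simp [h, h.not_gt]
    · simp [h]
  have f4 : (∀ i, ¬ 0 < c i) ↔ ∀ i, c i < 0 :=
    forall_congr' fun i => ⟨fun h => lt_of_le_of_ne (not_lt.1 h) (hc i), fun h => h.not_gt⟩
  simp only [f4] at key
  simp only [f1, f2, f3]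
  have := congrArg (· * (SignType.sign (Matrix.of A).det : ℚ)) key
  simp only [sub_mul, Finset.sum_mul, ite_mul, zero_mul, one_mul] at this
  rw [← this]
  congr 1
  refine Finset.sum_congr rfl fun i _ => ?_
  split_ifs <;> simp

/-- The contribution of a simplicial cone to the constant represented by a top dimensional cycle. -/
theorem cycle_eq_of_coning {r : ℕ} {s : Finset (Fin (r + 1) → E)} {b : (Fin (r + 1) → E) → ℚ}
    (hs : ∀ σ ∈ s, LinearIndependent ℝ σ) (hc : bd r (∑ σ ∈ s, b σ • ev σ) = 0) {v : E}
    (hv : ∀ σ ∈ s, ∀ i, v ∉ Submodule.span ℝ (Set.range (facet σ i)))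
    {w : Fin (r + 1) → E} :
    (∑ σ ∈ s, b σ • ev σ) w = ∑ σ ∈ s, b σ * (ev σ w - ∑ i : Fin (r + 1), (-1 : ℚ) ^ (i : ℕ) *
      ev (Fin.cons v (facet σ i) : Fin (r + 1) → E) w) := by
  have h0 : ∑ x ∈ s ×ˢ (Finset.univ : Finset (Fin (r + 1))),
      (b x.1 * (-1) ^ (x.2 : ℕ)) • ev (facet x.1 x.2) = 0 := by
    rw [Finset.sum_product, ← hc, map_sum]
    refine Finset.sum_congr rfl fun σ hσ => ?_
    rw [map_smul, bd_ev (hs σ hσ), bdSum, Finset.smul_sum]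
    simp only [smul_smul]
  have h1 := cone_rel (v := v) (fun a ha => facet_indep (hs _ (Finset.mem_product.1 ha).1) _) h0
    (fun a ha => hv _ (Finset.mem_product.1 ha).1 _)
  rw [Finset.sum_product] at h1
  have h2 := congrFun h1 w
  simp only [Finset.sum_apply, Pi.smul_apply, smul_eq_mul, Pi.zero_apply] at h2 ⊢
  simp only [mul_sub, Finset.sum_sub_distrib, Finset.mul_sum, ← mul_assoc]
  rw [h2, sub_zero]

theorem coeff_ne_zero {r : ℕ} {σ : Fin (r + 1) → E} {c : Fin (r + 1) → ℝ}
    (h : ∀ i, ∑ i, c i • σ i ∉ Submodule.span ℝ (Set.range (facet σ i))) (i) : c i ≠ 0 := by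
  intro hi
  apply h i
  rw [Fin.sum_univ_succAbove _ i, hi, zero_smul, zero_add]
  exact Submodule.sum_mem _ fun k _ => Submodule.smul_mem _ _ (Submodule.subset_span ⟨k, rfl⟩)

end Top

end PolyChain

namespace PolyChain

section Cutting

variable {E : Type*} [AddCommGroup E] [Module ℝ E]

/-- All members of `τ` lie in the closed convex cone generated by `σ`. -/
def InHull {r m : ℕ} (σ : Fin r → E) (τ : Fin m → E) : Prop :=
  ∀ i, ∃ c : Fin r → ℝ, (∀ k, 0 ≤ c k) ∧ τ i = ∑ k, c k • σ k

theorem InHull.refl {r : ℕ} (σ : Fin r → E) : InHull σ σ := fun i =>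
  ⟨Pi.single i 1, fun k => by
    by_cases h : k = i
    · subst h; simp
    · simp [h], by
    rw [Finset.sum_eq_single i] <;> simp +contextual⟩

theorem InHull.comb {r m : ℕ} {σ : Fin r → E} {τ : Fin m → E} (h : InHull σ τ)
    {t : Fin m → ℝ} (ht : ∀ i, 0 ≤ t i) :
    ∃ c : Fin r → ℝ, (∀ k, 0 ≤ c k) ∧ ∑ i, t i • τ i = ∑ k, c k • σ k := by
  choose c hc hτ using h
  refine ⟨fun k => ∑ i, t i * c i k, fun k => Finset.sum_nonneg fun i _ =>
    mul_nonneg (ht i) (hc i k), ?_⟩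
  simp only [hτ, Finset.smul_sum, smul_smul, Finset.sum_smul]
  rw [Finset.sum_comm]

theorem InHull.trans {r m l : ℕ} {σ : Fin r → E} {τ : Fin m → E} {υ : Fin l → E}
    (h : InHull σ τ) (h' : InHull τ υ) : InHull σ υ := by
  intro i
  obtain ⟨c, hc, e⟩ := h' i
  obtain ⟨d, hd, e'⟩ := h.comb hc
  exact ⟨d, hd, e.trans e'⟩

theorem ev_update {r : ℕ} {σ w : Fin r → E} (hσ : LinearIndependent ℝ σ)
    {A : Fin r → Fin r → ℝ} (hA : ∀ j, w j = ∑ i, A i j • σ i) {i j : Fin r} (hij : i ≠ j)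
    {a b : ℝ} (ha : 0 < a) :
    LinearIndependent ℝ (Function.update σ i (a • σ i + b • σ j)) ∧
    ev (Function.update σ i (a • σ i + b • σ j)) w =
      (open Classical in if LexPos (A i) ∧ LexPos (a • A j - b • A i) ∧
        ∀ k, k ≠ i → k ≠ j → LexPos (A k) then (SignType.sign (Matrix.of A).det : ℚ) else 0) := by
  classical
  have hτ : LinearIndependent ℝ (Function.update σ i (a • σ i + b • σ j)) := by
    rw [Fintype.linearIndependent_iff] at hσ ⊢
    intro g hg
    have h1 : ∑ k, (Function.update (Function.update g i (g i * a)) j (g j + g i * b)) k • σ k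
        = 0 := by
      rw [← hg, ← sub_eq_zero, ← Finset.sum_sub_distrib]
      rw [← Finset.add_sum_erase _ _ (Finset.mem_univ i),
        ← Finset.add_sum_erase _ _ (Finset.mem_erase.2 ⟨hij.symm, Finset.mem_univ j⟩),
        Finset.sum_eq_zero]
      · simp only [Function.update_self, Function.update_of_ne hij, Function.update_of_ne hij.symm]
        module
      · intro k hk
        simp only [Finset.mem_erase] at hk
        simp [Function.update_of_ne hk.1, Function.update_of_ne hk.2.1]
    have h2 := hσ _ h1
    have hi : g i = 0 := by
      have := h2 i
      rw [Function.update_of_ne hij, Function.update_self] at this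
      exact (mul_eq_zero.1 this).resolve_right ha.ne'
    intro k
    by_cases hki : k = i
    · rw [hki, hi]
    by_cases hkj : k = j
    · have := h2 j
      rw [Function.update_self, hi] at this
      rw [hkj]
      linarith
    · have := h2 k
      rwa [Function.update_of_ne hkj, Function.update_of_ne hki] at this
  refine ⟨hτ, ?_⟩
  obtain ⟨B, hB⟩ : ∃ B : Fin r → Fin r → ℝ, B =
      Function.update (Function.update A j (A j + (-(b / a)) • A i)) i (a⁻¹ • A i) := ⟨_, rfl⟩
  have hBi : B i = a⁻¹ • A i := by rw [hB, Function.update_self]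
  have hBj : B j = a⁻¹ • (a • A j - b • A i) := by
    rw [hB, Function.update_of_ne hij.symm, Function.update_self, smul_sub, smul_smul, smul_smul,
      inv_mul_cancel₀ ha.ne', one_smul, neg_smul, ← sub_eq_add_neg, div_eq_inv_mul]
  have hBk : ∀ k, k ≠ i → k ≠ j → B k = A k := fun k h1 h2 => by
    rw [hB, Function.update_of_ne h1, Function.update_of_ne h2]
  have hBw : ∀ l, w l = ∑ k, B k l • Function.update σ i (a • σ i + b • σ j) k := by
    intro l
    rw [hA, ← sub_eq_zero, ← Finset.sum_sub_distrib]
    rw [← Finset.add_sum_erase _ _ (Finset.mem_univ i),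
      ← Finset.add_sum_erase _ _ (Finset.mem_erase.2 ⟨hij.symm, Finset.mem_univ j⟩),
      Finset.sum_eq_zero]
    · simp only [Function.update_self, Function.update_of_ne hij.symm, hBi, hBj, Pi.smul_apply,
        Pi.sub_apply, smul_eq_mul]
      match_scalars
      · field_simp
        ring
      · field_simp
        ring
    · intro k hk
      simp only [Finset.mem_erase] at hk
      simp [Function.update_of_ne hk.2.1, hBk k hk.2.1 hk.1]
  have hdet : (Matrix.of B).det = a⁻¹ * (Matrix.of A).det := by
    have e1 : Matrix.of B = ((Matrix.of A).updateRow j ((Matrix.of A) j +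
        (-(b / a)) • (Matrix.of A) i)).updateRow i
          (a⁻¹ • ((Matrix.of A).updateRow j ((Matrix.of A) j + (-(b / a)) • (Matrix.of A) i)) i) := by
      rw [Matrix.updateRow_ne hij, hB]
      rfl
    rw [e1, Matrix.det_updateRow_smul, Matrix.updateRow_eq_self,
      Matrix.det_updateRow_add_smul_self _ hij.symm]
  rw [ev_of' hτ hBw, hdet, sign_mul_rat, sign_pos (inv_pos.2 ha)]
  have hall : (∀ k, LexPos (B k)) ↔ LexPos (A i) ∧ LexPos (a • A j - b • A i) ∧
        ∀ k, k ≠ i → k ≠ j → LexPos (A k) := by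
    constructor
    · intro h
      refine ⟨?_, ?_, fun k h1 h2 => hBk k h1 h2 ▸ h k⟩
      · have := h i
        rwa [hBi, lexPos_smul_iff (inv_pos.2 ha)] at this
      · have := h j
        rwa [hBj, lexPos_smul_iff (inv_pos.2 ha)] at this
    · rintro ⟨h1, h2, h3⟩ k
      by_cases hki : k = i
      · rw [hki, hBi, lexPos_smul_iff (inv_pos.2 ha)]
        exact h1
      by_cases hkj : k = j
      · rw [hkj, hBj, lexPos_smul_iff (inv_pos.2 ha)]
        exact h2
      · rw [hBk k hki hkj]
        exact h3 k hki hkj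
  simp only [hall]
  split_ifs <;> simp

theorem ev_eq_zero_of_not_mem {r : ℕ} {σ w : Fin r → E} (hσ : LinearIndependent ℝ σ)
    (h : ¬ ∀ j, w j ∈ Submodule.span ℝ (Set.range σ)) : ev σ w = 0 := by
  by_contra hne
  exact h (mem_span_of_ev_ne_zero hσ hne)

theorem InHull.span_le {r m : ℕ} {σ : Fin r → E} {τ : Fin m → E} (h : InHull σ τ) :
    Submodule.span ℝ (Set.range τ) ≤ Submodule.span ℝ (Set.range σ) := by
  rw [Submodule.span_le]
  rintro _ ⟨i, rfl⟩
  obtain ⟨c, -, e⟩ := h i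
  rw [e]
  exact Submodule.sum_mem _ fun k _ => Submodule.smul_mem _ _ (Submodule.subset_span ⟨k, rfl⟩)

theorem InHull.update {r : ℕ} (σ : Fin r → E) {i j : Fin r} {a b : ℝ} (ha : 0 ≤ a) (hb : 0 ≤ b) :
    InHull σ (Function.update σ i (a • σ i + b • σ j)) := by
  intro k
  by_cases h : k = i
  · subst h
    obtain ⟨c, hc, e⟩ := InHull.refl σ k
    obtain ⟨d, hd, e'⟩ := InHull.refl σ j
    refine ⟨fun l => a * c l + b * d l, fun l => add_nonneg (mul_nonneg ha (hc l))
      (mul_nonneg hb (hd l)), ?_⟩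
    rw [Function.update_self]
    conv_lhs => rw [e, e']
    simp only [add_smul, Finset.sum_add_distrib, mul_smul, Finset.smul_sum]
  · rw [Function.update_of_ne h]
    exact InHull.refl σ k

theorem ev_cut {r : ℕ} {σ : Fin r → E} (hσ : LinearIndependent ℝ σ) {i j : Fin r} (hij : i ≠ j)
    {a b : ℝ} (ha : 0 < a) (hb : 0 < b) :
    ev σ = ev (Function.update σ i (a • σ i + b • σ j)) +
      ev (Function.update σ j (b • σ j + a • σ i)) := by
  classical
  funext w
  rw [Pi.add_apply]
  have h0 : LinearIndependent ℝ (Function.update σ i (a • σ i + b • σ j)) :=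
    (ev_update hσ (w := 0) (A := 0) (fun j => by simp) hij ha).1
  have h0' : LinearIndependent ℝ (Function.update σ j (b • σ j + a • σ i)) :=
    (ev_update hσ (w := 0) (A := 0) (fun j => by simp) hij.symm hb).1
  by_cases hw : ∀ j, w j ∈ Submodule.span ℝ (Set.range σ)
  swap
  · rw [ev_eq_zero_of_not_mem hσ hw, ev_eq_zero_of_not_mem h0 fun h => hw fun k =>
      (InHull.update σ ha.le hb.le).span_le (h k), ev_eq_zero_of_not_mem h0' fun h => hw fun k =>
      (InHull.update σ hb.le ha.le).span_le (h k), add_zero]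
  obtain ⟨A, hA⟩ := exists_matrix hw
  obtain ⟨A, rfl⟩ : ∃ a : Fin r → Fin r → ℝ, Matrix.of a = A := ⟨A, rfl⟩
  simp only [Matrix.of_apply] at hA
  rw [ev_of' hσ hA, (ev_update hσ hA hij ha).2, (ev_update hσ hA hij.symm hb).2]
  by_cases hd : (Matrix.of A).det = 0
  · simp [hd]
  have hne : a • A j - b • A i ≠ 0 := by
    intro h
    apply hd
    have h2 : A j = (b / a) • A i := by
      rw [div_eq_inv_mul, mul_smul, ← sub_eq_zero.1 h, smul_smul, inv_mul_cancel₀ ha.ne', one_smul]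
    have h3 : Matrix.of A = (Matrix.of A).updateRow j ((b / a) • Matrix.of A i) := by
      conv_lhs => rw [← Matrix.updateRow_eq_self (Matrix.of A) j]
      congr 1
    rw [h3, Matrix.det_updateRow_smul, Matrix.det_updateRow_eq_zero hij, mul_zero]
  have hneg : b • A i - a • A j = -(a • A j - b • A i) := by abel
  have hall : (∀ k, LexPos (A k)) ↔ LexPos (A i) ∧ LexPos (A j) ∧
      ∀ k, k ≠ i → k ≠ j → LexPos (A k) := by
    refine ⟨fun h => ⟨h i, h j, fun k _ _ => h k⟩, ?_⟩
    rintro ⟨h1, h2, h3⟩ k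
    by_cases hki : k = i
    · rwa [hki]
    by_cases hkj : k = j
    · rwa [hkj]
    exact h3 k hki hkj
  have hcomm : (∀ k, k ≠ j → k ≠ i → LexPos (A k)) ↔ ∀ k, k ≠ i → k ≠ j → LexPos (A k) :=
    forall_congr' fun k => ⟨fun h h1 h2 => h h2 h1, fun h h1 h2 => h h2 h1⟩
  suffices goal : ∀ P : Prop, ∀ s : ℚ, (if LexPos (A i) ∧ LexPos (A j) ∧ P then s else 0) =
      (if LexPos (A i) ∧ LexPos (a • A j - b • A i) ∧ P then s else 0) +
      if LexPos (A j) ∧ LexPos (b • A i - a • A j) ∧ P then s else 0 by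
    simp only [hall, hcomm]
    convert goal (∀ k, k ≠ i → k ≠ j → LexPos (A k)) (SignType.sign (Matrix.of A).det : ℚ)
  intro P s
  by_cases h3 : P
  swap
  · simp only [h3, and_false, if_false, add_zero]
  simp only [h3, and_true]
  rcases lexPos_or_neg hne with h | h
  · have h' : ¬ LexPos (b • A i - a • A j) := fun h' => h.not_neg (hneg ▸ h')
    simp only [h, h', and_true, and_false, if_false, add_zero]
    have : LexPos (A i) → LexPos (A j) := by
      intro h1
      have h2 : LexPos (a • A j) := by
        have := h.add (h1.smul hb)
        rwa [sub_add_cancel] at this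
      exact (lexPos_smul_iff ha).1 h2
    by_cases h1 : LexPos (A i) <;> simp [h1, this]
  · have h' : ¬ LexPos (a • A j - b • A i) := fun h' => h'.not_neg h
    rw [← hneg] at h
    simp only [h, h', and_true, and_false, if_false, zero_add]
    have : LexPos (A j) → LexPos (A i) := by
      intro h1
      have h2 : LexPos (b • A i) := by
        have := h.add (h1.smul ha)
        rwa [sub_add_cancel] at this
      exact (lexPos_smul_iff hb).1 h2
    by_cases h1 : LexPos (A j) <;> simp [h1, this]

/-- The functional `ℓ` does not change sign on the cone generated by `τ`. -/
def SignPure {r : ℕ} (ℓ : E →ₗ[ℝ] ℝ) (τ : Fin r → E) : Prop :=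
  (∀ i, 0 ≤ ℓ (τ i)) ∨ ∀ i, ℓ (τ i) ≤ 0

theorem SignPure.mono {r m : ℕ} {ℓ : E →ₗ[ℝ] ℝ} {σ : Fin r → E} {τ : Fin m → E}
    (h : SignPure ℓ σ) (h' : InHull σ τ) : SignPure ℓ τ := by
  rcases h with h | h
  · left
    intro i
    obtain ⟨c, hc, e⟩ := h' i
    rw [e, map_sum]
    refine Finset.sum_nonneg fun k _ => ?_
    rw [map_smul, smul_eq_mul]
    exact mul_nonneg (hc k) (h k)
  · right
    intro i
    obtain ⟨c, hc, e⟩ := h' i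
    rw [e, map_sum]
    refine Finset.sum_nonpos fun k _ => ?_
    rw [map_smul, smul_eq_mul]
    exact mul_nonpos_of_nonneg_of_nonpos (hc k) (h k)

theorem ev_mem_pure_one (ℓ : E →ₗ[ℝ] ℝ) {r : ℕ} (n : ℕ) (σ : Fin r → E)
    (hσ : LinearIndependent ℝ σ) (hn : (Finset.univ.filter fun i => ℓ (σ i) ≠ 0).card ≤ n) :
    ev σ ∈ Submodule.span ℚ
      (ev '' {τ : Fin r → E | LinearIndependent ℝ τ ∧ InHull σ τ ∧ SignPure ℓ τ}) := by
  classical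
  induction n generalizing σ with
  | zero =>
    refine Submodule.subset_span ⟨σ, ⟨hσ, InHull.refl σ, Or.inl fun i => ?_⟩, rfl⟩
    have := Finset.card_eq_zero.1 (Nat.le_zero.1 hn)
    have h2 := Finset.filter_eq_empty_iff.1 this (Finset.mem_univ i)
    simp only [ne_eq, not_not] at h2
    exact h2.ge
  | succ n ih =>
    by_cases hp : SignPure ℓ σ
    · exact Submodule.subset_span ⟨σ, ⟨hσ, InHull.refl σ, hp⟩, rfl⟩
    rw [SignPure, not_or] at hp
    push Not at hp
    obtain ⟨⟨j, hj⟩, ⟨i, hi⟩⟩ := hp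
    have hij : i ≠ j := by
      rintro rfl
      exact lt_asymm hi hj
    have ha : 0 < -ℓ (σ j) := by linarith
    have hm : ℓ ((-ℓ (σ j)) • σ i + ℓ (σ i) • σ j) = 0 := by
      simp only [map_add, map_smul, smul_eq_mul]
      ring
    have hm' : ℓ (ℓ (σ i) • σ j + (-ℓ (σ j)) • σ i) = 0 := by rw [add_comm]; exact hm
    have hcard : ∀ (k : Fin r) (x : E), ℓ (σ k) ≠ 0 → ℓ x = 0 →
        (Finset.univ.filter fun l => ℓ (Function.update σ k x l) ≠ 0).card ≤ n := by
      intro k x hk hx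
      have : (Finset.univ.filter fun l => ℓ (Function.update σ k x l) ≠ 0) ⊂
          Finset.univ.filter fun i => ℓ (σ i) ≠ 0 := by
        rw [Finset.ssubset_iff_of_subset]
        · exact ⟨k, by simpa using hk, by simp [hx]⟩
        · intro l hl
          simp only [Finset.mem_filter, Finset.mem_univ, true_and] at hl ⊢
          by_cases hlk : l = k
          · rwa [hlk]
          · rwa [Function.update_of_ne hlk] at hl
      have := Finset.card_lt_card this
      omega
    rw [ev_cut hσ hij ha hi]
    have key : ∀ σ' : Fin r → E, InHull σ σ' → Submodule.span ℚ
      (ev '' {τ : Fin r → E | LinearIndependent ℝ τ ∧ InHull σ' τ ∧ SignPure ℓ τ}) ≤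
      Submodule.span ℚ
      (ev '' {τ : Fin r → E | LinearIndependent ℝ τ ∧ InHull σ τ ∧ SignPure ℓ τ}) :=
      fun σ' h => Submodule.span_mono (Set.image_mono fun τ hτ => ⟨hτ.1, h.trans hτ.2.1, hτ.2.2⟩)
    refine Submodule.add_mem _ ?_ ?_
    · exact key _ (InHull.update σ ha.le hi.le) (ih _
        (ev_update hσ (w := 0) (A := 0) (fun j => by simp) hij ha).1 (hcard _ _ hi.ne' hm))
    · exact key _ (InHull.update σ hi.le ha.le) (ih _
        (ev_update hσ (w := 0) (A := 0) (fun j => by simp) hij.symm hi).1 (hcard _ _ hj.ne hm'))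

theorem ev_mem_pure (ls : Finset (E →ₗ[ℝ] ℝ)) {r : ℕ} (σ : Fin r → E)
    (hσ : LinearIndependent ℝ σ) :
    ev σ ∈ Submodule.span ℚ
      (ev '' {τ : Fin r → E | LinearIndependent ℝ τ ∧ InHull σ τ ∧ ∀ ℓ ∈ ls, SignPure ℓ τ}) := by
  classical
  induction ls using Finset.induction_on with
  | empty => exact Submodule.subset_span ⟨σ, ⟨hσ, InHull.refl σ, by simp⟩, rfl⟩
  | insert ℓ ls _ ih =>
    refine (Submodule.span_le.2 ?_) ih
    rintro _ ⟨τ, ⟨h1, h2, h3⟩, rfl⟩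
    refine Submodule.span_mono (Set.image_mono ?_) (ev_mem_pure_one ℓ _ τ h1 le_rfl)
    rintro υ ⟨k1, k2, k3⟩
    refine ⟨k1, h2.trans k2, fun ℓ' hℓ' => ?_⟩
    rcases Finset.mem_insert.1 hℓ' with rfl | h
    · exact k3
    · exact (h3 ℓ' h).mono k2

theorem ev_ne_zero_of_inHull {r : ℕ} {σ τ w : Fin r → E} (hσ : LinearIndependent ℝ σ)
    (hτ : LinearIndependent ℝ τ) (h : InHull σ τ) (hw : ev τ w ≠ 0) : ev σ w ≠ 0 := by
  classical
  obtain ⟨A, hA, hA', hd, -⟩ := exists_of_ev_ne_zero hτ hw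
  choose c hc hcτ using h
  have hC : ∀ j, τ j = ∑ i, (Matrix.of fun i j => c j i) i j • σ i := hcτ
  have hCd := det_ne_zero_of_indep hτ hC
  have hB : ∀ j, w j = ∑ i, ((Matrix.of fun i j => c j i) * A) i j • σ i := by
    intro j
    rw [hA]
    simp only [hcτ, Finset.smul_sum, smul_smul, Matrix.mul_apply, Finset.sum_smul, Matrix.of_apply]
    rw [Finset.sum_comm]
    simp only [mul_comm]
  rw [ev_of hσ hB, if_pos]
  · have : ((Matrix.of fun i j => c j i) * A).det ≠ 0 := by
      rw [Matrix.det_mul]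
      exact mul_ne_zero hCd hd
    generalize ((Matrix.of fun i j => c j i) * A).det = d at this
    rcases lt_or_gt_of_ne this with h | h <;> simp [h]
  · intro i
    have hrow : ∃ k, c k i ≠ 0 := by
      by_contra hcon
      push Not at hcon
      exact hCd (Matrix.det_eq_zero_of_row_eq_zero i fun j => hcon j)
    obtain ⟨k, hk⟩ := hrow
    have e : ((Matrix.of fun i j => c j i) * A) i = fun j => ∑ l, A l j * c l i := by
      funext j
      simp only [Matrix.mul_apply, Matrix.of_apply, mul_comm]
    exact (congrArg LexPos e).mpr
      (lexPos_sum_smul hA' (t := fun l => c l i) (fun l => hc l i) (Function.ne_iff.2 ⟨k, hk⟩))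

/-- Multiplying a cone by a function of germs that only depends on the signs of finitely many
linear functionals yields a combination of subcones. -/
theorem mul_ev_mem (ls : Finset (E →ₗ[ℝ] ℝ)) {r : ℕ} {σ : Fin r → E}
    (hσ : LinearIndependent ℝ σ) {φ : (Fin r → E) → ℚ}
    (hφ : ∀ w w', ev σ w ≠ 0 → ev σ w' ≠ 0 → (∀ ℓ ∈ ls,
      (LexPos (fun i => ℓ (w i)) ↔ LexPos (fun i => ℓ (w' i))) ∧
      (LexPos (fun i => -ℓ (w i)) ↔ LexPos (fun i => -ℓ (w' i)))) → φ w = φ w') :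
    (fun w => φ w * ev σ w) ∈ Submodule.span ℚ
      (ev '' {τ : Fin r → E | LinearIndependent ℝ τ ∧ InHull σ τ}) := by
  classical
  have h0 : ∀ τ : Fin r → E, LinearIndependent ℝ τ → InHull σ τ → (∀ ℓ ∈ ls, SignPure ℓ τ) →
      (fun w => φ w * ev τ w) ∈ Submodule.span ℚ
      (ev '' {τ : Fin r → E | LinearIndependent ℝ τ ∧ InHull σ τ}) := by
    intro τ hτ hh hp
    by_cases hz : ∀ w, ev τ w = 0
    · simp only [hz, mul_zero]
      exact Submodule.zero_mem _
    push Not at hz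
    obtain ⟨w₀, hw₀⟩ := hz
    have hc : (fun w => φ w * ev τ w) = φ w₀ • ev τ := by
      funext w
      by_cases hw : ev τ w = 0
      · simp [hw]
      have : φ w = φ w₀ := by
        refine hφ _ _ (ev_ne_zero_of_inHull hσ hτ hh hw) (ev_ne_zero_of_inHull hσ hτ hh hw₀) ?_
        have aux : ∀ w, ev τ w ≠ 0 → ∀ ℓ : E →ₗ[ℝ] ℝ, (∀ i, 0 ≤ ℓ (τ i)) →
            (LexPos (fun i => ℓ (w i)) ↔ ∃ i, ℓ (τ i) ≠ 0) ∧
            (LexPos (fun i => -ℓ (w i)) ↔ False) := by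
          intro w hw ℓ hℓ
          obtain ⟨A, hA, hA', -, -⟩ := exists_of_ev_ne_zero hτ hw
          have e : (fun i => ℓ (w i)) = fun j => ∑ i, A i j * ℓ (τ i) := by
            funext j
            simp [hA]
          by_cases hex : ∃ i, ℓ (τ i) ≠ 0
          · have hpos : LexPos (fun i => ℓ (w i)) := e ▸ lexPos_sum_smul hA' hℓ (Function.ne_iff.2 hex)
            exact ⟨iff_of_true hpos hex, iff_of_false hpos.not_neg not_false⟩
          · have hzero : ∀ i, ℓ (w i) = 0 := by
              push Not at hex
              intro i
              simp [hA, hex]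
            simp only [hzero, hex, neg_zero]
            exact ⟨iff_of_false not_lexPos_zero not_false, iff_of_false not_lexPos_zero not_false⟩
        intro ℓ hℓ
        rcases hp ℓ hℓ with h | h
        · rw [(aux w hw ℓ h).1, (aux w₀ hw₀ ℓ h).1, (aux w hw ℓ h).2, (aux w₀ hw₀ ℓ h).2]
          simp
        · have h' : ∀ i, 0 ≤ (-ℓ) (τ i) := fun i => by simpa using h i
          have a1 := aux w hw (-ℓ) h'
          have a2 := aux w₀ hw₀ (-ℓ) h'
          simp only [LinearMap.neg_apply, neg_neg] at a1 a2
          rw [a1.1, a2.1, a1.2, a2.2]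
          simp
      rw [this]
      simp
    rw [hc]
    exact Submodule.smul_mem _ _ (Submodule.subset_span ⟨τ, ⟨hτ, hh⟩, rfl⟩)
  have h1 := ev_mem_pure ls σ hσ
  let L : PF E r →ₗ[ℚ] PF E r :=
    { toFun := fun T w => φ w * T w
      map_add' := fun a b => by funext w; simp [mul_add]
      map_smul' := fun a b => by funext w; simp [mul_left_comm] }
  have h2 : Submodule.span ℚ
      (ev '' {τ : Fin r → E | LinearIndependent ℝ τ ∧ InHull σ τ ∧ ∀ ℓ ∈ ls, SignPure ℓ τ}) ≤
      (Submodule.span ℚ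
        (ev '' {τ : Fin r → E | LinearIndependent ℝ τ ∧ InHull σ τ})).comap L := by
    rw [Submodule.span_le]
    rintro _ ⟨τ, ⟨k1, k2, k3⟩, rfl⟩
    exact h0 τ k1 k2 k3
  exact h2 h1

end Cutting

end PolyChain

namespace PolyChain

section Generic

variable {E : Type*} [AddCommGroup E] [Module ℝ E]

theorem exists_mem_forall_notMem (L : Submodule ℝ E) (Ws : Finset (Submodule ℝ E))
    (h : ∀ W ∈ Ws, ¬ L ≤ W) : ∃ v ∈ L, ∀ W ∈ Ws, v ∉ W := by
  classical
  by_contra hcon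
  push Not at hcon
  have h1 : ⋃ p ∈ (Ws.image (fun W => W.comap L.subtype) : Finset (Submodule ℝ L)),
      (p : Set L) = Set.univ := by
    rw [Set.eq_univ_iff_forall]
    intro x
    obtain ⟨W, hW, hx⟩ := hcon x x.2
    simp only [Set.mem_iUnion]
    exact ⟨W.comap L.subtype, Finset.mem_image_of_mem _ hW, hx⟩
  have h2 := Subspace.top_mem_of_biUnion_eq_univ h1
  obtain ⟨W, hW, e⟩ := Finset.mem_image.1 h2
  refine h W hW fun x hx => ?_
  have : (⟨x, hx⟩ : L) ∈ W.comap L.subtype := by rw [e]; trivial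
  exact this

theorem exists_generic [TopologicalSpace E] [ContinuousAdd E] [ContinuousSMul ℝ E]
    (L : Submodule ℝ E) {e : E} (he : e ∈ L) {O : Set E} (hO : O ∈ nhds e)
    (Ws : Finset (Submodule ℝ E)) (h : ∀ W ∈ Ws, ¬ L ≤ W) :
    ∃ v ∈ L, v ∈ O ∧ ∀ W ∈ Ws, v ∉ W := by
  classical
  obtain ⟨x, hx, hxW⟩ := exists_mem_forall_notMem L Ws h
  have hc : Filter.Tendsto (fun t : ℝ => e + t • x) (nhds 0) (nhds e) := by
    have : Continuous fun t : ℝ => e + t • x := by fun_prop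
    have := this.tendsto 0
    simpa using this
  have hinf : (((fun t : ℝ => e + t • x) ⁻¹' O)).Infinite := infinite_of_mem_nhds 0 (hc hO)
  have hfin : (⋃ W ∈ Ws, {t : ℝ | e + t • x ∈ W}).Finite := by
    refine Set.Finite.biUnion Ws.finite_toSet fun W hW => Set.Subsingleton.finite ?_
    intro t ht s hs
    by_contra hne
    apply hxW W hW
    have h1 : (t - s) • x ∈ W := by
      have := W.sub_mem ht hs
      rwa [add_sub_add_left_eq_sub, ← sub_smul] at this
    exact (W.smul_mem_iff (sub_ne_zero.2 hne)).1 h1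
  obtain ⟨t, ht, ht'⟩ := (hinf.sdiff hfin).nonempty
  refine ⟨e + t • x, L.add_mem he (L.smul_mem _ hx), ht, fun W hW hm => ht' ?_⟩
  simp only [Set.mem_iUnion]
  exact ⟨W, hW, hm⟩

end Generic

section MayerVietoris

variable {E : Type*} [AddCommGroup E] [Module ℝ E]

/-- Exactness of a family of chain groups in degree `r`. -/
def ExactIn (F : ∀ r, Submodule ℚ (PF E r)) (r : ℕ) : Prop :=
  ∀ T ∈ F r, IsCyc T → ∃ R ∈ F (r + 1), bd r R = T

/-- The homology of the family is concentrated in degree `k` and one dimensional. -/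
def SphereLike (F : ∀ r, Submodule ℚ (PF E r)) (k : ℕ) : Prop :=
  (∀ r, r ≠ k → ExactIn F r) ∧ ∃ ζ ∈ F k, IsCyc ζ ∧ (∀ R ∈ F (k + 1), bd k R ≠ ζ) ∧
    ∀ T ∈ F k, IsCyc T → ∃ c : ℚ, ∃ R ∈ F (k + 1), T = c • ζ + bd k R

theorem isCyc_bd (A : ConeClass E) {r : ℕ} {T : PF E (r + 1)} (hT : T ∈ A.PC (r + 1)) :
    IsCyc (bd r T) := by
  cases r with
  | zero => trivial
  | succ r => exact A.bd_bd hT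

theorem SphereLike.mayerVietoris {A B C D : ConeClass E} {k : ℕ}
    (hA : ∀ r, ExactIn A.PC r) (hB : ∀ r, ExactIn B.PC r)
    (hD : ∀ r, D.PC r = A.PC r ⊔ B.PC r) (hC : ∀ r, C.PC r = A.PC r ⊓ B.PC r)
    (h : SphereLike C.PC k) : SphereLike D.PC (k + 1) := by
  have hCA : ∀ {r T}, T ∈ C.PC r → T ∈ A.PC r := fun h => by
    rw [hC] at h
    exact h.1
  have hCB : ∀ {r T}, T ∈ C.PC r → T ∈ B.PC r := fun h => by
    rw [hC] at h
    exact h.2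
  have hADd : ∀ {r T}, T ∈ A.PC r → T ∈ D.PC r := fun h => by
    rw [hD]
    exact Submodule.mem_sup_left h
  have hBD : ∀ {r T}, T ∈ B.PC r → T ∈ D.PC r := fun h => by
    rw [hD]
    exact Submodule.mem_sup_right h
  have hbdC : ∀ {r : ℕ} {a b : PF E (r + 1)}, a ∈ A.PC (r + 1) → b ∈ B.PC (r + 1) →
      bd r (a + b) = 0 → bd r a ∈ C.PC r := by
    intro r a b ha hb hab
    rw [hC]
    refine ⟨A.bd_mem ha, ?_⟩
    rw [map_add] at hab
    rw [eq_neg_of_add_eq_zero_left hab]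
    exact Submodule.neg_mem _ (B.bd_mem hb)
  obtain ⟨h1, ζ, hζ, hζc, hζn, hζg⟩ := h
  refine ⟨fun r hr T hT hTc => ?_, ?_⟩
  · rw [hD] at hT
    obtain ⟨a, ha, b, hb, rfl⟩ := Submodule.mem_sup.1 hT
    cases r with
    | zero =>
      obtain ⟨a', ha', rfl⟩ := hA 0 a ha trivial
      obtain ⟨b', hb', rfl⟩ := hB 0 b hb trivial
      exact ⟨a' + b', Submodule.add_mem _ (hADd ha') (hBD hb'), map_add _ _ _⟩
    | succ r =>
      obtain ⟨c, hc, e⟩ := h1 r (by omega) _ (hbdC ha hb hTc) (isCyc_bd A ha)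
      obtain ⟨a', ha', ea⟩ := hA (r + 1) (a - c) (Submodule.sub_mem _ ha (hCA hc))
        (by show bd r _ = 0; rw [map_sub, e, sub_self])
      obtain ⟨b', hb', eb⟩ := hB (r + 1) (b + c) (Submodule.add_mem _ hb (hCB hc))
        (by
          show bd r _ = 0
          rw [map_add, e, add_comm, ← map_add]
          exact hTc)
      refine ⟨a' + b', Submodule.add_mem _ (hADd ha') (hBD hb'), ?_⟩
      rw [map_add, ea, eb]
      abel
  · obtain ⟨α, hα, eα⟩ := hA k ζ (hCA hζ) hζc
    obtain ⟨β, hβ, eβ⟩ := hB k ζ (hCB hζ) hζc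
    refine ⟨α - β, Submodule.sub_mem _ (hADd hα) (hBD hβ), ?_, ?_, ?_⟩
    · show bd k _ = 0
      rw [map_sub, eα, eβ, sub_self]
    · intro R hR e
      rw [hD] at hR
      obtain ⟨a, ha, b, hb, rfl⟩ := Submodule.mem_sup.1 hR
      have e2 : α - bd (k + 1) a = β + bd (k + 1) b := by
        rw [map_add] at e
        have e3 : α = β + (bd (k + 1) a + bd (k + 1) b) := by rw [e]; abel
        rw [sub_eq_iff_eq_add, e3]
        abel
      have hm : α - bd (k + 1) a ∈ C.PC (k + 1) := by
        rw [hC]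
        refine ⟨Submodule.sub_mem _ hα (A.bd_mem ha), ?_⟩
        rw [e2]
        exact Submodule.add_mem _ hβ (B.bd_mem hb)
      refine hζn _ hm ?_
      rw [map_sub, eα, A.bd_bd ha, sub_zero]
    · intro T hT hTc
      rw [hD] at hT
      obtain ⟨a, ha, b, hb, rfl⟩ := Submodule.mem_sup.1 hT
      have hTc' : bd k (a + b) = 0 := hTc
      obtain ⟨c, R, hR, e⟩ := hζg _ (hbdC ha hb hTc') (isCyc_bd A ha)
      obtain ⟨a', ha', ea⟩ := hA (k + 1) (a - c • α - R) (Submodule.sub_mem _ (Submodule.sub_mem _ ha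
        (Submodule.smul_mem _ _ hα)) (hCA hR))
        (by show bd k _ = 0; rw [map_sub, map_sub, map_smul, e, eα]; abel)
      obtain ⟨b', hb', eb⟩ := hB (k + 1) (b + c • β + R) (Submodule.add_mem _ (Submodule.add_mem _ hb
        (Submodule.smul_mem _ _ hβ)) (hCB hR))
        (by
          show bd k _ = 0
          rw [map_add, map_add, map_smul, eβ, add_assoc, ← e, add_comm, ← map_add]
          exact hTc')
      refine ⟨c, a' + b', Submodule.add_mem _ (hADd ha') (hBD hb'), ?_⟩
      rw [map_add, ea, eb, smul_sub]
      abel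

end MayerVietoris

section ConesInSet

variable {E : Type*} [AddCommGroup E] [Module ℝ E]

theorem facet_comb {r : ℕ} (σ : Fin (r + 1) → E) (i : Fin (r + 1)) (t : Fin r → ℝ) :
    ∑ k, t k • facet σ i k = ∑ k, (i.insertNth 0 t : Fin (r + 1) → ℝ) k • σ k := by
  rw [Fin.sum_univ_succAbove _ i]
  simp [facet]

/-- The simplicial cones contained, except for the apex, in a set `V`. -/
def conesIn (V : Set E) : ConeClass E where
  carrier r := {σ | LinearIndependent ℝ σ ∧
    ∀ t : Fin r → ℝ, (∀ i, 0 ≤ t i) → t ≠ 0 → ∑ i, t i • σ i ∈ V}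
  indep h := h.1
  facet_mem := by
    intro r σ h i
    refine ⟨facet_indep h.1 i, fun t ht ht0 => ?_⟩
    rw [facet_comb]
    refine h.2 _ (fun k => ?_) ?_
    · induction k using Fin.succAboveCases i with
      | x => simp
      | p k => simpa using ht k
    · intro e
      apply ht0
      funext k
      have := congrFun e (i.succAbove k)
      simpa using this
  nil_mem σ := ⟨linearIndependent_empty_type, fun t _ h => absurd (Subsingleton.elim t 0) h⟩

theorem mem_conesIn_of_inHull {V : Set E} {r m : ℕ} {σ : Fin r → E} {τ : Fin m → E}
    (hσ : σ ∈ (conesIn V).carrier r) (hτ : LinearIndependent ℝ τ) (h : InHull σ τ) :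
    τ ∈ (conesIn V).carrier m := by
  refine ⟨hτ, fun t ht ht0 => ?_⟩
  obtain ⟨c, hc, e⟩ := h.comb ht
  rw [e]
  refine hσ.2 c hc ?_
  rintro rfl
  apply ht0
  funext i
  refine Fintype.linearIndependent_iff.1 hτ t ?_ i
  rw [e]
  simp

theorem mem_of_mem_conesIn {V : Set E} {r : ℕ} {σ : Fin r → E}
    (hσ : σ ∈ (conesIn V).carrier r) (i : Fin r) : σ i ∈ V := by
  classical
  have := hσ.2 (Pi.single i 1) (fun k => by
    by_cases h : k = i
    · subst h; simp
    · simp [h]) (fun h => by simpa using congrFun h i)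
  rw [Finset.sum_eq_single i (by simp +contextual) (by simp)] at this
  simpa using this

theorem conesIn_mono {V W : Set E} (h : V ⊆ W) (r : ℕ) : (conesIn V).PC r ≤ (conesIn W).PC r :=
  Submodule.span_mono (Set.image_mono fun _ hσ => ⟨hσ.1, fun t ht h0 => h (hσ.2 t ht h0)⟩)

theorem PC_split (V : Set E) (ℓ : E →ₗ[ℝ] ℝ) (r : ℕ) : (conesIn V).PC r =
    (conesIn {x | x ∈ V ∧ 0 ≤ ℓ x}).PC r ⊔ (conesIn {x | x ∈ V ∧ ℓ x ≤ 0}).PC r := by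
  refine le_antisymm ?_ (sup_le (conesIn_mono (fun x h => h.1) r) (conesIn_mono (fun x h => h.1) r))
  rw [ConeClass.PC, Submodule.span_le]
  rintro _ ⟨σ, hσ, rfl⟩
  refine (Submodule.span_le.2 ?_) (ev_mem_pure_one ℓ _ σ hσ.1 le_rfl)
  rintro _ ⟨τ, ⟨h1, h2, h3⟩, rfl⟩
  have h4 := mem_conesIn_of_inHull hσ h1 h2
  rcases h3 with h | h
  · refine Submodule.mem_sup_left (ConeClass.ev_mem _ ⟨h1, fun t ht ht0 => ⟨h4.2 t ht ht0, ?_⟩⟩)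
    rw [map_sum]
    refine Finset.sum_nonneg fun i _ => ?_
    rw [map_smul]
    exact mul_nonneg (ht i) (h i)
  · refine Submodule.mem_sup_right (ConeClass.ev_mem _ ⟨h1, fun t ht ht0 => ⟨h4.2 t ht ht0, ?_⟩⟩)
    rw [map_sum]
    refine Finset.sum_nonpos fun i _ => ?_
    rw [map_smul]
    exact mul_nonpos_of_nonneg_of_nonpos (ht i) (h i)

theorem nonneg_of_mem_PC {V : Set E} {ℓ : E →ₗ[ℝ] ℝ} (hV : ∀ x ∈ V, 0 ≤ ℓ x) {r : ℕ} {T : PF E r}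
    (hT : T ∈ (conesIn V).PC r) {w : Fin r → E} (hw : T w ≠ 0) :
    LexPos (fun i => ℓ (w i)) ∨ ∀ i, ℓ (w i) = 0 := by
  contrapose! hw
  induction hT using Submodule.span_induction with
  | mem x hx =>
    obtain ⟨σ, hσ, rfl⟩ := hx
    by_contra hne
    obtain ⟨A, hA, hA', -, -⟩ := exists_of_ev_ne_zero hσ.1 hne
    have e : (fun i => ℓ (w i)) = fun j => ∑ i, A i j * ℓ (σ i) := by
      funext j
      simp [hA]
    obtain ⟨i, hi⟩ := hw.2
    refine hw.1 (e ▸ lexPos_sum_smul hA' (fun i => hV _ (mem_of_mem_conesIn hσ i)) ?_)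
    intro h0
    apply hi
    rw [show ℓ (w i) = ∑ k, A k i * ℓ (σ k) from congrFun e i]
    exact Finset.sum_eq_zero fun k _ => by
      have := congrFun h0 k
      rw [show ℓ (σ k) = 0 from this, mul_zero]
  | zero => rfl
  | add x y _ _ hx hy => simp [hx, hy]
  | smul a x _ hx => simp [hx]

theorem PC_inter (V : Set E) (ℓ : E →ₗ[ℝ] ℝ) (r : ℕ) :
    (conesIn {x | x ∈ V ∧ ℓ x = 0}).PC r =
    (conesIn {x | x ∈ V ∧ 0 ≤ ℓ x}).PC r ⊓ (conesIn {x | x ∈ V ∧ ℓ x ≤ 0}).PC r := by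
  classical
  refine le_antisymm (le_inf
    (conesIn_mono (V := {x | x ∈ V ∧ ℓ x = 0}) (W := {x | x ∈ V ∧ 0 ≤ ℓ x})
      (fun x h => ⟨h.1, h.2.ge⟩) r)
    (conesIn_mono (V := {x | x ∈ V ∧ ℓ x = 0}) (W := {x | x ∈ V ∧ ℓ x ≤ 0})
      (fun x h => ⟨h.1, h.2.le⟩) r)) ?_
  rintro T ⟨h1, h2⟩
  have hsupp : ∀ w, T w ≠ 0 → ∀ i, ℓ (w i) = 0 := by
    intro w hw
    rcases nonneg_of_mem_PC (fun x hx => hx.2) h1 hw with h | h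
    · rcases nonneg_of_mem_PC (ℓ := -ℓ) (fun x hx => by simpa using hx.2) h2 hw with h' | h'
      · exact absurd h' h.not_neg
      · simpa using h'
    · exact h
  obtain ⟨s, b, hs, rfl⟩ := ConeClass.exists_rep _ h1
  have e : ∑ σ ∈ s, b σ • ev σ = ∑ σ ∈ s with (∀ i, ℓ (σ i) = 0), b σ • ev σ := by
    rw [Finset.sum_filter]
    funext w
    have aux : ∀ σ ∈ s, ev σ w ≠ 0 → ((∀ i, ℓ (σ i) = 0) ↔ ∀ i, ℓ (w i) = 0) := by
      intro σ hσ hne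
      have hsp := span_eq_of_ev_ne_zero (hs σ hσ).1 hne
      have : ∀ τ : Fin r → E, (∀ i, ℓ (τ i) = 0) ↔
          Submodule.span ℝ (Set.range τ) ≤ LinearMap.ker ℓ := by
        intro τ
        rw [Submodule.span_le, Set.range_subset_iff]
        rfl
      rw [this, this, hsp]
    by_cases hw : ∀ i, ℓ (w i) = 0
    · rw [Finset.sum_apply, Finset.sum_apply]
      refine Finset.sum_congr rfl fun σ hσ => ?_
      by_cases hne : ev σ w = 0
      · split_ifs <;> simp [hne]
      · rw [if_pos ((aux σ hσ hne).2 hw)]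
    · have h0 : (∑ σ ∈ s, b σ • ev σ) w = 0 := by
        by_contra hne
        exact hw (hsupp w hne)
      rw [h0, Finset.sum_apply]
      symm
      refine Finset.sum_eq_zero fun σ hσ => ?_
      by_cases hne : ev σ w = 0
      · split_ifs <;> simp [hne]
      · rw [if_neg (fun h => hw ((aux σ hσ hne).1 h))]
        rfl
  rw [e]
  refine Submodule.sum_mem _ fun σ hσ => Submodule.smul_mem _ _ (ConeClass.ev_mem _ ?_)
  rw [Finset.mem_filter] at hσ
  refine ⟨(hs σ hσ.1).1, fun t ht ht0 => ⟨((hs σ hσ.1).2 t ht ht0).1, ?_⟩⟩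
  rw [map_sum]
  exact Finset.sum_eq_zero fun i _ => by rw [map_smul, hσ.2 i, smul_zero]

end ConesInSet

end PolyChain

namespace PolyChain

section Visible

variable {E : Type*} [AddCommGroup E] [Module ℝ E] [FiniteDimensional ℝ E]

theorem span_eq_of_finrank_le {L : Submodule ℝ E} {r : ℕ} {σ : Fin r → E}
    (hσ : LinearIndependent ℝ σ) (hL : ∀ i, σ i ∈ L) (hr : Module.finrank ℝ L ≤ r) :
    Submodule.span ℝ (Set.range σ) = L := by
  refine Submodule.eq_of_le_of_finrank_le (Submodule.span_le.2 (Set.range_subset_iff.2 hL)) ?_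
  rwa [finrank_span_eq_card hσ, Fintype.card_fin]

theorem not_le_span_of_lt {L : Submodule ℝ E} {r : ℕ} (σ : Fin r → E)
    (hr : r < Module.finrank ℝ L) : ¬ L ≤ Submodule.span ℝ (Set.range σ) := by
  intro h
  have h1 := Submodule.finrank_mono h
  have h2 := finrank_range_le_card (R := ℝ) σ
  rw [Fintype.card_fin, Set.finrank] at h2
  omega

variable [TopologicalSpace E] [ContinuousAdd E] [ContinuousSMul ℝ E]

/-- If every simplicial cone inside `V` can be coned off with any generic apex of `L` close to
`e`, and some linear functional is nonnegative on `V` and positive at `e`, then the chain complex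
of `V` is exact. -/
theorem exactIn_of_visible {V : Set E} {L : Submodule ℝ E} (hVL : V ⊆ L) {e : E} (he : e ∈ L)
    (h1 : ∀ {r} (σ : Fin r → E), σ ∈ (conesIn V).carrier r → ∀ᶠ v in nhds e, v ∈ L →
      ∀ t : Fin (r + 1) → ℝ, (∀ i, 0 ≤ t i) → t ≠ 0 → t 0 • v + ∑ i, t i.succ • σ i ∈ V)
    {ℓ : E →ₗ[ℝ] ℝ} (hℓ : ∀ x ∈ V, 0 ≤ ℓ x) (hℓe : ∀ᶠ v in nhds e, 0 < ℓ v)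
    (r : ℕ) : ExactIn (conesIn V).PC r := by
  classical
  intro T hT hc
  rcases lt_or_ge r (Module.finrank ℝ L) with hr | hr
  · refine (conesIn V).exists_bd_of_coning (fun F hF => ?_) hT hc
    have hO : ∀ᶠ v in nhds e, ∀ σ ∈ F, v ∈ L →
      ∀ t : Fin (r + 1) → ℝ, (∀ i, 0 ≤ t i) → t ≠ 0 → t 0 • v + ∑ i, t i.succ • σ i ∈ V :=
      (Filter.eventually_all_finset F).2 fun σ hσ => h1 σ (hF σ hσ)
    obtain ⟨v, hvL, hvO, hvW⟩ := exists_generic L he hO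
      (F.image fun σ => Submodule.span ℝ (Set.range σ)) (by
        intro W hW
        obtain ⟨σ, -, rfl⟩ := Finset.mem_image.1 hW
        exact not_le_span_of_lt σ hr)
    refine ⟨v, fun σ hσ => ?_⟩
    have hv := hvW _ (Finset.mem_image_of_mem _ hσ)
    refine ⟨hv, linearIndependent_finCons.2 ⟨(hF σ hσ).1, hv⟩, fun t ht ht0 => ?_⟩
    rw [Fin.sum_univ_succ]
    simpa using hvO σ hσ hvL t ht ht0
  · suffices hT0 : T = 0 by
      subst hT0
      exact ⟨0, Submodule.zero_mem _, map_zero _⟩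
    obtain ⟨s, b, hs, rfl⟩ := (conesIn V).exists_rep hT
    have hsp : ∀ σ ∈ s, Submodule.span ℝ (Set.range σ) = L := fun σ hσ =>
      span_eq_of_finrank_le (hs σ hσ).1 (fun i => hVL (mem_of_mem_conesIn (hs σ hσ) i)) hr
    cases r with
    | zero =>
      exfalso
      have hL : L = ⊥ := Submodule.finrank_eq_zero.1 (Nat.le_zero.1 hr)
      rw [hL, Submodule.mem_bot] at he
      subst he
      simpa using hℓe.self_of_nhds
    | succ r =>
      have hdim : ∀ σ ∈ s, Module.finrank ℝ L = r + 1 := fun σ hσ => by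
        rw [← hsp σ hσ, finrank_span_eq_card (hs σ hσ).1, Fintype.card_fin]
      obtain ⟨v, hvL, hvO, hvW⟩ := exists_generic L he hℓe
        ((s ×ˢ (Finset.univ : Finset (Fin (r + 1)))).image
          fun x => Submodule.span ℝ (Set.range (facet x.1 x.2))) (by
        intro W hW
        obtain ⟨x, hx, rfl⟩ := Finset.mem_image.1 hW
        refine not_le_span_of_lt _ ?_
        rw [hdim _ (Finset.mem_product.1 hx).1]
        exact Nat.lt_succ_self r)
      have hv : ∀ σ ∈ s, ∀ i, v ∉ Submodule.span ℝ (Set.range (facet σ i)) := fun σ hσ i =>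
        hvW _ (Finset.mem_image.2 ⟨(σ, i), Finset.mem_product.2 ⟨hσ, Finset.mem_univ _⟩, rfl⟩)
      funext w
      by_contra hne
      have hspw : Submodule.span ℝ (Set.range w) = L := by
        rw [Finset.sum_apply] at hne
        obtain ⟨σ, hσ, h⟩ := Finset.exists_ne_zero_of_sum_ne_zero hne
        have h' : ev σ w ≠ 0 := fun h0 => h (by simp [h0])
        rw [span_eq_of_ev_ne_zero (hs σ hσ).1 h', hsp σ hσ]
      apply hne
      rw [cycle_eq_of_coning (fun σ hσ => (hs σ hσ).1) hc hv]
      refine Finset.sum_eq_zero fun σ hσ => ?_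
      have hw : ∀ j, w j ∈ Submodule.span ℝ (Set.range σ) := fun j => by
        rw [hsp σ hσ, ← hspw]
        exact Submodule.subset_span ⟨j, rfl⟩
      obtain ⟨A, hA⟩ := exists_matrix hw
      obtain ⟨c, rfl⟩ := (Submodule.mem_span_range_iff_exists_fun ℝ).1 ((hsp σ hσ).symm ▸ hvL)
      rw [ev_sub_cone (hs σ hσ).1 (coeff_ne_zero (hv σ hσ)) (A := fun i j => A i j) hA,
        if_neg, mul_zero]
      intro hneg
      have : 0 < ℓ (∑ i, c i • σ i) := hvO
      rw [map_sum] at this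
      refine absurd this (not_lt.2 (Finset.sum_nonpos fun i _ => ?_))
      rw [map_smul]
      exact mul_nonpos_of_nonpos_of_nonneg (hneg i).le (hℓ _ (mem_of_mem_conesIn (hs σ hσ) i))

end Visible

end PolyChain

namespace PolyChain

section NegativeCone

theorem Qpq_smul (p N : ℕ) (a : ℝ) (x : Fin N → ℝ) : Qpq p N (a • x) = a ^ 2 * Qpq p N x := by
  simp only [Qpq, Finset.mul_sum, Pi.smul_apply, smul_eq_mul]
  refine Finset.sum_congr rfl fun i _ => ?_
  split_ifs <;> ring

theorem continuous_Qpq (p N : ℕ) : Continuous (Qpq p N) := by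
  unfold Qpq
  refine continuous_finsetSum _ fun i _ => ?_
  split_ifs <;> fun_prop

theorem Qpq_zero (p N : ℕ) : Qpq p N 0 = 0 := by simp [Qpq]

theorem Qpq_smul_single_add {p N : ℕ} {i : Fin N} (hi : p ≤ i) (a : ℝ) (y : Fin N → ℝ) :
    Qpq p N (a • Pi.single i 1 + y) = Qpq p N y - 2 * a * y i - a ^ 2 := by
  unfold Qpq
  rw [← Finset.add_sum_erase _ _ (Finset.mem_univ i),
    ← Finset.add_sum_erase Finset.univ (fun i : Fin N =>
      if (i : ℕ) < p then (y i) ^ 2 else -((y i) ^ 2)) (Finset.mem_univ i)]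
  rw [if_neg (not_lt.2 hi), if_neg (not_lt.2 hi)]
  rw [Finset.sum_congr rfl (g := fun i : Fin N =>
      if (i : ℕ) < p then (y i) ^ 2 else -((y i) ^ 2)) fun j hj => by
    have : j ≠ i := Finset.ne_of_mem_erase hj
    simp [this]]
  simp
  ring

/-- The vectors of negative square whose coordinates of index at least `p + k` vanish. -/
def negCone (p N k : ℕ) : Set (Fin N → ℝ) :=
  {x | Qpq p N x < 0 ∧ ∀ i : Fin N, p + k ≤ i → x i = 0}

/-- The subspace of vectors whose coordinates of index at least `m` vanish. -/
def coordSubspace (N m : ℕ) : Submodule ℝ (Fin N → ℝ) where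
  carrier := {x | ∀ i : Fin N, m ≤ i → x i = 0}
  add_mem' ha hb i hi := by simp [ha i hi, hb i hi]
  zero_mem' i _ := rfl
  smul_mem' c x hx i hi := by simp [hx i hi]

theorem mem_coordSubspace {N m : ℕ} {x : Fin N → ℝ} :
    x ∈ coordSubspace N m ↔ ∀ i : Fin N, m ≤ i → x i = 0 := Iff.rfl

theorem exactIn_half_negCone {p N k : ℕ} {i₀ : Fin N} (hi₀ : (i₀ : ℕ) = p + k) {s : ℝ}
    (hs : s ^ 2 = 1) (r : ℕ) :
    ExactIn (conesIn {x | x ∈ negCone p N (k + 1) ∧ 0 ≤ s * x i₀}).PC r := by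
  have hss : s * s = 1 := by rw [← sq, hs]
  have hco : ∀ᶠ v in nhds (s • (Pi.single i₀ 1 : Fin N → ℝ)), 0 < s * v i₀ := by
    have h : Continuous fun v : Fin N → ℝ => s * v i₀ := by fun_prop
    refine (h.tendsto _).eventually_const_lt ?_
    simp [hss]
  refine exactIn_of_visible (L := coordSubspace N (p + k + 1)) (fun x hx => hx.1.2)
    (e := s • Pi.single i₀ 1) ?_ ?_ (ℓ := s • LinearMap.proj i₀) (fun x hx => hx.2) hco r
  · refine Submodule.smul_mem _ _ (mem_coordSubspace.2 fun i hi => ?_)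
    have : i ≠ i₀ := by
      rintro rfl
      omega
    simp [this]
  · intro r σ hσ
    have hcont : Continuous fun z : (Fin N → ℝ) × (Fin (r + 1) → ℝ) =>
        Qpq p N (z.2 0 • z.1 + ∑ i, z.2 i.succ • σ i) := by
      refine (continuous_Qpq p N).comp ?_
      fun_prop
    have hev : ∀ᶠ v in nhds (s • (Pi.single i₀ 1 : Fin N → ℝ)), ∀ t ∈ stdSimplex ℝ (Fin (r + 1)),
        Qpq p N (t 0 • v + ∑ i, t i.succ • σ i) < 0 := by
      refine (isCompact_stdSimplex ℝ (Fin (r + 1))).eventually_forall_of_forall_eventually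
        fun t ht => (hcont.tendsto _).eventually_lt_const ?_
      simp only
      rw [smul_smul, Qpq_smul_single_add (by omega)]
      have ht0 := ht.1 0
      by_cases hz : (fun i : Fin r => t i.succ) = 0
      · have hz' : ∀ i : Fin r, t i.succ = 0 := fun i => congrFun hz i
        have h1 : t 0 = 1 := by
          have := ht.2
          rw [Fin.sum_univ_succ] at this
          simpa [hz'] using this
        simp [hz', h1, Qpq_zero, hs]
      · obtain ⟨⟨h2, -⟩, h3⟩ := hσ.2 _ (fun i => ht.1 i.succ) hz
        have h4 := mul_nonneg ht0 h3
        have h5 := sq_nonneg (t 0 * s)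
        linarith
    filter_upwards [hev, hco] with v hv hv0 hvL t ht ht0
    have hS : 0 < ∑ i, t i := by
      refine (Finset.sum_nonneg fun i _ => ht i).lt_of_ne' fun h => ht0 ?_
      funext i
      exact (Finset.sum_eq_zero_iff_of_nonneg fun i _ => ht i).1 h i (Finset.mem_univ i)
    have h6 := hv ((∑ i, t i)⁻¹ • t) ⟨fun i => mul_nonneg (inv_nonneg.2 hS.le) (ht i), by
      simp only [Pi.smul_apply, smul_eq_mul]
      rw [← Finset.mul_sum, inv_mul_cancel₀ hS.ne']⟩
    have h7 : (((∑ i, t i)⁻¹ • t) 0 • v + ∑ i : Fin r, ((∑ i, t i)⁻¹ • t) i.succ • σ i) =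
        (∑ i, t i)⁻¹ • (t 0 • v + ∑ i : Fin r, t i.succ • σ i) := by
      simp only [Pi.smul_apply, smul_eq_mul, smul_add, Finset.smul_sum, mul_smul]
    rw [h7, Qpq_smul] at h6
    refine ⟨⟨by
      by_contra hcon
      exact absurd h6 (not_lt.2 (mul_nonneg (sq_nonneg _) (not_lt.1 hcon))), ?_⟩, ?_⟩
    · refine mem_coordSubspace.1 (Submodule.add_mem _ (Submodule.smul_mem _ _ hvL)
        (Submodule.sum_mem _ fun i _ => Submodule.smul_mem _ _ ?_))
      exact fun j hj => (mem_of_mem_conesIn hσ i).1.2 j hj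
    · simp only [Pi.add_apply, Pi.smul_apply, smul_eq_mul, Finset.sum_apply, mul_add,
        Finset.mul_sum]
      refine add_nonneg ?_ (Finset.sum_nonneg fun i _ => ?_)
      · nlinarith [mul_nonneg (ht 0) hv0.le]
      · nlinarith [mul_nonneg (ht i.succ) (mem_of_mem_conesIn hσ i).2]

theorem PC_empty {E : Type*} [AddCommGroup E] [Module ℝ E] (r : ℕ) :
    (conesIn (∅ : Set E)).PC (r + 1) = ⊥ := by
  rw [eq_bot_iff, ConeClass.PC, Submodule.span_le]
  rintro _ ⟨σ, hσ, rfl⟩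
  exact (mem_of_mem_conesIn hσ 0).elim

theorem sphereLike_empty {E : Type*} [AddCommGroup E] [Module ℝ E] :
    SphereLike (conesIn (∅ : Set E)).PC 0 := by
  have hnil : ev (E := E) (Fin.elim0 : Fin 0 → E) (Fin.elim0 : Fin 0 → E) = 1 := by
    rw [ev_of' linearIndependent_empty_type (a := fun i => Fin.elim0 i) (fun j => Fin.elim0 j),
      if_pos (fun i => Fin.elim0 i)]
    simp
  refine ⟨?_, ev Fin.elim0, ConeClass.ev_mem _ ((conesIn ∅).nil_mem _), trivial, ?_, ?_⟩
  · intro r hr T hT _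
    obtain ⟨r, rfl⟩ := Nat.exists_eq_succ_of_ne_zero hr
    rw [PC_empty, Submodule.mem_bot] at hT
    exact ⟨0, Submodule.zero_mem _, by rw [hT, map_zero]⟩
  · intro R hR h
    rw [PC_empty, Submodule.mem_bot] at hR
    rw [hR, map_zero] at h
    rw [← h] at hnil
    exact zero_ne_one hnil
  · intro T _ _
    refine ⟨T Fin.elim0, 0, Submodule.zero_mem _, ?_⟩
    funext w
    rw [Subsingleton.elim w Fin.elim0]
    simp [hnil]

theorem sphereLike_negCone (p N : ℕ) : ∀ k, p + k ≤ N → SphereLike (conesIn (negCone p N k)).PC k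
  | 0, h => by
    have : negCone p N 0 = ∅ := by
      refine Set.eq_empty_of_forall_notMem fun x hx => ?_
      refine absurd hx.1 (not_lt.2 (Finset.sum_nonneg fun i _ => ?_))
      split_ifs with hi
      · exact sq_nonneg _
      · rw [hx.2 i (by omega)]
        simp
    rw [this]
    exact sphereLike_empty
  | k + 1, h => by
    have ih := sphereLike_negCone p N k (by omega)
    set i₀ : Fin N := ⟨p + k, by omega⟩ with hi₀
    have hcap : negCone p N k =
        {x | x ∈ negCone p N (k + 1) ∧ (LinearMap.proj i₀ : (Fin N → ℝ) →ₗ[ℝ] ℝ) x = 0} := by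
      ext x
      refine ⟨fun hx => ⟨⟨hx.1, fun i hi => hx.2 i (by omega)⟩, hx.2 i₀ le_rfl⟩, fun hx =>
        ⟨hx.1.1, fun i hi => ?_⟩⟩
      rcases hi.lt_or_eq with hlt | heq
      · exact hx.1.2 i (by omega)
      · have : i = i₀ := Fin.ext heq.symm
        rw [this]
        exact hx.2
    refine SphereLike.mayerVietoris
      (A := conesIn {x | x ∈ negCone p N (k + 1) ∧
        0 ≤ (LinearMap.proj i₀ : (Fin N → ℝ) →ₗ[ℝ] ℝ) x})
      (B := conesIn {x | x ∈ negCone p N (k + 1) ∧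
        (LinearMap.proj i₀ : (Fin N → ℝ) →ₗ[ℝ] ℝ) x ≤ 0})
      (C := conesIn (negCone p N k)) ?_ ?_ (fun r => PC_split _ _ r) (fun r => ?_) ih
    · intro r
      simpa using exactIn_half_negCone (p := p) (N := N) (k := k) (i₀ := i₀) rfl (s := 1)
        (by norm_num) r
    · intro r
      simpa using exactIn_half_negCone (p := p) (N := N) (k := k) (i₀ := i₀) rfl (s := -1)
        (by norm_num) r
    · rw [hcap]
      exact PC_inter _ _ r

end NegativeCone

end PolyChain

namespace PolyChain

section Equivariant

variable {Γ : Type} [Group Γ] {E : Type} [AddCommGroup E] [Module ℝ E]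

/-- The action of `Γ` on functions of `r` vectors, twisted by a character. -/
def twist (a : Representation ℝ Γ E) (χ : Γ →* ℚˣ) (r : ℕ) : Γ →* Module.End ℚ (PF E r) where
  toFun γ :=
    { toFun := fun T w => (χ γ : ℚ) * T (fun i => a γ⁻¹ (w i))
      map_add' := fun S T => by
        funext w
        exact mul_add _ _ _
      map_smul' := fun c T => by
        funext w
        exact mul_left_comm _ _ _ }
  map_one' := by
    refine LinearMap.ext fun T => funext fun w => ?_
    simp
  map_mul' γ δ := by
    refine LinearMap.ext fun T => funext fun w => ?_
    simp [mul_assoc]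

theorem twist_apply (a : Representation ℝ Γ E) (χ : Γ →* ℚˣ) (r : ℕ) (γ : Γ) (T : PF E r)
    (w : Fin r → E) : twist a χ r γ T w = (χ γ : ℚ) * T (fun i => a γ⁻¹ (w i)) := rfl

theorem rep_injective (a : Representation ℝ Γ E) (γ : Γ) : Function.Injective (a γ) := by
  refine Function.LeftInverse.injective (g := a γ⁻¹) fun x => ?_
  rw [← Module.End.mul_apply, ← map_mul, inv_mul_cancel, map_one, Module.End.one_apply]

theorem rep_apply_inv (a : Representation ℝ Γ E) (γ : Γ) (x : E) : a γ (a γ⁻¹ x) = x := by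
  rw [← Module.End.mul_apply, ← map_mul, mul_inv_cancel, map_one, Module.End.one_apply]

theorem twist_ev (a : Representation ℝ Γ E) (χ : Γ →* ℚˣ) {r : ℕ} (γ : Γ) (σ : Fin r → E) :
    twist a χ r γ (ev σ) = (χ γ : ℚ) • ev (fun i => a γ (σ i)) := by
  funext w
  rw [twist_apply, Pi.smul_apply, smul_eq_mul,
    ← ev_map (a γ) (rep_injective a γ) σ (fun i => a γ⁻¹ (w i))]
  simp only [rep_apply_inv]

theorem rep_indep (a : Representation ℝ Γ E) (γ : Γ) {r : ℕ} {σ : Fin r → E}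
    (hσ : LinearIndependent ℝ σ) : LinearIndependent ℝ (fun i => a γ (σ i)) :=
  hσ.map' (a γ) (LinearMap.ker_eq_bot.2 (rep_injective a γ))

theorem bd_twist (a : Representation ℝ Γ E) (χ : Γ →* ℚˣ) {r : ℕ} (γ : Γ) {T : PF E (r + 1)}
    (hT : T ∈ PCall E (r + 1)) : bd r (twist a χ (r + 1) γ T) = twist a χ r γ (bd r T) := by
  induction hT using Submodule.span_induction with
  | mem x hx =>
    obtain ⟨σ, hσ, rfl⟩ := hx
    rw [twist_ev, map_smul, bd_ev hσ, bd_ev (rep_indep a γ hσ)]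
    simp only [bdSum, map_sum, map_smul, twist_ev, Finset.smul_sum]
    exact Finset.sum_congr rfl fun i _ => smul_comm _ _ _
  | zero => simp
  | add x y _ _ hx hy => simp only [map_add, hx, hy]
  | smul c x _ hx => simp only [map_smul, hx]

/-- Invariance of a class of cones under a linear action. -/
def ConeClass.Inv (S : ConeClass E) (a : Representation ℝ Γ E) : Prop :=
  ∀ γ {r} (σ : Fin r → E), σ ∈ S.carrier r → (fun i => a γ (σ i)) ∈ S.carrier r

theorem conesIn_inv {V : Set E} (a : Representation ℝ Γ E) (h : ∀ γ, ∀ x ∈ V, a γ x ∈ V) :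
    (conesIn V).Inv a := fun γ r σ hσ => ⟨rep_indep a γ hσ.1, fun t ht ht0 => by
  have := h γ _ (hσ.2 t ht ht0)
  simpa only [map_sum, map_smul] using this⟩

theorem ConeClass.Inv.twist_mem {S : ConeClass E} {a : Representation ℝ Γ E} (h : S.Inv a)
    (χ : Γ →* ℚˣ) {r : ℕ} (γ : Γ) {T : PF E r} (hT : T ∈ S.PC r) : twist a χ r γ T ∈ S.PC r := by
  have : S.PC r ≤ (S.PC r).comap (twist a χ r γ) := by
    rw [ConeClass.PC, Submodule.span_le]
    rintro _ ⟨σ, hσ, rfl⟩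
    rw [SetLike.mem_coe, Submodule.mem_comap, twist_ev]
    exact Submodule.smul_mem _ _ (S.ev_mem (h γ σ hσ))
  exact this hT

/-- The rational group algebra. -/
abbrev GA (Γ : Type) [Group Γ] := MonoidAlgebra ℚ Γ

/-- The functions of `r` vectors, as a module over the group algebra. -/
def TPF (_ : Representation ℝ Γ E) (_ : Γ →* ℚˣ) (r : ℕ) : Type := PF E r

instance (a : Representation ℝ Γ E) (χ : Γ →* ℚˣ) (r : ℕ) : AddCommGroup (TPF a χ r) :=
  inferInstanceAs (AddCommGroup (PF E r))

instance (a : Representation ℝ Γ E) (χ : Γ →* ℚˣ) (r : ℕ) : Module ℚ (TPF a χ r) :=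
  inferInstanceAs (Module ℚ (PF E r))

instance (a : Representation ℝ Γ E) (χ : Γ →* ℚˣ) (r : ℕ) : Module (GA Γ) (TPF a χ r) :=
  Module.compHom (PF E r) (MonoidAlgebra.lift ℚ (Module.End ℚ (PF E r)) Γ (twist a χ r)).toRingHom

theorem single_smul_TPF (a : Representation ℝ Γ E) (χ : Γ →* ℚˣ) (r : ℕ) (γ : Γ) (c : ℚ)
    (T : TPF a χ r) : (MonoidAlgebra.single γ c : GA Γ) • T = c • (twist a χ r γ T : PF E r) := by
  show (MonoidAlgebra.lift ℚ (Module.End ℚ (PF E r)) Γ (twist a χ r)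
    (MonoidAlgebra.single γ c)) T = _
  rw [MonoidAlgebra.lift_single]
  rfl

instance (a : Representation ℝ Γ E) (χ : Γ →* ℚˣ) (r : ℕ) :
    IsScalarTower ℚ (GA Γ) (TPF a χ r) where
  smul_assoc c x T := by
    show (MonoidAlgebra.lift ℚ (Module.End ℚ (PF E r)) Γ (twist a χ r) (c • x)) T =
      c • (MonoidAlgebra.lift ℚ (Module.End ℚ (PF E r)) Γ (twist a χ r) x) T
    rw [map_smul]
    rfl

/-- The chains of a `Γ`-invariant class of cones, as a module over the group algebra. -/
def PCM (S : ConeClass E) (a : Representation ℝ Γ E) (χ : Γ →* ℚˣ) (h : S.Inv a) (r : ℕ) :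
    Submodule (GA Γ) (TPF a χ r) where
  carrier := {T | T ∈ S.PC r}
  add_mem' := (S.PC r).add_mem
  zero_mem' := (S.PC r).zero_mem
  smul_mem' x T hT := by
    induction x using MonoidAlgebra.induction_linear with
    | zero =>
      rw [zero_smul]
      exact (S.PC r).zero_mem
    | add x y hx hy =>
      rw [add_smul]
      exact (S.PC r).add_mem hx hy
    | single γ c =>
      rw [single_smul_TPF]
      exact (S.PC r).smul_mem _ (h.twist_mem χ γ hT)

instance (S : ConeClass E) (a : Representation ℝ Γ E) (χ : Γ →* ℚˣ) (h : S.Inv a) (r : ℕ) :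
    Module ℚ (PCM S a χ h r) := inferInstanceAs (Module ℚ (S.PC r))

instance (S : ConeClass E) (a : Representation ℝ Γ E) (χ : Γ →* ℚˣ) (h : S.Inv a) (r : ℕ) :
    IsScalarTower ℚ (GA Γ) (PCM S a χ h r) where
  smul_assoc c x T := Subtype.ext (smul_assoc c x (T : TPF a χ r))

/-- The boundary operator as a linear map over the group algebra. -/
def bdM (S : ConeClass E) (a : Representation ℝ Γ E) (χ : Γ →* ℚˣ) (h : S.Inv a) (r : ℕ) :
    PCM S a χ h (r + 1) →ₗ[GA Γ] PCM S a χ h r :=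
  MonoidAlgebra.equivariantOfLinearOfComm
    { toFun := fun T => ⟨bd r (T.1 : PF E (r + 1)), S.bd_mem T.2⟩
      map_add' := fun S T => Subtype.ext (map_add (bd r) _ _)
      map_smul' := fun c T => Subtype.ext (map_smul (bd r) _ _) }
    (fun γ T => Subtype.ext (by
      show bd r ((MonoidAlgebra.single γ 1 : GA Γ) • T.1 : TPF a χ (r + 1)) =
        (MonoidAlgebra.single γ 1 : GA Γ) • (show TPF a χ r from bd r (T.1 : PF E (r + 1)))
      rw [single_smul_TPF, single_smul_TPF, one_smul, one_smul]
      exact bd_twist a χ γ (S.le_all _ T.2)))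

/-- A module over the group algebra on which there is a linear operator with locally finite
conjugates that sum to the identity is projective. -/
theorem projective_of_average {M : Type} [AddCommGroup M] [Module ℚ M] [Module (GA Γ) M]
    [IsScalarTower ℚ (GA Γ) M] (R : M →ₗ[ℚ] M)
    (hfin : ∀ m, {γ : Γ | R ((MonoidAlgebra.single γ⁻¹ 1 : GA Γ) • m) ≠ 0}.Finite)
    (hsum : ∀ m, ∑ᶠ γ : Γ, (MonoidAlgebra.single γ 1 : GA Γ) •
      R ((MonoidAlgebra.single γ⁻¹ 1 : GA Γ) • m) = m) : Module.Projective (GA Γ) M := by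
  refine Module.Projective.of_lifting_property'' fun f hf => ?_
  obtain ⟨t, ht⟩ := LinearMap.exists_rightInverse_of_surjective (f.restrictScalars ℚ)
    (LinearMap.range_eq_top.2 hf)
  have ht' : ∀ m, f (t m) = m := fun m => LinearMap.congr_fun ht m
  have hmul : ∀ (γ δ : Γ), (MonoidAlgebra.single γ 1 : GA Γ) * MonoidAlgebra.single δ 1 =
      MonoidAlgebra.single (γ * δ) 1 := fun γ δ => by
    rw [MonoidAlgebra.single_mul_single, one_mul]
  let g : Γ → M → (M →₀ GA Γ) := fun γ m => (MonoidAlgebra.single γ 1 : GA Γ) •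
      t (R ((MonoidAlgebra.single γ⁻¹ 1 : GA Γ) • m))
  have hg : ∀ m, (Function.support fun γ => g γ m).Finite := fun m =>
    (hfin m).subset fun γ hγ h0 => hγ (by simp only [g]; rw [h0, map_zero, smul_zero])
  let s : M →ₗ[ℚ] (M →₀ GA Γ) :=
    { toFun := fun m => ∑ᶠ γ : Γ, g γ m
      map_add' := fun m m' => by
        rw [← finsum_add_distrib (hg m) (hg m')]
        simp only [g, smul_add, map_add]
      map_smul' := fun c m => by
        rw [RingHom.id_apply, smul_finsum']
        · refine finsum_congr fun γ => ?_
          simp only [g]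
          rw [smul_comm _ c m, map_smul, map_smul, smul_comm]
        · exact hg m }
  refine ⟨MonoidAlgebra.equivariantOfLinearOfComm s fun δ m => ?_, LinearMap.ext fun m => ?_⟩
  · show ∑ᶠ γ : Γ, g γ _ = (MonoidAlgebra.single δ 1 : GA Γ) • ∑ᶠ γ : Γ, g γ m
    rw [smul_finsum' _ (hg m)]
    rw [← finsum_comp_equiv (Equiv.mulLeft δ)]
    refine finsum_congr fun γ => ?_
    simp only [g, Equiv.coe_mulLeft]
    rw [smul_smul, smul_smul, hmul, hmul, _root_.mul_inv_rev, inv_mul_cancel_right]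
  · show f (∑ᶠ γ : Γ, g γ m) = m
    rw [← hsum m]
    have := (f : (M →₀ GA Γ) →+ M).map_finsum (hg m)
    rw [hsum m]
    refine this.trans ((finsum_congr fun γ => ?_).trans (hsum m))
    show f _ = _
    simp only [g]
    rw [map_smul, ht']

end Equivariant

end PolyChain

namespace PolyChain

section ProjectiveDimension

open CategoryTheory

variable {A : Type} [Ring A]

/-- The projective dimension of the module `M` is less than `n`. -/
def PdLT (A : Type) [Ring A] (M : Type) [AddCommGroup M] [Module A M] (n : ℕ) : Prop :=
  HasProjectiveDimensionLT (ModuleCat.of A M) n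

theorem PdLT.mono {M : Type} [AddCommGroup M] [Module A M] {m n : ℕ} (h : PdLT A M m)
    (hmn : m ≤ n) : PdLT A M n :=
  have : HasProjectiveDimensionLT (ModuleCat.of A M) m := h
  hasProjectiveDimensionLT_of_ge _ m n hmn

theorem pdLT_of_projective {M : Type} [AddCommGroup M] [Module A M] (h : Module.Projective A M)
    {n : ℕ} (hn : 1 ≤ n) : PdLT A M n :=
  PdLT.mono (projective_iff_hasProjectiveDimensionLT_one.1
    ((IsProjective.iff_projective M).1 h)) hn

theorem PdLT.projective {M : Type} [AddCommGroup M] [Module A M] (h : PdLT A M 1) :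
    Module.Projective A M :=
  (IsProjective.iff_projective M).2 (projective_iff_hasProjectiveDimensionLT_one.2 h)

theorem PdLT.of_equiv {M N : Type} [AddCommGroup M] [Module A M] [AddCommGroup N] [Module A N]
    (e : M ≃ₗ[A] N) {n : ℕ} (h : PdLT A M n) : PdLT A N n :=
  have : HasProjectiveDimensionLT (ModuleCat.of A M) n := h
  hasProjectiveDimensionLT_of_iso e.toModuleIso n

theorem pdLT_of_subsingleton {M : Type} [AddCommGroup M] [Module A M] [Subsingleton M] (n : ℕ) :
    PdLT A M n :=
  PdLT.mono ((ModuleCat.isZero_of_subsingleton (ModuleCat.of A M)).hasProjectiveDimensionLT_zero)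
    (Nat.zero_le n)

theorem PdLT.ker {M N : Type} [AddCommGroup M] [Module A M] [AddCommGroup N] [Module A N]
    {f : M →ₗ[A] N} (hf : Function.Surjective f) {n : ℕ} (hM : PdLT A M n)
    (hN : PdLT A N (n + 1)) : PdLT A (LinearMap.ker f) n :=
  (LinearMap.shortExact_shortComplexKer hf).hasProjectiveDimensionLT_X₁ n hM hN

theorem PdLT.of_ker {M N : Type} [AddCommGroup M] [Module A M] [AddCommGroup N] [Module A N]
    {f : M →ₗ[A] N} (hf : Function.Surjective f) {n : ℕ} (hK : PdLT A (LinearMap.ker f) n)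
    (hM : PdLT A M (n + 1)) : PdLT A N (n + 1) :=
  (LinearMap.shortExact_shortComplexKer hf).hasProjectiveDimensionLT_X₃ n hK hM

theorem exists_lift_of_range {X Y Z : Type} [AddCommGroup X] [Module A X] [AddCommGroup Y]
    [Module A Y] [AddCommGroup Z] [Module A Z] (hX : Module.Projective A X) (d : Y →ₗ[A] Z)
    (φ : X →ₗ[A] Z) (h : ∀ x, φ x ∈ LinearMap.range d) : ∃ g : X →ₗ[A] Y, ∀ x, d (g x) = φ x := by
  obtain ⟨g, hg⟩ := Module.projective_lifting_property d.rangeRestrict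
    (φ.codRestrict (LinearMap.range d) h) d.surjective_rangeRestrict
  exact ⟨g, fun x => congrArg Subtype.val (LinearMap.congr_fun hg x)⟩

/-- A chain map from a complex of projective modules over a module of finite projective dimension
`k` to a resolution is, in degree `k + 1`, homotopic to a map with values in cycles. -/
theorem exists_homotopy (k : ℕ) : ∀ {B B' : Type} [AddCommGroup B] [Module A B] [AddCommGroup B']
    [Module A B'] {M N : ℕ → Type} [∀ n, AddCommGroup (M n)] [∀ n, Module A (M n)]
    [∀ n, AddCommGroup (N n)] [∀ n, Module A (N n)] (_ : PdLT A B (k + 1))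
    (dM : ∀ n, M (n + 1) →ₗ[A] M n) (εM : M 0 →ₗ[A] B) (_ : ∀ n x, dM n (dM (n + 1) x) = 0)
    (_ : ∀ x, εM (dM 0 x) = 0) (_ : ∀ n, Module.Projective A (M n))
    (dN : ∀ n, N (n + 1) →ₗ[A] N n) (εN : N 0 →ₗ[A] B') (_ : ∀ n x, dN n (dN (n + 1) x) = 0)
    (_ : ∀ x, εN (dN 0 x) = 0) (_ : Function.Surjective εN)
    (_ : ∀ x, εN x = 0 → x ∈ LinearMap.range (dN 0))
    (_ : ∀ n, n < k → ∀ x, dN n x = 0 → x ∈ LinearMap.range (dN (n + 1)))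
    (i : ∀ n, M n →ₗ[A] N n) (j : B →ₗ[A] B') (_ : ∀ n x, dN n (i (n + 1) x) = i n (dM n x))
    (_ : ∀ x, εN (i 0 x) = j (εM x)),
    ∃ h : M k →ₗ[A] N (k + 1), ∀ x, dN k (i (k + 1) x - h (dM k x)) = 0 := by
  induction k with
  | zero =>
    intro B B' _ _ _ _ M N _ _ _ _ hB dM εM hM hMε hP dN εN hN hNε hsurj hex0 hex i j hi hj
    obtain ⟨s, hs⟩ := exists_lift_of_range hB.projective εN j (fun x => hsurj (j x))
    obtain ⟨h, hh⟩ := exists_lift_of_range (hP 0) (dN 0) (i 0 - s.comp εM) (fun x => hex0 _ (by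
      simp [hs, hj]))
    refine ⟨h, fun x => ?_⟩
    rw [map_sub, hh, hi]
    simp [hMε]
  | succ k ih =>
    intro B B' _ _ _ _ M N _ _ _ _ hB dM εM hM hMε hP dN εN hN hNε hsurj hex0 hex i j hi hj
    set π : (B →₀ A) →ₗ[A] B := Finsupp.linearCombination A id with hπ
    have hπs : Function.Surjective π := Finsupp.linearCombination_id_surjective A B
    have hPf : Module.Projective A (B →₀ A) := inferInstance
    have hK : PdLT A (LinearMap.ker π) (k + 1) :=
      PdLT.ker hπs (pdLT_of_projective hPf (by omega)) hB
    obtain ⟨s, hs⟩ := exists_lift_of_range hPf εN (j.comp π) (fun x => hsurj _)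
    obtain ⟨f, hf⟩ := exists_lift_of_range (hP 0) π εM (fun x => hπs _)
    obtain ⟨g, hg⟩ := exists_lift_of_range (hP 0) (dN 0) (i 0 - s.comp f) (fun x => hex0 _ (by
      simp [hs, hj, hf]))
    obtain ⟨h, hh⟩ := ih (B := LinearMap.ker π) (B' := LinearMap.ker εN)
      (M := fun n => M (n + 1)) (N := fun n => N (n + 1)) hK (fun n => dM (n + 1))
      ((f.comp (dM 0)).codRestrict _ fun x => by simp [hf, hMε]) (fun n x => hM (n + 1) x)
      (fun x => Subtype.ext (by simp [hM])) (fun n => hP (n + 1)) (fun n => dN (n + 1))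
      ((dN 0).codRestrict _ fun x => by simp [hNε]) (fun n x => hN (n + 1) x)
      (fun x => Subtype.ext (by simp [hN]))
      (fun x => by
        obtain ⟨y, hy⟩ := hex0 x.1 x.2
        exact ⟨y, Subtype.ext hy⟩)
      (fun x hx => hex 0 (by omega) x (congrArg Subtype.val hx))
      (fun n hn x hx => hex (n + 1) (by omega) x hx)
      (fun n => match n with
        | 0 => i 1 - g.comp (dM 0)
        | n + 1 => i (n + 2))
      (s.restrict fun x hx => by
        rw [LinearMap.mem_ker] at hx ⊢
        simp [hs, hx])
      (fun n x => by
        cases n with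
        | zero => simp [hM, hi]
        | succ n => exact hi _ _)
      (fun x => Subtype.ext (by simp [hg, hi]))
    exact ⟨h, hh⟩

end ProjectiveDimension

section Complexes

variable {A : Type} [Ring A] {M : ℕ → Type} [∀ n, AddCommGroup (M n)] [∀ n, Module A (M n)]

/-- The boundaries of a complex of projective modules that is exact above degree `m` and vanishes
above degree `m + j` have projective dimension less than `j`. -/
theorem pdLT_boundaries (d : ∀ n, M (n + 1) →ₗ[A] M n) (hP : ∀ n, Module.Projective A (M (n + 1)))
    (j : ℕ) : ∀ m, (∀ n, m ≤ n → LinearMap.ker (d n) = LinearMap.range (d (n + 1))) →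
    (∀ n, m + j < n → Subsingleton (M n)) → PdLT A (LinearMap.range (d m)) j := by
  induction j with
  | zero =>
    intro m _ hz
    have := hz (m + 1) (by omega)
    have : Subsingleton (LinearMap.range (d m)) := ⟨by
      rintro ⟨_, x, rfl⟩ ⟨_, y, rfl⟩
      rw [Subsingleton.elim x y]⟩
    exact pdLT_of_subsingleton 0
  | succ j ih =>
    intro m hex hz
    have h1 := ih (m + 1) (fun n hn => hex n (by omega)) (fun n hn => hz n (by omega))
    refine PdLT.of_ker (f := (d m).rangeRestrict) (d m).surjective_rangeRestrict ?_
      (pdLT_of_projective (hP m) (by omega))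
    rw [LinearMap.ker_rangeRestrict, hex m le_rfl]
    exact h1

/-- The cycles of a complex. -/
def cyclesM (d : ∀ n, M (n + 1) →ₗ[A] M n) : ∀ n, Submodule A (M n)
  | 0 => ⊤
  | n + 1 => LinearMap.ker (d n)

theorem pdLT_cycles (d : ∀ n, M (n + 1) →ₗ[A] M n) (hP : ∀ n, Module.Projective A (M (n + 1)))
    {k : ℕ} (hk : 1 ≤ k) (m : ℕ) : (∀ n, n < m → cyclesM d n = LinearMap.range (d n)) →
    ∀ l, k ≤ l → PdLT A (M 0) (l + m) → PdLT A (cyclesM d m) l := by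
  induction m with
  | zero =>
    intro _ l hl h
    exact PdLT.of_equiv (Submodule.topEquiv (R := A) (M := M 0)).symm h
  | succ m ih =>
    intro hex l hl h
    have h1 := ih (fun n hn => hex n (by omega)) (l + 1) (by omega)
      (by rwa [show l + 1 + m = l + (m + 1) by omega])
    rw [hex m (by omega)] at h1
    have h2 := PdLT.ker (f := (d m).rangeRestrict) (d m).surjective_rangeRestrict
      (pdLT_of_projective (hP m) (by omega)) h1
    rwa [LinearMap.ker_rangeRestrict] at h2

end Complexes

end PolyChain

namespace PolyChain

theorem PdLT.of_exact {A M N : Type} [Ring A] [AddCommGroup M] [Module A M] [AddCommGroup N]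
    [Module A N] {K L : Submodule A M} {f : L →ₗ[A] N}
    (hf : Function.Surjective f) (hKL : K ≤ L) (hK : ∀ x, f x = 0 ↔ x.1 ∈ K) {n : ℕ}
    (hB : PdLT A K n) (hL : PdLT A L (n + 1)) : PdLT A N (n + 1) := by
  refine PdLT.of_ker hf ?_ hL
  have e : LinearMap.ker f = K.comap L.subtype := by
    ext x
    exact hK x
  rw [e]
  exact PdLT.of_equiv (Submodule.comapSubtypeEquivOfLe hKL).symm hB

section Characters

variable {Γ : Type} [Group Γ]

/-- The rational numbers, with `Γ` acting through a character. -/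
def QChar (_ : Γ →* ℚˣ) : Type := ℚ

instance (χ : Γ →* ℚˣ) : AddCommGroup (QChar χ) := inferInstanceAs (AddCommGroup ℚ)

instance (χ : Γ →* ℚˣ) : Module ℚ (QChar χ) := inferInstanceAs (Module ℚ ℚ)

instance (χ : Γ →* ℚˣ) : Module (GA Γ) (QChar χ) :=
  Module.compHom ℚ (MonoidAlgebra.lift ℚ ℚ Γ ((Units.coeHom ℚ).comp χ)).toRingHom

theorem single_smul_QChar (χ : Γ →* ℚˣ) (γ : Γ) (c : ℚ) (x : QChar χ) :
    (MonoidAlgebra.single γ c : GA Γ) • x = (c * (χ γ : ℚ) * (show ℚ from x) : ℚ) := by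
  show (MonoidAlgebra.lift ℚ ℚ Γ ((Units.coeHom ℚ).comp χ) (MonoidAlgebra.single γ c)) *
    (show ℚ from x) = _
  rw [MonoidAlgebra.lift_single]
  rfl

instance (χ : Γ →* ℚˣ) : IsScalarTower ℚ (GA Γ) (QChar χ) where
  smul_assoc c x T := by
    show (MonoidAlgebra.lift ℚ ℚ Γ ((Units.coeHom ℚ).comp χ) (c • x)) * (show ℚ from T) =
      c • ((MonoidAlgebra.lift ℚ ℚ Γ ((Units.coeHom ℚ).comp χ) x) * (show ℚ from T))
    rw [map_smul, smul_mul_assoc]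

variable {E : Type} [AddCommGroup E] [Module ℝ E] {S : ConeClass E} {a : Representation ℝ Γ E}
  {h : S.Inv a}

theorem ev_elim0 : ev (E := E) (Fin.elim0 : Fin 0 → E) (Fin.elim0 : Fin 0 → E) = 1 := by
  rw [ev_of' linearIndependent_empty_type (a := fun i => Fin.elim0 i) (fun j => Fin.elim0 j),
    if_pos (fun i => Fin.elim0 i)]
  simp

theorem mem_PC_zero (S : ConeClass E) (T : PF E 0) : T ∈ S.PC 0 := by
  have : T = T Fin.elim0 • ev (Fin.elim0 : Fin 0 → E) := by
    funext w
    rw [Subsingleton.elim w Fin.elim0, Pi.smul_apply, ev_elim0, smul_eq_mul, mul_one]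
  rw [this]
  exact Submodule.smul_mem _ _ (S.ev_mem (S.nil_mem _))

/-- The chains of degree zero form a one dimensional module. -/
def pcmZeroEquiv (S : ConeClass E) (a : Representation ℝ Γ E) (χ : Γ →* ℚˣ) (h : S.Inv a) :
    PCM S a χ h 0 ≃ₗ[GA Γ] QChar χ :=
  LinearEquiv.ofBijective (MonoidAlgebra.equivariantOfLinearOfComm (W := QChar χ)
    { toFun := fun T => (show PF E 0 from T.1) Fin.elim0
      map_add' := fun S T => rfl
      map_smul' := fun c T => rfl }
    (fun γ T => by
      rw [single_smul_QChar, one_mul]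
      have key : ∀ P : PF E 0, twist a χ 0 γ P Fin.elim0 = (χ γ : ℚ) * P Fin.elim0 := fun P => by
        rw [twist_apply]
        congr 2
        exact Subsingleton.elim _ _
      refine Eq.trans (congrFun ?_ Fin.elim0) (key T.1)
      refine (single_smul_TPF a χ 0 γ 1 T.1).trans ?_
      exact one_smul ℚ _))
    ⟨fun S T hST => Subtype.ext (funext fun w => by
      rw [Subsingleton.elim w Fin.elim0]
      exact hST), fun x => ⟨⟨fun _ => x, mem_PC_zero S _⟩, rfl⟩⟩

/-- The cycles among the chains of degree `m`. -/
abbrev cycM (S : ConeClass E) (a : Representation ℝ Γ E) (χ : Γ →* ℚˣ) (h : S.Inv a) (m : ℕ) :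
    Submodule (GA Γ) (PCM S a χ h m) :=
  cyclesM (M := fun r => PCM S a χ h r) (bdM S a χ h) m

theorem mem_cyclesM {χ : Γ →* ℚˣ} {m : ℕ} (T : PCM S a χ h m) :
    T ∈ cycM S a χ h m ↔ IsCyc (T.1 : PF E m) := by
  cases m with
  | zero => exact ⟨fun _ => trivial, fun _ => trivial⟩
  | succ m => exact Subtype.ext_iff

theorem cyclesM_eq_range {χ : Γ →* ℚˣ} {m : ℕ} (hex : ExactIn S.PC m) :
    cycM S a χ h m = LinearMap.range (bdM S a χ h m) := by
  ext T
  rw [mem_cyclesM]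
  constructor
  · intro hT
    obtain ⟨R, hR, hRT⟩ := hex _ T.2 hT
    exact ⟨⟨R, hR⟩, Subtype.ext hRT⟩
  · rintro ⟨R, rfl⟩
    exact isCyc_bd S R.2

theorem subsingleton_PCM {χ : Γ →* ℚˣ} {r : ℕ} (hr : S.PC r = ⊥) :
    Subsingleton (PCM S a χ h r) := by
  refine ⟨fun x y => Subtype.ext ?_⟩
  have key : ∀ P ∈ S.PC r, P = 0 := fun P hP => by rwa [hr, Submodule.mem_bot] at hP
  exact (key _ x.2).trans (key _ y.2).symm

theorem pdLT_QChar_of_exact (hex : ∀ r, ExactIn S.PC r)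
    (hP : ∀ χ r, Module.Projective (GA Γ) (PCM S a χ h (r + 1))) {d : ℕ}
    (hd : ∀ r, d < r → S.PC r = ⊥) (χ : Γ →* ℚˣ) : PdLT (GA Γ) (QChar χ) d := by
  have h1 := pdLT_boundaries (M := fun r => PCM S a χ h r) (bdM S a χ h) (hP χ) d 0
    (fun n _ => cyclesM_eq_range (m := n + 1) (hex _))
    (fun n hn => subsingleton_PCM (hd n (by omega)))
  rw [← cyclesM_eq_range (hex 0)] at h1
  exact PdLT.of_equiv ((Submodule.topEquiv (R := GA Γ)).trans (pcmZeroEquiv S a χ h)) h1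

theorem isCyc_twist (χ : Γ →* ℚˣ) {m : ℕ} {T : PF E m} (hT : T ∈ S.PC m) (hc : IsCyc T) (γ : Γ) :
    IsCyc (twist a χ m γ T) := by
  cases m with
  | zero => trivial
  | succ m =>
    show bd m _ = 0
    rw [bd_twist a χ γ (S.le_all _ hT), show bd m T = 0 from hc, map_zero]

theorem exists_homology_character (h : S.Inv a) {m : ℕ} (hS : SphereLike S.PC m) :
    ∃ χH : Γ →* ℚˣ, ∀ χ : Γ →* ℚˣ, ∃ f : cycM S a χ h m →ₗ[GA Γ] QChar (χ * χH),
      Function.Surjective f ∧ ∀ T, f T = 0 ↔ T.1 ∈ LinearMap.range (bdM S a χ h m) := by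
  obtain ⟨-, ζ, hζ, hζc, hζb, hgen⟩ := hS
  choose! c R hR hT using hgen
  have huniq : ∀ (T : PF E m) (b : ℚ) (P : PF E (m + 1)), T ∈ S.PC m → IsCyc T →
      P ∈ S.PC (m + 1) → T = b • ζ + bd m P → c T = b := by
    intro T b P h1 h2 h3 h4
    by_contra hne
    have h5 : (c T - b) • ζ = bd m (P - R T) := by
      rw [map_sub, sub_smul, sub_eq_sub_iff_add_eq_add, ← hT T h1 h2, h4]
      abel
    refine hζb ((c T - b)⁻¹ • (P - R T)) (Submodule.smul_mem _ _
      (Submodule.sub_mem _ h3 (hR T h1 h2))) ?_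
    rw [map_smul, ← h5, smul_smul, inv_mul_cancel₀ (sub_ne_zero.2 hne), one_smul]
  have htw : ∀ (γ : Γ) (T : PF E m), T ∈ S.PC m → IsCyc T →
      c (twist a 1 m γ T) = c (twist a 1 m γ ζ) * c T := by
    intro γ T h1 h2
    have h3 := h.twist_mem 1 γ hζ
    have h4 := isCyc_twist (a := a) 1 hζ hζc γ
    refine huniq _ _ (c T • R (twist a 1 m γ ζ) + twist a 1 (m + 1) γ (R T))
      (h.twist_mem 1 γ h1) (isCyc_twist 1 h1 h2 γ)
      (Submodule.add_mem _ (Submodule.smul_mem _ _ (hR _ h3 h4)) (h.twist_mem 1 γ (hR _ h1 h2))) ?_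
    conv_lhs => rw [hT T h1 h2]
    rw [map_add, map_smul, ← bd_twist a 1 γ (S.le_all _ (hR _ h1 h2)), hT _ h3 h4, map_add,
      map_smul, smul_add, smul_smul, mul_comm, add_assoc, ← hT _ h3 h4]
  have hc1 : c ζ = 1 := huniq ζ 1 0 hζ hζc (Submodule.zero_mem _) (by simp)
  let χ₀ : Γ →* ℚ :=
    { toFun := fun γ => c (twist a 1 m γ ζ)
      map_one' := by rw [map_one]; exact hc1
      map_mul' := fun γ δ => by
        rw [map_mul, Module.End.mul_apply,
          htw γ _ (h.twist_mem 1 δ hζ) (isCyc_twist 1 hζ hζc δ)] }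
  have hcadd : ∀ T ∈ S.PC m, IsCyc T → ∀ T' ∈ S.PC m, IsCyc T' → IsCyc (T + T') →
      c (T + T') = c T + c T' := fun T h1 h2 T' h1' h2' h3 =>
    huniq _ _ (R T + R T') (Submodule.add_mem _ h1 h1') h3
      (Submodule.add_mem _ (hR _ h1 h2) (hR _ h1' h2')) (by
        conv_lhs => rw [hT _ h1 h2, hT _ h1' h2']
        rw [map_add, add_smul]
        abel)
  have hcsmul : ∀ (b : ℚ), ∀ T ∈ S.PC m, IsCyc T → IsCyc (b • T) → c (b • T) = b * c T :=
    fun b T h1 h2 h3 => huniq _ _ (b • R T) (Submodule.smul_mem _ _ h1) h3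
      (Submodule.smul_mem _ _ (hR _ h1 h2)) (by
        conv_lhs => rw [hT _ h1 h2]
        rw [map_smul, mul_smul, smul_add])
  have hctw : ∀ (χ : Γ →* ℚˣ) (γ : Γ), ∀ T ∈ S.PC m, IsCyc T → c (twist a χ m γ T) =
      (χ γ : ℚ) * (χ₀ γ * c T) := by
    intro χ γ T h1 h2
    have e : twist a χ m γ T = (χ γ : ℚ) • twist a 1 m γ T := by
      funext w
      simp [twist_apply]
    rw [e, hcsmul _ _ (h.twist_mem 1 γ h1) (isCyc_twist 1 h1 h2 γ)
      (by rw [← e]; exact isCyc_twist χ h1 h2 γ), htw γ T h1 h2]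
    rfl
  refine ⟨χ₀.toHomUnits, fun χ => ?_⟩
  have hmem : ∀ T : cycM S a χ h m, (T.1.1 : PF E m) ∈ S.PC m := fun T => T.1.2
  have hcyc : ∀ T : cycM S a χ h m, IsCyc (T.1.1 : PF E m) :=
    fun T => (mem_cyclesM T.1).1 T.2
  let f₀ : cycM S a χ h m →ₗ[ℚ] QChar (χ * χ₀.toHomUnits) :=
    { toFun := fun T => c (T.1.1 : PF E m)
      map_add' := fun T T' => hcadd _ (hmem T) (hcyc T) _ (hmem T') (hcyc T') (hcyc (T + T'))
      map_smul' := fun b T => hcsmul b _ (hmem T) (hcyc T) (hcyc (b • T)) }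
  refine ⟨MonoidAlgebra.equivariantOfLinearOfComm f₀ fun γ T => ?_, fun x => ?_, fun T => ?_⟩
  · rw [single_smul_QChar, one_mul]
    refine (congrArg c ((single_smul_TPF a χ m γ 1 T.1.1).trans (one_smul ℚ _))).trans ?_
    refine (hctw χ γ _ (hmem T) (hcyc T)).trans ?_
    rw [MonoidHom.mul_apply, Units.val_mul, mul_assoc]
    rfl
  · have h1 : (show ℚ from x) • ζ ∈ S.PC m := Submodule.smul_mem _ _ hζ
    have h2 : IsCyc ((show ℚ from x) • ζ) := by
      cases m with
      | zero => trivial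
      | succ m => show bd m _ = 0; rw [map_smul, show bd m ζ = 0 from hζc, smul_zero]
    refine ⟨⟨⟨(show ℚ from x) • ζ, h1⟩, (mem_cyclesM _).2 h2⟩, ?_⟩
    exact huniq _ _ 0 h1 h2 (Submodule.zero_mem _) (by simp)
  · show c (T.1.1 : PF E m) = 0 ↔ _
    constructor
    · intro h0
      refine ⟨⟨R T.1.1, hR _ (hmem T) (hcyc T)⟩, Subtype.ext ?_⟩
      have := hT _ (hmem T) (hcyc T)
      rw [h0, zero_smul, zero_add] at this
      exact this.symm
    · rintro ⟨P, hP⟩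
      refine huniq _ _ P.1 (hmem T) (hcyc T) P.2 ?_
      rw [zero_smul, zero_add]
      exact (congrArg Subtype.val hP).symm

theorem pdLT_QChar_of_sphereLike {m p : ℕ} (hS : SphereLike S.PC m)
    (hP : ∀ χ r, Module.Projective (GA Γ) (PCM S a χ h (r + 1)))
    (hd : ∀ r, m + p < r → S.PC r = ⊥) {l : ℕ} (hl : p ≤ l)
    (H : ∀ χ : Γ →* ℚˣ, PdLT (GA Γ) (QChar χ) (l + 1 + m)) (χ : Γ →* ℚˣ) :
    PdLT (GA Γ) (QChar χ) (l + 1) := by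
  obtain ⟨χH, hχ⟩ := exists_homology_character h hS
  obtain ⟨f, hf, hker⟩ := hχ (χ * χH⁻¹)
  have hB := pdLT_boundaries (M := fun r => PCM S a (χ * χH⁻¹) h r) (bdM S a (χ * χH⁻¹) h)
    (hP _) p m (fun n hn => cyclesM_eq_range (m := n + 1) (hS.1 _ (by omega)))
    (fun n hn => subsingleton_PCM (hd n (by omega)))
  have hZ : PdLT (GA Γ) (cycM S a (χ * χH⁻¹) h m) (l + 1) :=
    pdLT_cycles (M := fun r => PCM S a (χ * χH⁻¹) h r) (bdM S a (χ * χH⁻¹) h) (hP _) (k := 1)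
      le_rfl m (fun n hn => cyclesM_eq_range (hS.1 _ (by omega))) (l + 1) (by omega)
      (PdLT.of_equiv (pcmZeroEquiv S a _ h).symm (H _))
  have hle : LinearMap.range (bdM S a (χ * χH⁻¹) h m) ≤ cycM S a (χ * χH⁻¹) h m := by
    rintro _ ⟨R, rfl⟩
    exact (mem_cyclesM _).2 (isCyc_bd S R.2)
  have := PdLT.of_exact hf hle hker (hB.mono hl) hZ
  rwa [inv_mul_cancel_right] at this

end Characters

end PolyChain

namespace PolyChain

section Weights

variable {Γ : Type} [Group Γ]

/-- The first index occurring in a family of sets. -/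
def firstIdx (M : ℕ → Γ → Prop) : ℕ := sInf {i | ∃ γ, M i γ}

open Classical in
/-- The weight of the identity in the first nonempty member of a family of sets. -/
def weight (M : ℕ → Γ → Prop) : ℚ :=
  if M (firstIdx M) 1 then ((Set.ncard {γ | M (firstIdx M) γ} : ℕ) : ℚ)⁻¹ else 0

theorem firstIdx_mem {M : ℕ → Γ → Prop} (h : ∃ i γ, M i γ) : ∃ γ, M (firstIdx M) γ :=
  Nat.sInf_mem h

theorem firstIdx_le {M : ℕ → Γ → Prop} {i : ℕ} {γ : Γ} (h : M i γ) : firstIdx M ≤ i :=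
  Nat.sInf_le ⟨γ, h⟩

/-- A function of families of sets that depends only on an initial segment of the family. -/
def IsLocal (Φ : (ℕ → Γ → Prop) → ℚ) : Prop :=
  ∀ M M' I, (∃ i ≤ I, ∃ γ, M i γ) → (∀ i ≤ I, ∀ γ, M i γ ↔ M' i γ) → Φ M = Φ M'

theorem firstIdx_congr {M M' : ℕ → Γ → Prop} {I : ℕ} (h : ∃ i ≤ I, ∃ γ, M i γ)
    (hM : ∀ i ≤ I, ∀ γ, M i γ ↔ M' i γ) : firstIdx M = firstIdx M' := by
  obtain ⟨i, hi, γ, hγ⟩ := h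
  have h1 := firstIdx_le hγ
  have h2 := firstIdx_le ((hM i hi γ).1 hγ)
  obtain ⟨δ, hδ⟩ := firstIdx_mem ⟨i, γ, hγ⟩
  obtain ⟨δ', hδ'⟩ := firstIdx_mem ⟨i, γ, (hM i hi γ).1 hγ⟩
  exact le_antisymm (firstIdx_le ((hM _ (h2.trans hi) _).2 hδ'))
    (firstIdx_le ((hM _ (h1.trans hi) _).1 hδ))

theorem isLocal_weight : IsLocal (weight (Γ := Γ)) := by
  intro M M' I h hM
  have h1 := firstIdx_congr h hM
  obtain ⟨i, hi, γ, hγ⟩ := h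
  have h2 : firstIdx M ≤ I := (firstIdx_le hγ).trans hi
  have h3 : M (firstIdx M) = M' (firstIdx M) := funext fun γ => propext (hM _ h2 γ)
  unfold weight
  rw [← h1, h3]

theorem firstIdx_comp_mul (M : ℕ → Γ → Prop) (δ : Γ) :
    firstIdx (fun i γ => M i (δ * γ)) = firstIdx M := by
  unfold firstIdx
  congr 1
  ext i
  exact ⟨fun ⟨γ, h⟩ => ⟨δ * γ, h⟩, fun ⟨γ, h⟩ => ⟨δ⁻¹ * γ, by
    simpa only [mul_inv_cancel_left] using h⟩⟩

open Classical in
theorem weight_comp_mul (M : ℕ → Γ → Prop) (δ : Γ) : weight (fun i γ => M i (δ * γ)) =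
    if M (firstIdx M) δ then ((Set.ncard {γ | M (firstIdx M) γ} : ℕ) : ℚ)⁻¹ else 0 := by
  have : Set.ncard {γ | M (firstIdx M) (δ * γ)} = Set.ncard {γ | M (firstIdx M) γ} :=
    Set.ncard_congr (fun γ _ => δ * γ) (fun γ h => h) (fun γ γ' _ _ h => mul_left_cancel h)
      (fun γ h => ⟨δ⁻¹ * γ, by simpa only [Set.mem_ofPred_eq, mul_inv_cancel_left] using h,
        mul_inv_cancel_left _ _⟩)
  simp only [weight, firstIdx_comp_mul, mul_one, this]

theorem weight_comp_mul_ne_zero {M : ℕ → Γ → Prop} {δ : Γ}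
    (h : weight (fun i γ => M i (δ * γ)) ≠ 0) : M (firstIdx M) δ := by
  classical
  rw [weight_comp_mul] at h
  by_contra h'
  exact h (if_neg h')

theorem finsum_weight {M : ℕ → Γ → Prop} (h : ∃ i γ, M i γ) (hfin : ∀ i, {γ | M i γ}.Finite) :
    ∑ᶠ δ : Γ, weight (fun i γ => M i (δ * γ)) = 1 := by
  classical
  have hf := hfin (firstIdx M)
  obtain ⟨γ₀, h0⟩ := firstIdx_mem h
  rw [finsum_eq_sum_of_support_subset (s := hf.toFinset) _ (fun δ hδ => by
    rw [Set.Finite.coe_toFinset]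
    exact weight_comp_mul_ne_zero hδ)]
  have : ∀ δ ∈ hf.toFinset, weight (fun i γ => M i (δ * γ)) =
      ((Set.ncard {γ | M (firstIdx M) γ} : ℕ) : ℚ)⁻¹ := fun δ hδ => by
    have h1 : M (firstIdx M) δ := (Set.Finite.mem_toFinset hf).1 hδ
    rw [weight_comp_mul, if_pos h1]
  rw [Finset.sum_congr rfl this, Finset.sum_const, nsmul_eq_mul, Set.ncard_eq_toFinset_card _ hf]
  refine mul_inv_cancel₀ ?_
  rw [Nat.cast_ne_zero]
  exact Finset.card_ne_zero_of_mem ((Set.Finite.mem_toFinset hf).2 h0)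

end Weights

section Geometry

variable {E : Type} [NormedAddCommGroup E] [NormedSpace ℝ E] [FiniteDimensional ℝ E]

/-- The slice of the simplicial cone spanned by a tuple. -/
def slice {r : ℕ} (σ : Fin r → E) : Set E := (fun t => ∑ i, t i • σ i) '' stdSimplex ℝ (Fin r)

theorem isCompact_slice {r : ℕ} (σ : Fin r → E) : IsCompact (slice σ) :=
  (isCompact_stdSimplex ℝ (Fin r)).image (by fun_prop)

theorem slice_subset {V : Set E} {r : ℕ} {σ : Fin r → E}
    (h : ∀ t : Fin r → ℝ, (∀ i, 0 ≤ t i) → t ≠ 0 → ∑ i, t i • σ i ∈ V) : slice σ ⊆ V := by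
  rintro _ ⟨t, ht, rfl⟩
  refine h t ht.1 ?_
  rintro rfl
  simpa using ht.2

theorem exists_smul_mem_slice {r : ℕ} (σ : Fin r → E) {t : Fin r → ℝ} (ht : ∀ i, 0 ≤ t i)
    (ht0 : t ≠ 0) : ∃ s : ℝ, 0 < s ∧ s • ∑ i, t i • σ i ∈ slice σ := by
  have hpos : 0 < ∑ i, t i := by
    obtain ⟨i, hi⟩ := Function.ne_iff.1 ht0
    exact Finset.sum_pos' (fun i _ => ht i) ⟨i, Finset.mem_univ i, lt_of_le_of_ne (ht i) hi.symm⟩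
  refine ⟨(∑ i, t i)⁻¹, inv_pos.2 hpos, (fun i => (∑ i, t i)⁻¹ * t i), ⟨fun i => ?_, ?_⟩, ?_⟩
  · exact mul_nonneg (inv_nonneg.2 hpos.le) (ht i)
  · rw [← Finset.mul_sum, inv_mul_cancel₀ hpos.ne']
  · simp only [mul_smul, Finset.smul_sum]

theorem exists_smul_first_mem_slice {r : ℕ} {σ w : Fin (r + 1) → E} (hσ : LinearIndependent ℝ σ)
    (h : ev σ w ≠ 0) : ∃ s : ℝ, 0 < s ∧ s • w 0 ∈ slice σ := by
  obtain ⟨A, hA, hA', hd, -⟩ := exists_of_ev_ne_zero hσ h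
  rw [hA 0]
  refine exists_smul_mem_slice σ (fun i => (hA' i).nonneg_zero) fun h0 => hd ?_
  exact Matrix.det_eq_zero_of_column_eq_zero 0 fun i => congrFun h0 i

/-- The closed simplicial cone spanned by a basis contains the germ of a tuple. -/
def GermIn {d : ℕ} (κ : Module.Basis (Fin d) ℝ E) {r : ℕ} (w : Fin r → E) : Prop :=
  ∀ j, ¬ LexPos fun i => -κ.coord j (w i)

theorem germIn_of_pos {d : ℕ} {κ : Module.Basis (Fin d) ℝ E} {r : ℕ} {w : Fin (r + 1) → E}
    (h : ∀ j, 0 < κ.coord j (w 0)) : GermIn κ w := fun j hj => by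
  have := hj.nonneg_zero
  linarith [h j]

theorem GermIn.nonneg {d : ℕ} {κ : Module.Basis (Fin d) ℝ E} {r : ℕ} {w : Fin (r + 1) → E}
    (h : GermIn κ w) (j : Fin d) : 0 ≤ κ.coord j (w 0) := by
  by_contra! hlt
  exact h j (lexPos_of_pos_zero (by linarith))

theorem GermIn.exists_smul_mem_slice {d : ℕ} {κ : Module.Basis (Fin d) ℝ E} {r : ℕ}
    {w : Fin (r + 1) → E} (h : GermIn κ w) (h0 : w 0 ≠ 0) :
    ∃ s : ℝ, 0 < s ∧ s • w 0 ∈ slice κ := by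
  have := PolyChain.exists_smul_mem_slice κ (t := fun j => κ.coord j (w 0)) h.nonneg
    (fun hz => h0 (by
      rw [← κ.sum_repr (w 0)]
      exact Finset.sum_eq_zero fun j _ => by
        rw [show κ.repr (w 0) j = 0 from congrFun hz j, zero_smul]))
  simpa only [Module.Basis.coord_apply, κ.sum_repr] using this

theorem exists_basis_around {V : Set E} (hV : IsOpen V)
    (hcone : ∀ x ∈ V, ∀ t : ℝ, 0 < t → t • x ∈ V) (h0 : (0 : E) ∉ V) {x : E} (hx : x ∈ V) :
    ∃ κ : Module.Basis (Fin (Module.finrank ℝ E)) ℝ E,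
      (∀ t : Fin (Module.finrank ℝ E) → ℝ, (∀ i, 0 ≤ t i) → t ≠ 0 → ∑ i, t i • κ i ∈ V) ∧
      ∀ j, 0 < κ.coord j x := by
  have hx0 : x ≠ 0 := fun h => h0 (h ▸ hx)
  set d := Module.finrank ℝ E with hd
  let b₀ : Module.Basis (Fin d) ℝ E := Module.finBasis ℝ E
  have hne : Nontrivial E := ⟨x, 0, hx0⟩
  have hdpos : 0 < d := Module.finrank_pos
  have hy : ∑ i, b₀ i ≠ 0 := by
    intro h
    have := Fintype.linearIndependent_iff.1 b₀.linearIndependent (fun _ => 1) (by simpa using h)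
      ⟨0, hdpos⟩
    exact one_ne_zero this
  obtain ⟨A, hA⟩ := SeparatingDual.exists_continuousLinearEquiv_apply_eq (R := ℝ) hy hx0
  have hxA : x = ∑ i, A (b₀ i) := by rw [← hA, map_sum]
  obtain ⟨δ, hδ, hball⟩ := Metric.isOpen_iff.1 hV x hx
  set C := ∑ i, ‖A (b₀ i)‖ with hC
  have hC0 : 0 ≤ C := Finset.sum_nonneg fun i _ => norm_nonneg _
  set ε := δ / (1 + C) with hε
  have hε0 : 0 < ε := by positivity
  have hli : LinearIndependent ℝ (fun i => x + ε • A (b₀ i)) := by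
    rw [Fintype.linearIndependent_iff]
    intro g hg
    have h1 : ∑ i, ((∑ j, g j) + ε * g i) • A (b₀ i) = 0 := by
      simp only [add_smul, Finset.sum_add_distrib, ← Finset.smul_sum, ← hxA, mul_smul]
      rw [← hg]
      simp only [smul_add, Finset.sum_add_distrib, ← Finset.sum_smul, Finset.smul_sum]
      congr 1
      exact Finset.sum_congr rfl fun i _ => smul_comm _ _ _
    have h2 : ∑ i, ((∑ j, g j) + ε * g i) • b₀ i = 0 := by
      apply A.injective
      rw [map_sum, map_zero, ← h1]
      exact Finset.sum_congr rfl fun i _ => map_smul _ _ _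
    have h3 := Fintype.linearIndependent_iff.1 b₀.linearIndependent _ h2
    have h4 : (d : ℝ) * (∑ j, g j) + ε * ∑ j, g j = 0 := by
      have := Finset.sum_congr rfl fun i (_ : i ∈ Finset.univ) => h3 i
      rw [Finset.sum_add_distrib, ← Finset.mul_sum] at this
      simpa using this
    have h5 : ∑ j, g j = 0 := by
      have h6 : ((d : ℝ) + ε) * ∑ j, g j = 0 := by linarith
      exact (mul_eq_zero.1 h6).resolve_left (by positivity)
    intro i
    have := h3 i
    rw [h5, zero_add] at this
    exact (mul_eq_zero.1 this).resolve_left hε0.ne'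
  have : Nonempty (Fin d) := ⟨⟨0, hdpos⟩⟩
  let κ := basisOfLinearIndependentOfCardEqFinrank hli (by simp [hd])
  have hκ : ∀ i, κ i = x + ε • A (b₀ i) := fun i => by simp [κ]
  refine ⟨κ, fun t ht ht0 => ?_, fun j => ?_⟩
  · obtain ⟨s, hs, t', ht', hst⟩ := exists_smul_mem_slice κ ht ht0
    have h1 : ∑ i, t i • κ i = s⁻¹ • ∑ i, t' i • κ i := by
      simp only [hst, smul_smul, inv_mul_cancel₀ hs.ne', one_smul]
    rw [h1]
    refine hcone _ (hball ?_) _ (inv_pos.2 hs)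
    have h2 : ∑ i, t' i • κ i = x + ε • ∑ i, t' i • A (b₀ i) := by
      simp only [hκ, smul_add, Finset.sum_add_distrib, ← Finset.sum_smul, ht'.2, one_smul,
        Finset.smul_sum]
      congr 1
      exact Finset.sum_congr rfl fun i _ => smul_comm _ _ _
    rw [h2, Metric.mem_ball, dist_eq_norm, add_sub_cancel_left, norm_smul, Real.norm_eq_abs,
      abs_of_pos hε0]
    have h3 : ‖∑ i, t' i • A (b₀ i)‖ ≤ C := by
      refine (norm_sum_le _ _).trans (Finset.sum_le_sum fun i _ => ?_)
      rw [norm_smul, Real.norm_eq_abs, abs_of_nonneg (ht'.1 i)]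
      refine mul_le_of_le_one_left (norm_nonneg _) ?_
      rw [← ht'.2]
      exact Finset.single_le_sum (fun i _ => ht'.1 i) (Finset.mem_univ i)
    calc ε * ‖∑ i, t' i • A (b₀ i)‖ ≤ ε * C := mul_le_mul_of_nonneg_left h3 hε0.le
      _ < ε * (1 + C) := by nlinarith
      _ = δ := by rw [hε]; field_simp
  · have h1 : x = ((d : ℝ) + ε)⁻¹ • ∑ i, κ i := by
      simp only [hκ, Finset.sum_add_distrib, Finset.sum_const, Finset.card_univ, Fintype.card_fin,
        ← Finset.smul_sum, ← hxA, ← Nat.cast_smul_eq_nsmul ℝ, ← add_smul, smul_smul]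
      rw [inv_mul_cancel₀ (by positivity), one_smul]
    have h2 : κ.coord j x = ((d : ℝ) + ε)⁻¹ := by
      rw [h1, map_smul, map_sum]
      simp [Finsupp.single_apply]
    rw [h2]
    positivity

theorem exists_bases_covering {V : Set E} (hV : IsOpen V)
    (hcone : ∀ x ∈ V, ∀ t : ℝ, 0 < t → t • x ∈ V) (h0 : (0 : E) ∉ V) (hne : V.Nonempty) :
    ∃ κ : ℕ → Module.Basis (Fin (Module.finrank ℝ E)) ℝ E,
      (∀ n, ∀ t : Fin (Module.finrank ℝ E) → ℝ, (∀ i, 0 ≤ t i) → t ≠ 0 →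
        ∑ i, t i • κ n i ∈ V) ∧ ∀ x ∈ V, ∃ n, ∀ j, 0 < (κ n).coord j x := by
  have h1 : ∀ x : V, ∃ κ : Module.Basis (Fin (Module.finrank ℝ E)) ℝ E,
      (∀ t : Fin (Module.finrank ℝ E) → ℝ, (∀ i, 0 ≤ t i) → t ≠ 0 → ∑ i, t i • κ i ∈ V) ∧
      ∀ j, 0 < κ.coord j x := fun x => exists_basis_around hV hcone h0 x.2
  choose κ hκ hκ' using h1
  obtain ⟨t, htc, ht⟩ := TopologicalSpace.countable_cover_nhds
    (f := fun x : V => {y : V | ∀ j, 0 < (κ x).coord j y}) (fun x => by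
      have ho : IsOpen {y : V | ∀ j, 0 < (κ x).coord j y} := by
        simp only [Set.ofPred_forall]
        refine isOpen_iInter_of_finite fun j => isOpen_lt continuous_const ?_
        exact (LinearMap.continuous_of_finiteDimensional ((κ x).coord j)).comp
          continuous_subtype_val
      exact ho.mem_nhds (hκ' x))
  have htne : t.Nonempty := by
    obtain ⟨x, hx⟩ := hne
    have : (⟨x, hx⟩ : V) ∈ ⋃ x ∈ t, {y : V | ∀ j, 0 < (κ x).coord j y} := by
      rw [ht]
      trivial
    simp only [Set.mem_iUnion] at this
    obtain ⟨y, hy, -⟩ := this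
    exact ⟨y, hy⟩
  obtain ⟨f, hf⟩ := htc.exists_eq_range htne
  refine ⟨fun n => κ (f n), fun n => hκ _, fun x hx => ?_⟩
  have : (⟨x, hx⟩ : V) ∈ ⋃ x ∈ t, {y : V | ∀ j, 0 < (κ x).coord j y} := by
    rw [ht]
    trivial
  simp only [Set.mem_iUnion] at this
  obtain ⟨y, hy, hy'⟩ := this
  rw [hf] at hy
  obtain ⟨n, rfl⟩ := hy
  exact ⟨n, hy'⟩

end Geometry

end PolyChain

namespace PolyChain

section Projective

variable {Γ : Type} [Group Γ]
  {E : Type} [NormedAddCommGroup E] [NormedSpace ℝ E] [FiniteDimensional ℝ E]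

/-- An open cone with a linear action of `Γ` that is proper up to scaling. -/
structure ProperCone (V : Set E) (a : Representation ℝ Γ E) : Prop where
  isOpen : IsOpen V
  smul_mem : ∀ x ∈ V, ∀ t : ℝ, 0 < t → t • x ∈ V
  zero_notMem : (0 : E) ∉ V
  inv_mem : ∀ γ, ∀ x ∈ V, a γ x ∈ V
  proper : ∀ A ⊆ V, ∀ B ⊆ V, IsCompact A → IsCompact B →
    {γ | ∃ x ∈ A, ∃ t : ℝ, 0 < t ∧ t • a γ x ∈ B}.Finite

/-- Simplicial cones contained in `V` whose interiors cover `V`. -/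
structure Covering (V : Set E) {d : ℕ} (κ : ℕ → Module.Basis (Fin d) ℝ E) : Prop where
  comb_mem : ∀ n, ∀ t : Fin d → ℝ, (∀ i, 0 ≤ t i) → t ≠ 0 → ∑ i, t i • κ n i ∈ V
  exists_pos : ∀ x ∈ V, ∃ n, ∀ j, 0 < (κ n).coord j x

variable {V : Set E} {a : Representation ℝ Γ E} {d : ℕ} {κ : ℕ → Module.Basis (Fin d) ℝ E}

/-- The translates of the cones of a family that contain a germ. -/
def rel (κ : ℕ → Module.Basis (Fin d) ℝ E) (a : Representation ℝ Γ E) {r : ℕ} (w : Fin r → E)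
    (i : ℕ) (γ : Γ) : Prop := GermIn (κ i) fun k => a γ⁻¹ (w k)

theorem rel_translate {r : ℕ} (w : Fin r → E) (δ : Γ) :
    rel κ a (fun k => a δ⁻¹ (w k)) = fun i γ => rel κ a w i (δ * γ) := by
  funext i γ
  simp only [rel, _root_.mul_inv_rev, map_mul, Module.End.mul_apply]

theorem first_mem {r : ℕ} {σ w : Fin (r + 1) → E} (hσ : σ ∈ (conesIn V).carrier (r + 1))
    (hw : ev σ w ≠ 0) : w 0 ∈ V := by
  obtain ⟨A, hA, hA', hd, -⟩ := exists_of_ev_ne_zero hσ.1 hw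
  rw [hA 0]
  refine hσ.2 _ (fun i => (hA' i).nonneg_zero) fun h0 => hd ?_
  exact Matrix.det_eq_zero_of_column_eq_zero 0 fun i => congrFun h0 i

theorem finite_rel (hV : ProperCone V a) (hκ : Covering V κ) {r : ℕ} {σ : Fin (r + 1) → E}
    (hσ : σ ∈ (conesIn V).carrier (r + 1)) (i : ℕ) :
    {γ | ∃ w, ev σ w ≠ 0 ∧ rel κ a w i γ}.Finite := by
  refine (hV.proper _ (slice_subset (hκ.comb_mem i)) _ (slice_subset hσ.2) (isCompact_slice _)
    (isCompact_slice _)).subset ?_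
  rintro γ ⟨w, hw, hγ⟩
  obtain ⟨s, hs, hs'⟩ := exists_smul_first_mem_slice hσ.1 hw
  obtain ⟨u, hu, hu'⟩ := GermIn.exists_smul_mem_slice hγ (fun h => hV.zero_notMem (by
    have := hV.inv_mem γ⁻¹ _ (first_mem hσ hw)
    rwa [h] at this))
  refine ⟨_, hu', s * u⁻¹, by positivity, ?_⟩
  rw [map_smul, rep_apply_inv, smul_smul, inv_mul_cancel_right₀ hu.ne']
  exact hs'

theorem exists_rel_bound (hκ : Covering V κ) (a : Representation ℝ Γ E) {r : ℕ}
    {σ : Fin (r + 1) → E} (hσ : σ ∈ (conesIn V).carrier (r + 1)) :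
    ∃ I, ∀ w, ev σ w ≠ 0 → ∃ i ≤ I, rel κ a w i 1 := by
  have ho : ∀ i, IsOpen {x | ∀ j, 0 < (κ i).coord j x} := fun i => by
    simp only [Set.ofPred_forall]
    exact isOpen_iInter_of_finite fun j => isOpen_lt continuous_const
      (LinearMap.continuous_of_finiteDimensional ((κ i).coord j))
  obtain ⟨t, ht⟩ := (isCompact_slice σ).elim_finite_subcover _ ho (fun x hx => by
    obtain ⟨n, hn⟩ := hκ.exists_pos x (slice_subset hσ.2 hx)
    exact Set.mem_iUnion.2 ⟨n, hn⟩)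
  refine ⟨t.sup id, fun w hw => ?_⟩
  obtain ⟨s, hs, hs'⟩ := exists_smul_first_mem_slice hσ.1 hw
  obtain ⟨i, hi, hi'⟩ := Set.mem_iUnion₂.1 (ht hs')
  refine ⟨i, Finset.le_sup (f := id) hi, ?_⟩
  refine germIn_of_pos fun j => ?_
  have := hi' j
  rw [map_smul, smul_eq_mul] at this
  rw [inv_one, map_one, Module.End.one_apply]
  exact pos_of_mul_pos_right this hs.le

theorem mul_local_ev_mem (hV : ProperCone V a) (hκ : Covering V κ) {Φ : (ℕ → Γ → Prop) → ℚ}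
    (hΦ : IsLocal Φ) {r : ℕ} {σ : Fin (r + 1) → E} (hσ : σ ∈ (conesIn V).carrier (r + 1)) :
    (fun w => Φ (rel κ a w) * ev σ w) ∈ (conesIn V).PC (r + 1) := by
  classical
  obtain ⟨I, hI⟩ := exists_rel_bound hκ a hσ
  have hF := fun i => finite_rel hV hκ hσ i
  let ls : Finset (E →ₗ[ℝ] ℝ) := (Finset.range (I + 1)).biUnion fun i =>
    (hF i).toFinset.biUnion fun γ => Finset.univ.image fun j => (κ i).coord j ∘ₗ a γ⁻¹
  have hls : ∀ i ≤ I, ∀ γ, (∃ w, ev σ w ≠ 0 ∧ rel κ a w i γ) → ∀ j,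
      (κ i).coord j ∘ₗ a γ⁻¹ ∈ ls := fun i hi γ h j =>
    Finset.mem_biUnion.2 ⟨i, Finset.mem_range.2 (by omega), Finset.mem_biUnion.2
      ⟨γ, (Set.Finite.mem_toFinset _).2 h, Finset.mem_image_of_mem _ (Finset.mem_univ j)⟩⟩
  have hmain := mul_ev_mem ls hσ.1 (φ := fun w => Φ (rel κ a w)) fun w w' hw hw' h => by
    refine hΦ _ _ I ?_ ?_
    · obtain ⟨i, hi, hi'⟩ := hI w hw
      exact ⟨i, hi, 1, hi'⟩
    · intro i hi γ
      by_cases hγ : ∃ w, ev σ w ≠ 0 ∧ rel κ a w i γ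
      · refine forall_congr' fun j => not_congr ?_
        exact (h _ (hls i hi γ hγ j)).2
      · push Not at hγ
        exact ⟨fun h' => (hγ w hw h').elim, fun h' => (hγ w' hw' h').elim⟩
  refine Submodule.span_mono ?_ hmain
  rintro _ ⟨τ, ⟨hτ, hτ'⟩, rfl⟩
  exact ⟨τ, mem_conesIn_of_inHull hσ hτ hτ', rfl⟩

theorem mul_local_mem (hV : ProperCone V a) (hκ : Covering V κ) {Φ : (ℕ → Γ → Prop) → ℚ}
    (hΦ : IsLocal Φ) {r : ℕ} {T : PF E (r + 1)} (hT : T ∈ (conesIn V).PC (r + 1)) :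
    (fun w => Φ (rel κ a w) * T w) ∈ (conesIn V).PC (r + 1) := by
  induction hT using Submodule.span_induction with
  | mem x hx =>
    obtain ⟨σ, hσ, rfl⟩ := hx
    exact mul_local_ev_mem hV hκ hΦ hσ
  | zero =>
    have : (fun w => Φ (rel κ a w) * (0 : PF E (r + 1)) w) = 0 := funext fun w => mul_zero _
    rw [this]
    exact Submodule.zero_mem _
  | add x y _ _ hx hy =>
    have : (fun w => Φ (rel κ a w) * (x + y) w) = (fun w => Φ (rel κ a w) * x w) +
        fun w => Φ (rel κ a w) * y w := funext fun w => mul_add _ _ _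
    rw [this]
    exact Submodule.add_mem _ hx hy
  | smul c x _ hx =>
    have : (fun w => Φ (rel κ a w) * (c • x) w) = c • fun w => Φ (rel κ a w) * x w :=
      funext fun w => mul_left_comm _ _ _
    rw [this]
    exact Submodule.smul_mem _ _ hx

theorem ConeClass.exists_ev_ne_zero {E : Type} [AddCommGroup E] [Module ℝ E] (S : ConeClass E)
    {r : ℕ} {T : PF E r} (hT : T ∈ S.PC r) : ∃ F : Finset (Fin r → E),
      (∀ σ ∈ F, σ ∈ S.carrier r) ∧ ∀ w, T w ≠ 0 → ∃ σ ∈ F, ev σ w ≠ 0 := by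
  classical
  induction hT using Submodule.span_induction with
  | mem x hx =>
    obtain ⟨σ, hσ, rfl⟩ := hx
    exact ⟨{σ}, by simpa using hσ, fun w hw => ⟨σ, by simp, hw⟩⟩
  | zero => exact ⟨∅, by simp, fun w hw => (hw rfl).elim⟩
  | add x y _ _ hx hy =>
    obtain ⟨F, hF, hF'⟩ := hx
    obtain ⟨G, hG, hG'⟩ := hy
    refine ⟨F ∪ G, fun σ hσ => (Finset.mem_union.1 hσ).elim (hF σ) (hG σ), fun w hw => ?_⟩
    by_cases h : x w = 0
    · obtain ⟨σ, hσ, h'⟩ := hG' w (fun h' => hw (by rw [Pi.add_apply, h, h', add_zero]))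
      exact ⟨σ, Finset.mem_union_right _ hσ, h'⟩
    · obtain ⟨σ, hσ, h'⟩ := hF' w h
      exact ⟨σ, Finset.mem_union_left _ hσ, h'⟩
  | smul c x _ hx =>
    obtain ⟨F, hF, hF'⟩ := hx
    exact ⟨F, hF, fun w hw => hF' w fun h => hw (by rw [Pi.smul_apply, h, smul_zero])⟩

theorem finsum_weight_rel (hV : ProperCone V a) (hκ : Covering V κ) {r : ℕ}
    {σ w : Fin (r + 1) → E} (hσ : σ ∈ (conesIn V).carrier (r + 1)) (hw : ev σ w ≠ 0) :
    ∑ᶠ γ : Γ, weight (rel κ a fun k => a γ⁻¹ (w k)) = 1 := by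
  simp only [rel_translate]
  obtain ⟨I, hI⟩ := exists_rel_bound hκ a hσ
  obtain ⟨i, -, hi⟩ := hI w hw
  exact finsum_weight ⟨i, 1, hi⟩ fun i => (finite_rel hV hκ hσ i).subset fun γ hγ => ⟨w, hw, hγ⟩

theorem finite_weight_rel (hV : ProperCone V a) (hκ : Covering V κ) {r : ℕ} {T : PF E (r + 1)}
    (hT : T ∈ (conesIn V).PC (r + 1)) :
    {γ : Γ | ∃ w, weight (rel κ a fun k => a γ⁻¹ (w k)) * T w ≠ 0}.Finite := by
  obtain ⟨F, hF, hF'⟩ := ConeClass.exists_ev_ne_zero _ hT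
  have h1 : ∀ σ ∈ F, {γ : Γ | ∃ w, ev σ w ≠ 0 ∧
      weight (rel κ a fun k => a γ⁻¹ (w k)) ≠ 0}.Finite := by
    intro σ hσ
    obtain ⟨I, hI⟩ := exists_rel_bound hκ a (hF σ hσ)
    refine ((Set.finite_Iic I).biUnion fun i _ => finite_rel hV hκ (hF σ hσ) i).subset ?_
    rintro γ ⟨w, hw, hγ⟩
    rw [rel_translate] at hγ
    obtain ⟨i, hi, hi'⟩ := hI w hw
    exact Set.mem_biUnion (Set.mem_Iic.2 ((firstIdx_le hi').trans hi))
      ⟨w, hw, weight_comp_mul_ne_zero hγ⟩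
  refine (F.finite_toSet.biUnion h1).subset ?_
  rintro γ ⟨w, hw⟩
  obtain ⟨σ, hσ, h⟩ := hF' w (right_ne_zero_of_mul hw)
  exact Set.mem_biUnion hσ ⟨w, h, left_ne_zero_of_mul hw⟩

/-- Multiplication of chains by the weight function of a covering. -/
def weightMul (hV : ProperCone V a) (hκ : Covering V κ) (χ : Γ →* ℚˣ)
    (h : (conesIn V).Inv a) (r : ℕ) :
    PCM (conesIn V) a χ h (r + 1) →ₗ[ℚ] PCM (conesIn V) a χ h (r + 1) where
  toFun T := ⟨fun w => weight (rel κ a w) * (show PF E (r + 1) from T.1) w,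
    mul_local_mem hV hκ isLocal_weight T.2⟩
  map_add' S T := Subtype.ext (funext fun w => mul_add _ _ _)
  map_smul' c T := Subtype.ext (funext fun w => mul_left_comm _ _ _)

variable (hV : ProperCone V a) (hκ : Covering V κ) (χ : Γ →* ℚˣ) (h : (conesIn V).Inv a) (r : ℕ)

theorem weightMul_conj (γ : Γ) (T : PCM (conesIn V) a χ h (r + 1)) :
    (((MonoidAlgebra.single γ 1 : GA Γ) •
      weightMul hV hκ χ h r ((MonoidAlgebra.single γ⁻¹ 1 : GA Γ) • T)).1 :
        PF E (r + 1)) = fun w => weight (rel κ a fun k => a γ⁻¹ (w k)) *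
          (show PF E (r + 1) from T.1) w := by
  refine (single_smul_TPF a χ (r + 1) γ 1 _).trans ((one_smul ℚ _).trans ?_)
  funext w
  have e : (((MonoidAlgebra.single γ⁻¹ 1 : GA Γ) • T).1 : PF E (r + 1)) =
      twist a χ (r + 1) γ⁻¹ (show PF E (r + 1) from T.1) :=
    (single_smul_TPF a χ (r + 1) γ⁻¹ 1 _).trans (one_smul ℚ _)
  have e2 := congrFun e (fun k => a γ⁻¹ (w k))
  refine (twist_apply a χ (r + 1) γ _ w).trans ?_
  have e3 : (show PF E (r + 1) from
      (weightMul hV hκ χ h r ((MonoidAlgebra.single γ⁻¹ 1 : GA Γ) • T)).1)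
      (fun k => a γ⁻¹ (w k)) = weight (rel κ a fun k => a γ⁻¹ (w k)) *
        ((χ γ⁻¹ : ℚ) * (show PF E (r + 1) from T.1) w) := by
    refine congrArg (weight (rel κ a fun k => a γ⁻¹ (w k)) * ·) (e2.trans ?_)
    rw [twist_apply]
    simp only [inv_inv, rep_apply_inv]
  refine (congrArg ((χ γ : ℚ) * ·) e3).trans ?_
  generalize (show PF E (r + 1) from T.1) w = x
  have := (χ γ).ne_zero
  simp only [map_inv, Units.val_inv_eq_inv_val]
  field_simp

theorem finite_weightMul (T : PCM (conesIn V) a χ h (r + 1)) :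
    {γ : Γ | (MonoidAlgebra.single γ 1 : GA Γ) •
      weightMul hV hκ χ h r ((MonoidAlgebra.single γ⁻¹ 1 : GA Γ) • T) ≠ 0}.Finite := by
  refine (finite_weight_rel hV hκ T.2).subset fun γ hγ => ?_
  by_contra hne
  refine hγ (Subtype.ext ((weightMul_conj hV hκ χ h r γ T).trans (funext fun w => ?_)))
  by_contra h'
  exact hne ⟨w, h'⟩

theorem finsum_weightMul (T : PCM (conesIn V) a χ h (r + 1)) :
    ∑ᶠ γ : Γ, (MonoidAlgebra.single γ 1 : GA Γ) •
      weightMul hV hκ χ h r ((MonoidAlgebra.single γ⁻¹ 1 : GA Γ) • T) = T := by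
  refine Subtype.ext (funext fun w => ?_)
  let evw : PCM (conesIn V) a χ h (r + 1) →+ ℚ :=
    { toFun := fun T => (show PF E (r + 1) from T.1) w
      map_zero' := rfl
      map_add' := fun _ _ => rfl }
  refine (evw.map_finsum (finite_weightMul hV hκ χ h r T)).trans ?_
  have e : ∀ γ, evw ((MonoidAlgebra.single γ 1 : GA Γ) •
      weightMul hV hκ χ h r ((MonoidAlgebra.single γ⁻¹ 1 : GA Γ) • T)) =
        weight (rel κ a fun k => a γ⁻¹ (w k)) * (show PF E (r + 1) from T.1) w :=
    fun γ => congrFun (weightMul_conj hV hκ χ h r γ T) w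
  rw [finsum_congr e]
  by_cases hw : (show PF E (r + 1) from T.1) w = 0
  · simp only [hw, mul_zero, finsum_zero]
  · obtain ⟨F, hF, hF'⟩ := ConeClass.exists_ev_ne_zero _ T.2
    obtain ⟨σ, hσ, hσw⟩ := hF' w hw
    have h1 := finsum_weight_rel hV hκ (hF σ hσ) hσw
    rw [← finsum_mul', h1, one_mul]
    by_contra hinf
    rw [finsum_of_infinite_support hinf] at h1
    exact zero_ne_one h1

/-- The chains of a properly acted upon cone form projective modules. -/
theorem projective_PCM (hV : ProperCone V a) (hκ : Covering V κ) (χ : Γ →* ℚˣ)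
    (h : (conesIn V).Inv a) (r : ℕ) : Module.Projective (GA Γ) (PCM (conesIn V) a χ h (r + 1)) := by
  refine projective_of_average (weightMul hV hκ χ h r) (fun T =>
    (finite_weightMul hV hκ χ h r T).subset fun γ hγ h0 => hγ ?_) (finsum_weightMul hV hκ χ h r)
  have := congrArg (fun x => (MonoidAlgebra.single γ⁻¹ 1 : GA Γ) • x) h0
  simp only [smul_smul, smul_zero, MonoidAlgebra.single_mul_single, inv_mul_cancel,
    mul_one] at this
  rwa [← MonoidAlgebra.one_def, one_smul] at this

end Projective

end PolyChain

namespace PolyChain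

section Groups

variable {p N : ℕ}

/-- The Gram matrix of `Qpq`. -/
def Jmat (p N : ℕ) : Matrix (Fin N) (Fin N) ℝ := Matrix.diagonal fun i => if (i : ℕ) < p then 1 else -1

theorem Jmat_mul_self : Jmat p N * Jmat p N = 1 := by
  rw [Jmat, Matrix.diagonal_mul_diagonal, ← Matrix.diagonal_one]
  congr 1
  funext i
  split_ifs <;> simp

theorem Jmat_transpose : (Jmat p N)ᵀ = Jmat p N := Matrix.diagonal_transpose _

theorem Qpq_eq_dotProduct (x : Fin N → ℝ) : Qpq p N x = x ⬝ᵥ (Jmat p N *ᵥ x) := by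
  simp only [Qpq, dotProduct, Jmat, Matrix.mulVec_diagonal]
  refine Finset.sum_congr rfl fun i _ => ?_
  split_ifs <;> ring

theorem eq_of_forall_dotProduct {A B : Matrix (Fin N) (Fin N) ℝ} (hA : Aᵀ = A) (hB : Bᵀ = B)
    (h : ∀ x, x ⬝ᵥ (A *ᵥ x) = x ⬝ᵥ (B *ᵥ x)) : A = B := by
  have hs : ∀ {A : Matrix (Fin N) (Fin N) ℝ}, Aᵀ = A → ∀ x y, x ⬝ᵥ (A *ᵥ y) = y ⬝ᵥ (A *ᵥ x) := by
    intro A hA x y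
    rw [Matrix.dotProduct_mulVec, ← Matrix.mulVec_transpose, hA, dotProduct_comm]
  have h2 : ∀ x y, x ⬝ᵥ (A *ᵥ y) = x ⬝ᵥ (B *ᵥ y) := by
    intro x y
    have := h (x + y)
    simp only [Matrix.mulVec_add, dotProduct_add, add_dotProduct] at this
    linarith [h x, h y, hs hA x y, hs hB x y]
  ext i j
  have := h2 (Pi.single i 1) (Pi.single j 1)
  simpa using this

theorem transpose_mul_Jmat_mul (g : ↥(Opq p N)) :
    (g.1.1)ᵀ * Jmat p N * g.1.1 = Jmat p N := by
  refine eq_of_forall_dotProduct ?_ Jmat_transpose fun x => ?_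
  · rw [Matrix.transpose_mul, Matrix.transpose_mul, Jmat_transpose, Matrix.transpose_transpose,
      Matrix.mul_assoc]
  · rw [← Qpq_eq_dotProduct, ← g.2 x, Qpq_eq_dotProduct, ← Matrix.mulVec_mulVec,
      ← Matrix.mulVec_mulVec, Matrix.dotProduct_mulVec x, Matrix.vecMul_transpose]

theorem coe_inv_eq (g : ↥(Opq p N)) :
    (g⁻¹).1.1 = Jmat p N * (g.1.1)ᵀ * Jmat p N := by
  have h : Jmat p N * (g.1.1)ᵀ * Jmat p N * g.1.1 = 1 := by
    rw [Matrix.mul_assoc, Matrix.mul_assoc, ← Matrix.mul_assoc (g.1.1)ᵀ, transpose_mul_Jmat_mul,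
      Jmat_mul_self]
  calc (g⁻¹).1.1 = Jmat p N * (g.1.1)ᵀ * Jmat p N * g.1.1 * (g⁻¹).1.1 := by rw [h, one_mul]
    _ = _ := by
      rw [Matrix.mul_assoc _ g.1.1]
      have : g.1.1 * (g⁻¹).1.1 = 1 := Units.mul_inv g.1
      rw [this, mul_one]

theorem abs_inv_entry (g : ↥(Opq p N)) (i j : Fin N) : |(g⁻¹).1.1 i j| = |g.1.1 j i| := by
  rw [coe_inv_eq, Jmat, Matrix.mul_diagonal, Matrix.diagonal_mul, Matrix.transpose_apply, abs_mul,
    abs_mul]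
  have : ∀ k : Fin N, |(if (k : ℕ) < p then (1 : ℝ) else -1)| = 1 := fun k => by
    split_ifs <;> simp
  rw [this, this, one_mul, mul_one]

theorem isCompact_bounded_entries (p N : ℕ) (R : ℝ) :
    IsCompact {g : ↥(Opq p N) | ∀ i j, |g.1.1 i j| ≤ R} := by
  let K : Set (Matrix (Fin N) (Fin N) ℝ) :=
    {M | Mᵀ * Jmat p N * M = Jmat p N ∧ ∀ i j, |M i j| ≤ R}
  have hK : IsCompact K := by
    have h1 : IsCompact {M : Matrix (Fin N) (Fin N) ℝ | ∀ i j, |M i j| ≤ R} := by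
      have : {M : Matrix (Fin N) (Fin N) ℝ | ∀ i j, |M i j| ≤ R} =
          Set.pi Set.univ fun i => Set.pi Set.univ fun j => Set.Icc (-R) R := by
        ext M
        simp only [Set.mem_ofPred_eq, abs_le]
        exact ⟨fun h i _ j _ => h i j, fun h i j => h i trivial j trivial⟩
      rw [this]
      exact isCompact_univ_pi fun i => isCompact_univ_pi fun j => isCompact_Icc
    refine h1.of_isClosed_subset ?_ fun M hM => hM.2
    refine IsClosed.inter ?_ h1.isClosed
    refine isClosed_eq ?_ continuous_const
    fun_prop
  have hinv : ∀ M : K, Jmat p N * (M.1)ᵀ * Jmat p N * M.1 = 1 := fun M => by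
    rw [Matrix.mul_assoc, Matrix.mul_assoc, ← Matrix.mul_assoc (M.1)ᵀ, M.2.1, Jmat_mul_self]
  let f : K → ↥(Opq p N) := fun M =>
    ⟨⟨M.1, Jmat p N * (M.1)ᵀ * Jmat p N, mul_eq_one_comm.1 (hinv M), hinv M⟩, fun x => by
      show Qpq p N (M.1 *ᵥ x) = _
      rw [Qpq_eq_dotProduct, Qpq_eq_dotProduct]
      conv_rhs => rw [← M.2.1]
      rw [← Matrix.mulVec_mulVec,
      ← Matrix.mulVec_mulVec, Matrix.dotProduct_mulVec x, Matrix.vecMul_transpose]⟩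
  have hf : Continuous f := by
    refine Continuous.subtype_mk ?_ _
    rw [Units.continuous_iff]
    refine ⟨continuous_subtype_val, ?_⟩
    show Continuous fun M : K => Jmat p N * (M.1)ᵀ * Jmat p N
    fun_prop
  have : CompactSpace K := isCompact_iff_compactSpace.1 hK
  convert isCompact_range hf using 1
  ext g
  constructor
  · intro hg
    exact ⟨⟨g.1.1, transpose_mul_Jmat_mul g, hg⟩, Subtype.ext (Units.ext rfl)⟩
  · rintro ⟨M, rfl⟩
    exact M.2.2

theorem finite_bounded_entries (Γ : Subgroup ↥(Opq p N)) [hdisc : DiscreteTopology ↥Γ] (R : ℝ) :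
    {γ : ↥Γ | ∀ i j, |γ.1.1.1 i j| ≤ R}.Finite := by
  have hc : IsClosed (Γ : Set ↥(Opq p N)) := Subgroup.isClosed_of_discrete
  have h1 := (isCompact_bounded_entries p N R).inter_right hc
  have h2 : IsDiscrete (Γ : Set ↥(Opq p N)) := ⟨hdisc⟩
  have h3 := h1.finite (h2.mono Set.inter_subset_right)
  refine (h3.preimage (f := Subtype.val) Subtype.val_injective.injOn).subset fun γ hγ => ⟨hγ, γ.2⟩

/-- The standard representation. -/
def repU (Γ : Subgroup ↥(Opq p N)) : Representation ℝ ↥Γ (Fin N → ℝ) where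
  toFun γ := γ.1.1.1.mulVecLin
  map_one' := Matrix.mulVecLin_one
  map_mul' γ δ := Matrix.mulVecLin_mul _ _

theorem repU_apply (Γ : Subgroup ↥(Opq p N)) (γ : ↥Γ) (x : Fin N → ℝ) :
    repU Γ γ x = γ.1.1.1 *ᵥ x := rfl

theorem Qpq_repU (Γ : Subgroup ↥(Opq p N)) (γ : ↥Γ) (x : Fin N → ℝ) :
    Qpq p N (repU Γ γ x) = Qpq p N x := γ.1.2 x

theorem mem_negCone_top {k : ℕ} (h : N ≤ p + k) {x : Fin N → ℝ} :
    x ∈ negCone p N k ↔ Qpq p N x < 0 :=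
  ⟨fun hx => hx.1, fun hx => ⟨hx, fun i hi => absurd i.2 (by omega)⟩⟩

/-- Radial projection to the quadric. -/
def toHpq (p N : ℕ) (x : {x : Fin N → ℝ // Qpq p N x < 0}) : Hpq p N :=
  ⟨(√(-Qpq p N x.1))⁻¹ • x.1, by
    rw [Qpq_smul, inv_pow, Real.sq_sqrt (by linarith [x.2])]
    have := x.2
    rw [inv_mul_eq_div, div_neg, div_self this.ne]⟩

theorem continuous_toHpq (p N : ℕ) : Continuous (toHpq p N) := by
  suffices hc : Continuous fun x : {x : Fin N → ℝ // Qpq p N x < 0} =>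
      (√(-Qpq p N x.1))⁻¹ • x.1 from hc.subtype_mk _
  have h1 : Continuous fun x : {x : Fin N → ℝ // Qpq p N x < 0} => √(-Qpq p N x.1) := ?_
  · exact (h1.inv₀ fun x => (Real.sqrt_pos.2 (by linarith [x.2])).ne').smul continuous_subtype_val
  · exact Real.continuous_sqrt.comp ((continuous_Qpq p N).comp continuous_subtype_val).neg

theorem properCone_repU (Γ : Subgroup ↥(Opq p N)) [ProperlyDiscontinuousSMul ↥Γ (Hpq p N)] {k : ℕ}
    (hk : N ≤ p + k) : ProperCone (negCone p N k) (repU Γ) where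
  isOpen := by
    have : negCone p N k = {x | Qpq p N x < 0} := Set.ext fun x => mem_negCone_top hk
    rw [this]
    exact isOpen_lt (continuous_Qpq p N) continuous_const
  smul_mem x hx t ht := by
    rw [mem_negCone_top hk] at hx ⊢
    rw [Qpq_smul]
    exact mul_neg_of_pos_of_neg (by positivity) hx
  zero_notMem h := by
    rw [mem_negCone_top hk, Qpq_zero] at h
    exact lt_irrefl _ h
  inv_mem γ x hx := by
    rw [mem_negCone_top hk] at hx ⊢
    rwa [Qpq_repU]
  proper A hA B hB hAc hBc := by
    have hcpt : ∀ A ⊆ negCone p N k, IsCompact A → IsCompact (toHpq p N '' (Subtype.val ⁻¹' A)) :=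
      fun A hA hAc => by
        refine IsCompact.image ?_ (continuous_toHpq p N)
        rw [Subtype.isCompact_iff, Set.image_preimage_eq_of_subset]
        · exact hAc
        · rintro x hx
          exact ⟨⟨x, (hA hx).1⟩, rfl⟩
    refine (ProperlyDiscontinuousSMul.finite_disjoint_inter_image (hcpt A hA hAc)
      (hcpt B hB hBc)).subset ?_
    rintro γ ⟨x, hx, t, ht, hB'⟩
    have hx0 : Qpq p N x < 0 := (hA hx).1
    show ((fun y => γ • y) '' (toHpq p N '' (Subtype.val ⁻¹' A)) ∩
      (toHpq p N '' (Subtype.val ⁻¹' B))).Nonempty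
    refine ⟨γ • toHpq p N ⟨x, hx0⟩,
      ⟨toHpq p N ⟨x, hx0⟩, ⟨⟨x, hx0⟩, hx, rfl⟩, rfl⟩, ⟨(⟨t • repU Γ γ x, (hB hB').1⟩ : {x // Qpq p N x < 0}), hB', ?_⟩⟩
    refine Subtype.ext ?_
    show (√(-Qpq p N (t • repU Γ γ x)))⁻¹ • (t • repU Γ γ x) =
      γ.1.1.1 *ᵥ ((√(-Qpq p N x))⁻¹ • x)
    rw [Qpq_smul, Qpq_repU, Matrix.mulVec_smul, repU_apply, smul_smul, ← mul_neg,
      Real.sqrt_mul (sq_nonneg t), Real.sqrt_sq ht.le, _root_.mul_inv_rev, inv_mul_cancel_right₀ ht.ne']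

/-- The value of a quadratic form. -/
def qform (S : Fin N → Fin N → ℝ) (x : Fin N → ℝ) : ℝ := x ⬝ᵥ (Matrix.of S *ᵥ x)

theorem qform_smul_left (t : ℝ) (S : Fin N → Fin N → ℝ) (x : Fin N → ℝ) :
    qform (t • S) x = t * qform S x := by
  show x ⬝ᵥ ((t • Matrix.of S) *ᵥ x) = _
  rw [Matrix.smul_mulVec, dotProduct_smul, smul_eq_mul, qform]

theorem qform_add_left (S S' : Fin N → Fin N → ℝ) (x : Fin N → ℝ) :
    qform (S + S') x = qform S x + qform S' x := by
  show x ⬝ᵥ ((Matrix.of S + Matrix.of S') *ᵥ x) = _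
  rw [Matrix.add_mulVec, dotProduct_add, qform, qform]

theorem qform_zero_left (x : Fin N → ℝ) : qform (0 : Fin N → Fin N → ℝ) x = 0 := by
  have := qform_smul_left 0 (0 : Fin N → Fin N → ℝ) x
  rwa [zero_smul, zero_mul] at this

theorem qform_smul (S : Fin N → Fin N → ℝ) (t : ℝ) (x : Fin N → ℝ) :
    qform S (t • x) = t ^ 2 * qform S x := by
  simp only [qform, Matrix.mulVec_smul, dotProduct_smul, smul_dotProduct, smul_eq_mul]
  ring

theorem continuous_qform : Continuous fun z : (Fin N → Fin N → ℝ) × (Fin N → ℝ) =>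
    qform z.1 z.2 := by
  unfold qform
  simp only [dotProduct, Matrix.mulVec, Matrix.of_apply]
  fun_prop

/-- Linear change of variables in quadratic forms. -/
def repS (Γ : Subgroup ↥(Opq p N)) : Representation ℝ ↥Γ (Fin N → Fin N → ℝ) where
  toFun γ :=
    { toFun := fun S => ((γ⁻¹).1.1.1)ᵀ * Matrix.of S * (γ⁻¹).1.1.1
      map_add' := fun S S' => by
        show ((γ⁻¹).1.1.1)ᵀ * (Matrix.of S + Matrix.of S') * (γ⁻¹).1.1.1 = _
        rw [mul_add, add_mul]
        rfl
      map_smul' := fun t S => by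
        show ((γ⁻¹).1.1.1)ᵀ * (t • Matrix.of S) * (γ⁻¹).1.1.1 = _
        rw [Matrix.mul_smul, Matrix.smul_mul]
        rfl }
  map_one' := by
    refine LinearMap.ext fun S => ?_
    show (((1 : ↥Γ)⁻¹).1.1.1)ᵀ * Matrix.of S * ((1 : ↥Γ)⁻¹).1.1.1 = S
    rw [inv_one]
    show (1 : Matrix (Fin N) (Fin N) ℝ)ᵀ * Matrix.of S * (1 : Matrix (Fin N) (Fin N) ℝ) = S
    rw [Matrix.transpose_one, one_mul, mul_one]
    rfl
  map_mul' γ δ := by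
    refine LinearMap.ext fun S => ?_
    show (((γ * δ)⁻¹).1.1.1)ᵀ * Matrix.of S * ((γ * δ)⁻¹).1.1.1 =
      ((γ⁻¹).1.1.1)ᵀ * (((δ⁻¹).1.1.1)ᵀ * Matrix.of S * (δ⁻¹).1.1.1) * (γ⁻¹).1.1.1
    rw [_root_.mul_inv_rev]
    have : (δ⁻¹ * γ⁻¹).1.1.1 = (δ⁻¹).1.1.1 * (γ⁻¹).1.1.1 := rfl
    rw [this, Matrix.transpose_mul]
    simp only [Matrix.mul_assoc]

theorem qform_repS (Γ : Subgroup ↥(Opq p N)) (γ : ↥Γ) (S : Fin N → Fin N → ℝ) (x : Fin N → ℝ) :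
    qform (repS Γ γ S) x = qform S ((γ⁻¹).1.1.1 *ᵥ x) := by
  show x ⬝ᵥ ((((γ⁻¹).1.1.1)ᵀ * Matrix.of S * (γ⁻¹).1.1.1) *ᵥ x) = _
  rw [← Matrix.mulVec_mulVec, ← Matrix.mulVec_mulVec, Matrix.dotProduct_mulVec x,
    Matrix.vecMul_transpose, qform]

/-- Positive definite forms (not necessarily symmetric). -/
def posForms (N : ℕ) : Set (Fin N → Fin N → ℝ) := {S | ∀ x, x ≠ 0 → 0 < qform S x}

theorem mem_posForms_iff {S : Fin N → Fin N → ℝ} :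
    S ∈ posForms N ↔ ∀ x ∈ Metric.sphere (0 : Fin N → ℝ) 1, 0 < qform S x := by
  constructor
  · intro h x hx
    exact h x (ne_zero_of_mem_sphere one_ne_zero ⟨x, hx⟩)
  · intro h x hx
    have hn : 0 < ‖x‖ := norm_pos_iff.2 hx
    have := h (‖x‖⁻¹ • x) (by simp [norm_smul, hn.ne'])
    rw [qform_smul] at this
    exact pos_of_mul_pos_right this (by positivity)

theorem eventually_posForms {X : Type*} [TopologicalSpace X] {x₀ : X} {f : X → Fin N → Fin N → ℝ}
    (hf : Continuous f) (h : f x₀ ∈ posForms N) : ∀ᶠ x in nhds x₀, f x ∈ posForms N := by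
  simp only [mem_posForms_iff] at h ⊢
  refine (isCompact_sphere _ _).eventually_forall_of_forall_eventually fun y hy => ?_
  refine (Continuous.tendsto (f := fun z : X × (Fin N → ℝ) => qform (f z.1) z.2)
    ?_ (x₀, y)).eventually (lt_mem_nhds (h y hy))
  exact continuous_qform.comp ((hf.comp continuous_fst).prodMk continuous_snd)

theorem posForms_bounds {A : Set (Fin N → Fin N → ℝ)} (hA : A ⊆ posForms N) (hAc : IsCompact A) :
    ∃ C : ℝ, 0 < C ∧ ∀ S ∈ A, ∀ x, ‖x‖ ^ 2 ≤ C * qform S x ∧ qform S x ≤ C * ‖x‖ ^ 2 := by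
  have hK := hAc.prod (isCompact_sphere (0 : Fin N → ℝ) 1)
  have hpos : ∀ z ∈ A ×ˢ Metric.sphere (0 : Fin N → ℝ) 1, 0 < qform z.1 z.2 := fun z hz =>
    mem_posForms_iff.1 (hA hz.1) _ hz.2
  obtain ⟨C, hC⟩ := hK.exists_bound_of_continuousOn (f := fun z => qform z.1 z.2)
    continuous_qform.continuousOn
  obtain ⟨C', hC'⟩ := hK.exists_bound_of_continuousOn (f := fun z => (qform z.1 z.2)⁻¹)
    (continuous_qform.continuousOn.inv₀ fun z hz => (hpos z hz).ne')
  refine ⟨|C| + |C'| + 1, by positivity, fun S hS x => ?_⟩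
  by_cases hx : x = 0
  · subst hx
    simp [qform]
  have hn : 0 < ‖x‖ := norm_pos_iff.2 hx
  have hu : ‖x‖⁻¹ • x ∈ Metric.sphere (0 : Fin N → ℝ) 1 := by simp [norm_smul, hn.ne']
  have h0 := hpos (S, ‖x‖⁻¹ • x) ⟨hS, hu⟩
  have h1 := hC (S, ‖x‖⁻¹ • x) ⟨hS, hu⟩
  have h2 := hC' (S, ‖x‖⁻¹ • x) ⟨hS, hu⟩
  have h3 : qform S x = ‖x‖ ^ 2 * qform S (‖x‖⁻¹ • x) := by
    rw [qform_smul]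
    field_simp
  simp only [Real.norm_eq_abs] at h0 h1 h2
  set s := qform S (‖x‖⁻¹ • x)
  rw [h3]
  rw [abs_of_pos h0] at h1
  rw [abs_of_pos (by positivity), inv_le_iff_one_le_mul₀ h0] at h2
  have e1 := le_abs_self C
  have e2 := le_abs_self C'
  have e3 := abs_nonneg C
  have e4 := abs_nonneg C'
  constructor
  · have : 1 ≤ (|C| + |C'| + 1) * s := by nlinarith
    nlinarith [sq_nonneg ‖x‖]
  · rw [mul_comm]
    gcongr
    linarith

theorem properCone_repS (Γ : Subgroup ↥(Opq p N)) [DiscreteTopology ↥Γ] (hN : 0 < N) :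
    ProperCone (posForms N) (repS Γ) where
  isOpen := by
    rw [isOpen_iff_mem_nhds]
    intro S hS
    exact eventually_posForms continuous_id hS
  smul_mem S hS t ht x hx := by
    rw [qform_smul_left]
    exact mul_pos ht (hS x hx)
  zero_notMem h := by
    have := h (Pi.single ⟨0, hN⟩ 1) (by simp)
    rw [qform_zero_left] at this
    exact lt_irrefl _ this
  inv_mem γ S hS x hx := by
    rw [qform_repS]
    refine hS _ fun h0 => hx ?_
    have : γ.1.1.1 *ᵥ ((γ⁻¹).1.1.1 *ᵥ x) = x := by
      rw [Matrix.mulVec_mulVec]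
      have : γ.1.1.1 * (γ⁻¹).1.1.1 = 1 := Units.mul_inv γ.1.1
      rw [this, Matrix.one_mulVec]
    rw [← this, h0, Matrix.mulVec_zero]
  proper A hA B hB hAc hBc := by
    obtain ⟨C, hC0, hC⟩ := posForms_bounds hA hAc
    obtain ⟨C', hC0', hC'⟩ := posForms_bounds hB hBc
    refine (finite_bounded_entries Γ (1 + C * C')).subset ?_
    rintro γ ⟨S, hS, t, ht, hB'⟩ i j
    have key : ∀ x, ‖x‖ ^ 2 ≤ C' * (t * qform S ((γ⁻¹).1.1.1 *ᵥ x)) ∧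
        t * qform S ((γ⁻¹).1.1.1 *ᵥ x) ≤ C' * ‖x‖ ^ 2 := fun x => by
      have := hC' _ hB' x
      rwa [qform_smul_left, qform_repS] at this
    have hcol : ∀ (M : Matrix (Fin N) (Fin N) ℝ) (a b : Fin N),
        |M a b| ≤ ‖M *ᵥ Pi.single b (1 : ℝ)‖ := fun M a b => by
      have := norm_le_pi_norm (M *ᵥ Pi.single b (1 : ℝ)) a
      simpa using this
    have hone : ∀ b : Fin N, ‖(Pi.single b (1 : ℝ) : Fin N → ℝ)‖ = 1 := fun b => by
      rw [Pi.norm_single, norm_one]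
    have h1 : t * |(γ⁻¹).1.1.1 j i| ^ 2 ≤ C * C' := by
      have k1 := (key (Pi.single i 1)).2
      have k2 := (hC S hS ((γ⁻¹).1.1.1 *ᵥ Pi.single i 1)).1
      have k3 := hcol (γ⁻¹).1.1.1 j i
      rw [hone, one_pow, mul_one] at k1
      calc t * |(γ⁻¹).1.1.1 j i| ^ 2 ≤ t * ‖(γ⁻¹).1.1.1 *ᵥ Pi.single i (1 : ℝ)‖ ^ 2 := by gcongr
        _ ≤ t * (C * qform S ((γ⁻¹).1.1.1 *ᵥ Pi.single i 1)) := by gcongr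
        _ = C * (t * qform S ((γ⁻¹).1.1.1 *ᵥ Pi.single i 1)) := by ring
        _ ≤ C * C' := by gcongr
    have h2 : |γ.1.1.1 i j| ^ 2 ≤ t * (C * C') := by
      have k1 := (key (γ.1.1.1 *ᵥ Pi.single j 1)).1
      have k2 := (hC S hS (Pi.single j 1)).2
      have k3 := hcol γ.1.1.1 i j
      have : (γ⁻¹).1.1.1 *ᵥ (γ.1.1.1 *ᵥ Pi.single j 1) = Pi.single j 1 := by
        rw [Matrix.mulVec_mulVec]
        have : (γ⁻¹).1.1.1 * γ.1.1.1 = 1 := Units.inv_mul γ.1.1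
        rw [this, Matrix.one_mulVec]
      rw [this] at k1
      rw [hone, one_pow, mul_one] at k2
      calc |γ.1.1.1 i j| ^ 2 ≤ ‖γ.1.1.1 *ᵥ Pi.single j (1 : ℝ)‖ ^ 2 := by gcongr
        _ ≤ C' * (t * qform S (Pi.single j 1)) := k1
        _ ≤ C' * (t * C) := by gcongr
        _ = _ := by ring
    have h3 : |(γ⁻¹).1.1.1 j i| = |γ.1.1.1 i j| := abs_inv_entry γ.1 j i
    rw [h3] at h1
    set m := |γ.1.1.1 i j|
    have hm : 0 ≤ m := abs_nonneg _
    have h4 : (m ^ 2) ^ 2 ≤ (C * C') ^ 2 := by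
      have : t * m ^ 2 * m ^ 2 ≤ t * ((C * C') * (C * C')) := by
        calc t * m ^ 2 * m ^ 2 ≤ (C * C') * (t * (C * C')) := by gcongr
          _ = _ := by ring
      nlinarith
    have h5 : m ^ 2 ≤ C * C' := by
      exact le_of_sq_le_sq h4 (by positivity)
    nlinarith [mul_pos hC0 hC0']

theorem qform_one (x : Fin N → ℝ) : qform (1 : Matrix (Fin N) (Fin N) ℝ) x = ∑ i, x i ^ 2 := by
  show x ⬝ᵥ ((1 : Matrix (Fin N) (Fin N) ℝ) *ᵥ x) = _
  rw [Matrix.one_mulVec, dotProduct]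
  exact Finset.sum_congr rfl fun i _ => (sq _).symm

theorem one_mem_posForms : (1 : Matrix (Fin N) (Fin N) ℝ) ∈ posForms N := fun x hx => by
  rw [qform_one]
  obtain ⟨i, hi⟩ := Function.ne_iff.1 hx
  exact Finset.sum_pos' (fun i _ => sq_nonneg _) ⟨i, Finset.mem_univ _, by
    have : x i ≠ 0 := hi
    positivity⟩

theorem exactIn_posForms (hN : 0 < N) (r : ℕ) : ExactIn (conesIn (posForms N)).PC r := by
  have h00 : (0 : Fin N → Fin N → ℝ) ∉ posForms N := fun h => by
    have := h (Pi.single ⟨0, hN⟩ 1) (by simp)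
    rw [qform_zero_left] at this
    exact lt_irrefl _ this
  have hadd : ∀ S ∈ posForms N, ∀ S', (∀ x, 0 ≤ qform S' x) → S + S' ∈ posForms N :=
    fun S hS S' hS' x hx => by
      rw [qform_add_left]
      linarith [hS x hx, hS' x]
  have hnn : ∀ S ∈ posForms N, ∀ x, 0 ≤ qform S x := fun S hS x => by
    by_cases hx : x = 0
    · subst hx
      simp [qform]
    · exact (hS x hx).le
  let ℓ : (Fin N → Fin N → ℝ) →ₗ[ℝ] ℝ := ∑ i : Fin N,
    (LinearMap.proj (R := ℝ) (φ := fun _ : Fin N => ℝ) i).comp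
      (LinearMap.proj (R := ℝ) (φ := fun _ : Fin N => Fin N → ℝ) i)
  have hdiag : ∀ (S : Fin N → Fin N → ℝ) i, qform S (Pi.single i 1) = S i i := fun S i => by
    simp [qform]
  have hℓ : ∀ S ∈ posForms N, 0 < ℓ S := fun S hS => by
    have : Nonempty (Fin N) := ⟨⟨0, hN⟩⟩
    have : ℓ S = ∑ i, S i i := by simp [ℓ]
    rw [this]
    refine Finset.sum_pos (fun i _ => ?_) Finset.univ_nonempty
    rw [← hdiag S i]
    exact hS _ (by simp)
  let e : Fin N → Fin N → ℝ := (1 : Matrix (Fin N) (Fin N) ℝ)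
  have hev : ∀ᶠ v in nhds e, v ∈ posForms N :=
    eventually_posForms (f := fun v => v) continuous_id one_mem_posForms
  refine exactIn_of_visible (L := ⊤) (e := e) (fun _ _ => trivial)
    trivial ?_ (ℓ := ℓ) (fun S hS => (hℓ S hS).le) (hev.mono fun v hv => hℓ v hv) r
  intro r σ hσ
  filter_upwards [hev] with v hv _ t ht ht0
  by_cases h0 : t 0 = 0
  · rw [h0, zero_smul, zero_add]
    refine hσ.2 _ (fun i => ht _) fun h => ht0 ?_
    funext i
    refine Fin.cases h0 (fun i => congrFun h i) i
  · refine hadd _ (fun x hx => ?_) _ fun x => ?_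
    · rw [qform_smul_left]
      exact mul_pos (lt_of_le_of_ne (ht 0) (Ne.symm h0)) (hv x hx)
    · by_cases h : (fun i : Fin r => t i.succ) = 0
      · have h' : ∀ i : Fin r, t i.succ = 0 := congrFun h
        simp only [h', zero_smul, Finset.sum_const_zero]
        rw [qform_zero_left]
      · exact hnn _ (hσ.2 _ (fun i => ht _) h) x

theorem PC_eq_bot_of_finrank_lt {E : Type} [AddCommGroup E] [Module ℝ E] [FiniteDimensional ℝ E]
    (S : ConeClass E) {r : ℕ} (hr : Module.finrank ℝ E < r) : S.PC r = ⊥ := by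
  refine Submodule.span_eq_bot.2 ?_
  rintro _ ⟨σ, hσ, rfl⟩
  have := (S.indep hσ).fintype_card_le_finrank
  rw [Fintype.card_fin] at this
  omega

theorem projective_PCM_of_properCone {Γ E : Type} [Group Γ] [NormedAddCommGroup E]
    [NormedSpace ℝ E] [FiniteDimensional ℝ E] {V : Set E} {a : Representation ℝ Γ E}
    (hV : ProperCone V a) (hne : V.Nonempty) (χ : Γ →* ℚˣ) (h : (conesIn V).Inv a) (r : ℕ) :
    Module.Projective (GA Γ) (PCM (conesIn V) a χ h (r + 1)) := by
  obtain ⟨κ, h1, h2⟩ := exists_bases_covering hV.isOpen hV.smul_mem hV.zero_notMem hne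
  exact projective_PCM hV ⟨h1, h2⟩ χ h r

theorem negCone_nonempty {q : ℕ} : (negCone p (p + q + 1) (q + 1)).Nonempty := by
  refine ⟨Pi.single (Fin.last _) 1, ?_, fun i hi => absurd i.2 (by omega)⟩
  rw [Qpq, Finset.sum_eq_single (Fin.last _)]
  · rw [if_neg (by simp)]
    simp
  · intro i _ hi
    simp [hi]
  · simp

theorem pdLT_QChar (p q : ℕ) (Γ : Subgroup ↥(Opq p (p + q + 1))) [DiscreteTopology ↥Γ]
    [ProperlyDiscontinuousSMul ↥Γ (Hpq p (p + q + 1))] (χ : ↥Γ →* ℚˣ) :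
    PdLT (GA ↥Γ) (QChar χ) (p + 1) := by
  have hU := properCone_repU Γ (k := q + 1) (by omega)
  have hS := properCone_repS Γ (by omega)
  have hbig : ∀ χ : ↥Γ →* ℚˣ, PdLT (GA ↥Γ) (QChar χ)
      (Module.finrank ℝ (Fin (p + q + 1) → Fin (p + q + 1) → ℝ)) :=
    pdLT_QChar_of_exact (h := conesIn_inv _ hS.inv_mem) (exactIn_posForms (by omega))
      (fun χ r => projective_PCM_of_properCone hS ⟨_, one_mem_posForms⟩ χ _ r)
      (fun r hr => PC_eq_bot_of_finrank_lt _ hr)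
  have hstep : ∀ l, p ≤ l → (∀ χ : ↥Γ →* ℚˣ, PdLT (GA ↥Γ) (QChar χ) (l + 1 + (q + 1))) →
      ∀ χ : ↥Γ →* ℚˣ, PdLT (GA ↥Γ) (QChar χ) (l + 1) := fun l hl H =>
    pdLT_QChar_of_sphereLike (h := conesIn_inv _ hU.inv_mem)
      (sphereLike_negCone p (p + q + 1) (q + 1) (by omega))
      (fun χ r => projective_PCM_of_properCone hU negCone_nonempty χ _ r)
      (fun r hr => PC_eq_bot_of_finrank_lt _ (by rw [Module.finrank_fin_fun]; omega)) hl H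
  generalize Module.finrank ℝ (Fin (p + q + 1) → Fin (p + q + 1) → ℝ) = d at hbig
  have hall : ∀ j, ∀ χ : ↥Γ →* ℚˣ, PdLT (GA ↥Γ) (QChar χ) (p + 1 + (d - j)) := by
    intro j
    induction j with
    | zero => exact fun χ => (hbig χ).mono (by omega)
    | succ j ih =>
      intro χ
      have := hstep (p + (d - (j + 1))) (by omega) (fun χ => (ih χ).mono (by omega)) χ
      exact this.mono (by omega)
  have := hall d χ
  rwa [Nat.sub_self] at this

end Groups

end PolyChain

namespace PolyChain

section Good

variable {E : Type} [AddCommGroup E] [Module ℝ E]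

theorem finite_quadratic_roots {a b c : ℝ} (h : a ≠ 0 ∨ c ≠ 0) :
    {s : ℝ | a + b * s + c * s ^ 2 = 0}.Finite := by
  let P : Polynomial ℝ := Polynomial.C a + Polynomial.C b * Polynomial.X +
    Polynomial.C c * Polynomial.X ^ 2
  have hP : P ≠ 0 := by
    intro h0
    rcases h with h | h
    · have := congrArg (fun p => Polynomial.coeff p 0) h0
      simp [P] at this
      exact h this
    · have := congrArg (fun p => Polynomial.coeff p 2) h0
      simp [P, Polynomial.coeff_X] at this
      exact h this
  refine (P.finite_setOfPred_isRoot hP).subset fun s hs => ?_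
  simpa [P, Polynomial.IsRoot] using hs

theorem exists_forall_quadratic_ne_zero (s : Finset (LinearMap.BilinForm ℝ E))
    (hs : ∀ C ∈ s, ∃ u, C u u ≠ 0) : ∃ v, ∀ C ∈ s, C v v ≠ 0 := by
  classical
  induction s using Finset.induction_on with
  | empty => exact ⟨0, by simp⟩
  | insert C s _ ih =>
    obtain ⟨v, hv⟩ := ih fun C' h => hs C' (Finset.mem_insert_of_mem h)
    obtain ⟨u, hu⟩ := hs C (Finset.mem_insert_self _ _)
    have hex : ∀ C' : LinearMap.BilinForm ℝ E, ∀ x : ℝ, C' (v + x • u) (v + x • u) =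
        C' v v + (C' v u + C' u v) * x + C' u u * x ^ 2 := fun C' x => by
      simp only [map_add, map_smul, LinearMap.add_apply, LinearMap.smul_apply, smul_eq_mul]
      ring
    have hfin : (⋃ C' ∈ insert C s, {x : ℝ | C' (v + x • u) (v + x • u) = 0}).Finite := by
      refine Set.Finite.biUnion (Finset.finite_toSet _) fun C' h => ?_
      simp only [hex]
      refine finite_quadratic_roots ?_
      rcases Finset.mem_insert.1 h with rfl | h
      · exact Or.inr hu
      · exact Or.inl (hv C' h)
    obtain ⟨x, hx⟩ := hfin.exists_notMem
    refine ⟨v + x • u, fun C' h h0 => hx ?_⟩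
    exact Set.mem_biUnion h h0

/-- Simplicial cones on which the quadratic form of `B` has no critical point along any face. -/
def goodCones (B : LinearMap.BilinForm ℝ E) : ConeClass E where
  carrier r := {σ | LinearIndependent ℝ σ ∧
    ∀ t : Fin r → ℝ, (∀ i, 0 ≤ t i) → t ≠ 0 → ∃ i, t i ≠ 0 ∧ B (∑ j, t j • σ j) (σ i) ≠ 0}
  indep h := h.1
  facet_mem := by
    intro r σ h i
    refine ⟨facet_indep h.1 i, fun t ht ht0 => ?_⟩
    rw [facet_comb]
    have h1 : ∀ k, 0 ≤ (i.insertNth 0 t : Fin (r + 1) → ℝ) k := fun k => by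
      induction k using Fin.succAboveCases i with
      | x => simp
      | p k => simpa using ht k
    have h2 : (i.insertNth 0 t : Fin (r + 1) → ℝ) ≠ 0 := fun e => ht0 (by
      funext k
      have := congrFun e (i.succAbove k)
      simpa using this)
    obtain ⟨k, hk, hk'⟩ := h.2 _ h1 h2
    induction k using Fin.succAboveCases i with
    | x => simp at hk
    | p k => exact ⟨k, by simpa using hk, hk'⟩
  nil_mem σ := ⟨linearIndependent_empty_type, fun t _ h => absurd (Subsingleton.elim t 0) h⟩

theorem mem_goodCones_of_neg {B : LinearMap.BilinForm ℝ E} {V : Set E} (hV : ∀ x ∈ V, B x x < 0)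
    {r : ℕ} {σ : Fin r → E} (hσ : σ ∈ (conesIn V).carrier r) : σ ∈ (goodCones B).carrier r := by
  refine ⟨hσ.1, fun t ht ht0 => ?_⟩
  by_contra! hc
  have h1 := hV _ (hσ.2 t ht ht0)
  have h2 : B (∑ j, t j • σ j) (∑ j, t j • σ j) = 0 := by
    conv_lhs => rw [map_sum]
    refine Finset.sum_eq_zero fun i _ => ?_
    rw [map_smul, smul_eq_mul]
    by_cases hi : t i = 0
    · rw [hi, zero_mul]
    · rw [hc i hi, mul_zero]
  linarith

theorem goodCones_inv {Γ : Type} [Group Γ] {B : LinearMap.BilinForm ℝ E}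
    {a : Representation ℝ Γ E} (h : ∀ γ x y, B (a γ x) (a γ y) = B x y) : (goodCones B).Inv a := by
  intro γ r σ hσ
  refine ⟨rep_indep a γ hσ.1, fun t ht ht0 => ?_⟩
  obtain ⟨i, hi, hi'⟩ := hσ.2 t ht ht0
  refine ⟨i, hi, ?_⟩
  have : ∑ j, t j • a γ (σ j) = a γ (∑ j, t j • σ j) := by
    rw [map_sum]
    simp only [map_smul]
  show B (∑ j, t j • a γ (σ j)) (a γ (σ i)) ≠ 0
  rwa [this, h]

variable [FiniteDimensional ℝ E] {B : LinearMap.BilinForm ℝ E}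

theorem exists_quadratic_vanishing (hs : ∀ x y, B x y = B y x) (hn : ∀ x, (∀ y, B x y = 0) → x = 0)
    {W : Submodule ℝ E} (hW : W ≠ ⊤) : ∃ C : LinearMap.BilinForm ℝ E, (∃ u, C u u ≠ 0) ∧
      ∀ v w, w ∈ W → B (v + w) v = 0 → (∀ w' ∈ W, B (v + w) w' = 0) → C v v = 0 := by
  have hr : B.IsRefl := fun x y h => by rw [hs, h]
  have hmem : ∀ x, x ∈ B.orthogonal W ↔ ∀ w ∈ W, B w x = 0 := fun x => Iff.rfl
  by_cases hd : Disjoint W (B.orthogonal W)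
  · have hc := (LinearMap.BilinForm.isCompl_orthogonal_iff_disjoint hr).2 hd
    let P : E →ₗ[ℝ] E := (B.orthogonal W).subtype ∘ₗ
      Submodule.projectionOnto (B.orthogonal W) W hc.symm
    have hPm : ∀ x, P x ∈ B.orthogonal W := fun x => Subtype.property _
    have hP1 : ∀ x ∈ B.orthogonal W, P x = x := fun x hx => by
      show ((Submodule.projectionOnto (B.orthogonal W) W hc.symm x : B.orthogonal W) : E) = x
      exact congrArg Subtype.val
        (Submodule.projectionOnto_apply_left hc.symm ⟨x, hx⟩)
    have hP0 : ∀ x ∈ W, P x = 0 := fun x hx => by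
      show ((Submodule.projectionOnto (B.orthogonal W) W hc.symm x : B.orthogonal W) : E) = 0
      exact congrArg Subtype.val
        (Submodule.projectionOnto_apply_right hc.symm ⟨x, hx⟩)
    have hPW : ∀ x, x - P x ∈ W := fun x => by
      obtain ⟨w, hw, y, hy, rfl⟩ : ∃ w ∈ W, ∃ y ∈ B.orthogonal W, w + y = x := by
        have : x ∈ W ⊔ B.orthogonal W := by rw [hc.sup_eq_top]; trivial
        exact Submodule.mem_sup.1 this
      rw [map_add, hP0 w hw, hP1 y hy, zero_add, add_sub_cancel_right]
      exact hw
    refine ⟨B.comp P P, ?_, fun v w hw h1 h2 => ?_⟩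
    · by_contra! hall
      obtain ⟨v₀, hv₀⟩ : ∃ v₀, v₀ ∉ W := by
        by_contra! h
        exact hW (eq_top_iff.2 fun x _ => h x)
      have hx0 : P v₀ ≠ 0 := fun h => hv₀ (by simpa [h] using hPW v₀)
      refine hx0 (hn _ fun y => ?_)
      have e1 : B (P v₀) (P y) = 0 := by
        have h0 := hall (v₀ + y)
        have h1 := hall v₀
        have h2 := hall y
        simp only [LinearMap.BilinForm.comp_apply, map_add, LinearMap.add_apply] at h0 h1 h2
        linarith [hs (P v₀) (P y)]
      have e2 : B (P v₀) (y - P y) = 0 := by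
        rw [hs]
        exact (hmem _).1 (hPm v₀) _ (hPW y)
      rw [map_sub] at e2
      linarith
    · have hx : v + w ∈ B.orthogonal W := (hmem _).2 fun w' hw' => by rw [hs]; exact h2 w' hw'
      have hPv : P v = v + w := by
        rw [← hP1 _ hx, map_add, hP0 w hw, add_zero]
      rw [LinearMap.BilinForm.comp_apply, hPv, map_add, h1, h2 w hw, add_zero]
  · rw [Submodule.disjoint_def] at hd
    push Not at hd
    obtain ⟨z, hz, hz', hz0⟩ := hd
    refine ⟨LinearMap.BilinForm.linMulLin (B z) (B z), ?_, fun v w hw h1 h2 => ?_⟩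
    · by_contra! h
      exact hz0 (hn z fun y => by simpa using h y)
    · have : B z v = 0 := by
        have e1 := h2 z hz
        rw [map_add, LinearMap.add_apply] at e1
        have e2 := (hmem z).1 hz' w hw
        rw [hs]
        linarith
      simp [this]

theorem exists_quadratic_vanishing_on {W : Submodule ℝ E} (hW : W ≠ ⊤) :
    ∃ C : LinearMap.BilinForm ℝ E, (∃ u, C u u ≠ 0) ∧ ∀ v ∈ W, C v v = 0 := by
  obtain ⟨f, hf, hf'⟩ := Submodule.exists_le_ker_of_lt_top W (lt_top_iff_ne_top.2 hW)
  refine ⟨LinearMap.BilinForm.linMulLin f f, ?_, fun v hv => ?_⟩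
  · by_contra! h
    exact hf (LinearMap.ext fun x => by simpa using h x)
  · have : f v = 0 := hf' hv
    simp [this]

theorem exactIn_goodCones (hs : ∀ x y, B x y = B y x) (hn : ∀ x, (∀ y, B x y = 0) → x = 0)
    {r : ℕ} (hr : r < Module.finrank ℝ E) : ExactIn (goodCones B).PC r := by
  classical
  intro T hT hc
  refine (goodCones B).exists_bd_of_coning (fun F hF => ?_) hT hc
  have hne : ∀ (σ : Fin r → E) (I : Finset (Fin r)), Submodule.span ℝ (σ '' I) ≠ ⊤ := by
    intro σ I h
    have h1 := finrank_span_finset_le_card (R := ℝ) (I.image σ)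
    rw [Finset.coe_image] at h1
    have h2 : (I.image σ).card ≤ r := Finset.card_image_le.trans (by
      simpa using Finset.card_le_univ I)
    rw [Set.finrank, h, finrank_top] at h1
    omega
  choose C hC1 hC2 using fun (σ : Fin r → E) (I : Finset (Fin r)) =>
    exists_quadratic_vanishing hs hn (hne σ I)
  choose C' hC1' hC2' using fun (σ : Fin r → E) =>
    exists_quadratic_vanishing_on (hne σ Finset.univ)
  obtain ⟨v, hv⟩ := exists_forall_quadratic_ne_zero
    ((F ×ˢ (Finset.univ : Finset (Finset (Fin r)))).image (fun z => C z.1 z.2) ∪ F.image C') (by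
      intro D hD
      rcases Finset.mem_union.1 hD with h | h
      · obtain ⟨z, -, rfl⟩ := Finset.mem_image.1 h
        exact hC1 _ _
      · obtain ⟨z, -, rfl⟩ := Finset.mem_image.1 h
        exact hC1' _)
  refine ⟨v, fun σ hσ => ?_⟩
  have hv' : v ∉ Submodule.span ℝ (Set.range σ) := fun h => by
    refine hv (C' σ) (Finset.mem_union_right _ (Finset.mem_image_of_mem _ hσ)) (hC2' σ v ?_)
    rwa [Finset.coe_univ, Set.image_univ]
  refine ⟨hv', linearIndependent_finCons.2 ⟨(hF σ hσ).1, hv'⟩, fun t ht ht0 => ?_⟩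
  rw [Fin.sum_univ_succ]
  simp only [Fin.cons_zero, Fin.cons_succ]
  by_cases h0 : t 0 = 0
  · obtain ⟨i, hi, hi'⟩ := (hF σ hσ).2 (fun i => t i.succ) (fun i => ht _) (fun h => ht0 (by
      funext i
      refine Fin.cases h0 (fun i => congrFun h i) i))
    exact ⟨i.succ, hi, by simpa [h0] using hi'⟩
  · by_contra! hcon
    let I : Finset (Fin r) := Finset.univ.filter fun i => t i.succ ≠ 0
    refine hv (C σ I) (Finset.mem_union_left _ (Finset.mem_image.2
      ⟨(σ, I), Finset.mem_product.2 ⟨hσ, Finset.mem_univ _⟩, rfl⟩))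
      (hC2 σ I v ((t 0)⁻¹ • ∑ i, t i.succ • σ i) ?_ ?_ ?_)
    · refine Submodule.smul_mem _ _ (Submodule.sum_mem _ fun i _ => ?_)
      by_cases hi : t i.succ = 0
      · rw [hi, zero_smul]
        exact Submodule.zero_mem _
      · exact Submodule.smul_mem _ _ (Submodule.subset_span ⟨i, by simpa [I] using hi, rfl⟩)
    all_goals
      have hx : v + (t 0)⁻¹ • ∑ i, t i.succ • σ i =
          (t 0)⁻¹ • (t 0 • v + ∑ i, t i.succ • σ i) := by
        rw [smul_add, inv_smul_smul₀ h0]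
      rw [hx]
    · have := hcon 0 h0
      rw [map_smul, LinearMap.smul_apply]
      rw [Fin.cons_zero] at this
      rw [this, smul_zero]
    · intro w' hw'
      rw [map_smul, LinearMap.smul_apply]
      refine smul_eq_zero_of_right _ ?_
      induction hw' using Submodule.span_induction with
      | mem x hx =>
        obtain ⟨i, hi, rfl⟩ := hx
        have := hcon i.succ (by simpa [I] using hi)
        rwa [Fin.cons_succ] at this
      | zero => exact map_zero _
      | add x y _ _ hx hy => rw [map_add, hx, hy, add_zero]
      | smul c x _ hx => rw [map_smul, hx, smul_zero]

end Good

end PolyChain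

namespace PolyChain

section Orientation

variable {N : ℕ}

/-- The orientation of a family of `N` vectors in `ℝ^N`. -/
def sg (w : Fin N → Fin N → ℝ) : ℚ := (SignType.sign (Matrix.of w).det : ℚ)

theorem sg_eq_mul {σ w A : Fin N → Fin N → ℝ} (hA : ∀ j, w j = ∑ i, A i j • σ i) :
    sg w = (SignType.sign (Matrix.of A).det : ℚ) * sg σ := by
  have h : Matrix.of w = (Matrix.of A)ᵀ * Matrix.of σ := by
    ext j k
    simp [hA j, Matrix.mul_apply, Finset.sum_apply]
  rw [sg, h, Matrix.det_mul, Matrix.det_transpose, sign_mul_rat]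
  rfl

theorem sg_ne_zero {w : Fin N → Fin N → ℝ} (hw : LinearIndependent ℝ w) : sg w ≠ 0 := by
  have h : (Matrix.of w).det ≠ 0 := by
    have := Matrix.linearIndependent_rows_iff_isUnit (A := Matrix.of w).1 hw
    exact ((Matrix.isUnit_iff_isUnit_det _).1 this).ne_zero
  intro h0
  rcases lt_trichotomy (Matrix.of w).det 0 with h1 | h1 | h1
  · rw [sg, sign_neg h1] at h0
    norm_num at h0
  · exact h h1
  · rw [sg, sign_pos h1] at h0
    norm_num at h0

theorem sg_eq_zero {w : Fin N → Fin N → ℝ} (hw : ¬ LinearIndependent ℝ w) : sg w = 0 := by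
  have h : (Matrix.of w).det = 0 := by
    by_contra h
    refine hw ((Matrix.linearIndependent_rows_iff_isUnit (A := Matrix.of w)).2 ?_)
    exact (Matrix.isUnit_iff_isUnit_det _).2 (isUnit_iff_ne_zero.2 h)
  rw [sg, h]
  simp

theorem sg_mul_self {w : Fin N → Fin N → ℝ} (hw : LinearIndependent ℝ w) : sg w * sg w = 1 := by
  have h := sg_ne_zero hw
  rcases lt_trichotomy (Matrix.of w).det 0 with h1 | h1 | h1
  · rw [sg, sign_neg h1]
    norm_num
  · rw [sg, h1] at h
    simp at h
  · rw [sg, sign_pos h1]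
    norm_num

theorem sg_snoc_neg {n : ℕ} (w : Fin n → Fin (n + 1) → ℝ) (u : Fin (n + 1) → ℝ) :
    sg (Fin.snoc w (-u) : Fin (n + 1) → Fin (n + 1) → ℝ) =
      -sg (Fin.snoc w u : Fin (n + 1) → Fin (n + 1) → ℝ) := by
  have h : Matrix.of (Fin.snoc w (-u) : Fin (n + 1) → Fin (n + 1) → ℝ) =
      (Matrix.of (Fin.snoc w u : Fin (n + 1) → Fin (n + 1) → ℝ)).updateRow (Fin.last n)
        ((-1 : ℝ) • u) := by
    ext i k
    induction i using Fin.lastCases with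
    | last => simp
    | cast i => simp [Matrix.updateRow_apply]
  rw [sg, h, Matrix.det_updateRow_smul]
  have h2 : (Matrix.of (Fin.snoc w u : Fin (n + 1) → Fin (n + 1) → ℝ)).updateRow (Fin.last n) u =
      Matrix.of (Fin.snoc w u : Fin (n + 1) → Fin (n + 1) → ℝ) := by
    ext i k
    induction i using Fin.lastCases with
    | last => simp
    | cast i => simp [Matrix.updateRow_apply]
  rw [h2, neg_one_mul, sign_neg_rat]
  rfl

theorem exists_coords {σ : Fin N → Fin N → ℝ} (hσ : LinearIndependent ℝ σ) {m : ℕ}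
    (w : Fin m → Fin N → ℝ) : ∃ A : Fin N → Fin m → ℝ, ∀ j, w j = ∑ i, A i j • σ i := by
  have htop : Submodule.span ℝ (Set.range σ) = ⊤ :=
    hσ.span_eq_top_of_card_eq_finrank' (by simp)
  obtain ⟨A, hA⟩ := exists_matrix (σ := σ) (w := w) fun j => by rw [htop]; trivial
  exact ⟨A, hA⟩

/-- Top dimensional cycles are multiples of the orientation. -/
theorem exists_const_of_bd_eq_zero {n : ℕ} {S : ConeClass (Fin (n + 1) → ℝ)}
    {T : PF (Fin (n + 1) → ℝ) (n + 1)} (hT : T ∈ S.PC (n + 1)) (hc : bd n T = 0) :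
    ∃ C : ℚ, ∀ w, LinearIndependent ℝ w → T w = C * sg w := by
  classical
  obtain ⟨s, b, hs, rfl⟩ := S.exists_rep hT
  have hind : ∀ σ ∈ s, LinearIndependent ℝ σ := fun σ hσ => S.indep (hs σ hσ)
  obtain ⟨v, -, hv⟩ := exists_mem_forall_notMem (⊤ : Submodule ℝ (Fin (n + 1) → ℝ))
    (s.biUnion fun σ => Finset.univ.image fun i => Submodule.span ℝ (Set.range (facet σ i))) (by
      intro W hW h
      obtain ⟨σ, -, hW⟩ := Finset.mem_biUnion.1 hW
      obtain ⟨i, -, rfl⟩ := Finset.mem_image.1 hW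
      have h1 := finrank_range_le_card (R := ℝ) (facet σ i)
      rw [Set.finrank, top_le_iff.1 h, finrank_top] at h1
      simp at h1)
  have hv' : ∀ σ ∈ s, ∀ i, v ∉ Submodule.span ℝ (Set.range (facet σ i)) := fun σ hσ i =>
    hv _ (Finset.mem_biUnion.2 ⟨σ, hσ, Finset.mem_image_of_mem _ (Finset.mem_univ _)⟩)
  have hcoef : ∀ σ : Fin (n + 1) → Fin (n + 1) → ℝ, ∃ c : Fin (n + 1) → ℝ, σ ∈ s →
      v = ∑ i, c i • σ i := fun σ => by
    by_cases h : σ ∈ s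
    · obtain ⟨A, hA⟩ := exists_coords (hind σ h) (fun _ : Fin 1 => v)
      exact ⟨fun i => A i 0, fun _ => hA 0⟩
    · exact ⟨0, fun h' => absurd h' h⟩
  choose c hcv using hcoef
  refine ⟨∑ σ ∈ s, b σ * if ∀ i, c σ i < 0 then sg σ else 0, fun w hw => ?_⟩
  rw [cycle_eq_of_coning hind hc hv', Finset.sum_mul]
  refine Finset.sum_congr rfl fun σ hσ => ?_
  obtain ⟨A, hA⟩ := exists_coords (hind σ hσ) w
  have h1 := hcv σ hσ
  have h2 := ev_sub_cone (hind σ hσ) (coeff_ne_zero (c := c σ) (by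
    intro i; rw [← h1]; exact hv' σ hσ i)) hA
  rw [← h1] at h2
  rw [h2, mul_assoc]
  congr 1
  by_cases hneg : ∀ i, c σ i < 0
  · rw [if_pos hneg, if_pos hneg, sg_eq_mul hA, mul_left_comm, sg_mul_self (hind σ hσ), mul_one]
  · rw [if_neg hneg, if_neg hneg, zero_mul]

/-- The germ indicator of a basis in terms of the orientation. -/
theorem ev_basis {n : ℕ} (κ : Module.Basis (Fin (n + 1)) ℝ (Fin (n + 1) → ℝ))
    {w : Fin (n + 1) → Fin (n + 1) → ℝ} (hw : LinearIndependent ℝ w) [Decidable (GermIn κ w)] :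
    ev (⇑κ) w = if GermIn κ w then sg w * sg (⇑κ) else 0 := by
  classical
  have hA : ∀ j, w j = ∑ i, κ.coord i (w j) • κ i := fun j => (κ.sum_repr (w j)).symm
  have hdet := det_ne_zero_of_indep hw (A := Matrix.of fun i j => κ.coord i (w j)) hA
  have hiff : (∀ i, LexPos fun j => κ.coord i (w j)) ↔ GermIn κ w := by
    refine forall_congr' fun i => ?_
    constructor
    · exact fun h => h.not_neg
    · intro h
      refine (lexPos_or_neg fun h0 => hdet ?_).resolve_right h
      exact Matrix.det_eq_zero_of_row_eq_zero i fun j => congrFun h0 j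
  rw [ev_of' κ.linearIndependent (a := fun i j => κ.coord i (w j)) hA, sg_eq_mul hA, mul_assoc,
    sg_mul_self κ.linearIndependent, mul_one]
  by_cases h : GermIn κ w
  · rw [if_pos h, if_pos (hiff.2 h)]
  · rw [if_neg h, if_neg fun h' => h (hiff.1 h')]

end Orientation

end PolyChain

namespace PolyChain

section FundamentalChain

variable {Γ : Type} [Group Γ]

open Classical in
/-- The part of the weight coming from the families with a given first index. -/
def weightAt (i : ℕ) (M : ℕ → Γ → Prop) : ℚ := if firstIdx M = i then weight M else 0

theorem isLocal_weightAt (i : ℕ) : IsLocal (weightAt (Γ := Γ) i) := by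
  intro M M' I h hM
  unfold weightAt
  rw [firstIdx_congr h hM, isLocal_weight M M' I h hM]

theorem mem_of_weight_ne_zero {M : ℕ → Γ → Prop} (h : weight M ≠ 0) : M (firstIdx M) 1 := by
  by_contra h'
  exact h (by unfold weight; rw [if_neg h'])

variable {m : ℕ} {V : Set (Fin (m + 1) → ℝ)} {a : Representation ℝ Γ (Fin (m + 1) → ℝ)}
  {κ : ℕ → Module.Basis (Fin (m + 1)) ℝ (Fin (m + 1) → ℝ)}

theorem basis_mem_conesIn (hκ : Covering V κ) (i : ℕ) : ⇑(κ i) ∈ (conesIn V).carrier (m + 1) :=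
  ⟨(κ i).linearIndependent, hκ.comb_mem i⟩

theorem rel_one {r : ℕ} {w : Fin r → Fin (m + 1) → ℝ} {i : ℕ} :
    rel κ a w i 1 ↔ GermIn (κ i) w := by
  unfold rel
  simp

theorem GermIn.first_mem (hκ : Covering V κ) {i : ℕ} {w : Fin (m + 1) → Fin (m + 1) → ℝ}
    (hw : LinearIndependent ℝ w) (h : GermIn (κ i) w) : w 0 ∈ V := by
  have := hκ.comb_mem i (fun j => (κ i).coord j (w 0)) (fun j => h.nonneg j) (fun h0 =>
    hw.ne_zero 0 ((κ i).ext_elem fun j => by simpa using congrFun h0 j))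
  have e : ∑ j, (κ i).coord j (w 0) • κ i j = w 0 := (κ i).sum_repr (w 0)
  rwa [e] at this

variable (a κ) in
/-- The chain counting each orbit with total weight one. -/
def fundChain : PF (Fin (m + 1) → ℝ) (m + 1) := fun w => weight (rel κ a w) * sg w

theorem fundChain_mem (hV : ProperCone V a) (hκ : Covering V κ) {I : ℕ}
    (hI : ∀ x ∈ V, ∃ i ≤ I, ∃ γ, ∀ j, 0 < (κ i).coord j (a γ⁻¹ x)) :
    fundChain a κ ∈ (conesIn V).PC (m + 1) := by
  classical
  have e : fundChain a κ = ∑ i ∈ Finset.range (I + 1), sg (⇑(κ i)) •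
      (fun w => weightAt i (rel κ a w) * ev (⇑(κ i)) w : PF (Fin (m + 1) → ℝ) (m + 1)) := by
    funext w
    rw [Finset.sum_apply]
    simp only [Pi.smul_apply, smul_eq_mul, fundChain]
    by_cases hw : LinearIndependent ℝ w
    · by_cases h0 : weight (rel κ a w) = 0
      · rw [h0, zero_mul, Finset.sum_eq_zero]
        intro i _
        have : weightAt i (rel κ a w) = 0 := by
          unfold weightAt
          rw [h0, ite_self]
        rw [this, zero_mul, mul_zero]
      · have h1 : GermIn (κ (firstIdx (rel κ a w))) w := rel_one.1 (mem_of_weight_ne_zero h0)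
        have h2 : firstIdx (rel κ a w) ≤ I := by
          obtain ⟨i, hi, γ, h⟩ := hI _ (h1.first_mem hκ hw)
          refine (firstIdx_le (γ := γ) ?_).trans hi
          exact germIn_of_pos h
        rw [Finset.sum_eq_single (firstIdx (rel κ a w))]
        · have h3 : weightAt (firstIdx (rel κ a w)) (rel κ a w) = weight (rel κ a w) := by
            unfold weightAt
            rw [if_pos rfl]
          rw [h3, ev_basis _ hw, if_pos h1]
          have := sg_mul_self (κ (firstIdx (rel κ a w))).linearIndependent
          calc _ = weight (rel κ a w) * sg w * 1 := (mul_one _).symm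
            _ = _ := by rw [← this]; ring
        · intro i _ hi
          have : weightAt i (rel κ a w) = 0 := by
            unfold weightAt
            rw [if_neg (Ne.symm hi)]
          rw [this, zero_mul, mul_zero]
        · intro h
          exact absurd (Finset.mem_range.2 (Nat.lt_succ_of_le h2)) h
    · rw [sg_eq_zero hw, mul_zero, Finset.sum_eq_zero]
      intro i _
      have : ev (⇑(κ i)) w = 0 := by
        by_contra h
        exact hw (indep_of_ev_ne_zero (κ i).linearIndependent h)
      rw [this, mul_zero, mul_zero]
  rw [e]
  exact Submodule.sum_mem _ fun i _ => Submodule.smul_mem _ _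
    (mul_local_ev_mem hV hκ (isLocal_weightAt i) (basis_mem_conesIn hκ i))

theorem finsum_weight_germ (hV : ProperCone V a) (hκ : Covering V κ)
    {w : Fin (m + 1) → Fin (m + 1) → ℝ} (hw : LinearIndependent ℝ w) (h0 : w 0 ∈ V) :
    ∑ᶠ γ : Γ, weight (rel κ a fun k => a γ⁻¹ (w k)) = 1 := by
  classical
  obtain ⟨i, hi⟩ := hκ.exists_pos _ h0
  refine finsum_weight_rel hV hκ (basis_mem_conesIn hκ i) ?_
  rw [ev_basis _ hw, if_pos (germIn_of_pos hi)]
  exact mul_ne_zero (sg_ne_zero hw) (sg_ne_zero (κ i).linearIndependent)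

theorem finite_support_of_finsum_eq_one {ι : Type} {f : ι → ℚ} (h : ∑ᶠ i, f i = 1) :
    (Function.support f).Finite := by
  by_contra hinf
  rw [finsum_of_infinite_support hinf] at h
  exact zero_ne_one h

end FundamentalChain

section Vanishing

variable {Γ : Type} [Group Γ] {m : ℕ} {V : Set (Fin (m + 2) → ℝ)}
  {a : Representation ℝ Γ (Fin (m + 2) → ℝ)}
  {κ : ℕ → Module.Basis (Fin (m + 2)) ℝ (Fin (m + 2) → ℝ)}

theorem finsum_bd_fundChain (hV : ProperCone V a) (hκ : Covering V κ) {χ : Γ →* ℚˣ}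
    (hχ : ∀ γ w, sg (fun k => a γ (w k)) = (χ γ : ℚ) * sg w)
    (hF : fundChain a κ ∈ (conesIn V).PC (m + 2)) (w : Fin (m + 1) → Fin (m + 2) → ℝ) :
    ∑ᶠ γ : Γ, (χ γ : ℚ) * bd (m + 1) (fundChain a κ) (fun k => a γ⁻¹ (w k)) = 0 := by
  have hall := (conesIn V).le_all _ hF
  by_cases hw : LinearIndependent ℝ w
  swap
  · refine finsum_eq_zero_of_forall_eq_zero fun γ => ?_
    rw [bd_apply_of_dep hall, mul_zero]
    intro h
    refine hw ?_
    have := rep_indep a γ h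
    simpa only [← Module.End.mul_apply, ← map_mul, mul_inv_cancel, map_one,
      Module.End.one_apply] using this
  by_cases h0 : w 0 ∈ V
  swap
  · refine finsum_eq_zero_of_forall_eq_zero fun γ => ?_
    have : bd (m + 1) (fundChain a κ) (fun k => a γ⁻¹ (w k)) = 0 := by
      by_contra h
      obtain ⟨F, hF1, hF2⟩ := ConeClass.exists_ev_ne_zero _ ((conesIn V).bd_mem hF)
      obtain ⟨σ, hσ, hσw⟩ := hF2 _ h
      have h1 := hV.inv_mem γ _ (first_mem (hF1 σ hσ) hσw)
      rw [rep_apply_inv] at h1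
      exact h0 h1
    rw [this, mul_zero]
  obtain ⟨u, hu⟩ : ∃ u : Fin (m + 2) → ℝ, u ∉ Submodule.span ℝ (Set.range w) := by
    by_contra! h
    have h1 := finrank_range_le_card (R := ℝ) w
    have h2 : Submodule.span ℝ (Set.range w) = ⊤ := eq_top_iff.2 fun x _ => h x
    rw [Set.finrank, h2, finrank_top] at h1
    simp at h1
  have hwu : LinearIndependent ℝ (Fin.snoc w u : Fin (m + 2) → Fin (m + 2) → ℝ) :=
    linearIndependent_finSnoc.2 ⟨hw, hu⟩
  have hwu' : LinearIndependent ℝ (Fin.snoc w (-u) : Fin (m + 2) → Fin (m + 2) → ℝ) :=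
    linearIndependent_finSnoc.2 ⟨hw, fun h => hu (by simpa using Submodule.neg_mem _ h)⟩
  have hsnoc : ∀ γ (u : Fin (m + 2) → ℝ), (Fin.snoc (fun k => a γ (w k)) (a γ u) :
      Fin (m + 2) → Fin (m + 2) → ℝ) = fun k => a γ ((Fin.snoc w u : Fin (m + 2) → _) k) := by
    intro γ u
    funext k
    induction k using Fin.lastCases with
    | last => simp
    | cast k => simp
  have hone : ∀ u : Fin (m + 2) → ℝ, LinearIndependent ℝ (Fin.snoc w u : Fin (m + 2) → _) →
      ∑ᶠ γ : Γ, weight (rel κ a fun k => a γ⁻¹ ((Fin.snoc w u : Fin (m + 2) → _) k)) = 1 :=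
    fun u h => finsum_weight_germ hV hκ h (by
      have : (Fin.snoc w u : Fin (m + 2) → Fin (m + 2) → ℝ) 0 = w 0 :=
        Fin.snoc_castSucc (α := fun _ => Fin (m + 2) → ℝ) u w 0
      rwa [this])
  have hterm : ∀ γ : Γ, (χ γ : ℚ) * bd (m + 1) (fundChain a κ) (fun k => a γ⁻¹ (w k)) =
      ((-1) ^ (m + 1) * sg (Fin.snoc w u : Fin (m + 2) → Fin (m + 2) → ℝ)) *
        (weight (rel κ a fun k => a γ⁻¹ ((Fin.snoc w u : Fin (m + 2) → _) k)) -
          weight (rel κ a fun k => a γ⁻¹ ((Fin.snoc w (-u) : Fin (m + 2) → _) k))) := by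
    intro γ
    have h1 : LinearIndependent ℝ (Fin.snoc (fun k => a γ⁻¹ (w k)) (a γ⁻¹ u) :
        Fin (m + 2) → Fin (m + 2) → ℝ) := by
      rw [hsnoc]
      exact rep_indep a γ⁻¹ hwu
    rw [bd_apply_top (by simp) hall h1, ← map_neg, hsnoc, hsnoc]
    simp only [fundChain, hχ]
    have h2 : (χ γ : ℚ) * (χ γ⁻¹ : ℚ) = 1 := by
      rw [← Units.val_mul, ← map_mul, mul_inv_cancel, map_one, Units.val_one]
    rw [sg_snoc_neg]
    linear_combination ((-1) ^ (m + 1) * sg (Fin.snoc w u : Fin (m + 2) → Fin (m + 2) → ℝ)) *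
        (weight (rel κ a fun k => a γ⁻¹ ((Fin.snoc w u : Fin (m + 2) → _) k)) -
          weight (rel κ a fun k => a γ⁻¹ ((Fin.snoc w (-u) : Fin (m + 2) → _) k))) * h2
  rw [finsum_congr hterm, ← mul_finsum', finsum_sub_distrib, hone u hwu, hone _ hwu', sub_self,
    mul_zero]
  · exact finite_support_of_finsum_eq_one (hone u hwu)
  · exact finite_support_of_finsum_eq_one (hone _ hwu')
  · refine ((finite_support_of_finsum_eq_one (hone u hwu)).union
      (finite_support_of_finsum_eq_one (hone _ hwu'))).subset fun γ hγ => ?_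
    by_contra h
    rw [Set.mem_union, not_or, Function.notMem_support, Function.notMem_support] at h
    exact hγ (by simp only [h.1, h.2, sub_self])

theorem finite_weightMul_inv (hV : ProperCone V a) (hκ : Covering V κ) (χ : Γ →* ℚˣ)
    (h : (conesIn V).Inv a) (r : ℕ) (T : PCM (conesIn V) a χ h (r + 1)) :
    {γ : Γ | weightMul hV hκ χ h r ((MonoidAlgebra.single γ⁻¹ 1 : GA Γ) • T) ≠ 0}.Finite := by
  refine (finite_weightMul hV hκ χ h r T).subset fun γ hγ h0 => hγ ?_
  have := congrArg (fun x => (MonoidAlgebra.single γ⁻¹ 1 : GA Γ) • x) h0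
  simp only [smul_smul, smul_zero, MonoidAlgebra.single_mul_single, inv_mul_cancel,
    mul_one] at this
  rwa [← MonoidAlgebra.one_def, one_smul] at this

theorem functional_fundChain_eq_zero (hV : ProperCone V a) (hκ : Covering V κ) {χ : Γ →* ℚˣ}
    (hχ : ∀ γ w, sg (fun k => a γ (w k)) = (χ γ : ℚ) * sg w)
    (hF : fundChain a κ ∈ (conesIn V).PC (m + 2)) {S : ConeClass (Fin (m + 2) → ℝ)}
    (hS : S.Inv a) (hsub : ∀ r, (conesIn V).PC r ≤ S.PC r)
    (hex : ∀ r < m + 2, ExactIn S.PC r) (hpd : PdLT (GA Γ) (QChar χ) (m + 1))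
    {A : Type} [AddCommGroup A] [Module ℚ A] (c : S.PC (m + 2) →ₗ[ℚ] A)
    (hinv : ∀ γ T, c ⟨twist a χ (m + 2) γ T.1, hS.twist_mem χ γ T.2⟩ = c T)
    (hcyc : ∀ T, bd (m + 1) T.1 = 0 → c T = 0) : c ⟨fundChain a κ, hsub _ hF⟩ = 0 := by
  have hU : (conesIn V).Inv a := conesIn_inv a hV.inv_mem
  obtain ⟨h, hh⟩ := exists_homotopy (A := GA Γ) m (B := PCM (conesIn V) a χ hU 0)
    (B' := PCM S a χ hS 0) (M := fun n => PCM (conesIn V) a χ hU (n + 1))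
    (N := fun n => PCM S a χ hS (n + 1))
    (PdLT.of_equiv (pcmZeroEquiv _ a χ hU).symm hpd)
    (fun n => bdM (conesIn V) a χ hU (n + 1)) (bdM (conesIn V) a χ hU 0)
    (fun n x => Subtype.ext ((conesIn V).bd_bd x.2)) (fun x => Subtype.ext ((conesIn V).bd_bd x.2))
    (fun n => projective_PCM hV hκ χ hU n)
    (fun n => bdM S a χ hS (n + 1)) (bdM S a χ hS 0)
    (fun n x => Subtype.ext (S.bd_bd x.2)) (fun x => Subtype.ext (S.bd_bd x.2))
    (fun T => by
      obtain ⟨R, hR, hRT⟩ := hex 0 (by omega) _ T.2 trivial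
      exact ⟨⟨R, hR⟩, Subtype.ext hRT⟩)
    (fun T hT => by
      obtain ⟨R, hR, hRT⟩ := hex 1 (by omega) _ T.2 (congrArg Subtype.val hT)
      exact ⟨⟨R, hR⟩, Subtype.ext hRT⟩)
    (fun n hn T hT => by
      obtain ⟨R, hR, hRT⟩ := hex (n + 2) (by omega) _ T.2 (congrArg Subtype.val hT)
      exact ⟨⟨R, hR⟩, Subtype.ext hRT⟩)
    (fun n => Submodule.inclusion fun T hT => hsub _ hT)
    (Submodule.inclusion fun T hT => hsub _ hT)
    (fun n x => rfl) (fun x => rfl)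
  let D : PCM (conesIn V) a χ hU (m + 2) := ⟨fundChain a κ, hF⟩
  let F : PCM (conesIn V) a χ hU (m + 1) := bdM (conesIn V) a χ hU (m + 1) D
  let c' : PCM S a χ hS (m + 2) →+ A :=
    { toFun := fun T => c ⟨T.1, T.2⟩
      map_zero' := c.map_zero
      map_add' := fun S T => c.map_add ⟨S.1, S.2⟩ ⟨T.1, T.2⟩ }
  have hc' : ∀ (γ : Γ) T, c' ((MonoidAlgebra.single γ 1 : GA Γ) • T) = c' T := fun γ T => by
    refine Eq.trans (congrArg c (Subtype.ext ?_)) (hinv γ ⟨T.1, T.2⟩)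
    exact (single_smul_TPF a χ (m + 2) γ 1 T.1).trans (one_smul ℚ _)
  let R := weightMul hV hκ χ hU m
  have hzero : ∑ᶠ γ : Γ, R ((MonoidAlgebra.single γ⁻¹ 1 : GA Γ) • F) = 0 := by
    refine Subtype.ext (funext fun w => ?_)
    let evw : PCM (conesIn V) a χ hU (m + 1) →+ ℚ :=
      { toFun := fun T => (show PF (Fin (m + 2) → ℝ) (m + 1) from T.1) w
        map_zero' := rfl
        map_add' := fun _ _ => rfl }
    refine (evw.map_finsum (finite_weightMul_inv hV hκ χ hU m F)).trans ?_
    have e : ∀ γ, evw (R ((MonoidAlgebra.single γ⁻¹ 1 : GA Γ) • F)) =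
        weight (rel κ a w) * ((χ γ⁻¹ : ℚ) *
          bd (m + 1) (fundChain a κ) (fun k => a γ⁻¹⁻¹ (w k))) := fun γ => by
      refine congrArg (weight (rel κ a w) * ·) ?_
      refine (congrFun ((single_smul_TPF a χ (m + 1) γ⁻¹ 1 _).trans (one_smul ℚ _)) w).trans ?_
      exact twist_apply a χ (m + 1) γ⁻¹ _ w
    rw [finsum_congr e]
    by_cases hw : weight (rel κ a w) = 0
    · simp only [hw, zero_mul, finsum_zero]
      rfl
    · have h2 := finsum_bd_fundChain hV hκ hχ hF w
      rw [← finsum_comp_equiv (Equiv.inv Γ)] at h2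
      simp only [Equiv.inv_apply] at h2
      have h3 := smul_finsum (weight (rel κ a w)) fun γ : Γ => (χ γ⁻¹ : ℚ) *
          bd (m + 1) (fundChain a κ) (fun k => a γ⁻¹⁻¹ (w k))
      rw [h2, smul_zero] at h3
      exact h3.symm
  have h1 : c' (h F) = 0 := by
    have e1 := congrArg (fun x => c' (h x)) (finsum_weightMul hV hκ χ hU m F)
    refine e1.symm.trans ?_
    let ch : PCM (conesIn V) a χ hU (m + 1) →+ A := c'.comp h.toAddMonoidHom
    refine (ch.map_finsum (finite_weightMul hV hκ χ hU m F)).trans ?_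
    refine Eq.trans (finsum_congr fun γ => ?_)
      ((ch.map_finsum (finite_weightMul_inv hV hκ χ hU m F)).symm.trans
        ((congrArg ch hzero).trans ch.map_zero))
    show c' (h (_ • _)) = c' (h _)
    rw [map_smul, hc']
  have h2 := hh D
  let D' : PCM S a χ hS (m + 2) := ⟨fundChain a κ, hsub _ hF⟩
  have h3 : c' (D' - h F) = 0 := hcyc ⟨_, (D' - h F).2⟩ (congrArg Subtype.val h2)
  rw [map_sub, h1, sub_zero] at h3
  exact h3

end Vanishing

end PolyChain

section

open MvPolynomial Filter Topology

namespace PolyChain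

/-- The open positive orthant. -/
def orthant (N : ℕ) : Set (Fin N → ℝ) := {t | ∀ i, 0 < t i}

theorem isOpen_orthant (N : ℕ) : IsOpen (orthant N) := by
  have : orthant N = ⋂ i, {t | 0 < t i} := by ext t; simp [orthant]
  rw [this]
  exact isOpen_iInter_of_finite fun i => isOpen_lt continuous_const (continuous_apply i)

theorem measurableSet_orthant (N : ℕ) : MeasurableSet (orthant N) :=
  (isOpen_orthant N).measurableSet

theorem hasLineDerivAt_mvPolynomial {N : ℕ} (p : MvPolynomial (Fin N) ℝ) (t : Fin N → ℝ)
    (i : Fin N) :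
    HasLineDerivAt ℝ (fun t => eval t p) (eval t (pderiv i p)) t (Pi.single i 1) := by
  unfold HasLineDerivAt
  induction p using MvPolynomial.induction_on with
  | C a => simpa using hasDerivAt_const (0 : ℝ) a
  | add p q hp hq =>
    simp only [map_add]
    exact hp.add hq
  | mul_X p j hp =>
    have hX : HasDerivAt (fun h : ℝ => (t + h • (Pi.single i (1 : ℝ) : Fin N → ℝ)) j)
        (if j = i then 1 else 0) 0 := by
      by_cases h : j = i
      · subst h
        simpa using (hasDerivAt_id (0 : ℝ)).const_add (t j)
      · simpa [h] using hasDerivAt_const (0 : ℝ) (t j)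
    have := hp.mul hX
    simp only [map_mul, eval_X, pderiv_mul, pderiv_X, map_add]
    have hs : eval t ((Pi.single i 1 : Fin N → MvPolynomial (Fin N) ℝ) j) = if j = i then 1 else 0 := by
      by_cases h : j = i
      · subst h; simp
      · simp [h]
    rw [hs]
    simpa [Pi.mul_def] using this

theorem integral_lineDeriv_orthant {N : ℕ} (i : Fin N) {G G' : (Fin N → ℝ) → ℂ}
    (hd : ∀ t, HasLineDerivAt ℝ G (G' t) t (Pi.single i 1))
    (h0 : ∀ t, t i = 0 → G t = 0 ∧ G' t = 0)
    (hG : IntegrableOn G (orthant N)) (hG' : IntegrableOn G' (orthant N)) :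
    ∫ t in orthant N, G' t = 0 := by
  have key : ∀ t, HasLineDerivAt ℝ ((orthant N).indicator G) ((orthant N).indicator G' t) t
      (Pi.single i 1) := by
    intro t
    have hcont : Continuous fun h : ℝ => t + h • (Pi.single i (1 : ℝ) : Fin N → ℝ) := by
      fun_prop
    by_cases ht : t ∈ orthant N
    · rw [Set.indicator_of_mem ht]
      refine HasDerivAt.congr_of_eventuallyEq (hd t) ?_
      have : ∀ᶠ h : ℝ in 𝓝 0, t + h • (Pi.single i (1 : ℝ) : Fin N → ℝ) ∈ orthant N :=
        hcont.continuousAt.eventually_mem ((isOpen_orthant N).mem_nhds (by simpa using ht))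
      filter_upwards [this] with h hh
      rw [Set.indicator_of_mem hh]
    · rw [Set.indicator_of_notMem ht]
      by_cases hj : ∃ j, j ≠ i ∧ t j ≤ 0
      · obtain ⟨j, hji, hj⟩ := hj
        refine HasDerivAt.congr_of_eventuallyEq (hasDerivAt_const (0 : ℝ) (0 : ℂ)) ?_
        refine Eventually.of_forall fun h => ?_
        show (orthant N).indicator G _ = 0
        rw [Set.indicator_of_notMem]
        intro hh
        have := hh j
        simp [hji] at this
        linarith
      · push Not at hj
        have hti : t i ≤ 0 := by
          by_contra hlt
          exact ht fun j => by
            by_cases hji : j = i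
            · subst hji; linarith
            · exact hj j hji
        rcases hti.lt_or_eq with hlt | heq
        · refine HasDerivAt.congr_of_eventuallyEq (hasDerivAt_const (0 : ℝ) (0 : ℂ)) ?_
          have : ∀ᶠ h : ℝ in 𝓝 0, h < - t i := eventually_lt_nhds (by linarith)
          filter_upwards [this] with h hh
          show (orthant N).indicator G _ = 0
          rw [Set.indicator_of_notMem]
          intro hm
          have := hm i
          simp at this
          linarith
        · have h1 := hd t
          rw [(h0 t heq).2] at h1
          unfold HasLineDerivAt at h1 ⊢
          rw [hasDerivAt_iff_isLittleO] at h1 ⊢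
          simp only [zero_smul, add_zero, (h0 t heq).1, Set.indicator_of_notMem ht, sub_zero,
            smul_zero] at h1 ⊢
          refine (Asymptotics.isBigO_of_le _ fun h => ?_).trans_isLittleO h1
          exact norm_indicator_le_norm_self _ _
  have hI' : Integrable ((orthant N).indicator G') :=
    (integrable_indicator_iff (measurableSet_orthant N)).2 hG'
  have hI : Integrable ((orthant N).indicator G) :=
    (integrable_indicator_iff (measurableSet_orthant N)).2 hG
  have := integral_bilinear_hasLineDerivAt_right_eq_neg_left_of_integrable
    (μ := (volume : Measure (Fin N → ℝ))) (f := fun _ => (1 : ℝ)) (f' := fun _ => 0)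
    (g := (orthant N).indicator G) (g' := (orthant N).indicator G') (v := Pi.single i 1)
    (B := ContinuousLinearMap.lsmul ℝ ℝ) (by simp) (by simpa using hI') (by simpa using hI)
    (fun x _ => hasDerivAt_const (0 : ℝ) (1 : ℝ)) (fun x _ => key x)
  simp only [ContinuousLinearMap.lsmul_apply, one_smul, zero_smul, integral_zero, neg_zero]
    at this
  rwa [integral_indicator (measurableSet_orthant N)] at this

end PolyChain

end

section

open MvPolynomial Filter Topology

namespace PolyChain

theorem totalDegree_pderiv_le {N : ℕ} (i : Fin N) (p : MvPolynomial (Fin N) ℝ) :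
    (pderiv i p).totalDegree ≤ p.totalDegree - 1 := by
  conv_lhs => rw [p.as_sum]
  rw [map_sum]
  refine totalDegree_finsetSum_le fun m hm => ?_
  rw [pderiv_monomial]
  by_cases hi : m i = 0
  · simp [hi]
  refine (totalDegree_monomial_le _ _).trans ?_
  have h1 : (m.sum fun _ => id) ≤ p.totalDegree := le_totalDegree hm
  have h2 : m = (m - Finsupp.single i 1) + Finsupp.single i 1 := by
    ext j
    by_cases hj : j = i
    · subst hj
      simp
      omega
    · simp [Finsupp.single_apply, Ne.symm hj]
  have h3 : (m.sum fun _ => id) = ((m - Finsupp.single i 1).sum fun _ => id) + 1 := by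
    conv_lhs => rw [h2]
    rw [Finsupp.sum_add_index' (by simp) (by simp)]
    simp
  omega

theorem abs_eval_le {N : ℕ} (p : MvPolynomial (Fin N) ℝ) :
    ∃ C : ℝ, 0 ≤ C ∧ ∀ t : Fin N → ℝ, |eval t p| ≤ C * (1 + ‖t‖) ^ p.totalDegree := by
  refine ⟨∑ d ∈ p.support, |coeff d p|, Finset.sum_nonneg fun _ _ => abs_nonneg _, fun t => ?_⟩
  rw [eval_eq', Finset.sum_mul]
  refine (Finset.abs_sum_le_sum_abs _ _).trans (Finset.sum_le_sum fun d hd => ?_)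
  rw [abs_mul]
  refine mul_le_mul_of_nonneg_left ?_ (abs_nonneg _)
  rw [Finset.abs_prod]
  have h1 : ∀ i ∈ Finset.univ, |t i ^ d i| ≤ (1 + ‖t‖) ^ d i := fun i _ => by
    rw [abs_pow]
    refine pow_le_pow_left₀ (abs_nonneg _) ?_ _
    have := norm_le_pi_norm t i
    rw [Real.norm_eq_abs] at this
    linarith
  refine (Finset.prod_le_prod (fun _ _ => abs_nonneg _) h1).trans ?_
  rw [Finset.prod_pow_eq_pow_sum]
  refine pow_le_pow_right₀ (by linarith [norm_nonneg t]) ?_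
  have := le_totalDegree hd
  rwa [Finsupp.sum_fintype _ _ (by simp)] at this

/-- The vector field along which we integrate by parts; it is tangent to all the faces of
the orthant. -/
def vf {N : ℕ} (q : MvPolynomial (Fin N) ℝ) (i : Fin N) : MvPolynomial (Fin N) ℝ :=
  X i ^ 2 * pderiv i q

/-- The derivative of `s` along the vector field `vf q`. -/
def vfd {N : ℕ} (q s : MvPolynomial (Fin N) ℝ) : MvPolynomial (Fin N) ℝ :=
  ∑ i, vf q i * pderiv i s

variable {N : ℕ} {q s p : MvPolynomial (Fin N) ℝ}

theorem eval_vfd_self_nonneg (t : Fin N → ℝ) : 0 ≤ eval t (vfd q q) := by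
  simp only [vfd, vf, map_sum, map_mul, map_pow, eval_X]
  refine Finset.sum_nonneg fun i _ => ?_
  have : t i ^ 2 * eval t (pderiv i q) * eval t (pderiv i q)
    = (t i * eval t (pderiv i q)) ^ 2 := by ring
  rw [this]
  exact sq_nonneg _

theorem totalDegree_vf_le (hq : q.totalDegree ≤ 2) (i : Fin N) : (vf q i).totalDegree ≤ 3 := by
  refine (totalDegree_mul _ _).trans ?_
  have h1 := totalDegree_pderiv_le i q
  have h2 := totalDegree_pow (X i : MvPolynomial (Fin N) ℝ) 2
  rw [totalDegree_X] at h2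
  omega

theorem totalDegree_vfd_le (hq : q.totalDegree ≤ 2) (hs : s.totalDegree ≤ 2) :
    (vfd q s).totalDegree ≤ 4 := by
  refine totalDegree_finsetSum_le fun i _ => (totalDegree_mul _ _).trans ?_
  have h1 := totalDegree_pderiv_le i s
  have h2 := totalDegree_vf_le hq i
  omega

/-- A quadratic phase without stationary points at infinity on any face of the orthant. -/
structure PhaseGood (q : MvPolynomial (Fin N) ℝ) : Prop where
  deg : q.totalDegree ≤ 2
  lower : ∃ c : ℝ, 0 < c ∧ ∀ t ∈ orthant N, c * (1 + ‖t‖) ^ 4 ≤ 1 + eval t (vfd q q)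

/-- A quadratic polynomial that is positive on the orthant. -/
structure DampGood (s : MvPolynomial (Fin N) ℝ) : Prop where
  deg : s.totalDegree ≤ 2
  lower : ∃ c : ℝ, 0 < c ∧ ∀ t ∈ orthant N, c * ‖t‖ ^ 2 ≤ eval t s

variable (q s p) in
/-- The damped oscillating kernel. -/
def kern (ε : ℝ) (t : Fin N → ℝ) : ℂ :=
  Complex.exp (Complex.I * (eval t q : ℝ) - (ε * eval t s : ℝ))

variable (q p) in
/-- Amplitudes. -/
def amp (k : ℕ) (t : Fin N → ℝ) : ℝ := eval t p / (1 + eval t (vfd q q)) ^ k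

variable (q s p) in
/-- The damped oscillating integral with given amplitude. -/
def oint (k : ℕ) (ε : ℝ) : ℂ := ∫ t in orthant N, kern q s ε t * (amp q p k t : ℝ)

theorem norm_kern (ε : ℝ) (t : Fin N → ℝ) : ‖kern q s ε t‖ = Real.exp (-(ε * eval t s)) := by
  rw [kern, Complex.norm_exp]
  congr 1
  simp

theorem continuous_kern (ε : ℝ) : Continuous (kern q s ε) := by
  unfold kern
  have h1 := MvPolynomial.continuous_eval q
  have h2 := MvPolynomial.continuous_eval s
  fun_prop

theorem continuous_amp (k : ℕ) : Continuous (amp q p k) := by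
  unfold amp
  have h1 := MvPolynomial.continuous_eval p
  have h2 := MvPolynomial.continuous_eval (vfd q q)
  refine h1.div (by fun_prop) fun t => pow_ne_zero _ ?_
  have := eval_vfd_self_nonneg (q := q) t
  positivity

theorem exp_neg_bound {c : ℝ} (hc : 0 < c) (j : ℕ) : ∃ C : ℝ, 0 ≤ C ∧ ∀ ε r : ℝ, 0 < ε → ε ≤ 1 →
    0 ≤ r → Real.exp (-(ε * (c * r ^ 2))) * (1 + r) ^ (2 * j) ≤ C * (ε⁻¹) ^ j := by
  refine ⟨(2 / c) ^ j * j.factorial * Real.exp c, by positivity, fun ε r hε hε1 hr => ?_⟩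
  have h1 : (ε * (1 + r) ^ 2) * (c / 2) ≤ c * (1 + ε * r ^ 2) := by
    nlinarith [sq_nonneg (r - 1), mul_nonneg hε.le (sq_nonneg (r - 1))]
  have h2 := Real.pow_div_factorial_le_exp (c * (1 + ε * r ^ 2)) (by positivity) j
  have h3 : (ε * (1 + r) ^ 2) ^ j * (c / 2) ^ j ≤ j.factorial * Real.exp (c * (1 + ε * r ^ 2)) := by
    rw [← mul_pow]
    refine (pow_le_pow_left₀ (by positivity) h1 j).trans ?_
    rwa [div_le_iff₀' (by positivity)] at h2
  have h4 : Real.exp (c * (1 + ε * r ^ 2)) = Real.exp c * Real.exp (ε * (c * r ^ 2)) := by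
    rw [← Real.exp_add]; congr 1; ring
  rw [h4] at h3
  have h5 : (1 + r) ^ (2 * j) = (ε⁻¹) ^ j * (2 / c) ^ j * ((ε * (1 + r) ^ 2) ^ j * (c / 2) ^ j) := by
    rw [← mul_pow, ← mul_pow, ← mul_pow, pow_mul]
    congr 1
    field_simp
  have h6 : Real.exp (-(ε * (c * r ^ 2))) * Real.exp (ε * (c * r ^ 2)) = 1 := by
    rw [← Real.exp_add]; simp
  calc _ = (ε⁻¹) ^ j * (2 / c) ^ j * Real.exp (-(ε * (c * r ^ 2))) *
        ((ε * (1 + r) ^ 2) ^ j * (c / 2) ^ j) := by rw [h5]; ring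
    _ ≤ (ε⁻¹) ^ j * (2 / c) ^ j * Real.exp (-(ε * (c * r ^ 2))) *
        (j.factorial * (Real.exp c * Real.exp (ε * (c * r ^ 2)))) :=
        mul_le_mul_of_nonneg_left h3 (by positivity)
    _ = (ε⁻¹) ^ j * (2 / c) ^ j * (j.factorial * Real.exp c) *
        (Real.exp (-(ε * (c * r ^ 2))) * Real.exp (ε * (c * r ^ 2))) := by ring
    _ = _ := by rw [h6]; ring

theorem abs_amp_le (hq : PhaseGood q) {k j : ℕ} (hj : p.totalDegree + (N + 1) ≤ 4 * k + 2 * j) :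
    ∃ C : ℝ, 0 ≤ C ∧ ∀ t ∈ orthant N,
      |amp q p k t| * (1 + ‖t‖) ^ (N + 1) ≤ C * (1 + ‖t‖) ^ (2 * j) := by
  obtain ⟨C, hC, hp⟩ := abs_eval_le p
  obtain ⟨c, hc, hl⟩ := hq.lower
  refine ⟨C / c ^ k, by positivity, fun t ht => ?_⟩
  have h0 : 0 < 1 + eval t (vfd q q) := by linarith [eval_vfd_self_nonneg (q := q) t]
  have h1 : 1 ≤ 1 + ‖t‖ := by linarith [norm_nonneg t]
  have h2 : c ^ k * (1 + ‖t‖) ^ (4 * k) ≤ (1 + eval t (vfd q q)) ^ k := by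
    rw [pow_mul, ← mul_pow]
    exact pow_le_pow_left₀ (by positivity) (hl t ht) k
  rw [amp, abs_div, abs_of_pos (pow_pos h0 k), div_mul_eq_mul_div, div_le_iff₀ (pow_pos h0 k)]
  calc |eval t p| * (1 + ‖t‖) ^ (N + 1)
      ≤ C * (1 + ‖t‖) ^ p.totalDegree * (1 + ‖t‖) ^ (N + 1) := by
        gcongr; exact hp t
    _ = C * (1 + ‖t‖) ^ (p.totalDegree + (N + 1)) := by rw [mul_assoc, ← pow_add]
    _ ≤ C * (1 + ‖t‖) ^ (4 * k + 2 * j) := by gcongr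
    _ = C / c ^ k * (1 + ‖t‖) ^ (2 * j) * (c ^ k * (1 + ‖t‖) ^ (4 * k)) := by
        rw [pow_add]; field_simp
    _ ≤ _ := by gcongr

variable (N) in
/-- An integrable weight. -/
def bracket (t : Fin N → ℝ) : ℝ := ((1 + ‖t‖) ^ (N + 1))⁻¹

variable (N) in
theorem integrable_bracket : Integrable (bracket N) := by
  have := integrable_one_add_norm (E := Fin N → ℝ) (μ := volume) (r := ((N + 1 : ℕ) : ℝ))
    (by simp)
  refine this.congr (Eventually.of_forall fun t => ?_)
  show (1 + ‖t‖) ^ (-((N + 1 : ℕ) : ℝ)) = _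
  rw [Real.rpow_neg (by positivity), Real.rpow_natCast]
  rfl

theorem norm_integrand_le (hq : PhaseGood q) (hs : DampGood s) {k j : ℕ}
    (hj : p.totalDegree + (N + 1) ≤ 4 * k + 2 * j) :
    ∃ C : ℝ, 0 ≤ C ∧ ∀ ε : ℝ, 0 < ε → ε ≤ 1 → ∀ t ∈ orthant N,
      ‖kern q s ε t * (amp q p k t : ℝ)‖ ≤ C * (ε⁻¹) ^ j * bracket N t := by
  obtain ⟨C, hC, ha⟩ := abs_amp_le hq hj
  obtain ⟨c, hc, hl⟩ := hs.lower
  obtain ⟨C', hC', he⟩ := exp_neg_bound hc j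
  refine ⟨C * C', by positivity, fun ε hε hε1 t ht => ?_⟩
  have h1 : 0 < 1 + ‖t‖ := by positivity
  rw [norm_mul, norm_kern, bracket, ← div_eq_mul_inv, le_div_iff₀ (by positivity),
    Complex.norm_real, Real.norm_eq_abs]
  have h2 : Real.exp (-(ε * eval t s)) ≤ Real.exp (-(ε * (c * ‖t‖ ^ 2))) := by
    gcongr; exact hl t ht
  calc _ ≤ Real.exp (-(ε * (c * ‖t‖ ^ 2))) * (|amp q p k t| * (1 + ‖t‖) ^ (N + 1)) := by
        rw [mul_assoc]
        gcongr
    _ ≤ Real.exp (-(ε * (c * ‖t‖ ^ 2))) * (C * (1 + ‖t‖) ^ (2 * j)) := by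
        exact mul_le_mul_of_nonneg_left (ha t ht) (Real.exp_pos _).le
    _ = C * (Real.exp (-(ε * (c * ‖t‖ ^ 2))) * (1 + ‖t‖) ^ (2 * j)) := by ring
    _ ≤ C * (C' * (ε⁻¹) ^ j) := by exact mul_le_mul_of_nonneg_left (he ε ‖t‖ hε hε1 (norm_nonneg t)) hC
    _ = _ := by ring

theorem integrableOn_integrand (hq : PhaseGood q) (hs : DampGood s) (p : MvPolynomial (Fin N) ℝ)
    (k : ℕ) {ε : ℝ} (hε : 0 < ε) (hε1 : ε ≤ 1) :
    IntegrableOn (fun t => kern q s ε t * (amp q p k t : ℝ)) (orthant N) := by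
  obtain ⟨C, hC, h⟩ := norm_integrand_le (p := p) (k := k) (j := p.totalDegree + (N + 1)) hq hs
    (by omega)
  refine Integrable.mono' (Integrable.const_mul (integrable_bracket N).integrableOn (C * (ε⁻¹) ^ (p.totalDegree + (N + 1)))) ?_ ?_
  · have h1 := continuous_kern (q := q) (s := s) ε
    have h2 := continuous_amp (q := q) (p := p) k
    exact Continuous.aestronglyMeasurable (by fun_prop)
  · exact (ae_restrict_iff' (measurableSet_orthant N)).2
      (Eventually.of_forall fun t ht => h ε hε hε1 t ht)

theorem norm_oint_le (hq : PhaseGood q) (hs : DampGood s) {k j : ℕ}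
    (hj : p.totalDegree + (N + 1) ≤ 4 * k + 2 * j) :
    ∃ C : ℝ, 0 ≤ C ∧ ∀ ε : ℝ, 0 < ε → ε ≤ 1 → ‖oint q s p k ε‖ ≤ C * (ε⁻¹) ^ j := by
  obtain ⟨C, hC, h⟩ := norm_integrand_le (p := p) hq hs hj
  have hb : 0 ≤ ∫ t in orthant N, bracket N t :=
    integral_nonneg fun t => by unfold bracket; positivity
  refine ⟨C * ∫ t in orthant N, bracket N t, by positivity, fun ε hε hε1 => ?_⟩
  refine (norm_integral_le_of_norm_le
    ((integrable_bracket N).integrableOn.const_mul (C * (ε⁻¹) ^ j))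
    ((ae_restrict_iff' (measurableSet_orthant N)).2
      (Eventually.of_forall fun t ht => h ε hε hε1 t ht))).trans ?_
  rw [integral_const_mul]
  exact le_of_eq (by ring)

theorem tendsto_oint_of_amp_integrable (hq : PhaseGood q) (hs : DampGood s) {k : ℕ}
    (hj : p.totalDegree + (N + 1) ≤ 4 * k) :
    Tendsto (oint q s p k) (𝓝[>] 0)
      (𝓝 (∫ t in orthant N, kern q 0 0 t * (amp q p k t : ℝ))) := by
  obtain ⟨C, hC, h⟩ := norm_integrand_le (p := p) (j := 0) hq hs (by omega : _ ≤ 4 * k + 2 * 0)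
  have hε1 : ∀ᶠ ε : ℝ in 𝓝[>] 0, 0 < ε ∧ ε ≤ 1 := by
    filter_upwards [Ioc_mem_nhdsGT (zero_lt_one' ℝ)] with ε hε using hε
  refine tendsto_integral_filter_of_dominated_convergence (fun t => C * bracket N t) ?_ ?_
    ((integrable_bracket N).integrableOn.const_mul C) ?_
  · refine Eventually.of_forall fun ε => ?_
    have h1 := continuous_kern (q := q) (s := s) ε
    have h2 := continuous_amp (q := q) (p := p) k
    exact Continuous.aestronglyMeasurable (by fun_prop)
  · filter_upwards [hε1] with ε hε
    exact (ae_restrict_iff' (measurableSet_orthant N)).2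
      (Eventually.of_forall fun t ht => by simpa using h ε hε.1 hε.2 t ht)
  · refine Eventually.of_forall fun t => ?_
    refine Tendsto.mul_const _ ?_
    have : Continuous fun ε : ℝ => kern q s ε t := by unfold kern; fun_prop
    have h1 := this.tendsto 0
    have h2 : kern q s 0 t = kern q 0 0 t := by simp [kern]
    rw [h2] at h1
    exact h1.mono_left nhdsWithin_le_nhds

end PolyChain

end

section

open MvPolynomial Filter Topology

namespace PolyChain

variable {N : ℕ} {q s p : MvPolynomial (Fin N) ℝ}

theorem hasLineDerivAt_kern (ε : ℝ) (t : Fin N → ℝ) (i : Fin N) :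
    HasLineDerivAt ℝ (kern q s ε) (kern q s ε t *
      (Complex.I * (eval t (pderiv i q) : ℝ) - (ε * eval t (pderiv i s) : ℝ))) t
      (Pi.single i 1) := by
  have h1 := hasLineDerivAt_mvPolynomial q t i
  have h2 := hasLineDerivAt_mvPolynomial s t i
  unfold HasLineDerivAt at h1 h2 ⊢
  have h3 := ((h1.ofReal_comp.const_mul Complex.I).sub (h2.const_mul ε).ofReal_comp).cexp
  refine h3.congr_deriv ?_
  simp [kern]

variable (q) in
/-- The polynomial occurring as numerator of a derivative of an amplitude. -/
def dnum (p : MvPolynomial (Fin N) ℝ) (k : ℕ) (i : Fin N) : MvPolynomial (Fin N) ℝ :=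
  pderiv i p * (1 + vfd q q) - C (k : ℝ) * (p * pderiv i (vfd q q))

theorem hasLineDerivAt_amp (k : ℕ) (t : Fin N → ℝ) (i : Fin N) :
    HasLineDerivAt ℝ (amp q p k) (amp q (dnum q p k i) (k + 1) t) t (Pi.single i 1) := by
  have h1 := hasLineDerivAt_mvPolynomial p t i
  have h2 := hasLineDerivAt_mvPolynomial (1 + vfd q q) t i
  have hpos : 0 < 1 + eval t (vfd q q) := by linarith [eval_vfd_self_nonneg (q := q) t]
  unfold HasLineDerivAt at h1 h2 ⊢
  have h3 := h1.div (h2.pow k) (by simpa using (pow_pos hpos k).ne')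
  simp only [map_add, map_one, zero_smul, add_zero, pderiv_one, zero_add] at h3
  refine h3.congr_deriv ?_
  simp only [amp, dnum, map_sub, map_mul, map_add, map_one, eval_C, Pi.pow_apply, zero_smul,
    add_zero]
  rw [div_eq_div_iff (by positivity) (by positivity)]
  rcases k with _ | k
  · simp
  · simp
    ring

theorem amp_add (p p' : MvPolynomial (Fin N) ℝ) (k : ℕ) (t : Fin N → ℝ) :
    amp q (p + p') k t = amp q p k t + amp q p' k t := by
  simp [amp, add_div]

theorem oint_add (hq : PhaseGood q) (hs : DampGood s) (p p' : MvPolynomial (Fin N) ℝ) (k : ℕ)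
    {ε : ℝ} (hε : 0 < ε) (hε1 : ε ≤ 1) :
    oint q s (p + p') k ε = oint q s p k ε + oint q s p' k ε := by
  unfold oint
  rw [← integral_add (integrableOn_integrand hq hs p k hε hε1)
    (integrableOn_integrand hq hs p' k hε hε1)]
  refine integral_congr_ae (Eventually.of_forall fun t => ?_)
  simp [amp_add, mul_add]

theorem oint_zero (k : ℕ) (ε : ℝ) : oint q s 0 k ε = 0 := by simp [oint, amp]

theorem oint_sum (hq : PhaseGood q) (hs : DampGood s) {ι : Type} (I : Finset ι)
    (p : ι → MvPolynomial (Fin N) ℝ) (k : ℕ) {ε : ℝ} (hε : 0 < ε) (hε1 : ε ≤ 1) :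
    oint q s (∑ i ∈ I, p i) k ε = ∑ i ∈ I, oint q s (p i) k ε := by
  induction I using Finset.cons_induction with
  | empty => simp [oint_zero]
  | cons a I ha ih => rw [Finset.sum_cons, Finset.sum_cons, oint_add hq hs _ _ _ hε hε1, ih]

theorem oint_vfd_self (hq : PhaseGood q) (hs : DampGood s) (p : MvPolynomial (Fin N) ℝ) (k : ℕ)
    {ε : ℝ} (hε : 0 < ε) (hε1 : ε ≤ 1) :
    oint q s (vfd q q * p) (k + 1) ε = oint q s p k ε - oint q s p (k + 1) ε := by
  unfold oint
  rw [← integral_sub (integrableOn_integrand hq hs p k hε hε1)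
    (integrableOn_integrand hq hs p (k + 1) hε hε1)]
  refine integral_congr_ae (Eventually.of_forall fun t => ?_)
  have hpos : 0 < 1 + eval t (vfd q q) := by linarith [eval_vfd_self_nonneg (q := q) t]
  have : amp q (vfd q q * p) (k + 1) t = amp q p k t - amp q p (k + 1) t := by
    simp only [amp, map_mul]
    field_simp
    ring
  simp only [this]
  push_cast
  ring

theorem oint_parts (hq : PhaseGood q) (hs : DampGood s) (p : MvPolynomial (Fin N) ℝ) (k : ℕ)
    {ε : ℝ} (hε : 0 < ε) (hε1 : ε ≤ 1) (i : Fin N) :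
    Complex.I * oint q s (vf q i * pderiv i q * p) k ε - ε * oint q s (vf q i * pderiv i s * p) k ε
      + oint q s (dnum q (vf q i * p) k i) (k + 1) ε = 0 := by
  have h1 := integrableOn_integrand hq hs (vf q i * pderiv i q * p) k hε hε1
  have h2 := integrableOn_integrand hq hs (vf q i * pderiv i s * p) k hε hε1
  have h3 := integrableOn_integrand hq hs (dnum q (vf q i * p) k i) (k + 1) hε hε1
  have h4 := integrableOn_integrand hq hs (vf q i * p) k hε hε1
  have h5 := ((h1.const_mul Complex.I).sub (h2.const_mul (ε : ℂ))).add h3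
  have key := integral_lineDeriv_orthant i (G := fun t => kern q s ε t * (amp q (vf q i * p) k t : ℝ))
    (G' := fun t => Complex.I * (kern q s ε t * (amp q (vf q i * pderiv i q * p) k t : ℝ)) -
      ε * (kern q s ε t * (amp q (vf q i * pderiv i s * p) k t : ℝ)) +
      kern q s ε t * (amp q (dnum q (vf q i * p) k i) (k + 1) t : ℝ)) ?_ ?_ h4 h5
  · have e1 := integral_add ((h1.const_mul Complex.I).sub (h2.const_mul (ε : ℂ))) h3
    have e2 := integral_sub (h1.const_mul Complex.I) (h2.const_mul (ε : ℂ))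
    rw [integral_const_mul, integral_const_mul] at e2
    refine Eq.trans ?_ key
    refine Eq.trans ?_ e1.symm
    refine congrArg₂ (· + ·) e2.symm rfl
  · intro t
    have h6 := hasLineDerivAt_kern (q := q) (s := s) ε t i
    have h7 := hasLineDerivAt_amp (q := q) (p := vf q i * p) k t i
    unfold HasLineDerivAt at h6 h7 ⊢
    refine (h6.mul h7.ofReal_comp).congr_deriv ?_
    simp only [zero_smul, add_zero, amp, map_mul]
    push_cast
    ring
  · intro t ht
    have h8 : eval t (vf q i) = 0 := by simp [vf, ht]
    simp [amp, dnum, h8]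
    simp [vf, pderiv_mul, ht]

theorem oint_step (hq : PhaseGood q) (hs : DampGood s) (p : MvPolynomial (Fin N) ℝ) (k : ℕ)
    {ε : ℝ} (hε : 0 < ε) (hε1 : ε ≤ 1) :
    oint q s p k ε = oint q s p (k + 1) ε - Complex.I * (ε * oint q s (vfd q s * p) (k + 1) ε)
      + Complex.I * oint q s (∑ i, dnum q (vf q i * p) (k + 1) i) (k + 2) ε := by
  have h := Finset.sum_eq_zero fun i (_ : i ∈ Finset.univ) =>
    oint_parts hq hs p (k + 1) hε hε1 i
  rw [Finset.sum_add_distrib, Finset.sum_sub_distrib, ← Finset.mul_sum, ← Finset.mul_sum,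
    ← oint_sum hq hs _ _ _ hε hε1, ← oint_sum hq hs _ _ _ hε hε1, ← oint_sum hq hs _ _ _ hε hε1,
    ← Finset.sum_mul, ← Finset.sum_mul] at h
  have h' := oint_vfd_self hq hs p k hε hε1
  change Complex.I * oint q s (vfd q q * p) (k + 1) ε - ε * oint q s (vfd q s * p) (k + 1) ε + _ = 0
    at h
  rw [h'] at h
  linear_combination (-Complex.I) * h - (oint q s p (k + 1) ε - oint q s p k ε) * Complex.I_sq

theorem totalDegree_dnum_le (hq : PhaseGood q) (p : MvPolynomial (Fin N) ℝ) (k : ℕ) :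
    (∑ i, dnum q (vf q i * p) k i).totalDegree ≤ p.totalDegree + 6 := by
  refine totalDegree_finsetSum_le fun i _ => ?_
  have h1 := totalDegree_vfd_le hq.deg hq.deg
  have h2 := totalDegree_vf_le hq.deg i
  have h3 := totalDegree_mul (vf q i) p
  have h4 := totalDegree_pderiv_le i (vf q i * p)
  have h5 := totalDegree_pderiv_le i (vfd q q)
  have h6 : (1 + vfd q q).totalDegree ≤ 4 := by
    refine (totalDegree_add _ _).trans ?_
    simp [h1]
  refine (totalDegree_sub _ _).trans (max_le ?_ ?_)
  · have := totalDegree_mul (pderiv i (vf q i * p)) (1 + vfd q q)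
    omega
  · have h7 := totalDegree_mul (C (k : ℝ)) (vf q i * p * pderiv i (vfd q q))
    have h8 := totalDegree_mul (vf q i * p) (pderiv i (vfd q q))
    rw [totalDegree_C] at h7
    omega

theorem eventually_pos_le_one : ∀ᶠ ε : ℝ in 𝓝[>] 0, 0 < ε ∧ ε ≤ 1 := by
  filter_upwards [Ioc_mem_nhdsGT (zero_lt_one' ℝ)] with ε hε using hε

theorem tendsto_ofReal_nhdsGT : Tendsto (fun ε : ℝ => (ε : ℂ)) (𝓝[>] 0) (𝓝 0) :=
  (Complex.continuous_ofReal.tendsto' 0 0 (by simp)).mono_left nhdsWithin_le_nhds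

/-- **Abel summability of oscillating integrals over an orthant**, with a limit that does not
depend on the damping. -/
theorem exists_tendsto_oint (hq : PhaseGood q) (j : ℕ) : ∀ (p : MvPolynomial (Fin N) ℝ) (k : ℕ),
    p.totalDegree + (N + 1) ≤ 4 * k + 2 * j →
    ∃ L : ℂ, ∀ s, DampGood s → Tendsto (oint q s p k) (𝓝[>] 0) (𝓝 L) := by
  induction j with
  | zero => exact fun p k h => ⟨_, fun s hs => tendsto_oint_of_amp_integrable hq hs (by omega)⟩
  | succ j ih =>
    have hdec : ∀ s, DampGood s → ∀ d ≤ j + 1, ∀ K, K + d = j + 2 →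
        ∀ (p : MvPolynomial (Fin N) ℝ) (k : ℕ), p.totalDegree + (N + 1) ≤ 4 * k + 2 * (j + 1) →
        Tendsto (fun ε : ℝ => (ε : ℂ) ^ K * oint q s p k ε) (𝓝[>] 0) (𝓝 0) := by
      intro s hs d
      induction d with
      | zero =>
        intro _ K hK p k hpk
        obtain ⟨C, hC, hb⟩ := norm_oint_le (p := p) hq hs hpk
        have hlim : Tendsto (fun ε : ℝ => C * ε) (𝓝[>] 0) (𝓝 0) := by
          have : Continuous fun ε : ℝ => C * ε := by fun_prop
          exact (this.tendsto' 0 0 (by simp)).mono_left nhdsWithin_le_nhds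
        refine squeeze_zero_norm' ?_ hlim
        filter_upwards [eventually_pos_le_one] with ε hε
        have hK' : K = j + 1 + 1 := by omega
        rw [norm_mul, norm_pow, Complex.norm_real, Real.norm_eq_abs, abs_of_pos hε.1, hK']
        calc _ ≤ ε ^ (j + 1 + 1) * (C * (ε⁻¹) ^ (j + 1)) := by
              gcongr
              · exact pow_nonneg hε.1.le _
              · exact hb ε hε.1 hε.2
          _ = C * ε := by
              have := hε.1.ne'
              rw [pow_succ ε (j + 1), inv_pow]
              field_simp
      | succ d ihd =>
        intro hd K hK p k hpk
        have hK1 : K ≠ 0 := by omega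
        obtain ⟨L1, hL1⟩ := ih p (k + 1) (by omega)
        obtain ⟨L2, hL2⟩ := ih (∑ i, dnum q (vf q i * p) (k + 1) i) (k + 2)
          (by have := totalDegree_dnum_le hq p (k + 1); omega)
        have h3 := ihd (by omega) (K + 1) (by omega) (vfd q s * p) (k + 1)
          (by
            have h1 := totalDegree_mul (vfd q s) p
            have h2 := totalDegree_vfd_le hq.deg hs.deg
            omega)
        have hε := tendsto_ofReal_nhdsGT.pow K
        rw [zero_pow hK1] at hε
        have hlim := ((hε.mul (hL1 s hs)).sub (h3.const_mul Complex.I)).add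
          ((hε.mul (hL2 s hs)).const_mul Complex.I)
        simp only [zero_mul, mul_zero, sub_zero, add_zero] at hlim
        refine hlim.congr' ?_
        filter_upwards [eventually_pos_le_one] with ε hε
        rw [oint_step hq hs p k hε.1 hε.2]
        ring
    intro p k hpk
    obtain ⟨L1, hL1⟩ := ih p (k + 1) (by omega)
    obtain ⟨L2, hL2⟩ := ih (∑ i, dnum q (vf q i * p) (k + 1) i) (k + 2)
      (by have := totalDegree_dnum_le hq p (k + 1); omega)
    refine ⟨L1 - Complex.I * 0 + Complex.I * L2, fun s hs => ?_⟩
    have h3 := hdec s hs (j + 1) le_rfl 1 (by omega) (vfd q s * p) (k + 1)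
      (by
        have h1 := totalDegree_mul (vfd q s) p
        have h2 := totalDegree_vfd_le hq.deg hs.deg
        omega)
    have hlim := ((hL1 s hs).sub (h3.const_mul Complex.I)).add ((hL2 s hs).const_mul Complex.I)
    refine hlim.congr' ?_
    filter_upwards [eventually_pos_le_one] with ε hε
    rw [oint_step hq hs p k hε.1 hε.2, pow_one]

theorem exists_tendsto_integral_kern (hq : PhaseGood q) : ∃ L : ℂ, ∀ s, DampGood s →
    Tendsto (fun ε => ∫ t in orthant N, kern q s ε t) (𝓝[>] 0) (𝓝 L) := by
  obtain ⟨L, hL⟩ := exists_tendsto_oint hq (N + 1) 1 0 (by simp)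
  refine ⟨L, fun s hs => (hL s hs).congr fun ε => ?_⟩
  simp [oint, amp]

theorem integrableOn_kern (hs : DampGood s) (hq : PhaseGood q) {ε : ℝ} (hε : 0 < ε) (hε1 : ε ≤ 1) :
    IntegrableOn (kern q s ε) (orthant N) := by
  simpa [amp] using integrableOn_integrand hq hs 1 0 hε hε1

end PolyChain

end

section

open MvPolynomial Filter Topology

namespace PolyChain

variable {N : ℕ}

theorem exists_lower_bound_of_homogeneous {f : (Fin N → ℝ) → ℝ} (hf : Continuous f) (d : ℕ)
    (hd : ∀ (r : ℝ) t, f (r • t) = r ^ d * f t)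
    (hpos : ∀ t : Fin N → ℝ, (∀ i, 0 ≤ t i) → t ≠ 0 → 0 < f t) :
    ∃ c : ℝ, 0 < c ∧ ∀ t : Fin N → ℝ, (∀ i, 0 ≤ t i) → t ≠ 0 → c * ‖t‖ ^ d ≤ f t := by
  let s : Set (Fin N → ℝ) := Metric.sphere 0 1 ∩ {t | ∀ i, 0 ≤ t i}
  have hs : IsCompact s := by
    refine (isCompact_sphere 0 1).inter_right ?_
    have : {t : Fin N → ℝ | ∀ i, 0 ≤ t i} = ⋂ i, {t | 0 ≤ t i} := by ext t; simp
    rw [this]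
    exact isClosed_iInter fun i => isClosed_le continuous_const (continuous_apply i)
  have hne : ∀ t ∈ s, t ≠ 0 := by
    rintro t ht rfl
    simpa using ht.1
  have hsc : ∀ t : Fin N → ℝ, (∀ i, 0 ≤ t i) → t ≠ 0 → ‖t‖⁻¹ • t ∈ s := fun t ht ht0 => by
    refine ⟨?_, fun i => ?_⟩
    · simp [norm_smul, ht0]
    · simp only [Pi.smul_apply, smul_eq_mul]
      exact mul_nonneg (by positivity) (ht i)
  rcases s.eq_empty_or_nonempty with he | hn
  · refine ⟨1, one_pos, fun t ht ht0 => ?_⟩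
    have := hsc t ht ht0
    rw [he] at this
    exact this.elim
  · obtain ⟨t₀, ht₀, hmin⟩ := hs.exists_isMinOn hn hf.continuousOn
    refine ⟨f t₀, hpos _ ht₀.2 (hne _ ht₀), fun t ht ht0 => ?_⟩
    have h1 : f t₀ ≤ f (‖t‖⁻¹ • t) := hmin (hsc t ht ht0)
    have h2 : 0 < ‖t‖ := norm_pos_iff.2 ht0
    rw [hd, inv_pow, ← div_eq_inv_mul, le_div_iff₀ (by positivity)] at h1
    exact h1

/-- Linear combinations of a family of vectors in `ℝ^N`. -/
def comb (σ : Fin N → Fin N → ℝ) : (Fin N → ℝ) →ₗ[ℝ] (Fin N → ℝ) :=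
  Matrix.toLin' (Matrix.of σ)ᵀ

theorem comb_apply (σ : Fin N → Fin N → ℝ) (t : Fin N → ℝ) : comb σ t = ∑ j, t j • σ j := by
  ext k
  simp [comb, Matrix.mulVec, dotProduct, mul_comm]

theorem det_comb (σ : Fin N → Fin N → ℝ) : LinearMap.det (comb σ) = (Matrix.of σ).det := by
  rw [comb, LinearMap.det_toLin', Matrix.det_transpose]

theorem comb_injective {σ : Fin N → Fin N → ℝ} (hσ : LinearIndependent ℝ σ) :
    Function.Injective (comb σ) := by
  intro t t' h
  rw [comb_apply, comb_apply] at h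
  exact linearIndependent_iff_injective_fintypeLinearCombination.1 hσ (by
    simpa [Fintype.linearCombination_apply] using h)

/-- The open simplicial cone spanned by a family of vectors. -/
def icone (σ : Fin N → Fin N → ℝ) : Set (Fin N → ℝ) := comb σ '' orthant N

theorem measurableSet_icone {σ : Fin N → Fin N → ℝ} (hσ : LinearIndependent ℝ σ) :
    MeasurableSet (icone σ) :=
  (measurableSet_orthant N).image_of_continuousOn_injOn
    (comb σ).continuous_of_finiteDimensional.continuousOn (comb_injective hσ).injOn

theorem setIntegral_icone {σ : Fin N → Fin N → ℝ} (hσ : LinearIndependent ℝ σ)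
    (g : (Fin N → ℝ) → ℂ) :
    ∫ x in icone σ, g x = |(Matrix.of σ).det| • ∫ t in orthant N, g (comb σ t) := by
  have h := integral_image_eq_integral_abs_det_fderiv_smul volume (measurableSet_orthant N)
    (f := comb σ) (f' := fun _ => (comb σ).toContinuousLinearMap)
    (fun x _ => (comb σ).toContinuousLinearMap.hasFDerivAt.hasFDerivWithinAt)
    (comb_injective hσ).injOn g
  rw [icone, h, ← integral_smul]
  simp only [LinearMap.det_toContinuousLinearMap, det_comb]

theorem integrableOn_icone {σ : Fin N → Fin N → ℝ} (hσ : LinearIndependent ℝ σ)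
    {g : (Fin N → ℝ) → ℂ} (hg : IntegrableOn (fun t => g (comb σ t)) (orthant N)) :
    IntegrableOn g (icone σ) := by
  refine (integrableOn_image_iff_integrableOn_abs_det_fderiv_smul volume (measurableSet_orthant N)
    (f := comb σ) (f' := fun _ => (comb σ).toContinuousLinearMap)
    (fun x _ => (comb σ).toContinuousLinearMap.hasFDerivAt.hasFDerivWithinAt)
    (comb_injective hσ).injOn g).2 ?_
  exact hg.smul _

/-- The quadratic polynomial of a bilinear form in the coordinates of a simplicial cone. -/
def qpoly (B : LinearMap.BilinForm ℝ (Fin N → ℝ)) (σ : Fin N → Fin N → ℝ) :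
    MvPolynomial (Fin N) ℝ :=
  ∑ i, ∑ j, C (B (σ i) (σ j)) * (X i * X j)

variable {B : LinearMap.BilinForm ℝ (Fin N → ℝ)} {σ : Fin N → Fin N → ℝ}

theorem eval_qpoly (t : Fin N → ℝ) : eval t (qpoly B σ) = B (comb σ t) (comb σ t) := by
  simp only [qpoly, comb_apply, map_sum, map_mul, eval_C, eval_X, map_smul, LinearMap.sum_apply,
    LinearMap.smul_apply, smul_eq_mul, Finset.mul_sum]
  rw [Finset.sum_comm]
  refine Finset.sum_congr rfl fun i _ => Finset.sum_congr rfl fun j _ => ?_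
  ring

theorem totalDegree_qpoly_le : (qpoly B σ).totalDegree ≤ 2 := by
  refine totalDegree_finsetSum_le fun i _ => totalDegree_finsetSum_le fun j _ => ?_
  have h1 := totalDegree_mul (C (B (σ i) (σ j))) (X i * X j : MvPolynomial (Fin N) ℝ)
  have h2 := totalDegree_mul (X i : MvPolynomial (Fin N) ℝ) (X j)
  rw [totalDegree_C] at h1
  rw [totalDegree_X, totalDegree_X] at h2
  omega

theorem eval_pderiv_qpoly (hs : ∀ x y, B x y = B y x) (t : Fin N → ℝ) (k : Fin N) :
    eval t (pderiv k (qpoly B σ)) = 2 * B (comb σ t) (σ k) := by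
  have h1 := hasLineDerivAt_mvPolynomial (qpoly B σ) t k
  unfold HasLineDerivAt at h1
  have hc : comb σ (Pi.single k 1) = σ k := by
    rw [comb_apply]
    simp [Pi.single_apply]
  have h2 : (fun h : ℝ => eval (t + h • (Pi.single k (1 : ℝ) : Fin N → ℝ)) (qpoly B σ)) =
      fun h => B (comb σ t) (comb σ t) + (h * (2 * B (comb σ t) (σ k)) + h ^ 2 * B (σ k) (σ k)) := by
    funext h
    rw [eval_qpoly, map_add, map_smul, hc]
    simp only [map_add, map_smul, LinearMap.add_apply, LinearMap.smul_apply, smul_eq_mul]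
    rw [hs (σ k) (comb σ t)]
    ring
  rw [h2] at h1
  have h3 : HasDerivAt (fun h : ℝ => B (comb σ t) (comb σ t) + (h * (2 * B (comb σ t) (σ k)) +
      h ^ 2 * B (σ k) (σ k))) (2 * B (comb σ t) (σ k)) 0 := by
    have := (((hasDerivAt_id (0 : ℝ)).mul_const (2 * B (comb σ t) (σ k))).add
      ((hasDerivAt_pow 2 (0 : ℝ)).mul_const (B (σ k) (σ k)))).const_add (B (comb σ t) (comb σ t))
    simpa using this
  exact h1.unique h3

theorem phaseGood_qpoly (hs : ∀ x y, B x y = B y x) (hσ : σ ∈ (goodCones B).carrier N) :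
    PhaseGood (qpoly B σ) := by
  refine ⟨totalDegree_qpoly_le, ?_⟩
  have hv : ∀ t, eval t (vfd (qpoly B σ) (qpoly B σ)) =
      ∑ i, (t i) ^ 2 * (2 * B (comb σ t) (σ i)) ^ 2 := fun t => by
    simp only [vfd, vf, map_sum, map_mul, map_pow, eval_X, eval_pderiv_qpoly hs]
    exact Finset.sum_congr rfl fun i _ => by ring
  obtain ⟨c, hc, h⟩ := exists_lower_bound_of_homogeneous
    (f := fun t => eval t (vfd (qpoly B σ) (qpoly B σ))) (MvPolynomial.continuous_eval _) 4
    (fun r t => by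
      simp only [hv, map_smul, LinearMap.smul_apply, Pi.smul_apply, smul_eq_mul, Finset.mul_sum]
      exact Finset.sum_congr rfl fun i _ => by ring)
    (fun t ht ht0 => by
      rw [hv]
      obtain ⟨i, hi, hi'⟩ := hσ.2 t ht ht0
      rw [← comb_apply] at hi'
      refine Finset.sum_pos' (fun j _ => by positivity) ⟨i, Finset.mem_univ _, ?_⟩
      positivity)
  refine ⟨min 1 c / 8, by positivity, fun t ht => ?_⟩
  by_cases ht0 : t = 0
  · subst ht0
    have := eval_vfd_self_nonneg (q := qpoly B σ) 0
    have h1 : min 1 c ≤ 1 := min_le_left _ _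
    simp only [norm_zero, add_zero, one_pow, mul_one]
    linarith
  · have h1 := h t (fun i => (ht i).le) ht0
    have h2 : (1 + ‖t‖) ^ 4 ≤ 8 * (1 + ‖t‖ ^ 4) := by
      nlinarith [sq_nonneg (‖t‖ - 1), sq_nonneg (‖t‖ ^ 2 - 1), sq_nonneg (‖t‖ ^ 2 - ‖t‖),
        norm_nonneg t]
    have h3 : min 1 c ≤ 1 := min_le_left _ _
    have h4 : min 1 c * ‖t‖ ^ 4 ≤ c * ‖t‖ ^ 4 := by gcongr; exact min_le_right _ _
    have h5 : 0 ≤ min 1 c / 8 := by positivity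
    nlinarith [mul_le_mul_of_nonneg_left h2 h5]

theorem dampGood_qpoly (hpos : ∀ t : Fin N → ℝ, (∀ i, 0 ≤ t i) → t ≠ 0 →
    0 < B (comb σ t) (comb σ t)) : DampGood (qpoly B σ) := by
  refine ⟨totalDegree_qpoly_le, ?_⟩
  obtain ⟨c, hc, h⟩ := exists_lower_bound_of_homogeneous
    (f := fun t => eval t (qpoly B σ)) (MvPolynomial.continuous_eval _) 2
    (fun r t => by
      simp only [eval_qpoly, map_smul, LinearMap.smul_apply, smul_eq_mul]
      ring)
    (fun t ht ht0 => by rw [eval_qpoly]; exact hpos t ht ht0)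
  refine ⟨c, hc, fun t ht => ?_⟩
  by_cases ht0 : t = 0
  · subst ht0
    rw [eval_qpoly]
    simp
  · exact h t (fun i => (ht i).le) ht0

/-- The damped oscillating kernel attached to a pair of bilinear forms. -/
def bkern (B S : LinearMap.BilinForm ℝ (Fin N → ℝ)) (ε : ℝ) (x : Fin N → ℝ) : ℂ :=
  Complex.exp (Complex.I * (B x x : ℝ) - (ε * S x x : ℝ))

theorem bkern_comb (B S : LinearMap.BilinForm ℝ (Fin N → ℝ)) (ε : ℝ) (σ : Fin N → Fin N → ℝ)
    (t : Fin N → ℝ) : bkern B S ε (comb σ t) = kern (qpoly B σ) (qpoly S σ) ε t := by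
  rw [bkern, kern, eval_qpoly, eval_qpoly]

open Classical in
/-- The Abel regularized integral over the orthant of the exponential of a good phase. -/
def abelLimit (q : MvPolynomial (Fin N) ℝ) : ℂ :=
  if h : PhaseGood q then (exists_tendsto_integral_kern h).choose else 0

theorem tendsto_abelLimit {q s : MvPolynomial (Fin N) ℝ} (hq : PhaseGood q) (hs : DampGood s) :
    Tendsto (fun ε => ∫ t in orthant N, kern q s ε t) (𝓝[>] 0) (𝓝 (abelLimit q)) := by
  rw [abelLimit, dif_pos hq]
  exact (exists_tendsto_integral_kern hq).choose_spec s hs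

theorem tendsto_setIntegral_bkern (hs : ∀ x y, B x y = B y x) (hσ : σ ∈ (goodCones B).carrier N)
    {S : LinearMap.BilinForm ℝ (Fin N → ℝ)} (hpos : ∀ t : Fin N → ℝ, (∀ i, 0 ≤ t i) → t ≠ 0 →
      0 < S (comb σ t) (comb σ t)) :
    Tendsto (fun ε => ∫ x in icone σ, bkern B S ε x) (𝓝[>] 0)
      (𝓝 (|(Matrix.of σ).det| • abelLimit (qpoly B σ))) := by
  refine ((tendsto_abelLimit (phaseGood_qpoly hs hσ) (dampGood_qpoly hpos)).const_smul
    |(Matrix.of σ).det|).congr fun ε => ?_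
  rw [setIntegral_icone hσ.1]
  simp only [bkern_comb]

theorem integrableOn_bkern (hs : ∀ x y, B x y = B y x) (hσ : σ ∈ (goodCones B).carrier N)
    {S : LinearMap.BilinForm ℝ (Fin N → ℝ)} (hpos : ∀ t : Fin N → ℝ, (∀ i, 0 ≤ t i) → t ≠ 0 →
      0 < S (comb σ t) (comb σ t)) {ε : ℝ} (hε : 0 < ε) (hε1 : ε ≤ 1) :
    IntegrableOn (bkern B S ε) (icone σ) := by
  refine integrableOn_icone hσ.1 ?_
  simp only [bkern_comb]
  exact integrableOn_kern (dampGood_qpoly hpos) (phaseGood_qpoly hs hσ) hε hε1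

end PolyChain

end

section Functional

open MvPolynomial Filter Topology

namespace PolyChain

variable {n : ℕ}

theorem exists_frame {x : Fin (n + 1) → ℝ} (hx : x ≠ 0) :
    ∃ w : Fin (n + 1) → Fin (n + 1) → ℝ, LinearIndependent ℝ w ∧ w 0 = x := by
  have he : (Pi.single 0 1 : Fin (n + 1) → ℝ) ≠ 0 := by simp
  obtain ⟨A, hA⟩ := SeparatingDual.exists_continuousLinearEquiv_apply_eq (R := ℝ) he hx
  refine ⟨fun i => A (Pi.single i 1), ?_, hA⟩
  have := (Pi.basisFun ℝ (Fin (n + 1))).linearIndependent.map' A.toLinearEquiv.toLinearMap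
    A.toLinearEquiv.ker
  have e : (fun i => A (Pi.single i 1)) = (A.toLinearEquiv.toLinearMap : (Fin (n + 1) → ℝ) → _) ∘
      ⇑(Pi.basisFun ℝ (Fin (n + 1))) := by
    funext i
    simp
  rw [e]
  exact this

open Classical in
/-- A choice of a frame starting with a given nonzero vector. -/
def frame (x : Fin (n + 1) → ℝ) : Fin (n + 1) → Fin (n + 1) → ℝ :=
  if h : x ≠ 0 then (exists_frame h).choose else 0

theorem frame_indep {x : Fin (n + 1) → ℝ} (hx : x ≠ 0) : LinearIndependent ℝ (frame x) := by
  rw [frame, dif_pos hx]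
  exact (exists_frame hx).choose_spec.1

theorem frame_zero {x : Fin (n + 1) → ℝ} (hx : x ≠ 0) : frame x 0 = x := by
  rw [frame, dif_pos hx]
  exact (exists_frame hx).choose_spec.2

/-- The value of a chain of top degree at a point. -/
def germVal (T : PF (Fin (n + 1) → ℝ) (n + 1)) (x : Fin (n + 1) → ℝ) : ℚ :=
  T (frame x) * sg (frame x)

variable {σ : Fin (n + 1) → Fin (n + 1) → ℝ}

theorem mem_icone_comb {N : ℕ} {σ : Fin N → Fin N → ℝ} (hσ : LinearIndependent ℝ σ)
    {t : Fin N → ℝ} : comb σ t ∈ icone σ ↔ ∀ i, 0 < t i :=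
  (comb_injective hσ).mem_set_image

theorem ev_mul_sg (hσ : LinearIndependent ℝ σ) {t : Fin (n + 1) → ℝ} (ht : ∀ i, t i ≠ 0)
    {w : Fin (n + 1) → Fin (n + 1) → ℝ} (hw : LinearIndependent ℝ w) (h0 : w 0 = comb σ t) :
    ev σ w * sg w = (icone σ).indicator (fun _ => sg σ) (comb σ t) := by
  classical
  obtain ⟨A, hA⟩ := exists_coords hσ w
  have hA0 : (fun i => A i 0) = t := by
    refine comb_injective hσ ?_
    rw [comb_apply, ← hA 0, h0]
  have hlex : ∀ i, LexPos (A i) ↔ 0 < t i := fun i => by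
    have h0 : A i 0 = t i := congrFun hA0 i
    constructor
    · rintro ⟨k, hk, hk'⟩
      by_cases h : k = 0
      · rw [h, h0] at hk
        exact hk
      · exact absurd (h0 ▸ hk' 0 (Fin.pos_of_ne_zero h)) (ht i)
    · intro h
      exact ⟨0, h0 ▸ h, fun j hj => absurd hj (Fin.not_lt_zero j)⟩
  have hdet := sg_mul_self hw
  have hs := sg_mul_self hσ
  rw [ev_of' hσ hA, Set.indicator]
  simp only [hlex, mem_icone_comb hσ]
  split_ifs
  · have h1 := sg_eq_mul hA
    rw [h1] at hdet ⊢
    generalize (SignType.sign (Matrix.of A).det : ℚ) = d at *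
    have h2 : d * d = 1 := by linear_combination hdet - d * d * hs
    linear_combination sg σ * h2
  · ring

theorem germVal_ev (hσ : LinearIndependent ℝ σ) {t : Fin (n + 1) → ℝ} (ht : ∀ i, t i ≠ 0) :
    germVal (ev σ) (comb σ t) = (icone σ).indicator (fun _ => sg σ) (comb σ t) := by
  have hx : comb σ t ≠ 0 := fun h => by
    have := comb_injective hσ (h.trans (map_zero _).symm)
    exact ht 0 (congrFun this 0)
  exact ev_mul_sg hσ ht (frame_indep hx) (frame_zero hx)

/-- The points with no vanishing coordinate in the basis `σ`. -/
def genericSet {N : ℕ} (σ : Fin N → Fin N → ℝ) : Set (Fin N → ℝ) := comb σ '' {t | ∀ i, t i ≠ 0}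

theorem ae_generic {N : ℕ} {σ : Fin N → Fin N → ℝ} (hσ : LinearIndependent ℝ σ) :
    ∀ᵐ x : Fin N → ℝ, x ∈ genericSet σ := by
  have hsurj : Function.Surjective (comb σ) :=
    LinearMap.surjective_of_injective (comb_injective hσ)
  have h0 : volume (comb σ '' ⋃ i : Fin N, {t : Fin N → ℝ | t i = 0}) = 0 := by
    rw [Measure.addHaar_image_linearMap]
    have : volume (⋃ i : Fin N, {t : Fin N → ℝ | t i = 0}) = 0 := by
      refine measure_iUnion_null fun i => ?_
      rw [volume_pi]
      exact Measure.pi_hyperplane _ i 0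
    rw [this, mul_zero]
  refine (measure_eq_zero_iff_ae_notMem.1 h0).mono fun x hx => ?_
  obtain ⟨t, rfl⟩ := hsurj x
  refine ⟨t, fun i hi => hx ⟨t, Set.mem_iUnion.2 ⟨i, hi⟩, rfl⟩, rfl⟩

theorem germVal_ev_ae (hσ : LinearIndependent ℝ σ) :
    ∀ᵐ x, germVal (ev σ) x = (icone σ).indicator (fun _ => sg σ) x := by
  refine (ae_generic hσ).mono ?_
  rintro x ⟨t, ht, rfl⟩
  exact germVal_ev hσ ht

theorem germVal_sum_ae {s : Finset (Fin (n + 1) → Fin (n + 1) → ℝ)}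
    {b : (Fin (n + 1) → Fin (n + 1) → ℝ) → ℚ} (hs : ∀ σ ∈ s, LinearIndependent ℝ σ) :
    ∀ᵐ x, germVal (∑ σ ∈ s, b σ • ev σ) x =
      ∑ σ ∈ s, (icone σ).indicator (fun _ => b σ * sg σ) x := by
  have h : ∀ᵐ x : Fin (n + 1) → ℝ, ∀ σ ∈ s,
      germVal (ev σ) x = (icone σ).indicator (fun _ => sg σ) x :=
    (Finset.eventually_all s).2 fun σ hσ => germVal_ev_ae (hs σ hσ)
  refine h.mono fun x hx => ?_
  rw [germVal, Finset.sum_apply, Finset.sum_mul]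
  refine Finset.sum_congr rfl fun σ hσ => ?_
  have := hx σ hσ
  rw [germVal] at this
  rw [Pi.smul_apply, smul_eq_mul, mul_assoc, this]
  by_cases hm : x ∈ icone σ <;> simp [hm]

variable {B S : LinearMap.BilinForm ℝ (Fin (n + 1) → ℝ)}

/-- The regularized oscillating integral of a chain. -/
def regInt (B S : LinearMap.BilinForm ℝ (Fin (n + 1) → ℝ)) (T : PF (Fin (n + 1) → ℝ) (n + 1))
    (ε : ℝ) : ℂ := ∫ x, ((germVal T x : ℚ) : ℂ) * bkern B S ε x

/-- The regularized volume of a simplicial cone. -/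
def coneVal {N : ℕ} (B : LinearMap.BilinForm ℝ (Fin N → ℝ)) (σ : Fin N → Fin N → ℝ) : ℂ :=
  |(Matrix.of σ).det| • abelLimit (qpoly B σ)

theorem comb_pos_of_pos {N : ℕ} {S : LinearMap.BilinForm ℝ (Fin N → ℝ)}
    (hpos : ∀ x, x ≠ 0 → 0 < S x x) {σ : Fin N → Fin N → ℝ} (hσ : LinearIndependent ℝ σ)
    (t : Fin N → ℝ) (_ : ∀ i, 0 ≤ t i) (ht : t ≠ 0) : 0 < S (comb σ t) (comb σ t) :=
  hpos _ fun h => ht (comb_injective hσ (h.trans (map_zero _).symm))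

theorem integral_sum_bkern (hs : ∀ x y, B x y = B y x) (hpos : ∀ x, x ≠ 0 → 0 < S x x)
    {s : Finset (Fin (n + 1) → Fin (n + 1) → ℝ)} {b : (Fin (n + 1) → Fin (n + 1) → ℝ) → ℚ}
    (hσ : ∀ σ ∈ s, σ ∈ (goodCones B).carrier (n + 1)) {ε : ℝ} (hε : 0 < ε) (hε1 : ε ≤ 1) :
    Integrable (fun x => ((germVal (∑ σ ∈ s, b σ • ev σ) x : ℚ) : ℂ) * bkern B S ε x) ∧
    regInt B S (∑ σ ∈ s, b σ • ev σ) ε =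
      ∑ σ ∈ s, ((b σ * sg σ : ℚ) : ℂ) * ∫ x in icone σ, bkern B S ε x := by
  have hae : (fun x => ((germVal (∑ σ ∈ s, b σ • ev σ) x : ℚ) : ℂ) * bkern B S ε x) =ᵐ[volume]
      fun x => ∑ σ ∈ s, ((b σ * sg σ : ℚ) : ℂ) * (icone σ).indicator (bkern B S ε) x := by
    refine (germVal_sum_ae (b := b) fun σ h => (hσ σ h).1).mono fun x hx => ?_
    simp only [hx, Rat.cast_sum, Finset.sum_mul]
    refine Finset.sum_congr rfl fun σ _ => ?_
    by_cases hm : x ∈ icone σ <;> simp [hm]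
  have hint_f : ∀ σ ∈ s, Integrable
      (fun x => ((b σ * sg σ : ℚ) : ℂ) * (icone σ).indicator (bkern B S ε) x) := fun σ h => by
    refine Integrable.const_mul ?_ _
    exact (integrable_indicator_iff (measurableSet_icone (hσ σ h).1)).2
      (integrableOn_bkern hs (hσ σ h) (comb_pos_of_pos hpos (hσ σ h).1) hε hε1)
  refine ⟨(integrable_finsetSum s hint_f).congr hae.symm, ?_⟩
  rw [regInt, integral_congr_ae hae, integral_finsetSum s hint_f]
  refine Finset.sum_congr rfl fun σ h => ?_
  rw [integral_const_mul, integral_indicator (measurableSet_icone (hσ σ h).1)]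

theorem tendsto_regInt_sum (hs : ∀ x y, B x y = B y x) (hpos : ∀ x, x ≠ 0 → 0 < S x x)
    {s : Finset (Fin (n + 1) → Fin (n + 1) → ℝ)} {b : (Fin (n + 1) → Fin (n + 1) → ℝ) → ℚ}
    (hσ : ∀ σ ∈ s, σ ∈ (goodCones B).carrier (n + 1)) :
    Tendsto (regInt B S (∑ σ ∈ s, b σ • ev σ)) (𝓝[>] 0)
      (𝓝 (∑ σ ∈ s, ((b σ * sg σ : ℚ) : ℂ) * coneVal B σ)) := by
  have h : Tendsto (fun ε => ∑ σ ∈ s, ((b σ * sg σ : ℚ) : ℂ) * ∫ x in icone σ, bkern B S ε x)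
      (𝓝[>] 0) (𝓝 (∑ σ ∈ s, ((b σ * sg σ : ℚ) : ℂ) * coneVal B σ)) :=
    tendsto_finsetSum s fun σ h => (tendsto_setIntegral_bkern hs (hσ σ h)
      (comb_pos_of_pos hpos (hσ σ h).1)).const_mul _
  refine h.congr' ?_
  filter_upwards [eventually_pos_le_one] with ε hε
  exact (integral_sum_bkern hs hpos hσ hε.1 hε.2).2.symm

theorem integrable_regInt (hs : ∀ x y, B x y = B y x) (hpos : ∀ x, x ≠ 0 → 0 < S x x)
    {T : PF (Fin (n + 1) → ℝ) (n + 1)} (hT : T ∈ (goodCones B).PC (n + 1)) {ε : ℝ} (hε : 0 < ε)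
    (hε1 : ε ≤ 1) : Integrable (fun x => ((germVal T x : ℚ) : ℂ) * bkern B S ε x) := by
  obtain ⟨s, b, h, rfl⟩ := (goodCones B).exists_rep hT
  exact (integral_sum_bkern hs hpos h hε hε1).1

theorem exists_tendsto_regInt (hs : ∀ x y, B x y = B y x) (hpos : ∀ x, x ≠ 0 → 0 < S x x)
    {T : PF (Fin (n + 1) → ℝ) (n + 1)} (hT : T ∈ (goodCones B).PC (n + 1)) :
    ∃ L, Tendsto (regInt B S T) (𝓝[>] 0) (𝓝 L) := by
  obtain ⟨s, b, h, rfl⟩ := (goodCones B).exists_rep hT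
  exact ⟨_, tendsto_regInt_sum hs hpos h⟩

/-- The regularized volume, as a functional on chains of good cones. -/
def regVol (hs : ∀ x y, B x y = B y x) (hpos : ∀ x, x ≠ 0 → 0 < S x x) :
    (goodCones B).PC (n + 1) →ₗ[ℚ] ℂ where
  toFun T := (exists_tendsto_regInt hs hpos T.2).choose
  map_add' T T' := by
    refine tendsto_nhds_unique (exists_tendsto_regInt hs hpos (T + T').2).choose_spec ?_
    refine ((exists_tendsto_regInt hs hpos T.2).choose_spec.add
      (exists_tendsto_regInt hs hpos T'.2).choose_spec).congr' ?_
    filter_upwards [eventually_pos_le_one] with ε hε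
    have h := integral_add (integrable_regInt hs hpos T.2 hε.1 hε.2)
      (integrable_regInt hs hpos T'.2 hε.1 hε.2)
    refine h.symm.trans (integral_congr_ae (Eventually.of_forall fun x => ?_))
    simp only [germVal, Submodule.coe_add, Pi.add_apply]
    push_cast
    ring
  map_smul' r T := by
    refine tendsto_nhds_unique (exists_tendsto_regInt hs hpos (r • T).2).choose_spec ?_
    rw [RingHom.id_apply, Rat.smul_def]
    refine ((exists_tendsto_regInt hs hpos T.2).choose_spec.const_mul _).congr fun ε => ?_
    rw [regInt, regInt, ← integral_const_mul]
    refine integral_congr_ae (Eventually.of_forall fun x => ?_)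
    simp only [germVal, Submodule.coe_smul, Pi.smul_apply, smul_eq_mul]
    push_cast
    ring

theorem regVol_eq (hs : ∀ x y, B x y = B y x) (hpos : ∀ x, x ≠ 0 → 0 < S x x)
    (T : (goodCones B).PC (n + 1)) {L : ℂ} (h : Tendsto (regInt B S T.1) (𝓝[>] 0) (𝓝 L)) :
    regVol hs hpos T = L :=
  tendsto_nhds_unique (exists_tendsto_regInt hs hpos T.2).choose_spec h

theorem regVol_ev (hs : ∀ x y, B x y = B y x) (hpos : ∀ x, x ≠ 0 → 0 < S x x)
    {σ : Fin (n + 1) → Fin (n + 1) → ℝ} (hσ : σ ∈ (goodCones B).carrier (n + 1)) :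
    regVol hs hpos ⟨ev σ, (goodCones B).ev_mem hσ⟩ = (sg σ : ℂ) * coneVal B σ := by
  have h := tendsto_regInt_sum hs hpos (s := {σ}) (b := fun _ => 1) (by simpa using hσ)
  simp only [Finset.sum_singleton, one_smul, one_mul] at h
  exact regVol_eq hs hpos _ h

theorem regVol_of_eq_const (hs : ∀ x y, B x y = B y x) (hpos : ∀ x, x ≠ 0 → 0 < S x x) {M : ℂ}
    (hM : Tendsto (fun ε => ∫ x, bkern B S ε x) (𝓝[>] 0) (𝓝 M)) (T : (goodCones B).PC (n + 1))
    {C : ℚ} (hC : ∀ w, LinearIndependent ℝ w → T.1 w = C * sg w) :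
    regVol hs hpos T = C • M := by
  refine regVol_eq hs hpos _ ?_
  rw [Rat.smul_def]
  refine (hM.const_mul _).congr fun ε => ?_
  rw [regInt, ← integral_const_mul]
  have h0 : ∀ᵐ x : Fin (n + 1) → ℝ, x ≠ 0 := by
    simp [ae_iff]
  refine integral_congr_ae (h0.mono fun x hx => ?_)
  simp only [germVal, hC _ (frame_indep hx), mul_assoc, sg_mul_self (frame_indep hx), mul_one]

variable {Γ : Type} [Group Γ] {a : Representation ℝ Γ (Fin (n + 1) → ℝ)} {χ : Γ →* ℚˣ}

theorem coneVal_rep (hB : ∀ γ x y, B (a γ x) (a γ y) = B x y)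
    (hdet : ∀ γ (w : Fin (n + 1) → Fin (n + 1) → ℝ),
      |(Matrix.of fun k => a γ (w k)).det| = |(Matrix.of w).det|) (γ : Γ) :
    coneVal B (fun k => a γ (σ k)) = coneVal B σ := by
  have : qpoly B (fun k => a γ (σ k)) = qpoly B σ := by
    simp only [qpoly, hB]
  rw [coneVal, coneVal, hdet, this]

theorem ConeClass.hom_ext {E : Type} [AddCommGroup E] [Module ℝ E] {S : ConeClass E} {r : ℕ}
    {A : Type} [AddCommGroup A] [Module ℚ A] (f g : S.PC r →ₗ[ℚ] A)
    (h : ∀ σ (hσ : σ ∈ S.carrier r), f ⟨ev σ, S.ev_mem hσ⟩ = g ⟨ev σ, S.ev_mem hσ⟩) : f = g := by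
  ext ⟨T, hT⟩
  induction hT using Submodule.span_induction with
  | mem x hx =>
    obtain ⟨σ, hσ, rfl⟩ := hx
    exact h σ hσ
  | zero => exact (map_zero f).trans (map_zero g).symm
  | add x y hx hy h h' =>
    exact (map_add f ⟨x, hx⟩ ⟨y, hy⟩).trans ((congrArg₂ _ h h').trans
      (map_add g ⟨x, hx⟩ ⟨y, hy⟩).symm)
  | smul r x hx h =>
    exact (map_smul f r ⟨x, hx⟩).trans ((congrArg _ h).trans (map_smul g r ⟨x, hx⟩).symm)

theorem regVol_twist (hs : ∀ x y, B x y = B y x) (hpos : ∀ x, x ≠ 0 → 0 < S x x)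
    (hB : ∀ γ x y, B (a γ x) (a γ y) = B x y)
    (hdet : ∀ γ (w : Fin (n + 1) → Fin (n + 1) → ℝ),
      |(Matrix.of fun k => a γ (w k)).det| = |(Matrix.of w).det|)
    (hχ : ∀ γ (w : Fin (n + 1) → Fin (n + 1) → ℝ), sg (fun k => a γ (w k)) = (χ γ : ℚ) * sg w)
    (hS : (goodCones B).Inv a) (γ : Γ) (T : (goodCones B).PC (n + 1)) :
    regVol hs hpos ⟨twist a χ (n + 1) γ T.1, hS.twist_mem χ γ T.2⟩ = regVol hs hpos T := by
  obtain ⟨f, hf⟩ : ∃ f : (goodCones B).PC (n + 1) →ₗ[ℚ] ℂ, ∀ T : (goodCones B).PC (n + 1), f T =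
      regVol hs hpos ⟨twist a χ (n + 1) γ T.1, hS.twist_mem χ γ T.2⟩ :=
    ⟨(regVol hs hpos).comp
      ((twist a χ (n + 1) γ).restrict fun T hT => hS.twist_mem χ γ hT), fun T => rfl⟩
  rw [← hf]
  refine LinearMap.congr_fun (ConeClass.hom_ext _ _ fun σ hσ => ?_) T
  have hσ' : (fun k => a γ (σ k)) ∈ (goodCones B).carrier (n + 1) := hS γ σ hσ
  have e : f ⟨ev σ, (goodCones B).ev_mem hσ⟩ =
      (χ γ : ℚ) • regVol hs hpos ⟨ev fun k => a γ (σ k), (goodCones B).ev_mem hσ'⟩ := by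
    rw [hf, ← map_smul]
    exact congrArg _ (Subtype.ext (twist_ev a χ γ σ))
  have h1 : (χ γ : ℚ) * (χ γ : ℚ) = 1 := by
    have h2 := sg_mul_self hσ'.1
    have h3 := sg_mul_self hσ.1
    rw [hχ] at h2
    linear_combination h2 - (χ γ : ℚ) * (χ γ : ℚ) * h3
  refine e.trans ?_
  rw [regVol_ev hs hpos hσ', regVol_ev hs hpos hσ, coneVal_rep hB hdet, hχ, Rat.smul_def,
    ← mul_assoc, ← Rat.cast_mul, ← mul_assoc, h1, one_mul]

end PolyChain

end Functional

section FundChain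

open Filter Topology

namespace PolyChain

variable {m : ℕ} {B S : LinearMap.BilinForm ℝ (Fin (m + 2) → ℝ)}
  {Γ : Type} [Group Γ] {a : Representation ℝ Γ (Fin (m + 2) → ℝ)} {χ : Γ →* ℚˣ}
  {V : Set (Fin (m + 2) → ℝ)} {κ : ℕ → Module.Basis (Fin (m + 2)) ℝ (Fin (m + 2) → ℝ)}

theorem exists_rat_of_fundChain (hs : ∀ x y, B x y = B y x) (hn : ∀ x, (∀ y, B x y = 0) → x = 0)
    (hpos : ∀ x, x ≠ 0 → 0 < S x x)
    {M : ℂ} (hM : Tendsto (fun ε => ∫ x, bkern B S ε x) (𝓝[>] 0) (𝓝 M))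
    (hB : ∀ γ x y, B (a γ x) (a γ y) = B x y)
    (hdet : ∀ γ (w : Fin (m + 2) → Fin (m + 2) → ℝ),
      |(Matrix.of fun k => a γ (w k)).det| = |(Matrix.of w).det|)
    (hχ : ∀ γ (w : Fin (m + 2) → Fin (m + 2) → ℝ), sg (fun k => a γ (w k)) = (χ γ : ℚ) * sg w)
    (hV : ProperCone V a) (hneg : ∀ x ∈ V, B x x < 0) (hκ : Covering V κ)
    (hpd : PdLT (GA Γ) (QChar χ) (m + 1))
    (hF : fundChain a κ ∈ (conesIn V).PC (m + 2))
    {s : Finset (Fin (m + 2) → Fin (m + 2) → ℝ)} {b : (Fin (m + 2) → Fin (m + 2) → ℝ) → ℚ}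
    (hσ : ∀ σ ∈ s, σ ∈ (goodCones B).carrier (m + 2)) (hrep : fundChain a κ = ∑ σ ∈ s, b σ • ev σ) :
    ∃ r : ℚ, ∑ σ ∈ s, ((b σ * sg σ : ℚ) : ℂ) * coneVal B σ = r * M := by
  have hsub : ∀ r, (conesIn V).PC r ≤ (goodCones B).PC r := fun r => by
    refine Submodule.span_mono (Set.image_mono fun σ hσ => ?_)
    exact mem_goodCones_of_neg hneg hσ
  have hS : (goodCones B).Inv a := goodCones_inv hB
  let W : Submodule ℚ ℂ := Submodule.span ℚ {M}
  have h := functional_fundChain_eq_zero hV hκ hχ hF hS hsub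
    (fun r hr => exactIn_goodCones hs hn (by simpa using hr)) hpd (A := ℂ ⧸ W)
    (W.mkQ.comp (regVol hs hpos))
    (fun γ T => congrArg W.mkQ (regVol_twist hs hpos hB hdet hχ hS γ T))
    (fun T hT => by
      obtain ⟨C, hC⟩ := exists_const_of_bd_eq_zero T.2 hT
      rw [LinearMap.comp_apply, regVol_of_eq_const hs hpos hM T hC, Submodule.mkQ_apply,
        Submodule.Quotient.mk_eq_zero]
      exact W.smul_mem _ (Submodule.mem_span_singleton_self M))
  rw [LinearMap.comp_apply, Submodule.mkQ_apply, Submodule.Quotient.mk_eq_zero] at h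
  obtain ⟨r, hr⟩ := Submodule.mem_span_singleton.1 h
  refine ⟨r, ?_⟩
  rw [← Rat.smul_def, hr]
  refine (regVol_eq hs hpos _ ?_).symm
  show Tendsto (regInt B S (fundChain a κ)) _ _
  rw [hrep]
  exact tendsto_regInt_sum hs hpos hσ

end PolyChain

end FundChain

section Values

open MvPolynomial Filter Topology Pointwise

namespace PolyChain

variable {N : ℕ}

/-- A positive function homogeneous of degree two on a cone, with sublevel sets of finite volume. -/
structure Radial (C : Set (Fin N → ℝ)) (f : (Fin N → ℝ) → ℝ) : Prop where
  measurableSet : MeasurableSet C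
  measurable : Measurable f
  smul_mem : ∀ r : ℝ, 0 < r → ∀ x ∈ C, r • x ∈ C
  smul_eq : ∀ (r : ℝ) x, f (r • x) = r ^ 2 * f x
  pos : ∀ x ∈ C, 0 < f x
  finite : volume (C ∩ {x | f x ≤ 1}) ≠ ⊤

namespace Radial

variable {C : Set (Fin N → ℝ)} {f : (Fin N → ℝ) → ℝ}

/-- The distribution of the homogeneous function. -/
theorem map_Iic (h : Radial C f) (u : ℝ) : (volume.restrict C).map f (Set.Iic u) =
    if 0 < u then ENNReal.ofReal (|√u ^ N|) * volume (C ∩ {x | f x ≤ 1}) else 0 := by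
  rw [Measure.map_apply h.measurable measurableSet_Iic,
    Measure.restrict_apply (h.measurable measurableSet_Iic)]
  split_ifs with hu
  · have h0 : 0 < √u := Real.sqrt_pos.2 hu
    have e : f ⁻¹' Set.Iic u ∩ C = √u • (C ∩ {x | f x ≤ 1}) := by
      ext x
      rw [Set.mem_smul_set_iff_inv_smul_mem₀ h0.ne']
      simp only [Set.mem_inter_iff, Set.mem_preimage, Set.mem_Iic, Set.mem_ofPred_eq, h.smul_eq,
        inv_pow, Real.sq_sqrt hu.le]
      rw [inv_mul_le_iff₀ hu, mul_one, and_comm]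
      refine and_congr_left fun _ => ⟨fun hx => h.smul_mem _ (inv_pos.2 h0) _ hx, fun hx => ?_⟩
      have := h.smul_mem _ h0 _ hx
      rwa [smul_inv_smul₀ h0.ne'] at this
    rw [e, Measure.addHaar_smul]
    simp
  · have e : f ⁻¹' Set.Iic u ∩ C = ∅ := by
      ext x
      simp only [Set.mem_inter_iff, Set.mem_preimage, Set.mem_Iic, Set.mem_empty_iff_false,
        iff_false, not_and]
      intro hx hxC
      have := h.pos x hxC
      linarith
    rw [e, measure_empty]

variable {C' : Set (Fin N → ℝ)} {f' : (Fin N → ℝ) → ℝ}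

theorem smul_integral_eq (h : Radial C f) (h' : Radial C' f') {g : ℝ → ℂ} (hg : Continuous g) :
    (volume (C' ∩ {x | f' x ≤ 1})).toReal • ∫ x in C, g (f x) =
      (volume (C ∩ {x | f x ≤ 1})).toReal • ∫ x in C', g (f' x) := by
  have key : volume (C' ∩ {x | f' x ≤ 1}) • (volume.restrict C).map f =
      volume (C ∩ {x | f x ≤ 1}) • (volume.restrict C').map f' := by
    refine Measure.ext_of_generateFrom_of_iUnion (Set.range Set.Iic) (fun k : ℕ => Set.Iic (k : ℝ))
      ?_ isPiSystem_Iic ?_ (fun k => ⟨_, rfl⟩) ?_ ?_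
    · rw [← borel_eq_generateFrom_Iic]
      exact BorelSpace.measurable_eq
    · refine Set.eq_univ_of_forall fun x => ?_
      obtain ⟨k, hk⟩ := exists_nat_ge x
      exact Set.mem_iUnion.2 ⟨k, hk⟩
    · intro k
      rw [Measure.smul_apply, h.map_Iic, smul_eq_mul]
      split_ifs
      · exact ENNReal.mul_ne_top h'.finite (ENNReal.mul_ne_top ENNReal.ofReal_ne_top h.finite)
      · simp
    · rintro _ ⟨u, rfl⟩
      rw [Measure.smul_apply, Measure.smul_apply, h.map_Iic, h'.map_Iic, smul_eq_mul, smul_eq_mul]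
      split_ifs
      · ring
      · simp
  have h1 := congrArg (fun ν => ∫ u, g u ∂ν) key
  simp only [integral_smul_measure] at h1
  rwa [integral_map h.measurable.aemeasurable hg.aestronglyMeasurable,
    integral_map h'.measurable.aemeasurable hg.aestronglyMeasurable] at h1

end Radial

/-- The diagonal bilinear form with given entries. -/
def diagForm (s : Fin N → ℝ) : LinearMap.BilinForm ℝ (Fin N → ℝ) :=
  Matrix.toBilin' (Matrix.diagonal s)

theorem diagForm_apply (s x y : Fin N → ℝ) : diagForm s x y = ∑ i, s i * (x i * y i) := by
  rw [diagForm, Matrix.toBilin'_apply']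
  simp only [dotProduct, Matrix.mulVec_diagonal]
  exact Finset.sum_congr rfl fun i _ => by ring

theorem diagForm_comm (s x y : Fin N → ℝ) : diagForm s x y = diagForm s y x := by
  simp only [diagForm_apply, mul_comm]

theorem continuous_diagForm (s : Fin N → ℝ) : Continuous fun x => diagForm s x x := by
  simp only [diagForm_apply]
  fun_prop

theorem diagForm_one_pos (x : Fin N → ℝ) (hx : x ≠ 0) : 0 < diagForm 1 x x := by
  obtain ⟨i, hi⟩ := Function.ne_iff.1 hx
  rw [diagForm_apply]
  refine Finset.sum_pos' (fun j _ => ?_) ⟨i, Finset.mem_univ _, ?_⟩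
  · rw [Pi.one_apply, one_mul]
    exact mul_self_nonneg _
  · rw [Pi.one_apply, one_mul]
    exact mul_self_pos.2 hi

theorem integral_diag_gaussian {c : Fin N → ℂ} (hc : ∀ i, 0 < (c i).re) :
    ∫ x : Fin N → ℝ, Complex.exp (∑ i, -c i * (x i : ℂ) ^ 2) =
      ∏ i, (Real.pi / c i : ℂ) ^ (1 / 2 : ℂ) := by
  simp only [Complex.exp_sum]
  rw [integral_fintype_prod_volume_eq_prod (fun i (y : ℝ) => Complex.exp (-c i * (y : ℂ) ^ 2))]
  exact Finset.prod_congr rfl fun i _ => integral_gaussian_complex (hc i)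

theorem tendsto_gaussian {s : Fin N → ℝ} (hs : ∀ i, s i ≠ 0) :
    Tendsto (fun ε => ∫ x, bkern (diagForm s) (diagForm 1) ε x) (𝓝[>] 0)
      (𝓝 (∏ i, (Real.pi / (-(Complex.I * s i)) : ℂ) ^ (1 / 2 : ℂ))) := by
  have h : Tendsto (fun ε : ℝ => ∏ i, (Real.pi / ((ε : ℂ) - Complex.I * s i) : ℂ) ^ (1 / 2 : ℂ))
      (𝓝[>] 0) (𝓝 (∏ i, (Real.pi / (-(Complex.I * s i)) : ℂ) ^ (1 / 2 : ℂ))) := by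
    refine tendsto_finsetProd _ fun i _ => ?_
    have hne : -(Complex.I * (s i : ℂ)) ≠ 0 := by simp [hs i]
    have hmem : (Real.pi / (-(Complex.I * s i)) : ℂ) ∈ Complex.slitPlane := by
      refine Or.inr ?_
      have e : (Real.pi / (-(Complex.I * s i)) : ℂ) = ((Real.pi / s i : ℝ) : ℂ) * Complex.I := by
        have : (s i : ℂ) ≠ 0 := by exact_mod_cast hs i
        push_cast
        field_simp
        simp
      rw [e]
      simp [Real.pi_ne_zero, hs i]
    have ht : Tendsto (fun ε : ℝ => (Real.pi / ((ε : ℂ) - Complex.I * s i) : ℂ)) (𝓝[>] 0)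
        (𝓝 (Real.pi / (-(Complex.I * s i)) : ℂ)) := by
      refine tendsto_const_nhds.div ?_ hne
      have := tendsto_ofReal_nhdsGT.sub_const (Complex.I * (s i : ℂ))
      rwa [zero_sub] at this
    exact ht.cpow tendsto_const_nhds hmem
  refine h.congr' ?_
  filter_upwards [eventually_pos_le_one] with ε hε
  rw [← integral_diag_gaussian (fun i => by simpa using hε.1)]
  refine integral_congr_ae (Eventually.of_forall fun x => ?_)
  simp only [bkern, diagForm_apply]
  congr 1
  push_cast
  rw [Finset.mul_sum, Finset.mul_sum, ← Finset.sum_sub_distrib]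
  refine Finset.sum_congr rfl fun i _ => ?_
  simp only [Pi.one_apply]
  push_cast
  ring

theorem radial_icone {B : LinearMap.BilinForm ℝ (Fin N → ℝ)} {σ : Fin N → Fin N → ℝ}
    (hσ : LinearIndependent ℝ σ)
    (hneg : ∀ t : Fin N → ℝ, (∀ i, 0 ≤ t i) → t ≠ 0 → B (comb σ t) (comb σ t) < 0)
    (hN : N ≠ 0) (hB : Continuous fun x => B x x) : Radial (icone σ) fun x => -B x x := by
  refine ⟨measurableSet_icone hσ, hB.neg.measurable, ?_, ?_, ?_, ?_⟩
  · rintro r hr _ ⟨t, ht, rfl⟩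
    exact ⟨r • t, fun i => mul_pos hr (ht i), map_smul _ _ _⟩
  · intro r x
    simp only [map_smul, LinearMap.smul_apply, smul_eq_mul]
    ring
  · rintro _ ⟨t, ht, rfl⟩
    have h0 : t ≠ 0 := fun h => by
      have := ht ⟨0, Nat.pos_of_ne_zero hN⟩
      rw [h] at this
      exact lt_irrefl _ this
    have := hneg t (fun i => (ht i).le) h0
    simpa using this
  · obtain ⟨c, hc, h⟩ := exists_lower_bound_of_homogeneous
      (f := fun t => -B (comb σ t) (comb σ t))
      ((hB.comp (comb σ).continuous_of_finiteDimensional).neg) 2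
      (fun r t => by simp only [map_smul, LinearMap.smul_apply, smul_eq_mul]; ring)
      (fun t ht ht0 => by simpa using hneg t ht ht0)
    have hsub : icone σ ∩ {x | -B x x ≤ 1} ⊆ comb σ '' Metric.closedBall 0 (√(1 / c)) := by
      rintro _ ⟨⟨t, ht, rfl⟩, hx⟩
      refine ⟨t, ?_, rfl⟩
      rw [mem_closedBall_zero_iff]
      refine Real.le_sqrt_of_sq_le ?_
      rw [le_div_iff₀ hc, mul_comm]
      by_cases h0 : t = 0
      · rw [h0]
        simp
      · exact (h t (fun i => (ht i).le) h0).trans hx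
    refine ne_top_of_le_ne_top ?_ (measure_mono hsub)
    rw [Measure.addHaar_image_linearMap]
    exact ENNReal.mul_ne_top ENNReal.ofReal_ne_top measure_closedBall_lt_top.ne

theorem radial_compl_zero : Radial ({0}ᶜ : Set (Fin N → ℝ)) fun x => diagForm 1 x x := by
  refine ⟨(measurableSet_singleton 0).compl, (continuous_diagForm 1).measurable, ?_, ?_,
    diagForm_one_pos, ?_⟩
  · intro r hr x hx
    exact smul_ne_zero hr.ne' hx
  · intro r x
    simp only [map_smul, LinearMap.smul_apply, smul_eq_mul]
    ring
  · have hsub : ({0}ᶜ : Set (Fin N → ℝ)) ∩ {x | diagForm 1 x x ≤ 1} ⊆ Metric.closedBall 0 1 := by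
      rintro x ⟨-, hx⟩
      rw [mem_closedBall_zero_iff, pi_norm_le_iff_of_nonneg zero_le_one]
      intro i
      rw [Set.mem_ofPred_eq, diagForm_apply] at hx
      have h1 : (1 : Fin N → ℝ) i * (x i * x i) ≤ 1 :=
        (Finset.single_le_sum (f := fun i => (1 : Fin N → ℝ) i * (x i * x i)) (fun j _ => by
          rw [Pi.one_apply, one_mul]
          exact mul_self_nonneg _) (Finset.mem_univ i)).trans hx
      rw [Pi.one_apply, one_mul] at h1
      rw [Real.norm_eq_abs]
      exact abs_le_one_iff_mul_self_le_one.2 h1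
    exact ne_top_of_le_ne_top measure_closedBall_lt_top.ne (measure_mono hsub)

/-- The closed unit Euclidean ball. -/
def unitBall (N : ℕ) : Set (Fin N → ℝ) := {y | ∑ i, (y i) ^ 2 ≤ 1}

theorem volume_compl_zero (hN : N ≠ 0) :
    volume (({0}ᶜ : Set (Fin N → ℝ)) ∩ {x | diagForm 1 x x ≤ 1}) = volume (unitBall N) := by
  have : Nonempty (Fin N) := ⟨⟨0, Nat.pos_of_ne_zero hN⟩⟩
  refine measure_congr ?_
  have h0 : ∀ᵐ x : Fin N → ℝ, x ≠ 0 := by simp [ae_iff]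
  refine h0.mono fun x hx => ?_
  have e : diagForm 1 x x = ∑ i, (x i) ^ 2 := by
    rw [diagForm_apply]
    exact Finset.sum_congr rfl fun i _ => by rw [Pi.one_apply]; ring
  refine propext ?_
  change x ∈ _ ∧ diagForm 1 x x ≤ 1 ↔ ∑ i, (x i) ^ 2 ≤ 1
  rw [e]
  simp [hx]

theorem volume_smul_coneVal {B : LinearMap.BilinForm ℝ (Fin N → ℝ)} {σ : Fin N → Fin N → ℝ}
    (hs : ∀ x y, B x y = B y x) (hσ : σ ∈ (goodCones B).carrier N)
    (hneg : ∀ t : Fin N → ℝ, (∀ i, 0 ≤ t i) → t ≠ 0 → B (comb σ t) (comb σ t) < 0)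
    (hN : N ≠ 0) (hB : Continuous fun x => B x x) :
    (volume (unitBall N)).toReal • coneVal B σ =
      (volume (icone σ ∩ {x | -B x x ≤ 1})).toReal •
        ((Real.pi / Complex.I : ℂ) ^ (1 / 2 : ℂ)) ^ N := by
  have : Nonempty (Fin N) := ⟨⟨0, Nat.pos_of_ne_zero hN⟩⟩
  have h1 := (tendsto_setIntegral_bkern hs hσ (S := -B)
    (fun t ht ht0 => by simpa using hneg t ht ht0)).const_smul (volume (unitBall N)).toReal
  have h2 := (tendsto_gaussian (s := fun _ : Fin N => -1) fun _ => by norm_num).const_smul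
    (volume (icone σ ∩ {x | -B x x ≤ 1})).toReal
  simp only [Complex.ofReal_neg, Complex.ofReal_one, mul_neg, mul_one, neg_neg,
    Finset.prod_const, Finset.card_univ, Fintype.card_fin] at h2
  refine tendsto_nhds_unique h1 (h2.congr fun ε => ?_)
  have hg : Continuous fun u : ℝ => Complex.exp (-(ε + Complex.I) * (u : ℂ)) := by fun_prop
  have key := (radial_icone hσ.1 hneg hN hB).smul_integral_eq radial_compl_zero hg
  have h0 : ({0}ᶜ : Set (Fin N → ℝ)) =ᵐ[volume] Set.univ := by
    rw [ae_eq_univ, compl_compl]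
    exact measure_singleton 0
  rw [volume_compl_zero hN, setIntegral_congr_set h0, setIntegral_univ] at key
  refine Eq.trans ?_ (key.symm.trans ?_)
  · congr 1
    refine integral_congr_ae (Eventually.of_forall fun x => ?_)
    have e : diagForm (fun _ => -1) x x = -diagForm 1 x x := by
      simp [diagForm_apply]
    simp only [bkern, e]
    congr 1
    push_cast
    ring
  · congr 1
    refine integral_congr_ae (Eventually.of_forall fun x => ?_)
    simp only [bkern, LinearMap.neg_apply]
    congr 1
    push_cast
    ring

end PolyChain

end Values

section Group

open MvPolynomial Filter Topology

namespace PolyChain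

/-- The signs of the quadratic form. -/
def signs (p N : ℕ) : Fin N → ℝ := fun i => if (i : ℕ) < p then 1 else -1

theorem signs_ne_zero (p N : ℕ) (i : Fin N) : signs p N i ≠ 0 := by
  rw [signs]
  split_ifs <;> norm_num

theorem prod_signs {M : Type} [CommMonoid M] {p N : ℕ} (h : p ≤ N) (f : ℝ → M) :
    ∏ i, f (signs p N i) = f 1 ^ p * f (-1) ^ (N - p) := by
  obtain ⟨k, rfl⟩ := Nat.exists_eq_add_of_le h
  rw [Fin.prod_univ_add]
  simp [signs]

theorem diagForm_signs (p N : ℕ) (x : Fin N → ℝ) : diagForm (signs p N) x x = Qpq p N x := by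
  rw [diagForm_apply, Qpq]
  refine Finset.sum_congr rfl fun i _ => ?_
  rw [signs]
  split_ifs <;> ring

theorem diagForm_nondegenerate {N : ℕ} {s : Fin N → ℝ} (hs : ∀ i, s i ≠ 0) (x : Fin N → ℝ)
    (h : ∀ y, diagForm s x y = 0) : x = 0 := by
  funext i
  have := h (Pi.single i 1)
  rw [diagForm_apply, Finset.sum_eq_single i (fun j _ hj => by simp [hj]) (by simp)] at this
  simpa [hs i] using this

theorem sq_cpow_half (z : ℂ) : (z ^ (1 / 2 : ℂ)) ^ 2 = z := by
  rw [one_div]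
  exact Complex.cpow_ofNat_inv_pow z 2

theorem gaussian_values {p N : ℕ} (h : p ≤ N) (hp : Even p) :
    ∏ i, (Real.pi / (-(Complex.I * signs p N i)) : ℂ) ^ (1 / 2 : ℂ) =
      (-1) ^ (p / 2) * ((Real.pi / Complex.I : ℂ) ^ (1 / 2 : ℂ)) ^ N := by
  obtain ⟨k, rfl⟩ := hp
  obtain ⟨l, rfl⟩ := Nat.exists_eq_add_of_le h
  have e := prod_signs h (M := ℂ) fun s : ℝ => (Real.pi / (-(Complex.I * s)) : ℂ) ^ (1 / 2 : ℂ)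
  rw [e, show (k + k) / 2 = k by omega, show k + k + l - (k + k) = l by omega, pow_add _ (k + k),
    ← mul_assoc, ← two_mul, pow_mul, pow_mul, sq_cpow_half, sq_cpow_half, ← mul_pow]
  push_cast
  rw [mul_one, mul_neg, mul_one, neg_neg, div_neg, neg_one_mul]

theorem gaussian_ne_zero (N : ℕ) : ((Real.pi / Complex.I : ℂ) ^ (1 / 2 : ℂ)) ^ N ≠ 0 := by
  refine pow_ne_zero _ fun h => ?_
  have := sq_cpow_half (Real.pi / Complex.I : ℂ)
  rw [h] at this
  simp [Real.pi_ne_zero] at this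

theorem diagForm_polar {N : ℕ} (s x y : Fin N → ℝ) : diagForm s x y =
    (diagForm s (x + y) (x + y) - diagForm s x x - diagForm s y y) / 2 := by
  simp only [map_add, LinearMap.add_apply]
  rw [diagForm_comm s y x]
  ring

variable {p N : ℕ} (Γ : Subgroup ↥(Opq p N))

theorem diagForm_repU (γ : ↥Γ) (x y : Fin N → ℝ) :
    diagForm (signs p N) (repU Γ γ x) (repU Γ γ y) = diagForm (signs p N) x y := by
  rw [diagForm_polar, ← map_add, diagForm_signs, diagForm_signs, diagForm_signs, Qpq_repU,
    Qpq_repU, Qpq_repU, diagForm_polar, diagForm_signs, diagForm_signs, diagForm_signs]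

theorem abs_det_Opq (g : ↥(Opq p N)) : |(g.1.1).det| = 1 := by
  have h := congrArg Matrix.det (transpose_mul_Jmat_mul g)
  have hJ := congrArg Matrix.det (Jmat_mul_self (p := p) (N := N))
  rw [Matrix.det_mul, Matrix.det_one] at hJ
  rw [Matrix.det_mul, Matrix.det_mul, Matrix.det_transpose] at h
  have h1 : (g.1.1).det ^ 2 = 1 := by
    linear_combination (Jmat p N).det * h - (g.1.1).det ^ 2 * hJ + hJ
  rcases mul_self_eq_one_iff.1 ((sq _).symm.trans h1) with h | h <;> rw [h] <;> norm_num

theorem det_of_repU (γ : ↥Γ) (w : Fin N → Fin N → ℝ) :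
    (Matrix.of fun k => repU Γ γ (w k)).det = (Matrix.of w).det * (γ.1.1.1).det := by
  rw [← Matrix.det_transpose γ.1.1.1, ← Matrix.det_mul]
  congr 1
  ext k i
  simp [repU_apply, Matrix.mulVec, dotProduct, Matrix.mul_apply, mul_comm]

theorem abs_det_of_repU (γ : ↥Γ) (w : Fin N → Fin N → ℝ) :
    |(Matrix.of fun k => repU Γ γ (w k)).det| = |(Matrix.of w).det| := by
  rw [det_of_repU, abs_mul, abs_det_Opq, mul_one]

/-- The sign of the determinant, as a rational character. -/
def detSign : ↥Γ →* ℚˣ :=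
  (Units.map ((SignType.castHom (α := ℚ)).comp signHom : ℝ →*₀ ℚ).toMonoidHom).comp
    (Matrix.GeneralLinearGroup.det.comp ((Opq p N).subtype.comp Γ.subtype))

theorem sg_repU (γ : ↥Γ) (w : Fin N → Fin N → ℝ) :
    sg (fun k => repU Γ γ (w k)) = (detSign Γ γ : ℚ) * sg w := by
  have h : (detSign Γ γ : ℚ) = (SignType.sign (γ.1.1.1).det : ℚ) := rfl
  rw [h, sg, sg, det_of_repU, sign_mul, mul_comm]
  exact map_mul (SignType.castHom (α := ℚ)) _ _

theorem finset_sum_values {p N : ℕ} (h : p ≤ N) (hp : Even p) (hN : N ≠ 0)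
    {s : Finset (Fin N → Fin N → ℝ)} {c : (Fin N → Fin N → ℝ) → ℚ} {r : ℚ}
    (hσ : ∀ σ ∈ s, σ ∈ (conesIn {x : Fin N → ℝ | Qpq p N x < 0}).carrier N)
    (hr : ∑ σ ∈ s, (c σ : ℂ) * coneVal (diagForm (signs p N)) σ =
      r * ∏ i, (Real.pi / (-(Complex.I * signs p N i)) : ℂ) ^ (1 / 2 : ℂ)) :
    ∑ σ ∈ s, (c σ : ℝ) * (volume (icone σ ∩ {x | -Qpq p N x ≤ 1})).toReal =
      ((r * (-1) ^ (p / 2) : ℚ) : ℝ) * (volume (unitBall N)).toReal := by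
  have hg := gaussian_ne_zero N
  rw [gaussian_values h hp] at hr
  set G := ((Real.pi / Complex.I : ℂ) ^ (1 / 2 : ℂ)) ^ N
  have h1 := congrArg (fun z => (volume (unitBall N)).toReal • z) hr
  simp only [Finset.smul_sum] at h1
  have h2 : ∀ σ ∈ s, (volume (unitBall N)).toReal •
      ((c σ : ℂ) * coneVal (diagForm (signs p N)) σ) =
      (((c σ : ℝ) * (volume (icone σ ∩ {x | -Qpq p N x ≤ 1})).toReal : ℝ) : ℂ) * G := by
    intro σ hs
    have hneg : ∀ t : Fin N → ℝ, (∀ i, 0 ≤ t i) → t ≠ 0 →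
        diagForm (signs p N) (comb σ t) (comb σ t) < 0 := fun t ht ht0 => by
      rw [diagForm_signs, comb_apply]
      exact (hσ σ hs).2 t ht ht0
    have hmem : σ ∈ (goodCones (diagForm (signs p N))).carrier N :=
      mem_goodCones_of_neg (fun x hx => by rw [diagForm_signs]; exact hx) (hσ σ hs)
    have := volume_smul_coneVal (diagForm_comm _) hmem hneg hN (continuous_diagForm _)
    simp only [diagForm_signs] at this
    rw [← mul_smul_comm, this]
    simp only [Complex.real_smul]
    push_cast
    ring
  rw [Finset.sum_congr rfl h2, ← Finset.sum_mul, Complex.real_smul] at h1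
  have h3 := mul_right_cancel₀ hg (h1.trans (show _ =
    (((r * (-1) ^ (p / 2) : ℚ) : ℝ) * (volume (unitBall N)).toReal : ℂ) * G by push_cast; ring))
  exact_mod_cast h3

end PolyChain

end Group

section Covolume

open Filter Topology

namespace PolyChain

theorem measure_eq_ofReal_integral {G X : Type} [Group G] [MulAction G X] [MeasurableSpace X]
    [Countable G] [MeasurableConstSMul G X] {μ : Measure X} [SMulInvariantMeasure G X μ]
    {D : Set X} (hD : IsFundamentalDomain G D μ) {f : X → ℝ} (hm : Measurable f)
    (hf : Integrable f μ) (h0 : ∀ᵐ x ∂μ, ∀ g : G, 0 ≤ f (g⁻¹ • x))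
    (h1 : ∀ᵐ x ∂μ, HasSum (fun g : G => f (g⁻¹ • x)) 1) : μ D = ENNReal.ofReal (∫ x, f x ∂μ) := by
  have h : 0 ≤ᵐ[μ] f := h0.mono fun x hx => by simpa using hx 1
  rw [ofReal_integral_eq_lintegral_ofReal hf h, hD.lintegral_eq_tsum', ← lintegral_tsum]
  · have : ∀ᵐ x ∂μ.restrict D, ∑' g : G, ENNReal.ofReal (f (g⁻¹ • x)) = 1 := by
      filter_upwards [ae_restrict_of_ae h0, ae_restrict_of_ae h1] with x hx0 hx1
      rw [← ENNReal.ofReal_tsum_of_nonneg hx0 hx1.summable, hx1.tsum_eq, ENNReal.ofReal_one]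
    rw [lintegral_congr_ae this]
    simp
  · intro g
    exact (hm.comp (measurable_const_smul g⁻¹)).ennreal_ofReal.aemeasurable

variable {p N : ℕ} (Γ : Subgroup ↥(Opq p N))

theorem countable_of_discrete [DiscreteTopology ↥Γ] : Countable ↥Γ := by
  rw [← Set.countable_univ_iff]
  refine (Set.countable_iUnion fun R : ℕ => (finite_bounded_entries Γ R).countable).mono ?_
  intro γ _
  obtain ⟨R, hR⟩ := exists_nat_ge (∑ i, ∑ j, |γ.1.1.1 i j|)
  refine Set.mem_iUnion.2 ⟨R, fun i j => le_trans ?_ hR⟩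
  refine (Finset.single_le_sum (f := fun j => |γ.1.1.1 i j|) (fun _ _ => abs_nonneg _)
    (Finset.mem_univ j)).trans ?_
  exact Finset.single_le_sum (f := fun i => ∑ j, |γ.1.1.1 i j|)
    (fun _ _ => Finset.sum_nonneg fun _ _ => abs_nonneg _) (Finset.mem_univ i)

theorem val_smul (γ : ↥Γ) (x : Hpq p N) : (γ • x).1 = repU Γ γ x.1 := rfl

theorem continuous_val : Continuous fun x : Hpq p N => x.1 := continuous_subtype_val

theorem measurable_val : Measurable fun x : Hpq p N => x.1 := measurable_subtype_coe

instance : ContinuousConstSMul ↥Γ (Hpq p N) where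
  continuous_const_smul γ :=
    ((repU Γ γ).continuous_of_finiteDimensional.comp continuous_val).subtype_mk _

instance : MeasurableConstSMul ↥Γ (Hpq p N) where
  measurable_const_smul γ :=
    ((repU Γ γ).continuous_of_finiteDimensional.measurable.comp measurable_val).subtype_mk

theorem coneOver_preimage_smul (γ : ↥Γ) (s : Set (Hpq p N)) :
    coneOver p N ((γ • ·) ⁻¹' s) = repU Γ γ ⁻¹' coneOver p N s := by
  ext y
  constructor
  · rintro ⟨x, hx, t, ht, rfl⟩
    exact ⟨γ • x, hx, t, ht, map_smul _ _ _⟩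
  · rintro ⟨x, hx, t, ht, hy⟩
    refine ⟨γ⁻¹ • x, by simpa using hx, t, ht, ?_⟩
    rw [val_smul, ← map_smul, ← hy, ← Module.End.mul_apply, ← map_mul, inv_mul_cancel, map_one,
      Module.End.one_apply]

theorem det_repU (γ : ↥Γ) : LinearMap.det (repU Γ γ) = (γ.1.1.1).det :=
  LinearMap.det_toLin' _

variable {μ : Measure (Hpq p N)}

theorem smulInvariantMeasure_of_coneOver
    (hμ : ∀ s : Set (Hpq p N), MeasurableSet s → μ s = volume (coneOver p N s)) :
    SMulInvariantMeasure ↥Γ (Hpq p N) μ where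
  measure_preimage_smul γ s hs := by
    have hdet := abs_det_Opq γ.1
    rw [hμ _ hs, hμ _ (measurable_const_smul γ hs), coneOver_preimage_smul,
      Measure.addHaar_preimage_linearMap, det_repU, abs_inv, hdet]
    · simp
    · rw [det_repU]
      intro h
      rw [h] at hdet
      simp at hdet

theorem coneOver_val_preimage {C : Set (Fin N → ℝ)} (hC : ∀ r : ℝ, 0 < r → ∀ x ∈ C, r • x ∈ C)
    (hneg : ∀ x ∈ C, Qpq p N x < 0) :
    coneOver p N {x | x.1 ∈ C} = C ∩ {x | -Qpq p N x ≤ 1} := by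
  ext y
  constructor
  · rintro ⟨x, hx, t, ht, rfl⟩
    refine ⟨hC t ht.1 _ hx, ?_⟩
    have hx1 : Qpq p N x.1 = -1 := x.2
    simp only [Set.mem_ofPred_eq]
    rw [Qpq_smul, hx1]
    nlinarith [ht.1, ht.2]
  · rintro ⟨hy, hy1⟩
    have h0 := hneg y hy
    have hpos : 0 < √(-Qpq p N y) := Real.sqrt_pos.2 (by linarith)
    refine ⟨toHpq p N ⟨y, h0⟩, hC _ (inv_pos.2 hpos) _ hy, √(-Qpq p N y),
      ⟨hpos, Real.sqrt_le_one.2 hy1⟩, ?_⟩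
    exact (smul_inv_smul₀ hpos.ne' y).symm

theorem measure_val_preimage_eq_zero
    (hμ : ∀ s : Set (Hpq p N), MeasurableSet s → μ s = volume (coneOver p N s))
    {C : Set (Fin N → ℝ)} (hm : MeasurableSet C) (hC : ∀ r : ℝ, 0 < r → ∀ x ∈ C, r • x ∈ C)
    (h0 : volume C = 0) : μ {x | x.1 ∈ C} = 0 := by
  refine (hμ _ (measurable_val hm)).trans ?_
  refine measure_mono_null ?_ h0
  rintro _ ⟨x, hx, t, ht, rfl⟩
  exact hC t ht.1 _ hx

theorem measurableSet_genericSet {σ : Fin N → Fin N → ℝ} (hσ : LinearIndependent ℝ σ) :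
    MeasurableSet (genericSet σ) := by
  refine MeasurableSet.image_of_continuousOn_injOn ?_
    (comb σ).continuous_of_finiteDimensional.continuousOn (comb_injective hσ).injOn
  simp only [Set.ofPred_forall]
  exact MeasurableSet.iInter fun i => (measurable_pi_apply i) (measurableSet_singleton 0).compl

theorem smul_mem_genericSet {σ : Fin N → Fin N → ℝ} {r : ℝ} (hr : r ≠ 0) {x : Fin N → ℝ}
    (hx : x ∈ genericSet σ) : r • x ∈ genericSet σ := by
  obtain ⟨t, ht, rfl⟩ := hx
  exact ⟨r • t, fun i => mul_ne_zero hr (ht i), map_smul _ _ _⟩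

theorem ae_val_generic
    (hμ : ∀ s : Set (Hpq p N), MeasurableSet s → μ s = volume (coneOver p N s))
    {σ : Fin N → Fin N → ℝ} (hσ : LinearIndependent ℝ σ) : ∀ᵐ x ∂μ, x.1 ∈ genericSet σ := by
  refine measure_val_preimage_eq_zero hμ (C := (genericSet σ)ᶜ) (measurableSet_genericSet hσ).compl
    ?_ (ae_generic hσ)
  intro r hr x hx h
  refine hx ?_
  have := smul_mem_genericSet (inv_ne_zero hr.ne') h
  rwa [inv_smul_smul₀ hr.ne'] at this

theorem exists_bound_of_compactSpace [CompactSpace (MulAction.orbitRel.Quotient ↥Γ (Hpq p N))]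
    {V : Set (Fin N → ℝ)} (hV : ∀ x, x ∈ V ↔ Qpq p N x < 0) {d : ℕ}
    {κ : ℕ → Module.Basis (Fin d) ℝ (Fin N → ℝ)} (hκ : Covering V κ) :
    ∃ I, ∀ x ∈ V, ∃ i ≤ I, ∃ γ : ↥Γ, ∀ j, 0 < (κ i).coord j (repU Γ γ⁻¹ x) := by
  let W : ℕ → Set (Hpq p N) := fun i => {x | ∀ j, 0 < (κ i).coord j x.1}
  have hW : ∀ i, IsOpen (W i) := fun i => by
    simp only [W, Set.ofPred_forall]
    exact isOpen_iInter_of_finite fun j => isOpen_lt continuous_const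
      ((LinearMap.continuous_of_finiteDimensional ((κ i).coord j)).comp continuous_val)
  let π : Hpq p N → MulAction.orbitRel.Quotient ↥Γ (Hpq p N) := Quotient.mk''
  have hπ : ∀ i, IsOpen (π '' W i) := fun i => isOpenMap_quotient_mk'_mul _ (hW i)
  obtain ⟨t, ht⟩ := (isCompact_univ (X := MulAction.orbitRel.Quotient ↥Γ (Hpq p N))).elim_finite_subcover
    (fun i => π '' W i) hπ (by
      rintro ⟨x⟩ -
      have hx : Qpq p N x.1 < 0 := by rw [show Qpq p N x.1 = -1 from x.2]; norm_num
      obtain ⟨i, hi⟩ := hκ.exists_pos x.1 ((hV _).2 hx)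
      exact Set.mem_iUnion.2 ⟨i, x, hi, rfl⟩)
  refine ⟨t.sup id, fun x hx => ?_⟩
  have hx0 := (hV x).1 hx
  obtain ⟨i, hit, y, hy, hyx⟩ := by
    simpa only [Set.mem_iUnion, exists_prop] using ht (Set.mem_univ (π (toHpq p N ⟨x, hx0⟩)))
  obtain ⟨γ, hγ⟩ := (Quotient.exact hyx : MulAction.orbitRel ↥Γ (Hpq p N) y _)
  refine ⟨i, Finset.le_sup (f := id) hit, γ⁻¹, fun j => ?_⟩
  have h1 := hy j
  have h2 : y.1 = (√(-Qpq p N x))⁻¹ • repU Γ γ x := by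
    rw [← hγ, ← map_smul]
    rfl
  rw [h2, map_smul, smul_eq_mul] at h1
  rw [inv_inv]
  exact pos_of_mul_pos_right h1 (inv_nonneg.2 (Real.sqrt_nonneg _))

end PolyChain

end Covolume

section Rationality

open Filter Topology

namespace PolyChain

theorem weight_nonneg {G : Type} [Group G] (M : ℕ → G → Prop) : 0 ≤ weight M := by
  unfold weight
  split_ifs <;> positivity

/-- The function represented by a finite combination of open simplicial cones. -/
def coneFun {N : ℕ} (s : Finset (Fin N → Fin N → ℝ)) (c : (Fin N → Fin N → ℝ) → ℚ)
    (x : Fin N → ℝ) : ℝ :=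
  ∑ σ ∈ s, (c σ : ℝ) * (icone σ).indicator (fun _ => (1 : ℝ)) x

theorem measurable_coneFun {N : ℕ} {s : Finset (Fin N → Fin N → ℝ)}
    (hs : ∀ σ ∈ s, LinearIndependent ℝ σ) (c : (Fin N → Fin N → ℝ) → ℚ) :
    Measurable (coneFun s c) :=
  Finset.measurable_sum _ fun σ h =>
    (measurable_const.indicator (measurableSet_icone (hs σ h))).const_mul _

theorem coneFun_eq_weight {m : ℕ} {Γ : Type} [Group Γ]
    {a : Representation ℝ Γ (Fin (m + 1) → ℝ)}
    {κ : ℕ → Module.Basis (Fin (m + 1)) ℝ (Fin (m + 1) → ℝ)}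
    {s : Finset (Fin (m + 1) → Fin (m + 1) → ℝ)} {b : (Fin (m + 1) → Fin (m + 1) → ℝ) → ℚ}
    (hs : ∀ σ ∈ s, LinearIndependent ℝ σ) (hrep : fundChain a κ = ∑ σ ∈ s, b σ • ev σ)
    {w : Fin (m + 1) → Fin (m + 1) → ℝ} (hw : LinearIndependent ℝ w)
    (hgen : ∀ σ ∈ s, w 0 ∈ genericSet σ) :
    coneFun s (fun σ => b σ * sg σ) (w 0) = (weight (rel κ a w) : ℝ) := by
  have h := congrFun hrep w
  rw [fundChain, Finset.sum_apply] at h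
  have h1 : weight (rel κ a w) = ∑ σ ∈ s, b σ * (icone σ).indicator (fun _ => sg σ) (w 0) := by
    rw [← mul_one (weight _), ← sg_mul_self hw, ← mul_assoc, h, Finset.sum_mul]
    refine Finset.sum_congr rfl fun σ hσ => ?_
    obtain ⟨t, ht, h0⟩ := hgen σ hσ
    rw [← h0, ← ev_mul_sg (hs σ hσ) ht hw h0.symm, Pi.smul_apply, smul_eq_mul, mul_assoc]
  rw [h1, coneFun]
  push_cast
  refine Finset.sum_congr rfl fun σ hσ => ?_
  by_cases hx : w 0 ∈ icone σ
  · simp [hx]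
  · simp [hx]

variable {p N : ℕ} {μ : Measure (Hpq p N)}

theorem measure_icone (hμ : ∀ s : Set (Hpq p N), MeasurableSet s → μ s = volume (coneOver p N s))
    (hN : N ≠ 0) {σ : Fin N → Fin N → ℝ}
    (hσ : σ ∈ (conesIn {x : Fin N → ℝ | Qpq p N x < 0}).carrier N) :
    μ ((fun x : Hpq p N => x.1) ⁻¹' icone σ) = volume (icone σ ∩ {x | -Qpq p N x ≤ 1}) ∧
      volume (icone σ ∩ {x | -Qpq p N x ≤ 1}) ≠ ⊤ := by
  have hneg : ∀ t : Fin N → ℝ, (∀ i, 0 ≤ t i) → t ≠ 0 →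
      diagForm (signs p N) (comb σ t) (comb σ t) < 0 := fun t ht ht0 => by
    rw [diagForm_signs, comb_apply]
    exact hσ.2 t ht ht0
  have hr := radial_icone hσ.1 hneg hN (continuous_diagForm _)
  simp only [diagForm_signs] at hr
  refine ⟨(hμ _ (measurable_val hr.measurableSet)).trans ?_, hr.finite⟩
  exact congrArg volume (coneOver_val_preimage hr.smul_mem fun x hx => by linarith [hr.pos x hx])

theorem integral_coneFun
    (hμ : ∀ s : Set (Hpq p N), MeasurableSet s → μ s = volume (coneOver p N s)) (hN : N ≠ 0)
    {s : Finset (Fin N → Fin N → ℝ)} (c : (Fin N → Fin N → ℝ) → ℚ)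
    (hs : ∀ σ ∈ s, σ ∈ (conesIn {x : Fin N → ℝ | Qpq p N x < 0}).carrier N) :
    Integrable (fun x : Hpq p N => coneFun s c x.1) μ ∧ ∫ x : Hpq p N, coneFun s c x.1 ∂μ =
      ∑ σ ∈ s, (c σ : ℝ) * (volume (icone σ ∩ {x | -Qpq p N x ≤ 1})).toReal := by
  have hm : ∀ σ ∈ s, MeasurableSet ((fun x : Hpq p N => x.1) ⁻¹' icone σ) := fun σ h =>
    measurable_val (measurableSet_icone (hs σ h).1)
  have e : ∀ σ, (fun x : Hpq p N => (icone σ).indicator (fun _ => (1 : ℝ)) x.1) =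
      ((fun x : Hpq p N => x.1) ⁻¹' icone σ).indicator fun _ => 1 := fun σ => rfl
  have hi : ∀ σ ∈ s, Integrable
      (fun x : Hpq p N => (c σ : ℝ) * (icone σ).indicator (fun _ => (1 : ℝ)) x.1) μ := by
    intro σ h
    obtain ⟨h1, h2⟩ := measure_icone hμ hN (hs σ h)
    refine Integrable.const_mul ?_ _
    rw [e, integrable_indicator_iff (hm σ h)]
    exact integrableOn_const (by rwa [h1]) (by simp)
  refine ⟨integrable_finsetSum _ hi, ?_⟩
  simp only [coneFun]
  refine (integral_finsetSum _ hi).trans (Finset.sum_congr rfl fun σ h => ?_)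
  rw [integral_const_mul, e, integral_indicator (hm σ h), setIntegral_const, smul_eq_mul, mul_one,
    measureReal_def, (measure_icone hμ hN (hs σ h)).1]

theorem volume_unitBall_ne_top (N : ℕ) : volume (unitBall N) ≠ ⊤ := by
  refine ne_top_of_le_ne_top (measure_closedBall_lt_top (x := 0) (r := 1)).ne
    (measure_mono fun y (hy : ∑ i, (y i) ^ 2 ≤ 1) => ?_)
  rw [mem_closedBall_zero_iff, pi_norm_le_iff_of_nonneg zero_le_one]
  intro i
  rw [Real.norm_eq_abs, ← sq_le_one_iff_abs_le_one]
  exact (Finset.single_le_sum (f := fun i => (y i) ^ 2) (fun _ _ => sq_nonneg _)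
    (Finset.mem_univ i)).trans hy

theorem exists_rat_measure_fundamentalDomain {p m : ℕ} (h : p ≤ m + 2) (hp : Even p)
    (hne : ∃ x, Qpq p (m + 2) x < 0) (Γ : Subgroup ↥(Opq p (m + 2))) [DiscreteTopology ↥Γ]
    [ProperlyDiscontinuousSMul ↥Γ (Hpq p (m + 2))]
    [CompactSpace (MulAction.orbitRel.Quotient ↥Γ (Hpq p (m + 2)))]
    (hpd : ∀ χ : ↥Γ →* ℚˣ, PdLT (GA ↥Γ) (QChar χ) (m + 1))
    {μ : Measure (Hpq p (m + 2))}
    (hμ : ∀ s : Set (Hpq p (m + 2)), MeasurableSet s → μ s = volume (coneOver p (m + 2) s))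
    {D : Set (Hpq p (m + 2))} (hD : IsFundamentalDomain ↥Γ D μ) :
    ∃ r : ℚ, μ D = ENNReal.ofReal (r : ℝ) * volume (unitBall (m + 2)) := by
  classical
  let V : Set (Fin (m + 2) → ℝ) := {x | Qpq p (m + 2) x < 0}
  have hV : ProperCone V (repU Γ) := by
    have := properCone_repU Γ (k := m + 2) (by omega)
    rwa [show negCone p (m + 2) (m + 2) = V from Set.ext fun x => mem_negCone_top (by omega)]
      at this
  obtain ⟨κ, hκ⟩ : ∃ κ : ℕ → Module.Basis (Fin (m + 2)) ℝ (Fin (m + 2) → ℝ), Covering V κ := by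
    have := exists_bases_covering hV.isOpen hV.smul_mem hV.zero_notMem hne
    rw [Module.finrank_fin_fun] at this
    obtain ⟨κ, h1, h2⟩ := this
    exact ⟨κ, h1, h2⟩
  obtain ⟨I, hI⟩ := exists_bound_of_compactSpace Γ (V := V) (fun x => Iff.rfl) hκ
  have hF := fundChain_mem hV hκ hI
  obtain ⟨s, b, hs, hrep⟩ := ConeClass.exists_rep _ hF
  obtain ⟨r, hr⟩ := exists_rat_of_fundChain (B := diagForm (signs p (m + 2))) (S := diagForm 1)
    (χ := detSign Γ) (diagForm_comm _)
    (diagForm_nondegenerate (signs_ne_zero _ _)) diagForm_one_pos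
    (tendsto_gaussian (signs_ne_zero _ _)) (diagForm_repU Γ) (abs_det_of_repU Γ) (sg_repU Γ) hV
    (fun x hx => by rw [diagForm_signs]; exact hx) hκ (hpd _) hF
    (fun σ hσ => mem_goodCones_of_neg (fun x hx => by rw [diagForm_signs]; exact hx) (hs σ hσ))
    hrep
  have hsum := finset_sum_values (c := fun σ => b σ * sg σ) h hp (by omega) hs hr
  obtain ⟨hint_f, hval⟩ := integral_coneFun hμ (by omega) (fun σ => b σ * sg σ) hs
  have := countable_of_discrete Γ
  have := smulInvariantMeasure_of_coneOver Γ hμ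
  have hind : ∀ σ ∈ s, LinearIndependent ℝ σ := fun σ hσ => (hs σ hσ).1
  have hgen : ∀ᵐ x ∂μ, ∀ σ ∈ s, x.1 ∈ genericSet σ :=
    (ae_ball_iff s.countable_toSet).2 fun σ hσ => ae_val_generic hμ (hind σ hσ)
  have hgen' : ∀ᵐ x ∂μ, ∀ γ : ↥Γ, ∀ σ ∈ s, (γ⁻¹ • x).1 ∈ genericSet σ :=
    ae_all_iff.2 fun γ =>
      (measurePreserving_smul γ⁻¹ μ).quasiMeasurePreserving.ae hgen
  have hV0 : ∀ x : Hpq p (m + 2), x.1 ∈ V := fun x => by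
    show Qpq p (m + 2) x.1 < 0
    rw [show Qpq p (m + 2) x.1 = -1 from x.2]
    norm_num
  have hne0 : ∀ x : Hpq p (m + 2), x.1 ≠ 0 := fun x hx => hV.zero_notMem (hx ▸ hV0 x)
  have hwt : ∀ x : Hpq p (m + 2), ∀ γ : ↥Γ, (∀ σ ∈ s, (γ⁻¹ • x).1 ∈ genericSet σ) →
      coneFun s (fun σ => b σ * sg σ) (γ⁻¹ • x).1 =
        (weight (rel κ (repU Γ) fun k => repU Γ γ⁻¹ (frame x.1 k)) : ℝ) := by
    intro x γ hx
    have e : (γ⁻¹ • x).1 = repU Γ γ⁻¹ (frame x.1 0) := by rw [frame_zero (hne0 x)]; rfl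
    rw [e] at hx ⊢
    exact coneFun_eq_weight hind hrep (rep_indep _ γ⁻¹ (frame_indep (hne0 x))) hx
  have key := measure_eq_ofReal_integral hD
    (f := fun x : Hpq p (m + 2) => coneFun s (fun σ => b σ * sg σ) x.1)
    ((measurable_coneFun hind _).comp measurable_val) hint_f
    (hgen'.mono fun x hx γ => by
      rw [hwt x γ (hx γ)]
      exact_mod_cast weight_nonneg _)
    (hgen'.mono fun x hx => by
      simp only [fun γ => hwt x γ (hx γ)]
      have h1 := finsum_weight_germ hV hκ (frame_indep (hne0 x))
        (by rw [frame_zero (hne0 x)]; exact hV0 x)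
      have h2 := finite_support_of_finsum_eq_one h1
      have h3 : HasSum (fun γ : ↥Γ => weight (rel κ (repU Γ) fun k => repU Γ γ⁻¹ (frame x.1 k)))
          1 := by
        rw [← h1, finsum_eq_sum _ h2]
        exact hasSum_sum_of_ne_finset_zero fun γ hγ => by simpa using hγ
      have h4 := h3.map (Rat.castHom ℝ) Rat.continuous_coe_real
      rwa [map_one] at h4)
  refine ⟨r * (-1) ^ (p / 2), key.trans ?_⟩
  have hfin : volume (unitBall (m + 2)) ≠ ⊤ := volume_unitBall_ne_top _
  rw [hval, hsum, ENNReal.ofReal_mul' ENNReal.toReal_nonneg, ENNReal.ofReal_toReal hfin]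

end PolyChain

end Rationality

/-- **Rationality of volumes of compact Clifford–Klein forms of `H^{p,q}`, `p` even.**
Let `p` be even and positive, `q > 0`, and `n = p + q`. Let `Γ` be a discrete subgroup of
`O(p,q+1)` acting properly discontinuously and cocompactly on the quadric
`X = H^{p,q} ⊂ ℝ^{n+1}`, let `μ` be the cone measure on `X` (the measure of a set is the
Lebesgue measure of the cone over it), and let `D` be a fundamental domain for `Γ` on
`(X, μ)`. Then `μ(D)` is a rational multiple of the Lebesgue measure of the closed unit
Euclidean ball of `ℝ^{n+1}`; equivalently, the volume of the compact Clifford–Klein form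
`Γ \ H^{p,q}` is a rational multiple of the volume of the round sphere `S^{p+q}`. -/
theorem volume_rational_CliffordKlein_form_Hpq (p q : ℕ) (hp : 0 < p) (heven : Even p)
    (hq : 0 < q)
    (Γ : Subgroup ↥(Opq p (p + q + 1)))
    (hdisc : DiscreteTopology ↥Γ)
    (hpd : ProperlyDiscontinuousSMul ↥Γ (Hpq p (p + q + 1)))
    (hcc : CompactSpace (MulAction.orbitRel.Quotient ↥Γ (Hpq p (p + q + 1))))
    (μ : Measure (Hpq p (p + q + 1)))
    (hμ : ∀ s : Set (Hpq p (p + q + 1)), MeasurableSet s →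
      μ s = volume (coneOver p (p + q + 1) s))
    (D : Set (Hpq p (p + q + 1)))
    (hD : IsFundamentalDomain ↥Γ D μ) :
    ∃ r : ℚ, μ D = ENNReal.ofReal (r : ℝ) *
      volume {y : Fin (p + q + 1) → ℝ | ∑ i : Fin (p + q + 1), (y i) ^ 2 ≤ 1} := by
  obtain ⟨l, rfl⟩ : ∃ l, q = l + 1 := Nat.exists_eq_succ_of_ne_zero hq.ne'
  obtain ⟨x, hx⟩ := PolyChain.negCone_nonempty (p := p) (q := l + 1)
  exact PolyChain.exists_rat_measure_fundamentalDomain (m := p + l) (by omega) heven ⟨x, hx.1⟩ Γ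
    (fun χ => (PolyChain.pdLT_QChar p (l + 1) Γ χ).mono (by omega)) hμ hD
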